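/- Let K be a totally real number field of degree d. Then limsup_{n→∞} (log U_K(n)) / ((d/4)·n²·log n) = 1. -/

import Mathlib

open scoped TensorProduct

noncomputable section

open NumberField

structure OKLattice (K : Type) [Field K] : Type 1 where
  carrier : Type
  [addCommGroup : AddCommGroup carrier]
  [module : Module (𝓞 K) carrier]
  [finite : Module.Finite (𝓞 K) carrier]
  [torsionFree : NoZeroSMulDivisors (𝓞 K) carrier]
  form : carrier →ₗ[𝓞 K] carrier →ₗ[𝓞 K] 𝓞 K
  symm : ∀ x y, form x y = form y x
  posDef : ∀ v : carrier, v ≠ 0 → ∀ σ : K →+* ℝ, 0 < σ (algebraMap (𝓞 K) K (form v v))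

attribute [instance] OKLattice.addCommGroup OKLattice.module OKLattice.finite
  OKLattice.torsionFree

namespace OKLattice

variable {K : Type} [Field K]

/-- The rank of an `O_K`-lattice: the `K`-dimension of `L ⊗ K`. -/
def rank (L : OKLattice K) : ℕ :=
  Module.finrank K (K ⊗[𝓞 K] L.carrier)

/-- `L.Represents L'` : `L'` is represented by `L`. -/
def Represents (L L' : OKLattice K) : Prop :=
  ∃ σ : L'.carrier →ₗ[𝓞 K] L.carrier, ∀ x, L.form (σ x) (σ x) = L'.form x x

/-- `L` is `n`-universal. -/
def IsUniversal (L : OKLattice K) (n : ℕ) : Prop :=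
  ∀ L' : OKLattice K, L'.rank = n → L.Represents L'

end OKLattice

/-- `U_K(n)`: the minimal rank of an `n`-universal `O_K`-lattice. -/
def minUnivRank (K : Type) [Field K] (n : ℕ) : ℕ :=
  sInf {m | ∃ L : OKLattice K, L.IsUniversal n ∧ L.rank = m}

/-- `K` is totally real: every embedding into `ℂ` has image contained in `ℝ`. -/
def TotallyReal (K : Type) [Field K] : Prop :=
  ∀ φ : K →+* ℂ, ∀ x : K, (φ x).im = 0

set_option linter.unusedSectionVars false

/-! ### Totally real number fields -/

section NumberFieldBasics

variable {K : Type} [Field K] [NumberField K]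

/-- The restriction of a real embedding to the ring of integers. -/
def ov (σ : K →+* ℝ) : 𝓞 K →+* ℝ := σ.comp (algebraMap (𝓞 K) K)

theorem ov_apply (σ : K →+* ℝ) (x : 𝓞 K) : ov σ x = σ (algebraMap (𝓞 K) K x) := rfl

theorem ov_injective (σ : K →+* ℝ) : Function.Injective (ov σ) := fun x y h => by
  have := σ.injective (show σ (algebraMap (𝓞 K) K x) = σ (algebraMap (𝓞 K) K y) from h)
  exact RingOfIntegers.ext this

theorem ov_eq_zero (σ : K →+* ℝ) {x : 𝓞 K} : ov σ x = 0 ↔ x = 0 :=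
  map_eq_zero_iff _ (ov_injective σ)

/-- The trace to `ℤ` on the ring of integers. -/
abbrev trZ (x : 𝓞 K) : ℤ := Algebra.trace ℤ (𝓞 K) x

/-- The absolute value of the norm of an algebraic integer. -/
def nmN (x : 𝓞 K) : ℕ := (Algebra.norm ℤ x).natAbs

theorem nmN_ne_zero {x : 𝓞 K} (hx : x ≠ 0) : nmN x ≠ 0 := by
  simp [nmN, Algebra.norm_ne_zero_iff.mpr hx]

theorem nmN_pos {x : 𝓞 K} (hx : x ≠ 0) : 0 < nmN x := Nat.pos_of_ne_zero (nmN_ne_zero hx)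

theorem nmN_eq_absNorm (x : 𝓞 K) : nmN x = Ideal.absNorm (Ideal.span {x}) := by
  rw [Ideal.absNorm_span_singleton]; rfl

theorem nmN_dvd_self (x : 𝓞 K) : x ∣ (nmN x : 𝓞 K) := by
  rw [nmN_eq_absNorm, ← Ideal.mem_span_singleton]
  exact Ideal.absNorm_mem _

theorem nmN_natCast (n : ℕ) : nmN (n : 𝓞 K) = n ^ Module.finrank ℚ K := by
  have := Algebra.norm_algebraMap_of_basis (RingOfIntegers.basis K) (n : ℤ)
  rw [← Module.finrank_eq_card_chooseBasisIndex, RingOfIntegers.rank] at this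
  simp only [eq_intCast, Int.cast_natCast] at this
  simp [nmN, this, Int.natAbs_pow]

/-- The real embeddings of a totally real field correspond to the complex ones. -/
def TotallyReal.embEquiv (htr : TotallyReal K) : (K →+* ℂ) ≃ (K →+* ℝ) where
  toFun φ :=
    { toFun := fun x => (φ x).re
      map_one' := by simp
      map_zero' := by simp
      map_add' := by simp
      map_mul' := by intro x y; simp [htr φ] }
  invFun σ := Complex.ofRealHom.comp σ
  left_inv φ := by ext x; exact Complex.ext (by simp) (by simp [htr φ])
  right_inv σ := by ext x; simp

theorem TotallyReal.embEquiv_apply (htr : TotallyReal K) (φ : K →+* ℂ) (x : K) :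
    ((htr.embEquiv φ x : ℝ) : ℂ) = φ x := Complex.ext (by simp [embEquiv]) (by simp [htr φ])

variable [htr : Fact (TotallyReal K)]

theorem card_emb : Fintype.card (K →+* ℝ) = Module.finrank ℚ K := by
  rw [← NumberField.Embeddings.card K ℂ]
  exact (Fintype.card_congr htr.out.embEquiv).symm

theorem finrank_pos_K : 0 < Module.finrank ℚ K := Module.finrank_pos

instance nonempty_emb : Nonempty (K →+* ℝ) := by
  rw [← Fintype.card_pos_iff, card_emb]; exact finrank_pos_K

theorem trK_eq_sum (x : K) : ((Algebra.trace ℚ K x : ℚ) : ℝ) = ∑ σ : K →+* ℝ, σ x := by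
  have h := trace_eq_sum_embeddings (K := ℚ) (L := K) ℂ (x := x)
  have h2 : ((∑ σ : K →+* ℝ, σ x : ℝ) : ℂ) = ∑ σ : K →ₐ[ℚ] ℂ, σ x := by
    rw [Complex.ofReal_sum, ← Equiv.sum_comp htr.out.embEquiv,
      ← Equiv.sum_comp (RingHom.equivRatAlgHom K ℂ)]
    exact Finset.sum_congr rfl fun φ _ => htr.out.embEquiv_apply φ x
  rw [← h, eq_ratCast] at h2
  exact_mod_cast h2.symm

theorem normK_eq_prod (x : K) : ((Algebra.norm ℚ x : ℚ) : ℝ) = ∏ σ : K →+* ℝ, σ x := by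
  have h := Algebra.norm_eq_prod_embeddings ℚ ℂ x
  have h2 : ((∏ σ : K →+* ℝ, σ x : ℝ) : ℂ) = ∏ σ : K →ₐ[ℚ] ℂ, σ x := by
    rw [Complex.ofReal_prod, ← Equiv.prod_comp htr.out.embEquiv,
      ← Equiv.prod_comp (RingHom.equivRatAlgHom K ℂ)]
    exact Finset.prod_congr rfl fun φ _ => htr.out.embEquiv_apply φ x
  rw [← h, eq_ratCast] at h2
  exact_mod_cast h2.symm

theorem trZ_eq_sum (x : 𝓞 K) : (trZ x : ℝ) = ∑ σ : K →+* ℝ, ov σ x := by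
  rw [← show ((Algebra.trace ℚ K (x : K) : ℚ) : ℝ) = ∑ σ : K →+* ℝ, ov σ x from
    trK_eq_sum (x : K), ← Algebra.coe_trace_int]
  simp

theorem nmN_eq_prod (x : 𝓞 K) : (nmN x : ℝ) = ∏ σ : K →+* ℝ, |ov σ x| := by
  rw [← Finset.abs_prod, ← show ((Algebra.norm ℚ (x : K) : ℚ) : ℝ) = ∏ σ : K →+* ℝ, ov σ x from
    normK_eq_prod (x : K), ← Algebra.coe_norm_int, nmN, Nat.cast_natAbs]
  simp

theorem one_le_prod_ov {x : 𝓞 K} (hx : x ≠ 0) : 1 ≤ ∏ σ : K →+* ℝ, |ov σ x| := by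
  rw [← nmN_eq_prod]; exact_mod_cast nmN_pos hx

theorem eq_zero_of_ov_lt_one {x : 𝓞 K} (h : ∀ σ : K →+* ℝ, |ov σ x| < 1) : x = 0 := by
  by_contra hx
  have h1 := one_le_prod_ov hx
  have : ∏ σ : K →+* ℝ, |ov σ x| < ∏ σ : K →+* ℝ, (1 : ℝ) :=
    Finset.prod_lt_prod_of_nonempty (fun σ _ => abs_pos.mpr ((ov_eq_zero σ).not.mpr hx))
      (fun σ _ => h σ) Finset.univ_nonempty
  simp at this
  linarith

end NumberFieldBasics

section Approximation

variable {K : Type} [Field K] [NumberField K] [htr : Fact (TotallyReal K)]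

variable (K) in
/-- Elements of `K` are at bounded distance from algebraic integers. -/
theorem exists_integer_near :
    ∃ C : ℝ, 1 ≤ C ∧ ∀ k : K, ∃ z : 𝓞 K, ∀ σ : K →+* ℝ, |σ k - ov σ z| ≤ C := by
  let b := integralBasis K
  let C : ℝ := 1 + ∑ σ : K →+* ℝ, ∑ i, |σ (b i)|
  have hnn : ∀ σ : K →+* ℝ, 0 ≤ ∑ i, |σ (b i)| := fun σ => Finset.sum_nonneg fun _ _ => abs_nonneg _
  refine ⟨C, by simpa [C] using Finset.sum_nonneg fun σ _ => hnn σ, fun k => ?_⟩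
  refine ⟨∑ i, ⌊b.repr k i⌋ • RingOfIntegers.basis K i, fun σ => ?_⟩
  have h1 : σ k = ∑ i, (b.repr k i : ℝ) * σ (b i) := by
    conv_lhs => rw [← b.sum_repr k]
    simp [Algebra.smul_def]
  have h2 : ov σ (∑ i, ⌊b.repr k i⌋ • RingOfIntegers.basis K i)
      = ∑ i, (⌊b.repr k i⌋ : ℝ) * σ (b i) := by
    simp [ov_apply, b, integralBasis_apply]
  rw [h1, h2, ← Finset.sum_sub_distrib]
  calc _ ≤ ∑ i, |(b.repr k i : ℝ) * σ (b i) - ⌊b.repr k i⌋ * σ (b i)| :=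
        Finset.abs_sum_le_sum_abs _ _
    _ ≤ ∑ i, |σ (b i)| := by
        refine Finset.sum_le_sum fun i _ => ?_
        rw [← sub_mul, abs_mul]
        refine mul_le_of_le_one_left (abs_nonneg _) ?_
        have : ((b.repr k i : ℝ) - ⌊b.repr k i⌋) = Int.fract (b.repr k i : ℝ) := by
          rw [Int.fract, Rat.floor_cast]
        rw [this, abs_of_nonneg (Int.fract_nonneg _)]
        exact (Int.fract_lt_one _).le
    _ ≤ C := by
        have := Finset.single_le_sum (f := fun σ : K →+* ℝ => ∑ i, |σ (b i)|)
          (fun τ _ => hnn τ) (Finset.mem_univ σ)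
        simp only [C]; linarith

/-- Residue classes modulo `b` have representatives of size comparable to `b`. -/
theorem exists_small_residue {C : ℝ}
    (hC : ∀ k : K, ∃ z : 𝓞 K, ∀ σ : K →+* ℝ, |σ k - ov σ z| ≤ C) {b : 𝓞 K} (hb : b ≠ 0)
    (x : 𝓞 K) : ∃ y : 𝓞 K, b ∣ x - y ∧ ∀ σ : K →+* ℝ, |ov σ y| ≤ C * |ov σ b| := by
  obtain ⟨z, hz⟩ := hC ((x : K) / b)
  refine ⟨x - b * z, ⟨z, by ring⟩, fun σ => ?_⟩
  have hb' : ov σ b ≠ 0 := (ov_eq_zero σ).not.mpr hb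
  have : ov σ (x - b * z) = (σ ((x : K) / b) - ov σ z) * ov σ b := by
    rw [map_sub, map_mul, map_div₀, ← ov_apply, ← ov_apply]; field_simp
  rw [this, abs_mul]
  exact mul_le_mul_of_nonneg_right (hz σ) (abs_nonneg _)

variable (K) in
theorem emb_basis_surjective :
    ∀ y : (K →+* ℝ) → ℝ, ∃ t : Module.Free.ChooseBasisIndex ℤ (𝓞 K) → ℝ,
      ∀ σ : K →+* ℝ, ∑ i, t i * σ (integralBasis K i) = y σ := by
  classical
  let b := integralBasis K
  have hli : LinearIndependent ℝ (fun (σ : K →+* ℝ) i => σ (b i)) := by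
    rw [Fintype.linearIndependent_iff]
    intro g hg
    have h0 : ∀ k : K, ∑ σ : K →+* ℝ, g σ * σ k = 0 := by
      intro k
      rw [← b.sum_repr k]
      have : ∀ σ : K →+* ℝ, g σ * σ (∑ i, b.repr k i • b i)
          = ∑ i, (b.repr k i : ℝ) * (g σ * σ (b i)) := by
        intro σ
        rw [map_sum, Finset.mul_sum]
        refine Finset.sum_congr rfl fun i _ => ?_
        rw [Algebra.smul_def, map_mul]; simp; ring
      simp_rw [this]
      rw [Finset.sum_comm]
      refine Finset.sum_eq_zero fun i _ => ?_
      rw [← Finset.mul_sum]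
      have := congrFun hg i
      simp only [Finset.sum_apply, Pi.smul_apply, smul_eq_mul, Pi.zero_apply] at this
      rw [this, mul_zero]
    have hd := (linearIndependent_monoidHom K ℝ).comp
      (fun σ : K →+* ℝ => (σ : K →* ℝ)) (fun σ τ h => by ext x; exact DFunLike.congr_fun h x)
    rw [Fintype.linearIndependent_iff] at hd
    apply hd g
    ext k
    simpa using h0 k
  have hcard : Fintype.card (K →+* ℝ) = Fintype.card (Module.Free.ChooseBasisIndex ℤ (𝓞 K)) := by
    rw [card_emb, Module.finrank_eq_card_basis b]
  let e := Fintype.equivOfCardEq hcard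
  let A : Matrix (K →+* ℝ) (K →+* ℝ) ℝ := fun σ τ => σ (b (e τ))
  have hA : LinearIndependent ℝ A.row := by
    have := hli.map' (LinearMap.funLeft ℝ ℝ e)
      (LinearMap.ker_eq_bot.mpr (LinearMap.funLeft_injective_of_surjective _ _ _ e.surjective))
    exact this
  have hu : IsUnit A := Matrix.linearIndependent_rows_iff_isUnit.mp hA
  intro y
  obtain ⟨t, ht⟩ := Matrix.mulVec_surjective_iff_isUnit.mpr hu y
  refine ⟨fun i => t (e.symm i), fun σ => ?_⟩
  rw [← ht, ← Equiv.sum_comp e]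
  simp [Matrix.mulVec, dotProduct, A, b, mul_comm]

variable (K) in
/-- The integers form a relatively dense set in `ℝ^d`. -/
theorem exists_integer_approx :
    ∃ C : ℝ, 1 ≤ C ∧ ∀ y : (K →+* ℝ) → ℝ, ∃ a : 𝓞 K, ∀ σ : K →+* ℝ, |ov σ a - y σ| ≤ C := by
  let b := integralBasis K
  let C : ℝ := 1 + ∑ σ : K →+* ℝ, ∑ i, |σ (b i)|
  have hnn : ∀ σ : K →+* ℝ, 0 ≤ ∑ i, |σ (b i)| := fun σ => Finset.sum_nonneg fun _ _ => abs_nonneg _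
  refine ⟨C, by simpa [C] using Finset.sum_nonneg fun σ _ => hnn σ, fun y => ?_⟩
  obtain ⟨t, ht⟩ := emb_basis_surjective K y
  refine ⟨∑ i, ⌊t i⌋ • RingOfIntegers.basis K i, fun σ => ?_⟩
  have h2 : ov σ (∑ i, ⌊t i⌋ • RingOfIntegers.basis K i) = ∑ i, (⌊t i⌋ : ℝ) * σ (b i) := by
    simp [ov_apply, b, integralBasis_apply]
  rw [← ht, h2, ← Finset.sum_sub_distrib]
  calc _ ≤ ∑ i, |(⌊t i⌋ : ℝ) * σ (b i) - t i * σ (b i)| := Finset.abs_sum_le_sum_abs _ _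
    _ ≤ ∑ i, |σ (b i)| := by
        refine Finset.sum_le_sum fun i _ => ?_
        rw [← sub_mul, abs_mul]
        refine mul_le_of_le_one_left (abs_nonneg _) ?_
        rw [abs_sub_comm]
        change |Int.fract (t i)| ≤ 1
        rw [abs_of_nonneg (Int.fract_nonneg _)]
        exact (Int.fract_lt_one _).le
    _ ≤ C := by
        have := Finset.single_le_sum (f := fun σ : K →+* ℝ => ∑ i, |σ (b i)|)
          (fun τ _ => hnn τ) (Finset.mem_univ σ)
        simp only [C]; linarith

/-- `K` is dense in `ℝ^d`. -/
theorem exists_field_approx (y : (K →+* ℝ) → ℝ) {ε : ℝ} (hε : 0 < ε) :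
    ∃ k : K, ∀ σ : K →+* ℝ, |σ k - y σ| < ε := by
  obtain ⟨C, hC1, hC⟩ := exists_integer_approx K
  obtain ⟨n, hn⟩ := exists_nat_gt (C / ε)
  have hn0 : (0 : ℝ) < n := lt_trans (by positivity) hn
  obtain ⟨a, ha⟩ := hC fun σ => n * y σ
  refine ⟨(a : K) / n, fun σ => ?_⟩
  have : σ ((a : K) / n) - y σ = (ov σ a - n * y σ) / n := by
    rw [map_div₀, map_natCast, ← ov_apply]; field_simp
  rw [this, abs_div, abs_of_pos hn0, div_lt_iff₀ hn0]
  rw [div_lt_iff₀ hε] at hn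
  linarith [ha σ]

/-- A set of integers whose differences are small is small. -/
theorem finite_of_diff_lt (S : Set (𝓞 K)) {a : ℕ}
    (h : ∀ x ∈ S, ∀ y ∈ S, ∀ σ : K →+* ℝ, |ov σ (x - y)| < a) :
    S.Finite ∧ S.ncard ≤ a ^ Module.finrank ℚ K := by
  obtain rfl | ha := Nat.eq_zero_or_pos a
  · have : S = ∅ := by
      by_contra hne
      obtain ⟨x, hx⟩ := Set.nonempty_iff_ne_empty.mpr hne
      have := h x hx x hx (Classical.arbitrary _)
      simp at this
    simp [this]
  have ha0 : (a : 𝓞 K) ≠ 0 := by exact_mod_cast ha.ne'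
  let I : Ideal (𝓞 K) := Ideal.span {(a : 𝓞 K)}
  have hI : I ≠ ⊥ := by simpa [I] using ha.ne'
  have : Finite (𝓞 K ⧸ I) := Ideal.finiteQuotientOfFreeOfNeBot I hI
  have hinj : Set.InjOn (Ideal.Quotient.mk I) S := by
    intro x hx y hy hxy
    rw [Ideal.Quotient.eq, Ideal.mem_span_singleton] at hxy
    obtain ⟨z, hz⟩ := hxy
    have : z = 0 := eq_zero_of_ov_lt_one fun σ => by
      have h1 := h x hx y hy σ
      rw [hz, map_mul, map_natCast, abs_mul, Nat.abs_cast] at h1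
      have : (0 : ℝ) < a := by exact_mod_cast ha
      nlinarith
    rw [this, mul_zero, sub_eq_zero] at hz
    exact hz
  refine ⟨Set.Finite.of_finite_image (Set.toFinite _) hinj, ?_⟩
  rw [← hinj.ncard_image]
  calc _ ≤ (Set.univ : Set (𝓞 K ⧸ I)).ncard := Set.ncard_le_ncard (Set.subset_univ _)
    _ = Nat.card (𝓞 K ⧸ I) := Set.ncard_univ _
    _ = nmN (a : 𝓞 K) := by rw [nmN_eq_absNorm]; rfl
    _ = _ := nmN_natCast a

theorem finite_ov_le (Y : ℝ) : {x : 𝓞 K | ∀ σ : K →+* ℝ, |ov σ x| ≤ Y}.Finite := by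
  obtain ⟨a, ha⟩ := exists_nat_gt (2 * Y)
  refine (finite_of_diff_lt (a := a) _ fun x hx y hy σ => ?_).1
  rw [map_sub]
  linarith [abs_sub (ov σ x) (ov σ y), hx σ, hy σ]

/-- A nonzero ideal contains a small nonzero element. -/
theorem exists_small_mem_ideal {C : ℝ}
    (hC : ∀ k : K, ∃ z : 𝓞 K, ∀ σ : K →+* ℝ, |σ k - ov σ z| ≤ C) {I : Ideal (𝓞 K)} (hI : I ≠ ⊥)
    {b : ℕ} (hb : Ideal.absNorm I < b ^ Module.finrank ℚ K) :
    ∃ a ∈ I, a ≠ 0 ∧ ∀ σ : K →+* ℝ, |ov σ a| ≤ 2 * C * b := by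
  have hb0 : b ≠ 0 := by
    rintro rfl; rw [zero_pow finrank_pos_K.ne'] at hb; omega
  have hb0' : (b : 𝓞 K) ≠ 0 := by exact_mod_cast hb0
  let J : Ideal (𝓞 K) := Ideal.span {(b : 𝓞 K)}
  have hJ : J ≠ ⊥ := by simpa [J] using hb0
  have : Finite (𝓞 K ⧸ I) := Ideal.finiteQuotientOfFreeOfNeBot I hI
  have : Finite (𝓞 K ⧸ J) := Ideal.finiteQuotientOfFreeOfNeBot J hJ
  have := Fintype.ofFinite (𝓞 K ⧸ I)
  have := Fintype.ofFinite (𝓞 K ⧸ J)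
  choose rep hrep hrep2 using fun q : 𝓞 K ⧸ J => exists_small_residue hC hb0' q.out
  have hcard : Fintype.card (𝓞 K ⧸ I) < Fintype.card (𝓞 K ⧸ J) := by
    rw [← Nat.card_eq_fintype_card, ← Nat.card_eq_fintype_card]
    calc _ = Ideal.absNorm I := rfl
      _ < _ := hb
      _ = nmN (b : 𝓞 K) := (nmN_natCast b).symm
      _ = _ := by rw [nmN_eq_absNorm]; rfl
  obtain ⟨q, q', hne, hq⟩ := Fintype.exists_ne_map_eq_of_card_lt
    (fun q => Ideal.Quotient.mk I (rep q)) hcard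
  refine ⟨rep q - rep q', Ideal.Quotient.eq.mp hq, fun h0 => hne ?_, fun σ => ?_⟩
  · rw [sub_eq_zero] at h0
    rw [← q.out_eq, ← q'.out_eq]
    refine (Ideal.Quotient.eq (I := J)).mpr (Ideal.mem_span_singleton.mpr ?_)
    have := dvd_sub (hrep q) (hrep q')
    rw [h0] at this; simpa using this
  · rw [map_sub]
    have h1 := hrep2 q σ
    have h2 := hrep2 q' σ
    rw [map_natCast, Nat.abs_cast] at h1 h2
    linarith [abs_sub (ov σ (rep q)) (ov σ (rep q'))]

end Approximation

section SumsOfSquares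

theorem Rat.exists_sum_four_squares {q : ℚ} (hq : 0 ≤ q) :
    ∃ z : Fin 4 → ℚ, ∑ i, z i ^ 2 = q := by
  obtain ⟨a, b, c, e, h⟩ := Nat.sum_four_squares (q.num.natAbs * q.den)
  have hden : (q.den : ℚ) ≠ 0 := by exact_mod_cast q.den_nz
  refine ⟨![a / q.den, b / q.den, c / q.den, e / q.den], ?_⟩
  have h2 : (a : ℚ) ^ 2 + b ^ 2 + c ^ 2 + e ^ 2 = q.num * q.den := by
    have h3 : ((q.num.natAbs : ℤ) : ℚ) = q.num := by
      rw [Int.natAbs_of_nonneg (Rat.num_nonneg.mpr hq)]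
    rw [← h3]; exact_mod_cast h
  simp only [Fin.sum_univ_four, Matrix.cons_val]
  have h4 : q = q.num * q.den / q.den ^ 2 := by
    rw [pow_two, mul_div_mul_right _ _ hden, Rat.num_div_den]
  conv_rhs => rw [h4, ← h2]
  field_simp

theorem abs_le_of_sum_add {ι : Type*} [Fintype ι] [Nonempty ι] {p : ι → ℝ} {η : ℝ}
    (h : ∀ i, |(∑ j, p j) + p i| ≤ η) (i : ι) : |p i| ≤ 2 * η := by
  have hη : 0 ≤ η := (abs_nonneg _).trans (h i)
  have hs : |∑ j, p j| ≤ η := by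
    have h1 : ∑ i, ((∑ j, p j) + p i) = (Fintype.card ι + 1) * ∑ j, p j := by
      rw [Finset.sum_add_distrib]; simp; ring
    have h2 : |∑ i, ((∑ j, p j) + p i)| ≤ Fintype.card ι * η := by
      refine (Finset.abs_sum_le_sum_abs _ _).trans ((Finset.sum_le_sum fun i _ => h i).trans ?_)
      simp
    rw [h1, abs_mul, abs_of_nonneg (by positivity)] at h2
    by_contra hc
    push Not at hc
    have : (0 : ℝ) ≤ Fintype.card ι := by positivity
    nlinarith [abs_nonneg (∑ j, p j)]
  have := abs_sub ((∑ j, p j) + p i) (∑ j, p j)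
  rw [add_sub_cancel_left] at this
  linarith [h i]

theorem abs_mul_sum_le {ι : Type*} [Fintype ι] [Nonempty ι] {e c : ι → ℝ} {B : ℝ}
    (he : ∀ i, |e i| ≤ 1 / (8 * Fintype.card ι)) (hB : ∀ i, |c i| ≤ B) :
    |∑ i, e i * c i| ≤ B / 8 := by
  have hc : (0 : ℝ) < Fintype.card ι := by exact_mod_cast Fintype.card_pos
  calc _ ≤ ∑ i : ι, 1 / (8 * (Fintype.card ι : ℝ)) * B :=
        (Finset.abs_sum_le_sum_abs _ _).trans (Finset.sum_le_sum fun i _ => by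
          rw [abs_mul]
          exact mul_le_mul (he i) (hB i) (abs_nonneg _) (by positivity))
    _ = B / 8 := by simp; field_simp

variable {K : Type} [Field K] [NumberField K] [htr : Fact (TotallyReal K)]

theorem denseRange_emb : DenseRange (fun (k : K) (σ : K →+* ℝ) => σ k) := by
  rw [Metric.denseRange_iff]
  intro y r hr
  obtain ⟨k, hk⟩ := exists_field_approx y hr
  refine ⟨k, (dist_pi_lt_iff hr).mpr fun σ => ?_⟩
  rw [Real.dist_eq, abs_sub_comm]; exact hk σ

/-- A totally positive element is a sum of `4 d` squares. -/
theorem exists_sum_sq {y : K} (hy : ∀ σ : K →+* ℝ, 0 < σ y) :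
    ∃ z : Fin (4 * Module.finrank ℚ K) → K, ∑ i, z i ^ 2 = y := by
  classical
  have hcard : (0 : ℝ) < Fintype.card (K →+* ℝ) := by exact_mod_cast Fintype.card_pos
  set ε : ℝ := 1 / (8 * Fintype.card (K →+* ℝ)) with hε
  have hε0 : 0 < ε := by positivity
  have hex : ∀ τ : K →+* ℝ, ∃ β : K, ∀ σ : K →+* ℝ,
      |σ β ^ 2 - σ y * (1 + if σ = τ then 1 else 0)| < ε * σ y := by
    intro τ
    have hopen : IsOpen {z : (K →+* ℝ) → ℝ | ∀ σ : K →+* ℝ,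
        |z σ ^ 2 - σ y * (1 + if σ = τ then 1 else 0)| < ε * σ y} := by
      simp only [Set.ofPred_forall]
      exact isOpen_iInter_of_finite fun σ => isOpen_lt (by fun_prop) continuous_const
    obtain ⟨β, hβ⟩ := denseRange_emb.exists_mem_open hopen
      ⟨fun σ => √(σ y * (1 + if σ = τ then 1 else 0)), fun σ => by
        have : 0 ≤ σ y * (1 + if σ = τ then 1 else 0) :=
          mul_nonneg (hy σ).le (by split_ifs <;> norm_num)
        rw [Real.sq_sqrt this]
        simp [mul_pos hε0 (hy σ)]⟩
    exact ⟨β, hβ⟩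
  choose β hβ using hex
  let e : (K →+* ℝ) → (K →+* ℝ) → ℝ := fun σ τ =>
    σ (β τ) ^ 2 / σ y - (1 + if σ = τ then 1 else 0)
  have he : ∀ σ τ, |e σ τ| ≤ ε := by
    intro σ τ
    have h1 := hβ τ σ
    have h2 : e σ τ = (σ (β τ) ^ 2 - σ y * (1 + if σ = τ then 1 else 0)) / σ y := by
      have := (hy σ).ne'
      simp only [e]; field_simp
    rw [h2, abs_div, abs_of_pos (hy σ), div_le_iff₀ (hy σ)]
    exact h1.le
  have hval : ∀ (c : (K →+* ℝ) → ℝ) (σ : K →+* ℝ), ∑ τ, c τ * σ (β τ) ^ 2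
      = σ y * ((∑ τ, c τ) + c σ + ∑ τ, e σ τ * c τ) := by
    intro c σ
    have h2 : ∀ τ, c τ * σ (β τ) ^ 2 = σ y * (c τ + (if σ = τ then c τ else 0) + e σ τ * c τ) := by
      intro τ
      have := (hy σ).ne'
      simp only [e]
      split_ifs <;> field_simp <;> ring
    simp_rw [h2]
    rw [← Finset.mul_sum, Finset.sum_add_distrib, Finset.sum_add_distrib]
    simp
  have hli : LinearIndependent ℚ (fun τ => β τ ^ 2) := by
    rw [Fintype.linearIndependent_iff]
    intro g hg
    have h1 : ∀ σ : K →+* ℝ, |(∑ τ, (g τ : ℝ)) + g σ| ≤ ‖fun τ => (g τ : ℝ)‖ / 8 := by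
      intro σ
      have h2 := congrArg σ hg
      rw [map_sum, map_zero] at h2
      have h3 : ∑ τ, (g τ : ℝ) * σ (β τ) ^ 2 = 0 := by
        rw [← h2]
        exact Finset.sum_congr rfl fun τ _ => by simp [Algebra.smul_def]
      rw [hval] at h3
      have h4 := (mul_eq_zero.mp h3).resolve_left (hy σ).ne'
      rw [eq_neg_of_add_eq_zero_left h4, abs_neg]
      exact abs_mul_sum_le (he σ) fun τ => norm_le_pi_norm (fun τ => (g τ : ℝ)) τ
    have h5 := abs_le_of_sum_add h1
    have h6 : ‖fun τ => (g τ : ℝ)‖ ≤ 2 * (‖fun τ => (g τ : ℝ)‖ / 8) :=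
      (pi_norm_le_iff_of_nonneg (by positivity)).mpr h5
    have h7 : ‖fun τ => (g τ : ℝ)‖ = 0 := by linarith [norm_nonneg fun τ => (g τ : ℝ)]
    intro τ
    have := congrFun (norm_eq_zero.mp h7) τ
    simpa using this
  let b := basisOfLinearIndependentOfCardEqFinrank hli card_emb
  have hb : ∀ τ, b τ = β τ ^ 2 := fun τ => by simp [b]
  let q : (K →+* ℝ) → ℚ := fun τ => b.repr y τ
  have hyq : ∑ τ, q τ • β τ ^ 2 = y := by
    conv_rhs => rw [← b.sum_repr y]
    simp [q, hb]
  have hq1 : ∀ σ : K →+* ℝ, (∑ τ, (q τ : ℝ)) + q σ + ∑ τ, e σ τ * q τ = 1 := by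
    intro σ
    have h2 := congrArg σ hyq
    have h3 : ∑ τ, (q τ : ℝ) * σ (β τ) ^ 2 = σ y := by
      rw [← h2, map_sum]
      exact Finset.sum_congr rfl fun τ _ => by simp [Algebra.smul_def]
    rw [hval] at h3
    exact mul_left_cancel₀ (hy σ).ne' (by rw [h3, mul_one])
  have hqpos : ∀ τ, 0 ≤ q τ := by
    obtain ⟨N, hN⟩ : ∃ N : ℝ, N = (Fintype.card (K →+* ℝ) : ℝ) := ⟨_, rfl⟩
    have hN0 : 0 < N := hN ▸ hcard
    let p : (K →+* ℝ) → ℝ := fun τ => q τ - 1 / (N + 1)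
    have hp : ∀ σ, (∑ τ, p τ) + p σ = - ∑ τ, e σ τ * q τ := by
      intro σ
      have h := hq1 σ
      have h3 : ∑ τ, p τ = (∑ τ, (q τ : ℝ)) - N * (1 / (N + 1)) := by
        simp [p, Finset.sum_sub_distrib, hN]
      have h4 : N * (1 / (N + 1)) + 1 / (N + 1) = 1 := by field_simp
      rw [h3]; simp only [p]; linarith
    set Q : ℝ := ‖fun τ => (q τ : ℝ)‖ with hQ
    have h1 := abs_le_of_sum_add (p := p) (η := Q / 8) fun σ => by
      rw [hp, abs_neg]
      exact abs_mul_sum_le (he σ) fun τ => norm_le_pi_norm (fun τ => (q τ : ℝ)) τ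
    have hNpos : 0 < 1 / (N + 1) := by positivity
    have hQle : Q ≤ 1 / (N + 1) + 2 * (Q / 8) := by
      refine (pi_norm_le_iff_of_nonneg (by positivity)).mpr fun τ => ?_
      rw [Real.norm_eq_abs]
      have h5 : (q τ : ℝ) = 1 / (N + 1) + p τ := by simp [p]
      rw [h5]
      refine (abs_add_le _ _).trans ?_
      rw [abs_of_pos hNpos]
      linarith [h1 τ]
    intro τ
    have h2 := neg_abs_le (p τ)
    have h3 := h1 τ
    have : (0 : ℝ) ≤ q τ := by
      have h5 : (q τ : ℝ) = 1 / (N + 1) + p τ := by simp [p]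
      rw [h5]; linarith
    exact_mod_cast this
  choose w hw using fun τ => Rat.exists_sum_four_squares (hqpos τ)
  have hidx : Fintype.card (Fin 4 × (K →+* ℝ)) = 4 * Module.finrank ℚ K := by
    rw [Fintype.card_prod, card_emb, Fintype.card_fin]
  let E := Fintype.equivFinOfCardEq hidx
  refine ⟨fun i => (w (E.symm i).2 (E.symm i).1 : K) * β (E.symm i).2, ?_⟩
  rw [Equiv.sum_comp E.symm (fun t : Fin 4 × (K →+* ℝ) => ((w t.2 t.1 : K) * β t.2) ^ 2),
    Fintype.sum_prod_type_right]
  rw [← hyq]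
  refine Finset.sum_congr rfl fun τ _ => ?_
  rw [← hw τ]
  simp_rw [mul_pow, ← Finset.sum_mul]
  simp [Algebra.smul_def]

end SumsOfSquares

section IdealSums

open Ideal Filter

variable (K : Type) [Field K] [NumberField K]

theorem exists_card_ideal_le :
    ∃ C : ℝ, 0 ≤ C ∧ ∀ n : ℕ, 1 ≤ n → ∀ F : Finset (Ideal (𝓞 K)),
      (∀ I ∈ F, absNorm I = n) → (F.card : ℝ) ≤ C * n := by
  have h := (NumberField.Ideal.tendsto_norm_le_div_atTop K).comp tendsto_natCast_atTop_atTop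
  obtain ⟨C, hC⟩ := h.bddAbove_range
  have hC' : ∀ n : ℕ, (Nat.card {I : Ideal (𝓞 K) // (absNorm I : ℝ) ≤ (n : ℝ)} : ℝ) / n ≤ C :=
    fun n => hC ⟨n, rfl⟩
  refine ⟨C, le_trans (by positivity) (hC' 1), fun n hn F hF => ?_⟩
  have hn' : (0 : ℝ) < n := by exact_mod_cast hn
  rw [← div_le_iff₀ hn']
  refine le_trans ?_ (hC' n)
  gcongr
  have hfin : Finite {I : Ideal (𝓞 K) // (absNorm I : ℝ) ≤ (n : ℝ)} := by
    simp_rw [Nat.cast_le]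
    exact (Ideal.finite_setOfPred_absNorm_le n).to_subtype
  have := Nat.card_le_card_of_injective
    (fun I : F => (⟨I.1, by rw [hF _ I.2]⟩ : {I : Ideal (𝓞 K) // (absNorm I : ℝ) ≤ (n : ℝ)}))
    (fun I J hIJ => Subtype.ext (Subtype.mk.inj hIJ))
  simpa using this

theorem exists_sum_ideal_le :
    ∃ C : ℝ, 0 ≤ C ∧ ∀ F : Finset (Ideal (𝓞 K)), (∀ I ∈ F, I ≠ ⊥) →
      ∑ I ∈ F, ((absNorm I : ℝ) ^ 3)⁻¹ ≤ C := by
  classical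
  obtain ⟨C, hC0, hC⟩ := exists_card_ideal_le K
  have hsum : Summable fun n : ℕ => ((n : ℝ) ^ 2)⁻¹ := Real.summable_nat_pow_inv.mpr one_lt_two
  refine ⟨C * ∑' n : ℕ, ((n : ℝ) ^ 2)⁻¹, by positivity, fun F hF => ?_⟩
  rw [← Finset.sum_fiberwise_of_maps_to (t := F.image (fun I => absNorm I))
    (g := fun I => absNorm I)
    fun I hI => Finset.mem_image_of_mem _ hI]
  calc _ ≤ ∑ n ∈ F.image (fun I => absNorm I), C * ((n : ℝ) ^ 2)⁻¹ := by
        refine Finset.sum_le_sum fun n hn => ?_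
        obtain ⟨I, hI, rfl⟩ := Finset.mem_image.mp hn
        have hpos : 1 ≤ absNorm I := Nat.one_le_iff_ne_zero.mpr
          (Ideal.absNorm_eq_zero_iff.not.mpr (hF I hI))
        have hpos' : (0 : ℝ) < absNorm I := by exact_mod_cast hpos
        have h1 := hC (absNorm I) hpos {J ∈ F | absNorm J = absNorm I}
          fun J hJ => (Finset.mem_filter.mp hJ).2
        calc _ = ∑ J ∈ F with absNorm J = absNorm I, ((absNorm I : ℝ) ^ 3)⁻¹ :=
              Finset.sum_congr rfl fun J hJ => by rw [(Finset.mem_filter.mp hJ).2]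
          _ = _ * ((absNorm I : ℝ) ^ 3)⁻¹ := by rw [Finset.sum_const, nsmul_eq_mul]
          _ ≤ C * absNorm I * ((absNorm I : ℝ) ^ 3)⁻¹ := by gcongr
          _ = _ := by field_simp
    _ = C * ∑ n ∈ F.image (fun I => absNorm I), ((n : ℝ) ^ 2)⁻¹ := by rw [Finset.mul_sum]
    _ ≤ _ := by
        gcongr
        exact hsum.sum_le_tsum _ fun _ _ => by positivity

end IdealSums

/-! ### Basic geometry of positive definite lattices -/

namespace OKLattice

variable {K : Type} [Field K] [NumberField K] (L : OKLattice K)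

/-- The quadratic form attached to an embedding. -/
def q (σ : K →+* ℝ) (x : L.carrier) : ℝ := ov σ (L.form x x)

/-- The norm attached to an embedding. -/
def nrm (σ : K →+* ℝ) (x : L.carrier) : ℝ := √(L.q σ x)

theorem q_pos (σ : K →+* ℝ) {x : L.carrier} (hx : x ≠ 0) : 0 < L.q σ x := L.posDef x hx σ

theorem q_nonneg (σ : K →+* ℝ) (x : L.carrier) : 0 ≤ L.q σ x := by
  by_cases hx : x = 0
  · simp [q, hx]
  · exact (L.q_pos σ hx).le

theorem nrm_nonneg (σ : K →+* ℝ) (x : L.carrier) : 0 ≤ L.nrm σ x := Real.sqrt_nonneg _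

theorem nrm_sq (σ : K →+* ℝ) (x : L.carrier) : L.nrm σ x ^ 2 = L.q σ x :=
  Real.sq_sqrt (L.q_nonneg σ x)

theorem nrm_pos (σ : K →+* ℝ) {x : L.carrier} (hx : x ≠ 0) : 0 < L.nrm σ x :=
  Real.sqrt_pos.mpr (L.q_pos σ hx)

@[simp] theorem nrm_zero (σ : K →+* ℝ) : L.nrm σ 0 = 0 := by simp [nrm, q]

theorem nrm_smul (σ : K →+* ℝ) (a : 𝓞 K) (x : L.carrier) :
    L.nrm σ (a • x) = |ov σ a| * L.nrm σ x := by
  have : L.q σ (a • x) = ov σ a ^ 2 * L.q σ x := by simp [q]; ring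
  rw [nrm, this, Real.sqrt_mul (sq_nonneg _), Real.sqrt_sq_eq_abs]; rfl

theorem nrm_neg (σ : K →+* ℝ) (x : L.carrier) : L.nrm σ (-x) = L.nrm σ x := by
  simp [nrm, q]

theorem abs_form_le (σ : K →+* ℝ) (x y : L.carrier) :
    |ov σ (L.form x y)| ≤ L.nrm σ x * L.nrm σ y := by
  by_cases hy : y = 0
  · simp [hy]
  have h := L.q_nonneg σ (L.form y y • x - L.form x y • y)
  have hq : L.q σ (L.form y y • x - L.form x y • y)
      = L.q σ y * (L.q σ x * L.q σ y - ov σ (L.form x y) ^ 2) := by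
    simp only [q, map_sub, map_smul, LinearMap.sub_apply, LinearMap.smul_apply, smul_eq_mul,
      map_mul, L.symm y x]
    ring
  rw [hq] at h
  have h1 := nonneg_of_mul_nonneg_right h (L.q_pos σ hy)
  refine abs_le_of_sq_le_sq ?_ (mul_nonneg (L.nrm_nonneg σ x) (L.nrm_nonneg σ y))
  rw [mul_pow, nrm_sq, nrm_sq]
  linarith

theorem nrm_add_le (σ : K →+* ℝ) (x y : L.carrier) :
    L.nrm σ (x + y) ≤ L.nrm σ x + L.nrm σ y := by
  refine Real.sqrt_le_iff.mpr ⟨add_nonneg (L.nrm_nonneg σ x) (L.nrm_nonneg σ y), ?_⟩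
  have : L.q σ (x + y) = L.q σ x + L.q σ y + 2 * ov σ (L.form x y) := by
    simp only [q, map_add, LinearMap.add_apply, L.symm y x]; ring
  rw [this, add_sq, nrm_sq, nrm_sq]
  nlinarith [le_abs_self (ov σ (L.form x y)), L.abs_form_le σ x y]

theorem nrm_sub_le (σ : K →+* ℝ) (x y : L.carrier) :
    L.nrm σ (x - y) ≤ L.nrm σ x + L.nrm σ y := by
  rw [sub_eq_add_neg, ← L.nrm_neg σ y]; exact L.nrm_add_le σ x (-y)

theorem nrm_sum_le {ι : Type*} (s : Finset ι) (σ : K →+* ℝ) (x : ι → L.carrier) :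
    L.nrm σ (∑ i ∈ s, x i) ≤ ∑ i ∈ s, L.nrm σ (x i) :=
  Finset.le_sum_of_subadditive (L.nrm σ) (L.nrm_zero σ).le (L.nrm_add_le σ) s x

instance : Module.Finite ℤ L.carrier := Module.Finite.trans (𝓞 K) L.carrier

instance : NoZeroSMulDivisors ℤ L.carrier := ⟨fun {c x} h => by
  have : (c : 𝓞 K) • x = 0 := by rw [← h]; exact Int.cast_smul_eq_zsmul (𝓞 K) c x
  rcases smul_eq_zero.mp this with h | h
  · left; exact_mod_cast h
  · exact Or.inr h⟩

instance : Module.Free ℤ L.carrier := Module.free_of_finite_type_torsion_free'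

variable [htr : Fact (TotallyReal K)]

theorem form_self_eq_zero {x : L.carrier} : L.form x x = 0 ↔ x = 0 := by
  refine ⟨fun h => ?_, fun h => by simp [h]⟩
  by_contra hx
  have := L.q_pos (Classical.arbitrary _) hx
  simp [q, h] at this

theorem nmN_form_self (x : L.carrier) :
    (nmN (L.form x x) : ℝ) = (∏ σ : K →+* ℝ, L.nrm σ x) ^ 2 := by
  rw [nmN_eq_prod, ← Finset.prod_pow]
  refine Finset.prod_congr rfl fun σ _ => ?_
  rw [nrm_sq]; exact abs_of_nonneg (L.q_nonneg σ x)

/-- The set of lattice vectors in a box. -/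
theorem finite_box (y : (K →+* ℝ) → ℝ) : {x : L.carrier | ∀ σ, L.nrm σ x ≤ y σ}.Finite := by
  classical
  obtain ⟨n, e, he⟩ := Module.Finite.exists_fin (R := 𝓞 K) (M := L.carrier)
  let Y : ℝ := ∑ i, ∑ σ : K →+* ℝ, |y σ| * L.nrm σ (e i)
  let φ : L.carrier → Fin n → 𝓞 K := fun x i => L.form x (e i)
  have hφ : Function.Injective φ := by
    intro x x' h
    have h1 : L.form (x - x') = 0 := by
      refine LinearMap.ext_on he ?_
      rintro _ ⟨i, rfl⟩
      have := congrFun h i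
      simpa [φ, sub_eq_zero] using this
    have h2 : L.form (x - x') (x - x') = 0 := by rw [h1]; rfl
    exact sub_eq_zero.mp (L.form_self_eq_zero.mp h2)
  refine Set.Finite.of_finite_image (f := φ) (Set.Finite.subset
    (Set.Finite.pi' (fun _ => finite_ov_le (K := K) Y)) ?_) hφ.injOn
  rintro _ ⟨x, hx, rfl⟩ i σ
  calc _ ≤ L.nrm σ x * L.nrm σ (e i) := L.abs_form_le σ x (e i)
    _ ≤ |y σ| * L.nrm σ (e i) :=
        mul_le_mul_of_nonneg_right ((hx σ).trans (le_abs_self _)) (L.nrm_nonneg _ _)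
    _ ≤ ∑ σ : K →+* ℝ, |y σ| * L.nrm σ (e i) :=
        Finset.single_le_sum (f := fun σ => |y σ| * L.nrm σ (e i))
          (fun τ _ => mul_nonneg (abs_nonneg _) (L.nrm_nonneg _ _)) (Finset.mem_univ σ)
    _ ≤ Y := Finset.single_le_sum (f := fun i => ∑ σ : K →+* ℝ, |y σ| * L.nrm σ (e i))
          (fun j _ => Finset.sum_nonneg fun τ _ => mul_nonneg (abs_nonneg _) (L.nrm_nonneg _ _))
          (Finset.mem_univ i)

/-- The finset of lattice vectors in a box. -/
def box (y : (K →+* ℝ) → ℝ) : Finset L.carrier := (L.finite_box y).toFinset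

theorem mem_box {y : (K →+* ℝ) → ℝ} {x : L.carrier} : x ∈ L.box y ↔ ∀ σ, L.nrm σ x ≤ y σ := by
  simp [box]

/-- The finset of lattice vectors in a cube. -/
abbrev cube (X : ℝ) : Finset L.carrier := L.box fun _ => X

theorem box_mono {y y' : (K →+* ℝ) → ℝ} (h : ∀ σ, y σ ≤ y' σ) : L.box y ⊆ L.box y' :=
  fun _ hx => L.mem_box.mpr fun σ => (L.mem_box.mp hx σ).trans (h σ)

theorem card_box_mono {y y' : (K →+* ℝ) → ℝ} (h : ∀ σ, y σ ≤ y' σ) :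
    (L.box y).card ≤ (L.box y').card := Finset.card_le_card (L.box_mono h)

theorem zero_mem_box {y : (K →+* ℝ) → ℝ} (h : ∀ σ, 0 ≤ y σ) : 0 ∈ L.box y :=
  L.mem_box.mpr fun σ => by simpa using h σ

/-- Vectors can be reduced modulo a scalar. -/
theorem exists_reduce : ∃ C : ℕ, 1 ≤ C ∧ (∀ a : 𝓞 K, a ≠ 0 → ∀ x : L.carrier, ∃ y z : L.carrier,
      x = y + a • z ∧ ∀ σ, L.nrm σ y ≤ C * |ov σ a|) ∧
    ∀ x : L.carrier, x ≠ 0 → ∃ z, L.form x z ≠ 0 ∧ ∀ σ, L.nrm σ z ≤ C := by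
  classical
  obtain ⟨C, hC1, hC⟩ := exists_integer_near K
  obtain ⟨n, e, he⟩ := Module.Finite.exists_fin (R := 𝓞 K) (M := L.carrier)
  obtain ⟨N, hN⟩ := exists_nat_ge (1 + C * ∑ i, ∑ σ : K →+* ℝ, L.nrm σ (e i))
  have hs : ∀ i σ, L.nrm σ (e i) ≤ ∑ σ : K →+* ℝ, L.nrm σ (e i) := fun i σ =>
    Finset.single_le_sum (f := fun σ => L.nrm σ (e i)) (fun τ _ => L.nrm_nonneg _ _)
      (Finset.mem_univ σ)
  have hs0 : ∀ i, 0 ≤ ∑ σ : K →+* ℝ, L.nrm σ (e i) := fun i =>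
    Finset.sum_nonneg fun τ _ => L.nrm_nonneg _ _
  have hs1 : 0 ≤ ∑ i, ∑ σ : K →+* ℝ, L.nrm σ (e i) := Finset.sum_nonneg fun i _ => hs0 i
  refine ⟨N, ?_, fun a ha x => ?_, fun x hx => ?_⟩
  · have : (1 : ℝ) ≤ N := by nlinarith
    exact_mod_cast this
  · have hx : x ∈ Submodule.span (𝓞 K) (Set.range e) := by rw [he]; trivial
    obtain ⟨c, rfl⟩ := (Submodule.mem_span_range_iff_exists_fun _).mp hx
    choose r hr1 hr2 using fun i => exists_small_residue hC ha (c i)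
    choose s hs' using hr1
    refine ⟨∑ i, r i • e i, ∑ i, s i • e i, ?_, fun σ => ?_⟩
    · rw [Finset.smul_sum, ← Finset.sum_add_distrib]
      refine Finset.sum_congr rfl fun i _ => ?_
      rw [smul_smul, ← add_smul, ← hs', add_sub_cancel]
    · calc _ ≤ ∑ i, L.nrm σ (r i • e i) := L.nrm_sum_le _ σ _
        _ ≤ ∑ i, C * |ov σ a| * ∑ σ : K →+* ℝ, L.nrm σ (e i) := by
            refine Finset.sum_le_sum fun i _ => ?_
            rw [nrm_smul]
            exact mul_le_mul (hr2 i σ) (hs i σ) (L.nrm_nonneg _ _) (by positivity)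
        _ = (C * ∑ i, ∑ σ : K →+* ℝ, L.nrm σ (e i)) * |ov σ a| := by
            rw [← Finset.mul_sum]; ring
        _ ≤ N * |ov σ a| := mul_le_mul_of_nonneg_right (by linarith) (abs_nonneg _)
  · by_contra! hcon
    have h0 : ∀ i, L.form x (e i) = 0 := by
      intro i
      by_contra h1
      obtain ⟨σ, hσ⟩ := hcon (e i) h1
      have h2 := Finset.single_le_sum (f := fun i => ∑ σ : K →+* ℝ, L.nrm σ (e i))
          (fun j _ => hs0 j) (Finset.mem_univ i)
      have h3 := hs i σ
      nlinarith
    have h1 : L.form x = 0 := by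
      refine LinearMap.ext_on he ?_
      rintro _ ⟨i, rfl⟩
      exact h0 i
    exact hx (L.form_self_eq_zero.mp (by rw [h1]; rfl))

end OKLattice

namespace OKLattice

variable {K : Type} [Field K] [NumberField K] (L : OKLattice K)

/-- The index conditions on a lattice that drive the second moment estimate. -/
structure Good (r : ℕ) : Prop where
  rank : Module.finrank ℤ L.carrier = r * Module.finrank ℚ K
  smul : ∀ a : 𝓞 K, a ≠ 0 → ∃ T : Finset L.carrier, nmN a ^ r ≤ T.card ∧
    ∀ x ∈ T, ∀ y ∈ T, (∃ z, x - y = a • z) → x = y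
  ideal : ∀ I : Ideal (𝓞 K), I ≠ ⊥ → ∃ T : Finset L.carrier,
    Ideal.absNorm I ^ (r - 2) ≤ T.card ∧
    ∀ x ∈ T, ∀ y ∈ T, (∀ z, L.form (x - y) z ∈ I) → x = y

/-- `C` bounds representatives modulo scalars and a generating system. -/
structure ReduceConst (C : ℕ) : Prop where
  one_le : 1 ≤ C
  reduce : ∀ a : 𝓞 K, a ≠ 0 → ∀ x : L.carrier, ∃ y z : L.carrier,
    x = y + a • z ∧ ∀ σ, L.nrm σ y ≤ C * |ov σ a|
  nondeg : ∀ x : L.carrier, x ≠ 0 → ∃ z, L.form x z ≠ 0 ∧ ∀ σ, L.nrm σ z ≤ C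

variable [htr : Fact (TotallyReal K)] {L}

theorem card_smul_le {r C : ℕ} (hL : L.Good r) (hC : L.ReduceConst C) {a : 𝓞 K} (ha : a ≠ 0)
    (y : (K →+* ℝ) → ℝ) :
    nmN a ^ r * (L.box y).card ≤ (L.box fun σ => |ov σ a| * (y σ + C)).card := by
  classical
  obtain ⟨T, hT, hT2⟩ := hL.smul a ha
  choose g s hgs hg using hC.reduce a ha
  refine (Nat.mul_le_mul_right _ hT).trans ?_
  rw [← Finset.card_product]
  refine Finset.card_le_card_of_injOn (fun p => g p.1 + a • p.2) ?_ ?_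
  · rintro ⟨t, x⟩ hp
    simp only [Finset.coe_product, Set.mem_prod, Finset.mem_coe] at hp
    refine L.mem_box.mpr fun σ => (L.nrm_add_le σ _ _).trans ?_
    rw [nrm_smul]
    have h1 := mul_le_mul_of_nonneg_left (L.mem_box.mp hp.2 σ) (abs_nonneg (ov σ a))
    linarith [hg t σ]
  · rintro ⟨t, x⟩ hp ⟨t', x'⟩ hp' h
    simp only [Finset.coe_product, Set.mem_prod, Finset.mem_coe] at hp hp'
    simp only at h
    have h1 : t = t' := by
      refine hT2 t hp.1 t' hp'.1 ⟨x' - x + s t - s t', ?_⟩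
      have h2 : g t - g t' = a • x' - a • x := by
        rw [sub_eq_sub_iff_add_eq_add, h]; abel
      conv_lhs => rw [hgs t, hgs t']
      rw [add_sub_add_comm, h2]
      simp only [smul_sub, smul_add]; abel
    subst h1
    rw [add_right_inj] at h
    exact Prod.ext rfl (smul_right_injective _ ha h)

theorem card_ideal_le {r C : ℕ} (hL : L.Good r) (hC : L.ReduceConst C) {I : Ideal (𝓞 K)}
    (hI : I ≠ ⊥) {a : 𝓞 K} (haI : a ∈ I) (ha : a ≠ 0) (y : (K →+* ℝ) → ℝ)
    (F : Finset L.carrier) (hF : F ⊆ L.box y) (hFI : ∀ x ∈ F, ∀ z, L.form x z ∈ I) :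
    Ideal.absNorm I ^ (r - 2) * F.card ≤ (L.box fun σ => y σ + C * |ov σ a|).card := by
  classical
  obtain ⟨T, hT, hT2⟩ := hL.ideal I hI
  choose g s hgs hg using hC.reduce a ha
  refine (Nat.mul_le_mul_right _ hT).trans ?_
  rw [← Finset.card_product]
  refine Finset.card_le_card_of_injOn (fun p => p.2 + g p.1) ?_ ?_
  · rintro ⟨t, x⟩ hp
    simp only [Finset.coe_product, Set.mem_prod, Finset.mem_coe] at hp
    refine L.mem_box.mpr fun σ => (L.nrm_add_le σ _ _).trans ?_
    exact add_le_add (L.mem_box.mp (hF hp.2) σ) (hg t σ)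
  · rintro ⟨t, x⟩ hp ⟨t', x'⟩ hp' h
    simp only [Finset.coe_product, Set.mem_prod, Finset.mem_coe] at hp hp'
    simp only at h
    have h1 : t = t' := by
      refine hT2 t hp.1 t' hp'.1 fun z => ?_
      have h2 : g t - g t' = x' - x := by
        rw [sub_eq_sub_iff_add_eq_add, add_comm, h]
      have h3 : t - t' = (x' - x) + a • (s t - s t') := by
        conv_lhs => rw [hgs t, hgs t']
        rw [add_sub_add_comm, h2, smul_sub]
      rw [h3]
      simp only [map_add, map_sub, map_smul, LinearMap.add_apply, LinearMap.sub_apply,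
        LinearMap.smul_apply, smul_eq_mul]
      exact I.add_mem (I.sub_mem (hFI _ hp'.2 z) (hFI _ hp.2 z)) (I.mul_mem_right _ haI)
    subst h1
    rw [add_left_inj] at h
    exact Prod.ext rfl h

variable (L) in
theorem card_cover (Λ : Submodule ℤ L.carrier) [DecidablePred (· ∈ Λ)] (X : ℝ) {A : ℕ}
    (hA : 1 ≤ A) :
    ((L.cube X).filter (· ∈ Λ)).card
      ≤ A ^ Module.finrank ℤ Λ * ((L.cube (2 * X / A)).filter (· ∈ Λ)).card := by
  classical
  have : NeZero A := ⟨by omega⟩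
  have hA0 : (0 : ℝ) < A := by exact_mod_cast hA
  let b := Module.finBasis ℤ Λ
  let φ : L.carrier → (Fin (Module.finrank ℤ Λ) → ZMod A) := fun x i =>
    if h : x ∈ Λ then ((b.repr ⟨x, h⟩ i : ℤ) : ZMod A) else 0
  have key : ∀ x ∈ Λ, ∀ y ∈ Λ, φ x = φ y → ∃ z ∈ Λ, x - y = (A : 𝓞 K) • z := by
    intro x hx y hy h
    have h1 : ∀ i, ∃ c : ℤ, b.repr ⟨x, hx⟩ i - b.repr ⟨y, hy⟩ i = A * c := by
      intro i
      have := congrFun h i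
      simp only [φ, hx, hy, dif_pos] at this
      exact (Int.modEq_iff_dvd.mp ((ZMod.intCast_eq_intCast_iff _ _ _).mp this.symm))
    choose c hc using h1
    refine ⟨∑ i, c i • (b i : L.carrier), Submodule.sum_mem _ fun i _ =>
      Λ.smul_mem _ (b i).2, ?_⟩
    have h2 : (⟨x, hx⟩ - ⟨y, hy⟩ : Λ) = (A : ℤ) • ∑ i, c i • b i := by
      rw [← b.sum_repr ⟨x, hx⟩, ← b.sum_repr ⟨y, hy⟩, ← Finset.sum_sub_distrib, Finset.smul_sum]
      refine Finset.sum_congr rfl fun i _ => ?_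
      rw [← sub_smul, hc, smul_smul]
    have h3 := congrArg (fun v : Λ => (v : L.carrier)) h2
    simp only [Submodule.coe_sub, Submodule.coe_smul, Submodule.coe_sum] at h3
    rw [h3, natCast_zsmul, Nat.cast_smul_eq_nsmul]
  have h1 := Finset.card_le_mul_card_image (f := φ) ((L.cube X).filter (· ∈ Λ))
    ((L.cube (2 * X / A)).filter (· ∈ Λ)).card ?_
  · refine h1.trans ?_
    rw [mul_comm]
    refine Nat.mul_le_mul_right _ ((Finset.card_le_univ _).trans ?_)
    simp
  · intro v hv
    obtain ⟨x0, hx0, rfl⟩ := Finset.mem_image.mp hv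
    rw [Finset.mem_filter] at hx0
    have h2 : ∀ x, ∃ z, x ∈ Λ ∧ φ x = φ x0 → z ∈ Λ ∧ x - x0 = (A : 𝓞 K) • z := by
      intro x
      by_cases h : x ∈ Λ ∧ φ x = φ x0
      · obtain ⟨z, hz⟩ := key x h.1 x0 hx0.2 h.2
        exact ⟨z, fun _ => hz⟩
      · exact ⟨0, fun h' => absurd h' h⟩
    choose g hg using h2
    refine Finset.card_le_card_of_injOn g ?_ ?_
    · intro x hx
      simp only [Finset.coe_filter, Finset.mem_filter, Set.mem_ofPred_eq] at hx
      obtain ⟨⟨hx1, hx2⟩, hx3⟩ := hx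
      obtain ⟨hz1, hz2⟩ := hg x ⟨hx2, hx3⟩
      rw [Finset.mem_coe, Finset.mem_filter]
      refine ⟨L.mem_box.mpr fun σ => ?_, hz1⟩
      have h3 : (A : ℝ) * L.nrm σ (g x) ≤ X + X := by
        calc _ = L.nrm σ (x - x0) := by rw [hz2, nrm_smul]; simp
          _ ≤ _ := (L.nrm_sub_le σ _ _).trans
              (add_le_add (L.mem_box.mp hx1 σ) (L.mem_box.mp hx0.1 σ))
      rw [le_div_iff₀ hA0]; linarith
    · intro x hx x' hx' h
      simp only [Finset.coe_filter, Finset.mem_filter, Set.mem_ofPred_eq] at hx hx'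
      have h3 := (hg x ⟨hx.1.2, hx.2⟩).2
      have h4 := (hg x' ⟨hx'.1.2, hx'.2⟩).2
      rw [h, ← h4] at h3
      exact sub_left_inj.mp h3

theorem card_cube_mul_le {r : ℕ} (hL : L.Good r) {A : ℕ} (hA : 1 ≤ A) (X : ℝ) :
    (L.cube (A * X)).card ≤ (2 * A) ^ (r * Module.finrank ℚ K) * (L.cube X).card := by
  classical
  have h := L.card_cover ⊤ (A * X) (A := 2 * A) (by omega)
  rw [finrank_top, hL.rank] at h
  have hA0 : (A : ℝ) ≠ 0 := by exact_mod_cast (by omega : A ≠ 0)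
  have h2 : 2 * (A * X) / ((2 * A : ℕ) : ℝ) = X := by push_cast; field_simp
  rw [h2] at h
  simpa using h

end OKLattice

namespace OKLattice

variable {K : Type} [Field K] [NumberField K] (L : OKLattice K)

/-- The ideal of values `B(w, L)`. -/
def content (w : L.carrier) : Ideal (𝓞 K) := LinearMap.range (L.form w)

theorem form_mem_content (w z : L.carrier) : L.form w z ∈ L.content w := ⟨z, rfl⟩

variable [htr : Fact (TotallyReal K)]

theorem content_ne_bot {w : L.carrier} (hw : w ≠ 0) : L.content w ≠ ⊥ := by
  intro h
  have h1 := L.form_mem_content w w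
  rw [h, Ideal.mem_bot] at h1
  exact hw (L.form_self_eq_zero.mp h1)

theorem absNorm_le_nmN {I : Ideal (𝓞 K)} {a : 𝓞 K} (ha : a ≠ 0) (haI : a ∈ I) :
    Ideal.absNorm I ≤ nmN a := by
  rw [nmN_eq_absNorm]
  refine Nat.le_of_dvd ?_ (Ideal.absNorm_dvd_absNorm_of_le
    ((Ideal.span_singleton_le_iff_mem I).mpr haI))
  rw [← nmN_eq_absNorm]; exact nmN_pos ha

theorem absNorm_content_le {C : ℕ} (hC : L.ReduceConst C) {X : ℕ} {w : L.carrier} (hw : w ≠ 0)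
    (hX : w ∈ L.cube X) : Ideal.absNorm (L.content w) ≤ (X * C) ^ Module.finrank ℚ K := by
  obtain ⟨z, hz, hzC⟩ := hC.nondeg w hw
  refine (absNorm_le_nmN hz (L.form_mem_content w z)).trans ?_
  have : (nmN (L.form w z) : ℝ) ≤ ((X * C : ℕ) : ℝ) ^ Module.finrank ℚ K := by
    rw [nmN_eq_prod, ← card_emb, ← Finset.card_univ, ← Finset.prod_const]
    refine Finset.prod_le_prod (fun _ _ => abs_nonneg _) fun σ _ => ?_
    refine (L.abs_form_le σ w z).trans ?_
    push_cast
    exact mul_le_mul (L.mem_box.mp hX σ) (hzC σ) (L.nrm_nonneg _ _) (by positivity)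
  exact_mod_cast this

variable (K) in
open Classical in
theorem sum_content_sq_le {r : ℕ} (hr : 8 ≤ r) : ∃ A : ℝ, 0 ≤ A ∧ ∀ L : OKLattice K, L.Good r →
    ∃ ρ₀ : ℕ, ∀ ρ : ℕ, ρ₀ ≤ ρ →
      ∑ w ∈ (L.cube ρ).filter (· ≠ 0), (Ideal.absNorm (L.content w) : ℝ) ^ 2
        ≤ A * (L.cube ρ).card := by
  classical
  obtain ⟨A, hA0, hA⟩ := exists_sum_ideal_le K
  set d := Module.finrank ℚ K with hd
  have hd0 : 0 < d := finrank_pos_K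
  refine ⟨4 ^ (r * d) * A, by positivity, fun L hL => ?_⟩
  obtain ⟨C, hC⟩ := L.exists_reduce.imp fun C h => ReduceConst.mk h.1 h.2.1 h.2.2
  obtain ⟨C1, hC1, hC1'⟩ := exists_integer_near K
  obtain ⟨C2, hC2⟩ := exists_nat_ge (2 * C1)
  have hC2pos : 1 ≤ C2 := by
    have : (1 : ℝ) ≤ C2 := by linarith
    exact_mod_cast this
  have hCpos := hC.one_le
  set D := C * C2 with hD
  have hDpos : 1 ≤ D := Nat.mul_pos hCpos hC2pos
  set E := (2 * (1 + 2 * D * C)) ^ (r * d) with hE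
  have hEpos : 1 ≤ E := Nat.one_le_pow _ _ (by omega)
  refine ⟨2 * D * E, fun ρ hρ => ?_⟩
  have hρpos : 0 < ρ := lt_of_lt_of_le (by positivity) hρ
  set n : ℝ := ((L.cube ρ).card : ℝ) with hn
  have hn0 : 0 ≤ n := by positivity
  set W := (L.cube ρ).filter (· ≠ 0) with hW
  have hmaps : ∀ w ∈ W, L.content w ∈ W.image L.content := fun w hw => Finset.mem_image_of_mem _ hw
  rw [← Finset.sum_fiberwise_of_maps_to hmaps]
  have key : ∀ I ∈ W.image L.content,
      ∑ w ∈ W with L.content w = I, (Ideal.absNorm (L.content w) : ℝ) ^ 2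
        ≤ 4 ^ (r * d) * n * ((Ideal.absNorm I : ℝ) ^ 3)⁻¹ := by
    intro I hI
    obtain ⟨w0, hw0, rfl⟩ := Finset.mem_image.mp hI
    set I := L.content w0
    obtain ⟨hw0c, hw00⟩ := Finset.mem_filter.mp hw0
    have hIbot : I ≠ ⊥ := L.content_ne_bot hw00
    set N := Ideal.absNorm I with hN
    have hN1 : 1 ≤ N := Nat.one_le_iff_ne_zero.mpr (Ideal.absNorm_eq_zero_iff.not.mpr hIbot)
    have hNle : N ≤ (ρ * C) ^ d := L.absNorm_content_le hC hw00 hw0c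
    have hex : ∃ b : ℕ, N < b ^ d := ⟨N + 1, lt_of_lt_of_le (Nat.lt_succ_self N)
      (Nat.le_self_pow hd0.ne' _)⟩
    obtain ⟨b, hb1, hb2⟩ : ∃ b : ℕ, N < (b + 1) ^ d ∧ b ^ d ≤ N := by
      have h1 := Nat.find_spec hex
      have h2 : Nat.find hex ≠ 0 := by
        intro h; rw [h, zero_pow hd0.ne'] at h1; omega
      obtain ⟨b, hb⟩ := Nat.exists_eq_succ_of_ne_zero h2
      refine ⟨b, by rw [hb] at h1; exact h1, ?_⟩
      exact not_lt.mp (Nat.find_min hex (show b < Nat.find hex by omega))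
    have hbpos : 1 ≤ b := by
      by_contra h
      have : b = 0 := by omega
      subst this; simp at hb1; omega
    have hbρ : b ≤ ρ * C := (Nat.pow_le_pow_iff_left hd0.ne').mp (hb2.trans hNle)
    obtain ⟨a, haI, ha0, ha⟩ := exists_small_mem_ideal hC1' hIbot (b := b + 1) hb1
    set F := W.filter (fun w => L.content w = I) with hF
    have h1 := card_ideal_le hL hC hIbot haI ha0 (fun _ => (ρ : ℝ)) F
      (fun w hw => (Finset.mem_filter.mp (Finset.mem_filter.mp hw).1).1)
      (fun w hw z => by
        have := L.form_mem_content w z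
        rwa [(Finset.mem_filter.mp hw).2] at this)
    have h2 : (L.box fun σ => (ρ : ℝ) + C * |ov σ a|).card
        ≤ (L.cube ((ρ + D * (b + 1) : ℕ) : ℝ)).card := by
      refine L.card_box_mono fun σ => ?_
      push_cast
      have h3 : |ov σ a| ≤ C2 * (b + 1) := (ha σ).trans (by
        push_cast; exact mul_le_mul_of_nonneg_right hC2 (by positivity))
      have h4 := mul_le_mul_of_nonneg_left h3 (Nat.cast_nonneg (α := ℝ) C)
      rw [hD]; push_cast; linarith
    have h3 := h1.trans h2
    have hsum : ∑ w ∈ F, (Ideal.absNorm (L.content w) : ℝ) ^ 2 = N ^ 2 * F.card := by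
      rw [Finset.sum_congr rfl fun w hw => by rw [(Finset.mem_filter.mp hw).2]]
      rw [Finset.sum_const, nsmul_eq_mul, mul_comm]
    rw [hsum]
    have hN1' : (1 : ℝ) ≤ N := by exact_mod_cast hN1
    have hNpos : (0 : ℝ) < N := by linarith
    rw [← div_eq_mul_inv, le_div_iff₀ (by positivity)]
    by_cases hcase : D * (b + 1) ≤ ρ
    · have h4 : N ^ (r - 2) * F.card ≤ 4 ^ (r * d) * (L.cube ρ).card := by
        refine h3.trans ((L.card_box_mono fun σ => ?_).trans
          (card_cube_mul_le hL (A := 2) (by norm_num) ρ))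
        have : ((ρ + D * (b + 1) : ℕ) : ℝ) ≤ ((2 * ρ : ℕ) : ℝ) := by exact_mod_cast (by omega)
        simpa using this
      have h5 : (N : ℝ) ^ (r - 2) * F.card ≤ 4 ^ (r * d) * n := by rw [hn]; exact_mod_cast h4
      calc (N : ℝ) ^ 2 * (F.card : ℝ) * (N : ℝ) ^ 3 = (N : ℝ) ^ 5 * (F.card : ℝ) := by ring
        _ ≤ (N : ℝ) ^ (r - 2) * (F.card : ℝ) := by
            gcongr
            omega
        _ ≤ _ := h5
    · push Not at hcase
      have h4 : N ^ (r - 2) * F.card ≤ E * (L.cube ρ).card := by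
        refine h3.trans ((L.card_box_mono fun σ => ?_).trans
          (card_cube_mul_le hL (A := 1 + 2 * D * C) (by omega) ρ))
        have h6 : ρ + D * (b + 1) ≤ (1 + 2 * D * C) * ρ := by
          have : b + 1 ≤ 2 * (ρ * C) := by omega
          calc _ ≤ ρ + D * (2 * (ρ * C)) := by gcongr
            _ = _ := by ring
        have h7 : ((ρ + D * (b + 1) : ℕ) : ℝ) ≤ (((1 + 2 * D * C) * ρ : ℕ) : ℝ) := by
          exact_mod_cast h6
        push_cast at h7 ⊢; exact h7
      have h5 : (N : ℝ) ^ (r - 2) * F.card ≤ E * n := by rw [hn]; exact_mod_cast h4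
      have h6 : ρ ≤ 2 * D * N := by
        have h7 : b ≤ N := (Nat.le_self_pow hd0.ne' b).trans hb2
        nlinarith
      have h8 : E ≤ N := by
        have : 2 * D * E ≤ 2 * D * N := hρ.trans h6
        exact Nat.le_of_mul_le_mul_left this (by omega)
      have h8' : (E : ℝ) ≤ N := by exact_mod_cast h8
      have h9 : (N : ℝ) ^ 6 * F.card ≤ N * n := by
        calc (N : ℝ) ^ 6 * F.card ≤ N ^ (r - 2) * F.card := by
              gcongr
              omega
          _ ≤ E * n := h5
          _ ≤ N * n := by gcongr
      have h10 : (N : ℝ) ^ 5 * F.card ≤ n := by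
        refine le_of_mul_le_mul_left ?_ hNpos
        calc (N : ℝ) * (N ^ 5 * F.card) = N ^ 6 * F.card := by ring
          _ ≤ _ := h9
      calc (N : ℝ) ^ 2 * F.card * N ^ 3 = N ^ 5 * F.card := by ring
        _ ≤ 1 * n := by rw [one_mul]; exact h10
        _ ≤ _ := by
            gcongr
            exact one_le_pow₀ (by norm_num)
  refine (Finset.sum_le_sum key).trans ?_
  rw [← Finset.mul_sum]
  have h11 := hA (W.image L.content) fun I hI => by
    obtain ⟨w, hw, rfl⟩ := Finset.mem_image.mp hI
    exact L.content_ne_bot (Finset.mem_filter.mp hw).2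
  calc _ ≤ 4 ^ (r * d) * n * A := by gcongr
    _ = _ := by ring

end OKLattice

theorem exists_two_pow_mul_le {x ρ : ℝ} (hx : 0 < x) (h : x ≤ ρ) :
    ∃ k : ℕ, 2 ^ k * x ≤ ρ ∧ ρ < 2 ^ (k + 1) * x := by
  obtain ⟨k, h1, h2⟩ := exists_nat_pow_near (x := ρ / x) (y := 2)
    ((one_le_div hx).mpr h) (by norm_num)
  exact ⟨k, (le_div_iff₀ hx).mp h1, (div_lt_iff₀ hx).mp h2⟩

namespace OKLattice

variable {K : Type} [Field K] [NumberField K]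
variable [htr : Fact (TotallyReal K)]

variable (K) in
theorem card_dyadic_box_le (r : ℕ) : ∃ A : ℝ, 0 ≤ A ∧ ∀ L : OKLattice K, L.Good r →
    ∀ C : ℕ, L.ReduceConst C → ∀ (ρ : ℝ) (k : (K →+* ℝ) → ℕ), (∀ σ, 2 ^ k σ * C ≤ ρ) →
      2 ^ (r * ∑ σ, k σ) * ((L.box fun σ => ρ / 2 ^ k σ).card : ℝ) ≤ A * (L.cube ρ).card := by
  obtain ⟨C1, hC1, hap⟩ := exists_integer_approx K
  obtain ⟨Q, hQ⟩ := exists_nat_ge (6 * C1)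
  have hQ1 : 1 ≤ Q := by
    have : (1 : ℝ) ≤ Q := by linarith
    exact_mod_cast this
  refine ⟨((2 * Q) ^ (r * Module.finrank ℚ K) : ℕ), by positivity, fun L hL C hC ρ k hk => ?_⟩
  obtain ⟨a, ha⟩ := hap fun σ => 2 * C1 * 2 ^ k σ
  have h1 : ∀ σ, C1 * 2 ^ k σ ≤ |ov σ a| := fun σ => by
    have := abs_le.mp (ha σ)
    have h2 : (1 : ℝ) ≤ 2 ^ k σ := one_le_pow₀ (by norm_num)
    refine le_trans ?_ (le_abs_self _)
    nlinarith
  have h2 : ∀ σ, |ov σ a| ≤ 3 * C1 * 2 ^ k σ := fun σ => by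
    have := abs_le.mp (ha σ)
    have h2 : (1 : ℝ) ≤ 2 ^ k σ := one_le_pow₀ (by norm_num)
    rw [abs_le]
    constructor <;> nlinarith
  have h3 : ∀ σ : K →+* ℝ, (2 : ℝ) ^ k σ ≤ |ov σ a| := fun σ => by
    refine le_trans ?_ (h1 σ)
    exact le_mul_of_one_le_left (by positivity) hC1
  have ha0 : a ≠ 0 := by
    rintro rfl
    have := h3 (Classical.arbitrary _)
    simp only [map_zero, abs_zero] at this
    exact absurd this (not_le.mpr (by positivity))
  have h4 : (2 : ℝ) ^ (∑ σ, k σ) ≤ nmN a := by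
    rw [nmN_eq_prod, ← Finset.prod_pow_eq_pow_sum]
    exact Finset.prod_le_prod (fun _ _ => by positivity) fun σ _ => h3 σ
  have hρ0 : 0 ≤ ρ := le_trans (by positivity) (hk (Classical.arbitrary _))
  have h5 := card_smul_le hL hC ha0 fun σ => ρ / 2 ^ k σ
  have h6 := (h5.trans (L.card_box_mono (y' := fun _ => (Q : ℝ) * ρ) fun σ => ?_)).trans
    (card_cube_mul_le hL hQ1 ρ)
  · have h7 : ((nmN a : ℝ)) ^ r * ((L.box fun σ => ρ / 2 ^ k σ).card : ℝ)
        ≤ ((2 * Q) ^ (r * Module.finrank ℚ K) : ℕ) * (L.cube ρ).card := by exact_mod_cast h6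
    refine le_trans ?_ h7
    rw [mul_comm r, pow_mul]
    gcongr
  · have h8 : (0 : ℝ) < 2 ^ k σ := by positivity
    calc |ov σ a| * (ρ / 2 ^ k σ + C) ≤ 3 * C1 * 2 ^ k σ * (ρ / 2 ^ k σ + C) := by
          have := h2 σ
          gcongr
      _ = 3 * C1 * (ρ + 2 ^ k σ * C) := by field_simp
      _ ≤ 3 * C1 * (ρ + ρ) := by
          have := hk σ
          gcongr
      _ = 6 * C1 * ρ := by ring
      _ ≤ _ := by gcongr

variable (K) in
open Classical in
theorem sum_inv_norm_le {r : ℕ} (hr : 2 * Module.finrank ℚ K + 3 ≤ r) :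
    ∃ A : ℝ, 0 ≤ A ∧ ∀ L : OKLattice K, L.Good r → ∃ ρ₀ : ℕ, ∀ ρ : ℕ, ρ₀ ≤ ρ →
      ∑ w ∈ (L.cube ρ).filter (· ≠ 0), (nmN (L.form w w) : ℝ)⁻¹
        ≤ A * (L.cube ρ).card / ρ ^ (2 * Module.finrank ℚ K) := by
  classical
  obtain ⟨A, hA0, hA⟩ := card_dyadic_box_le K r
  set d := Module.finrank ℚ K with hd
  refine ⟨A * 4 ^ d * 2 ^ d + d * A, by positivity, fun L hL => ?_⟩
  obtain ⟨C, hC⟩ := L.exists_reduce.imp fun C h => ReduceConst.mk h.1 h.2.1 h.2.2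
  have hCpos := hC.one_le
  have hC1 : (1 : ℝ) ≤ C := by exact_mod_cast hCpos
  refine ⟨(2 * C) ^ r, fun ρ hρ => ?_⟩
  have hρC : C ≤ ρ := by
    refine le_trans ?_ hρ
    refine le_trans (by omega : C ≤ 2 * C) (Nat.le_self_pow (by omega) _)
  have hρC' : (C : ℝ) ≤ ρ := by exact_mod_cast hρC
  have hρ0 : (0 : ℝ) < ρ := by linarith
  set n : ℝ := ((L.cube ρ).card : ℝ) with hn
  have hn0 : 0 ≤ n := by positivity
  set W := (L.cube ρ).filter (· ≠ 0) with hW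
  have hWpos : ∀ w ∈ W, ∀ σ, 0 < L.nrm σ w := fun w hw σ => L.nrm_pos σ (Finset.mem_filter.mp hw).2
  have hWle : ∀ w ∈ W, ∀ σ, L.nrm σ w ≤ ρ := fun w hw =>
    L.mem_box.mp (Finset.mem_filter.mp hw).1
  have hw1 : ∀ w ∈ W, (nmN (L.form w w) : ℝ)⁻¹ ≤ 1 := fun w hw => by
    have h : 1 ≤ nmN (L.form w w) :=
      nmN_pos fun h => (Finset.mem_filter.mp hw).2 (L.form_self_eq_zero.mp h)
    exact inv_le_one_of_one_le₀ (by exact_mod_cast h)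
  set G := W.filter (fun w => ∀ σ, (C : ℝ) ≤ L.nrm σ w) with hG
  set B := W.filter (fun w => ¬ ∀ σ, (C : ℝ) ≤ L.nrm σ w) with hB
  have hbad : ∑ w ∈ B, (nmN (L.form w w) : ℝ)⁻¹ ≤ d * A * n / ρ ^ (2 * d) := by
    obtain ⟨j, hj1, hj2⟩ := exists_two_pow_mul_le (x := C) (ρ := ρ) (by linarith) hρC'
    let k : (K →+* ℝ) → (K →+* ℝ) → ℕ := fun σ => Pi.single σ j
    have hsub : B ⊆ Finset.univ.biUnion fun σ => L.box fun τ => (ρ : ℝ) / 2 ^ k σ τ := by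
      intro w hw
      obtain ⟨hwW, h⟩ := Finset.mem_filter.mp hw
      push Not at h
      obtain ⟨σ, hσ⟩ := h
      refine Finset.mem_biUnion.mpr ⟨σ, Finset.mem_univ _, L.mem_box.mpr fun τ => ?_⟩
      by_cases hτ : τ = σ
      · subst hτ
        simp only [k, Pi.single_eq_same]
        rw [le_div_iff₀ (by positivity)]
        refine le_trans ?_ hj1
        rw [mul_comm]
        gcongr
      · simpa [k, Pi.single_eq_of_ne hτ] using hWle w hwW τ
    have hcard : ∀ σ, ((L.box fun τ => (ρ : ℝ) / 2 ^ k σ τ).card : ℝ) ≤ A * n / ρ ^ (2 * d) := by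
      intro σ
      have h1 := hA L hL C hC ρ (k σ) fun τ => by
        by_cases hτ : τ = σ
        · subst hτ; simpa [k] using hj1
        · simpa [k, Pi.single_eq_of_ne hτ] using hρC'
      have h2 : ∑ τ, k σ τ = j := by simp [k]
      rw [h2] at h1
      have h3 : (ρ : ℝ) ^ (2 * d) ≤ 2 ^ (r * j) := by
        have h4 : (ρ : ℝ) ^ r ≤ (2 * C) ^ r * 2 ^ (r * j) := by
          calc (ρ : ℝ) ^ r ≤ (2 ^ (j + 1) * C) ^ r := by gcongr
            _ = _ := by rw [mul_comm r j, pow_mul, ← mul_pow]; congr 1; ring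
        have h5 : ((2 * C) ^ r : ℝ) * ρ ^ (2 * d) ≤ ρ ^ r := by
          calc ((2 * C) ^ r : ℝ) * ρ ^ (2 * d) ≤ ρ * ρ ^ (2 * d) := by
                gcongr
                exact_mod_cast hρ
            _ = ρ ^ (2 * d + 1) := by ring
            _ ≤ _ := by
                refine pow_le_pow_right₀ ?_ (by omega)
                linarith
        exact le_of_mul_le_mul_left (h5.trans h4) (by positivity)
      rw [le_div_iff₀ (by positivity), mul_comm]
      refine le_trans ?_ h1
      gcongr
    calc ∑ w ∈ B, (nmN (L.form w w) : ℝ)⁻¹ ≤ ∑ w ∈ B, (1 : ℝ) :=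
          Finset.sum_le_sum fun w hw => hw1 w (Finset.mem_filter.mp hw).1
      _ = (B.card : ℝ) := by simp
      _ ≤ ∑ σ : K →+* ℝ, ((L.box fun τ => (ρ : ℝ) / 2 ^ k σ τ).card : ℝ) := by
          exact_mod_cast (Finset.card_le_card hsub).trans Finset.card_biUnion_le
      _ ≤ ∑ σ : K →+* ℝ, A * n / ρ ^ (2 * d) := Finset.sum_le_sum fun σ _ => hcard σ
      _ = _ := by
          rw [Finset.sum_const, Finset.card_univ, card_emb, nsmul_eq_mul]; ring
  have hgood : ∑ w ∈ G, (nmN (L.form w w) : ℝ)⁻¹ ≤ A * 4 ^ d * 2 ^ d * n / ρ ^ (2 * d) := by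
    have hex : ∀ w σ, ∃ k : ℕ, w ∈ G → 2 ^ k * L.nrm σ w ≤ ρ ∧ ρ < 2 ^ (k + 1) * L.nrm σ w := by
      intro w σ
      by_cases hw : w ∈ G
      · have hwW := (Finset.mem_filter.mp hw).1
        obtain ⟨k, hk⟩ := exists_two_pow_mul_le (hWpos w hwW σ) (hWle w hwW σ)
        exact ⟨k, fun _ => hk⟩
      · exact ⟨0, fun h => absurd h hw⟩
    choose k hk using hex
    let P := Fintype.piFinset fun _ : K →+* ℝ => Finset.range (ρ + 1)
    have hmaps : ∀ w ∈ G, k w ∈ P := by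
      intro w hw
      refine Fintype.mem_piFinset.mpr fun σ => Finset.mem_range.mpr ?_
      have h1 := (hk w σ hw).1
      have h2 := (Finset.mem_filter.mp hw).2 σ
      have h3 : (2 : ℝ) ^ k w σ ≤ ρ := by
        refine le_trans ?_ h1
        exact le_mul_of_one_le_right (by positivity) (hC1.trans h2)
      have h4 : 2 ^ k w σ ≤ ρ := by exact_mod_cast h3
      have := Nat.lt_two_pow_self (n := k w σ)
      omega
    rw [← Finset.sum_fiberwise_of_maps_to hmaps]
    have key : ∀ κ ∈ P, ∑ w ∈ G with k w = κ, (nmN (L.form w w) : ℝ)⁻¹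
        ≤ A * 4 ^ d * n / ρ ^ (2 * d) * ∏ σ, (1 / 2 : ℝ) ^ κ σ := by
      intro κ _
      by_cases hne : (G.filter fun w => k w = κ).Nonempty
      swap
      · rw [Finset.not_nonempty_iff_eq_empty.mp hne, Finset.sum_empty]
        positivity
      obtain ⟨w0, hw0⟩ := hne
      have hκ : ∀ σ, (2 : ℝ) ^ κ σ * C ≤ ρ := fun σ => by
        obtain ⟨h1, h2⟩ := Finset.mem_filter.mp hw0
        have h3 := (hk w0 σ h1).1
        rw [h2] at h3
        refine le_trans ?_ h3
        have := (Finset.mem_filter.mp h1).2 σ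
        gcongr
      have h1 := hA L hL C hC ρ κ hκ
      have h2 : ∀ w ∈ G.filter fun w => k w = κ,
          (nmN (L.form w w) : ℝ)⁻¹ ≤ 4 ^ (∑ σ, κ σ) * 4 ^ d / ρ ^ (2 * d) := by
        intro w hw
        obtain ⟨h1, h2⟩ := Finset.mem_filter.mp hw
        have hwW := (Finset.mem_filter.mp h1).1
        rw [nmN_form_self]
        have h3 : (ρ : ℝ) ^ d ≤ 2 ^ (∑ σ, κ σ) * 2 ^ d * ∏ σ : K →+* ℝ, L.nrm σ w := by
          calc (ρ : ℝ) ^ d = ∏ σ : K →+* ℝ, (ρ : ℝ) := by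
                rw [Finset.prod_const, Finset.card_univ, card_emb]
            _ ≤ ∏ σ : K →+* ℝ, (2 ^ κ σ * 2 * L.nrm σ w) := by
                refine Finset.prod_le_prod (fun _ _ => hρ0.le) fun σ _ => ?_
                have := (hk w σ h1).2.le
                rwa [h2, pow_succ] at this
            _ = _ := by
                rw [Finset.prod_mul_distrib, Finset.prod_mul_distrib, Finset.prod_const,
                  Finset.card_univ, card_emb, Finset.prod_pow_eq_pow_sum]
        have h4 : 0 < ∏ σ : K →+* ℝ, L.nrm σ w := Finset.prod_pos fun σ _ => hWpos w hwW σ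
        rw [inv_le_comm₀ (by positivity) (by positivity), inv_div, div_le_iff₀ (by positivity)]
        have h5 : ((ρ : ℝ) ^ d) ^ 2 ≤ (2 ^ (∑ σ, κ σ) * 2 ^ d * ∏ σ : K →+* ℝ, L.nrm σ w) ^ 2 := by
          gcongr
        have h6 : ∀ e : ℕ, (4 : ℝ) ^ e = (2 ^ e) ^ 2 := fun e => by
          rw [← pow_mul, mul_comm, pow_mul]; norm_num
        rw [mul_comm 2 d, pow_mul, h6, h6]
        refine h5.trans (le_of_eq ?_)
        ring
      have h3 : (((G.filter fun w => k w = κ).card : ℕ) : ℝ) ≤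
        (L.box fun σ => (ρ : ℝ) / 2 ^ κ σ).card := by
        refine Nat.cast_le.mpr (Finset.card_le_card fun w hw => L.mem_box.mpr fun σ => ?_)
        obtain ⟨h1, h2⟩ := Finset.mem_filter.mp hw
        rw [le_div_iff₀ (by positivity), mul_comm, ← h2]
        exact (hk w σ h1).1
      refine (Finset.sum_le_card_nsmul _ _ _ h2).trans ?_
      rw [nsmul_eq_mul, Finset.prod_pow_eq_pow_sum]
      set s := ∑ σ, κ σ
      have h4 : (8 : ℝ) ^ s ≤ 2 ^ (r * s) := by
        rw [pow_mul]
        refine pow_le_pow_left₀ (by norm_num) ?_ s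
        calc (8 : ℝ) = 2 ^ 3 := by norm_num
          _ ≤ _ := pow_le_pow_right₀ (by norm_num) (by omega)
      set c : ℝ := (((G.filter fun w => k w = κ).card : ℕ) : ℝ)
      have h5 : 8 ^ s * c ≤ A * n := by
        refine le_trans ?_ h1
        gcongr
      have h6 : (4 : ℝ) ^ s * c ≤ A * n * (1 / 2) ^ s := by
        have : (8 : ℝ) ^ s = 4 ^ s * 2 ^ s := by rw [← mul_pow]; norm_num
        rw [one_div, inv_pow, ← div_eq_mul_inv, le_div_iff₀ (by positivity)]
        calc (4 : ℝ) ^ s * c * 2 ^ s = 8 ^ s * c := by rw [this]; ring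
          _ ≤ _ := h5
      calc c * (4 ^ s * 4 ^ d / (ρ : ℝ) ^ (2 * d)) = 4 ^ s * c * (4 ^ d / (ρ : ℝ) ^ (2 * d)) := by
            ring
        _ ≤ A * n * (1 / 2) ^ s * (4 ^ d / (ρ : ℝ) ^ (2 * d)) := by gcongr
        _ = _ := by ring
    refine (Finset.sum_le_sum key).trans ?_
    rw [← Finset.mul_sum, ← Finset.prod_univ_sum (fun _ : K →+* ℝ => Finset.range (ρ + 1))
      (fun _ j => (1 / 2 : ℝ) ^ j)]
    have h2 : ∏ _σ : K →+* ℝ, ∑ j ∈ Finset.range (ρ + 1), (1 / 2 : ℝ) ^ j ≤ 2 ^ d := by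
      rw [Finset.prod_const, Finset.card_univ, card_emb]
      refine pow_le_pow_left₀ (by positivity) ?_ d
      exact sum_geometric_two_le _
    calc _ ≤ A * 4 ^ d * n / ρ ^ (2 * d) * 2 ^ d := by gcongr
      _ = _ := by ring
  rw [← Finset.sum_filter_add_sum_filter_not W (fun w => ∀ σ, (C : ℝ) ≤ L.nrm σ w)]
  refine (add_le_add hgood hbad).trans (le_of_eq ?_)
  ring

variable (K) in
open Classical in
theorem sum_content_div_norm_le {r : ℕ} (hr : 2 * Module.finrank ℚ K + 8 ≤ r) :
    ∃ A : ℝ, 0 ≤ A ∧ ∀ L : OKLattice K, L.Good r → ∃ ρ₀ : ℕ, ∀ ρ : ℕ, ρ₀ ≤ ρ →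
      ∑ w ∈ (L.cube ρ).filter (· ≠ 0),
        (Ideal.absNorm (L.content w) : ℝ) / ∏ σ : K →+* ℝ, L.nrm σ w
        ≤ A * (L.cube ρ).card / ρ ^ (Module.finrank ℚ K) := by
  obtain ⟨A, hA0, hA⟩ := sum_content_sq_le K (r := r) (by omega)
  obtain ⟨B, hB0, hB⟩ := sum_inv_norm_le K (r := r) (by omega)
  refine ⟨√(A * B), by positivity, fun L hL => ?_⟩
  obtain ⟨ρ1, h1⟩ := hA L hL
  obtain ⟨ρ2, h2⟩ := hB L hL
  refine ⟨max ρ1 ρ2, fun ρ hρ => ?_⟩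
  have h1 := h1 ρ (le_of_max_le_left hρ)
  have h2 := h2 ρ (le_of_max_le_right hρ)
  refine abs_le_of_sq_le_sq' ?_ (by positivity) |>.2
  simp_rw [div_eq_mul_inv]
  refine (Finset.sum_mul_sq_le_sq_mul_sq _ _ _).trans ?_
  have h3 : ∀ w : L.carrier, (∏ σ : K →+* ℝ, L.nrm σ w)⁻¹ ^ 2 = (nmN (L.form w w) : ℝ)⁻¹ :=
    fun w => by rw [nmN_form_self, inv_pow]
  simp_rw [h3]
  refine (mul_le_mul h1 h2 (Finset.sum_nonneg fun _ _ => by positivity) (by positivity)).trans ?_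
  rw [mul_pow, mul_pow, Real.sq_sqrt (by positivity)]
  refine le_of_eq ?_
  rw [inv_pow, ← pow_mul, mul_comm _ 2]
  ring

end OKLattice

theorem Finset.card_sq_le_card_image_mul {α β : Type*} [DecidableEq β] (s : Finset α) (f : α → β) :
    s.card ^ 2 ≤ (s.image f).card * ((s ×ˢ s).filter fun p => f p.1 = f p.2).card := by
  classical
  have h1 : s.card = ∑ k ∈ s.image f, (s.filter fun x => f x = k).card :=
    Finset.card_eq_sum_card_image f s
  have h2 : ((s ×ˢ s).filter fun p => f p.1 = f p.2).card
      = ∑ k ∈ s.image f, (s.filter fun x => f x = k).card ^ 2 := by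
    rw [Finset.card_eq_sum_card_fiberwise (f := fun p => f p.1) (t := s.image f)]
    · refine Finset.sum_congr rfl fun k _ => ?_
      rw [sq, ← Finset.card_product]
      congr 1
      ext p
      simp only [Finset.mem_filter, Finset.mem_product]
      constructor
      · rintro ⟨⟨⟨a, b⟩, c⟩, d⟩; exact ⟨⟨a, d⟩, b, c ▸ d⟩
      · rintro ⟨⟨a, d⟩, b, c⟩; exact ⟨⟨⟨a, b⟩, d.trans c.symm⟩, d⟩
    · intro p hp
      exact Finset.mem_coe.mpr (Finset.mem_image_of_mem _
        (Finset.mem_product.mp (Finset.mem_filter.mp (Finset.mem_coe.mp hp)).1).1)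
  rw [h1, h2]
  exact sq_sum_le_card_mul_sum_sq

section scalars
variable {K : Type} [Field K] [NumberField K] [htr : Fact (TotallyReal K)]

variable (K) in
theorem exists_card_scalars : ∃ C : ℕ, 1 ≤ C ∧ ∀ y : (K →+* ℝ) → ℝ, (∀ σ, (C : ℝ) ≤ y σ) →
    ∃ A : Finset (𝓞 K), (∀ a ∈ A, ∀ σ, |ov σ a| ≤ y σ) ∧ ∏ σ, y σ ≤ C * A.card := by
  classical
  obtain ⟨C, hC1, hC⟩ := exists_integer_near K
  obtain ⟨D, hD1, hD⟩ := exists_integer_approx K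
  obtain ⟨M, hM⟩ := exists_nat_ge (max (4 * C * D) ((2 * C) ^ Module.finrank ℚ K))
  have hM1 := (le_max_left _ _).trans hM
  have hM2 := (le_max_right _ _).trans hM
  have hM0 : 1 ≤ M := by
    have : (1 : ℝ) ≤ M := by nlinarith
    exact_mod_cast this
  refine ⟨M, hM0, fun y hy => ?_⟩
  obtain ⟨b, hb⟩ := hD fun σ => y σ / C - D
  have hC0 : 0 < C := by linarith
  have hb1 : ∀ σ, y σ / (2 * C) ≤ |ov σ b| := fun σ => by
    have h1 := abs_le.mp (hb σ)
    have h2 : 4 * C * D ≤ y σ := hM1.trans (hy σ)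
    have h3 : 2 * D ≤ y σ / (2 * C) := by rw [le_div_iff₀ (by positivity)]; linarith
    have h4 : y σ / C = y σ / (2 * C) + y σ / (2 * C) := by field_simp; ring
    refine le_trans ?_ (le_abs_self _)
    linarith [h1.1]
  have hypos : ∀ σ, 0 < y σ := fun σ => by
    have : (1 : ℝ) ≤ M := by exact_mod_cast hM0
    linarith [hy σ]
  have hb2 : ∀ σ, C * |ov σ b| ≤ y σ := fun σ => by
    have h1 := abs_le.mp (hb σ)
    have h2 : 4 * C * D ≤ y σ := hM1.trans (hy σ)
    have h3 : |ov σ b| ≤ y σ / C := by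
      rw [abs_le]
      have h3 : 2 * D ≤ y σ / C := by rw [le_div_iff₀ (by positivity)]; nlinarith
      constructor <;> linarith
    rw [le_div_iff₀ hC0] at h3; linarith
  have hb0 : b ≠ 0 := by
    rintro rfl
    have h1 := hb1 (Classical.arbitrary _)
    have h2 := hypos (Classical.arbitrary _)
    simp only [map_zero, abs_zero] at h1
    exact absurd h1 (not_le.mpr (by positivity))
  have hres := fun x : 𝓞 K => exists_small_residue hC hb0 x
  choose g hg1 hg2 using hres
  let I := Ideal.span {b}
  have hIbot : I ≠ ⊥ := by simpa [I, Ideal.span_singleton_eq_bot] using hb0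
  have hfin : Finite (𝓞 K ⧸ I) := Ideal.finiteQuotientOfFreeOfNeBot I hIbot
  have : Fintype (𝓞 K ⧸ I) := Fintype.ofFinite _
  let φ : 𝓞 K ⧸ I → 𝓞 K := fun x => g (Quotient.out x)
  have hφ : Function.Injective φ := by
    intro x x' h
    have h1 : ∀ z : 𝓞 K ⧸ I, Ideal.Quotient.mk I (φ z) = z := fun z => by
      have h2 : Ideal.Quotient.mk I (Quotient.out z) = z := Quotient.out_eq z
      rw [← h2]
      refine Ideal.Quotient.eq.mpr ?_
      rw [h2, ← neg_mem_iff, neg_sub]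
      exact Ideal.mem_span_singleton.mpr (hg1 _)
    rw [← h1 x, ← h1 x', h]
  refine ⟨Finset.univ.image φ, ?_, ?_⟩
  · intro a ha σ
    obtain ⟨z, -, rfl⟩ := Finset.mem_image.mp ha
    exact (hg2 _ σ).trans (hb2 σ)
  · rw [Finset.card_image_of_injective _ hφ, Finset.card_univ]
    have h1 : Fintype.card (𝓞 K ⧸ I) = nmN b := by
      rw [nmN_eq_absNorm, Ideal.absNorm_apply, Submodule.cardQuot_apply, Nat.card_eq_fintype_card]
    rw [h1, nmN_eq_prod]
    calc ∏ σ, y σ = (2 * C) ^ Module.finrank ℚ K * ∏ σ : K →+* ℝ, y σ / (2 * C) := by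
          rw [Finset.prod_div_distrib, Finset.prod_const, Finset.card_univ, card_emb]
          field_simp
      _ ≤ M * ∏ σ : K →+* ℝ, |ov σ b| := by
          refine mul_le_mul hM2 ?_ ?_ (by positivity)
          · exact Finset.prod_le_prod (fun σ _ => by have := hypos σ; positivity) fun σ _ => hb1 σ
          · exact Finset.prod_nonneg fun σ _ => by have := hypos σ; positivity

theorem exists_residues_of_mem {I : Ideal (𝓞 K)} {b : 𝓞 K} (hb : b ≠ 0) (hbI : b ∈ I) :
    ∃ T : Finset (𝓞 K), (∀ x ∈ T, x ∈ I) ∧ (∀ x ∈ T, ∀ y ∈ T, b ∣ x - y → x = y) ∧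
      T.card * Ideal.absNorm I = nmN b := by
  classical
  let J := Ideal.span {b}
  have hJI : J ≤ I := (Ideal.span_singleton_le_iff_mem I).mpr hbI
  let Ja := Submodule.toAddSubgroup J
  let Ia := Submodule.toAddSubgroup I
  have h1 : Ja.relIndex Ia * Ia.index = Ja.index := AddSubgroup.relIndex_mul_index hJI
  have h2 : Ia.index = Ideal.absNorm I := rfl
  have h3 : Ja.index = nmN b := by rw [nmN_eq_absNorm]; rfl
  have hpos : Ja.relIndex Ia ≠ 0 := by
    intro h; rw [h, zero_mul, h3] at h1; exact (nmN_pos hb).ne h1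
  have hcard : Ja.relIndex Ia = Nat.card (Ia ⧸ Ja.addSubgroupOf Ia) := rfl
  have hfin : Finite (Ia ⧸ Ja.addSubgroupOf Ia) := Nat.finite_of_card_ne_zero (hcard ▸ hpos)
  have : Fintype (Ia ⧸ Ja.addSubgroupOf Ia) := Fintype.ofFinite _
  let φ : Ia ⧸ Ja.addSubgroupOf Ia → 𝓞 K := fun x => (Quotient.out x : Ia)
  have hφ : ∀ x y, b ∣ φ x - φ y → x = y := by
    intro x y h
    rw [← Quotient.out_eq x, ← Quotient.out_eq y]
    refine (QuotientAddGroup.eq).mpr ?_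
    rw [AddSubgroup.mem_addSubgroupOf]
    have h4 : φ x - φ y ∈ J := Ideal.mem_span_singleton.mpr h
    have h5 := J.neg_mem h4
    simp only [neg_sub] at h5
    show -(φ x) + φ y ∈ J
    rwa [neg_add_eq_sub]
  refine ⟨Finset.univ.image φ, ?_, ?_, ?_⟩
  · intro x hx
    obtain ⟨z, -, rfl⟩ := Finset.mem_image.mp hx
    exact (Quotient.out z : Ia).2
  · intro x hx y hy h
    obtain ⟨z, -, rfl⟩ := Finset.mem_image.mp hx
    obtain ⟨z', -, rfl⟩ := Finset.mem_image.mp hy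
    rw [hφ _ _ h]
  · rw [Finset.card_image_of_injective _ fun x y h =>
      hφ x y (by rw [h, sub_self]; exact dvd_zero b),
      Finset.card_univ, ← Nat.card_eq_fintype_card, ← hcard, ← h2, ← h3, h1]

end scalars

namespace OKLattice

variable {K : Type} [Field K] [NumberField K]
variable [htr : Fact (TotallyReal K)]

/-- The number of vectors of a box orthogonal to `w`. -/
def orthCount (L : OKLattice K) (X : ℝ) (w : L.carrier) : ℕ := by
  classical exact ((L.cube X).filter fun u => L.form w u = 0).card

variable (K) in
theorem orthCount_mul_le : ∃ A : ℕ, 1 ≤ A ∧ ∀ L : OKLattice K, ∀ C : ℕ, L.ReduceConst C →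
    ∀ (ρ X : ℝ) (w : L.carrier), w ≠ 0 → w ∈ L.cube ρ → A * ρ ≤ X → C * ρ ^ 2 ≤ X →
    (L.orthCount (2 * X) w : ℝ) * X ^ Module.finrank ℚ K * ∏ σ : K →+* ℝ, L.nrm σ w
      ≤ A * Ideal.absNorm (L.content w) * (L.cube (4 * X)).card := by
  classical
  obtain ⟨A, hA1, hA⟩ := exists_card_scalars K
  refine ⟨A, hA1, fun L C hC ρ X w hw hwρ hX1 hX2 => ?_⟩
  have hpos : ∀ σ, 0 < L.nrm σ w := fun σ => L.nrm_pos σ hw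
  have hle : ∀ σ, L.nrm σ w ≤ ρ := L.mem_box.mp hwρ
  have hfw : L.form w w ≠ 0 := fun h => hw (L.form_self_eq_zero.mp h)
  obtain ⟨S, hS1, hS2⟩ := hA (fun σ => X / L.nrm σ w) fun σ => by
    rw [le_div_iff₀ (hpos σ)]
    exact le_trans (mul_le_mul_of_nonneg_left (hle σ) (by positivity)) hX1
  obtain ⟨T, hT1, hT2, hT3⟩ := exists_residues_of_mem hfw (L.form_mem_content w w)
  have hg : ∀ t : 𝓞 K, ∃ x : L.carrier, t ∈ T →
      (L.form w w ∣ t - L.form w x) ∧ ∀ σ, L.nrm σ x ≤ X := by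
    intro t
    by_cases ht : t ∈ T
    · obtain ⟨z, hz⟩ := hT1 t ht
      obtain ⟨x, y, hxy, hx⟩ := hC.reduce _ hfw z
      refine ⟨x, fun _ => ⟨⟨L.form w y, ?_⟩, fun σ => (hx σ).trans ?_⟩⟩
      · rw [← hz, hxy]; simp
      · have h1 := L.nrm_sq σ w
        have h2 : |ov σ (L.form w w)| = L.nrm σ w ^ 2 := by
          rw [h1]; exact abs_of_nonneg (L.q_nonneg σ w)
        rw [h2]
        have h3 := hle σ
        have h4 := hpos σ
        exact le_trans (by gcongr) hX2
    · exact ⟨0, fun h => absurd h ht⟩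
  choose g hg using hg
  set F := (L.cube (2 * X)).filter fun u => L.form w u = 0 with hF
  have hcard : S.card * T.card * F.card ≤ (L.cube (4 * X)).card := by
    rw [← Finset.card_product, ← Finset.card_product]
    refine Finset.card_le_card_of_injOn (fun p => p.1.1 • w + g p.1.2 + p.2) ?_ ?_
    · rintro ⟨⟨a, t⟩, u⟩ hp
      simp only [Finset.mem_coe, Finset.mem_product] at hp
      obtain ⟨⟨ha, ht⟩, hu⟩ := hp
      refine L.mem_box.mpr fun σ => ?_
      have h1 := hS1 a ha σ
      rw [le_div_iff₀ (hpos σ)] at h1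
      have h2 := (hg t ht).2 σ
      have h3 := L.mem_box.mp (Finset.mem_filter.mp hu).1 σ
      calc L.nrm σ (a • w + g t + u) ≤ L.nrm σ (a • w) + L.nrm σ (g t) + L.nrm σ u :=
            (L.nrm_add_le σ _ _).trans (add_le_add_left (L.nrm_add_le σ _ _) _)
        _ ≤ _ := by rw [nrm_smul]; linarith
    · rintro ⟨⟨a, t⟩, u⟩ hp ⟨⟨a', t'⟩, u'⟩ hp' h
      simp only [Finset.mem_coe, Finset.mem_product] at hp hp'
      obtain ⟨⟨ha, ht⟩, hu⟩ := hp
      obtain ⟨⟨ha', ht'⟩, hu'⟩ := hp'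
      have hu0 := (Finset.mem_filter.mp hu).2
      have hu0' := (Finset.mem_filter.mp hu').2
      simp only at h
      have h1 := congrArg (L.form w) h
      simp only [map_add, map_smul, hu0, hu0', smul_eq_mul, add_zero] at h1
      have h2 : t = t' := by
        refine hT2 t ht t' ht' ?_
        obtain ⟨c, hc⟩ := (hg t ht).1
        obtain ⟨c', hc'⟩ := (hg t' ht').1
        refine ⟨c - c' + a' - a, ?_⟩
        linear_combination hc - hc' + h1
      subst h2
      rw [add_left_inj] at h1
      have h3 := mul_right_cancel₀ hfw h1
      subst h3
      rw [add_right_inj] at h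
      rw [h]
  have hcR : (S.card : ℝ) * T.card * F.card ≤ (L.cube (4 * X)).card := by exact_mod_cast hcard
  have hT3R : (T.card : ℝ) * Ideal.absNorm (L.content w) = (∏ σ : K →+* ℝ, L.nrm σ w) ^ 2 := by
    rw [← nmN_form_self]; exact_mod_cast hT3
  set P := ∏ σ : K →+* ℝ, L.nrm σ w with hP
  have hP0 : 0 < P := Finset.prod_pos fun σ _ => hpos σ
  have hS3 : X ^ Module.finrank ℚ K ≤ A * S.card * P := by
    rw [Finset.prod_div_distrib, Finset.prod_const, Finset.card_univ, card_emb,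
      div_le_iff₀ hP0] at hS2
    exact hS2
  have hOC : L.orthCount (2 * X) w = F.card := by
    unfold orthCount; rw [hF]
  rw [hOC]
  calc (F.card : ℝ) * X ^ Module.finrank ℚ K * P ≤ F.card * (A * S.card * P) * P := by gcongr
    _ = A * (S.card * F.card) * P ^ 2 := by ring
    _ = A * Ideal.absNorm (L.content w) * (S.card * T.card * F.card) := by rw [← hT3R]; ring
    _ ≤ _ := by gcongr

theorem finrank_orth_le {L : OKLattice K} {u : L.carrier} (hu : u ≠ 0) :
    Module.finrank ℤ (LinearMap.ker ((L.form u).restrictScalars ℤ)) + Module.finrank ℚ K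
      ≤ Module.finrank ℤ L.carrier := by
  set φ := (L.form u).restrictScalars ℤ with hφ
  have h1 := Submodule.finrank_quotient_add_finrank (LinearMap.ker φ)
  rw [φ.quotKerEquivRange.finrank_eq] at h1
  have hfu : L.form u u ≠ 0 := fun h => hu (L.form_self_eq_zero.mp h)
  let ψ : 𝓞 K →ₗ[ℤ] L.carrier :=
    ((LinearMap.id (R := 𝓞 K) (M := 𝓞 K)).smulRight u).restrictScalars ℤ
  have hψ : Function.Injective (φ.rangeRestrict ∘ₗ ψ) := by
    rw [← LinearMap.ker_eq_bot, LinearMap.ker_eq_bot']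
    intro a ha
    have h2 : φ (ψ a) = 0 := congrArg Subtype.val ha
    have h3 : a * L.form u u = 0 := by simpa [φ, ψ] using h2
    exact (mul_eq_zero.mp h3).resolve_right hfu
  have h2 := LinearMap.finrank_le_finrank_of_injective hψ
  have h3 : Module.finrank ℤ (𝓞 K) = Module.finrank ℚ K := RingOfIntegers.rank K
  omega

end OKLattice

namespace OKLattice

variable {K : Type} [Field K] [NumberField K]
variable [htr : Fact (TotallyReal K)]

theorem orthCount_eq (L : OKLattice K) (X : ℝ) (w : L.carrier)
    [DecidablePred fun u => L.form w u = 0] :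
    L.orthCount X w = ((L.cube X).filter fun u => L.form w u = 0).card := by
  unfold orthCount
  congr

theorem orthCount_le (L : OKLattice K) (X : ℝ) (w : L.carrier) :
    L.orthCount X w ≤ (L.cube X).card := by
  classical exact Finset.card_filter_le _ _

open Classical in
theorem card_eq_pairs_le (L : OKLattice K) {X : ℝ} (hX : 0 ≤ X) :
    ((L.cube X ×ˢ L.cube X).filter fun p => L.form p.1 p.1 = L.form p.2 p.2).card
      ≤ (L.cube (2 * X)).card
        + ∑ u ∈ (L.cube (2 * X)).filter (· ≠ 0), L.orthCount (2 * X) u := by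
  set Q := (L.cube (2 * X) ×ˢ L.cube (2 * X)).filter fun p => L.form p.1 p.2 = 0 with hQ
  have h1 : ((L.cube X ×ˢ L.cube X).filter fun p => L.form p.1 p.1 = L.form p.2 p.2).card
      ≤ Q.card := by
    refine Finset.card_le_card_of_injOn (fun p => (p.1 - p.2, p.1 + p.2)) ?_ ?_
    · intro p hp
      simp only [Finset.coe_filter, Finset.mem_product, Set.mem_ofPred_eq] at hp
      obtain ⟨⟨hp1, hp2⟩, hp3⟩ := hp
      refine Finset.mem_coe.mpr (Finset.mem_filter.mpr ⟨Finset.mem_product.mpr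
        ⟨L.mem_box.mpr fun σ => ?_, L.mem_box.mpr fun σ => ?_⟩, ?_⟩)
      · have := L.nrm_sub_le σ p.1 p.2
        linarith [L.mem_box.mp hp1 σ, L.mem_box.mp hp2 σ]
      · have := L.nrm_add_le σ p.1 p.2
        linarith [L.mem_box.mp hp1 σ, L.mem_box.mp hp2 σ]
      · simp only [map_add, map_sub, LinearMap.sub_apply]
        rw [L.symm p.2 p.1, hp3]; ring
    · rintro ⟨a, b⟩ - ⟨a', b'⟩ - h
      simp only [Prod.mk.injEq] at h
      have h2 : (2 : 𝓞 K) • a = (2 : 𝓞 K) • a' := by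
        rw [two_smul, two_smul]
        have := congrArg₂ (· + ·) h.1 h.2
        simpa [sub_add_add_cancel] using this
      have h3 := smul_right_injective L.carrier (two_ne_zero (α := 𝓞 K)) h2
      subst h3
      rw [add_right_inj] at h
      rw [h.2]
  have h2 : Q.card = ∑ u ∈ L.cube (2 * X), L.orthCount (2 * X) u := by
    rw [hQ, Finset.card_filter, Finset.sum_product]
    refine Finset.sum_congr rfl fun u _ => ?_
    rw [orthCount_eq, Finset.card_filter]
  have h0 : (0 : L.carrier) ∈ L.cube (2 * X) := L.zero_mem_box fun _ => by linarith
  rw [Finset.filter_ne']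
  rw [h2, ← Finset.add_sum_erase _ _ h0] at h1
  exact h1.trans (Nat.add_le_add_right (L.orthCount_le _ _) _)

open Classical in
theorem sum_orthCount_le (L : OKLattice K) {X : ℝ} (hX : 0 ≤ X) {A : ℕ} (hA : 1 ≤ A) :
    ∑ u ∈ (L.cube (2 * X)).filter (· ≠ 0), L.orthCount (2 * X) u
      ≤ A ^ (Module.finrank ℤ L.carrier - Module.finrank ℚ K) * ((L.cube (2 * X)).card
        + ∑ w ∈ (L.cube (4 * X / A)).filter (· ≠ 0), L.orthCount (2 * X) w) := by
  have h1 : ∀ u ∈ (L.cube (2 * X)).filter (· ≠ 0), L.orthCount (2 * X) u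
      ≤ A ^ (Module.finrank ℤ L.carrier - Module.finrank ℚ K) *
        ((L.cube (4 * X / A)).filter fun w => L.form u w = 0).card := by
    intro u hu
    have h2 := L.card_cover (LinearMap.ker ((L.form u).restrictScalars ℤ)) (2 * X) hA
    have h3 := finrank_orth_le (Finset.mem_filter.mp hu).2
    rw [show 2 * (2 * X) / A = 4 * X / A by ring] at h2
    simp only [LinearMap.mem_ker, LinearMap.coe_restrictScalars] at h2
    rw [orthCount_eq]
    exact h2.trans (Nat.mul_le_mul_right _ (Nat.pow_le_pow_right hA (by omega)))
  refine (Finset.sum_le_sum h1).trans ?_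
  rw [← Finset.mul_sum]
  refine Nat.mul_le_mul_left _ ?_
  simp_rw [Finset.card_filter]
  rw [Finset.sum_comm]
  have h0 : (0 : L.carrier) ∈ L.cube (4 * X / A) := L.zero_mem_box fun _ => by positivity
  rw [Finset.filter_ne' (L.cube (4 * X / A)), ← Finset.add_sum_erase _ _ h0]
  refine add_le_add ?_ (Finset.sum_le_sum fun w _ => ?_)
  · rw [← Finset.card_filter]
    exact (Finset.card_filter_le _ _).trans (Finset.card_filter_le _ _)
  · rw [← Finset.card_filter, orthCount_eq, Finset.filter_filter]
    refine Finset.card_le_card fun u hu => ?_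
    rw [Finset.mem_filter] at hu ⊢
    exact ⟨hu.1, by rw [L.symm]; exact hu.2.2⟩

variable (K) in
open Classical in
theorem card_eq_pairs_mul_le {r : ℕ} (hr : 2 * Module.finrank ℚ K + 8 ≤ r) :
    ∃ A : ℝ, 0 ≤ A ∧ ∀ L : OKLattice K, L.Good r → ∃ θ₀ : ℕ, ∀ θ : ℕ, θ₀ ≤ θ →
      (((L.cube ((θ : ℝ) ^ 6) ×ˢ L.cube ((θ : ℝ) ^ 6)).filter
        fun p => L.form p.1 p.1 = L.form p.2 p.2).card : ℝ) * (θ : ℝ) ^ (12 * Module.finrank ℚ K)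
        ≤ A * ((L.cube ((θ : ℝ) ^ 6)).card : ℝ) ^ 2 := by
  obtain ⟨A, hA0, hA⟩ := sum_content_div_norm_le K hr
  obtain ⟨B, hB1, hB⟩ := orthCount_mul_le K
  set d := Module.finrank ℚ K with hd
  have hd0 : 0 < d := finrank_pos_K
  refine ⟨4 ^ (r * d) * (1 + 4 ^ (r * d)) + 4 ^ (r * d) * B * A * 8 ^ (r * d) * 4 ^ (r * d),
    by positivity, fun L hL => ?_⟩
  obtain ⟨C, hC⟩ := L.exists_reduce.imp fun C h => ReduceConst.mk h.1 h.2.1 h.2.2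
  obtain ⟨ρ₀, hρ₀⟩ := hA L hL
  refine ⟨ρ₀ + C + B, fun θ hθ => ?_⟩
  have hC1 := hC.one_le
  have hθ1 : 1 ≤ θ := by omega
  have hθR : (1 : ℝ) ≤ θ := by exact_mod_cast hθ1
  have hθC : (C : ℝ) ≤ θ := by exact_mod_cast (by omega : C ≤ θ)
  have hθB : (B : ℝ) ≤ θ := by exact_mod_cast (by omega : B ≤ θ)
  have hC0 : (0 : ℝ) ≤ C := by positivity
  set X : ℝ := (θ : ℝ) ^ 6 with hX
  have hX0 : 0 < X := by positivity
  have hρθ : θ ≤ θ ^ 2 := Nat.le_self_pow (by norm_num) _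
  have hsum := hρ₀ (θ ^ 2) (by omega)
  push_cast at hsum
  set N : ℕ := (L.cube X).card with hN
  set N2 : ℕ := (L.cube (2 * X)).card with hN2
  set N4 : ℕ := (L.cube (4 * X)).card with hN4
  set Nρ : ℕ := (L.cube ((θ : ℝ) ^ 2)).card with hNρ
  have h2 : (N2 : ℝ) ≤ 4 ^ (r * d) * N := by
    have := card_cube_mul_le hL (A := 2) (by norm_num) X
    rw [hN2, hN]
    exact_mod_cast this
  have h4 : (N4 : ℝ) ≤ 8 ^ (r * d) * N := by
    have := card_cube_mul_le hL (A := 4) (by norm_num) X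
    rw [hN4, hN]
    exact_mod_cast this
  have hρ : (Nρ : ℝ) * (θ : ℝ) ^ (4 * (r * d)) ≤ N2 := by
    have h := card_smul_le hL hC (a := ((θ ^ 4 : ℕ) : 𝓞 K)) (by
      exact_mod_cast (by positivity : θ ^ 4 ≠ 0)) fun _ => (θ : ℝ) ^ 2
    rw [nmN_natCast] at h
    have h' := h.trans (L.card_box_mono (y' := fun _ => 2 * X) fun σ => ?_)
    · have h'' : (((θ ^ 4) ^ d) ^ r : ℝ) * Nρ ≤ N2 := by rw [hNρ, hN2]; exact_mod_cast h'
      refine le_trans (le_of_eq ?_) h''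
      rw [← pow_mul, ← pow_mul, mul_comm]
      congr 2; ring
    · rw [map_natCast, Nat.abs_cast, Nat.cast_pow, hX]
      have : (C : ℝ) ≤ (θ : ℝ) ^ 2 := hθC.trans (le_self_pow₀ hθR (by norm_num))
      calc (θ : ℝ) ^ 4 * ((θ : ℝ) ^ 2 + C) ≤ (θ : ℝ) ^ 4 * (θ ^ 2 + θ ^ 2) := by gcongr
        _ = _ := by ring
  have hNbig : (θ : ℝ) ^ (5 * (r * d)) ≤ N := by
    have h := card_smul_le hL hC (a := ((θ ^ 5 : ℕ) : 𝓞 K)) (by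
      exact_mod_cast (by positivity : θ ^ 5 ≠ 0)) fun _ => (0 : ℝ)
    rw [nmN_natCast] at h
    have h0 : 1 ≤ (L.box fun _ => (0 : ℝ)).card :=
      Finset.card_pos.mpr ⟨0, L.zero_mem_box fun _ => le_rfl⟩
    have h' := ((Nat.le_mul_of_pos_right _ h0).trans h).trans
      (L.card_box_mono (y' := fun _ => X) fun σ => ?_)
    · have h'' : (((θ ^ 5) ^ d) ^ r : ℝ) ≤ N := by rw [hN]; exact_mod_cast h'
      refine le_trans (le_of_eq ?_) h''
      rw [← pow_mul, ← pow_mul]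
      congr 1; ring
    · rw [map_natCast, Nat.abs_cast, Nat.cast_pow, hX, zero_add]
      calc (θ : ℝ) ^ 5 * C ≤ (θ : ℝ) ^ 5 * θ := by gcongr
        _ = _ := by ring
  have hs1 := L.card_eq_pairs_le hX0.le
  have hs2 := L.sum_orthCount_le hX0.le (A := 4 * θ ^ 4) (by
    have := Nat.one_le_pow 4 θ hθ1; omega)
  have hX4 : 4 * X / ((4 * θ ^ 4 : ℕ) : ℝ) = (θ : ℝ) ^ 2 := by
    rw [hX]; push_cast; field_simp
  rw [hX4, hL.rank] at hs2
  set W := (L.cube ((θ : ℝ) ^ 2)).filter (· ≠ 0) with hW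
  have hs3 : ((∑ w ∈ W, L.orthCount (2 * X) w : ℕ) : ℝ) * X ^ d
      ≤ B * N4 * (A * Nρ / (θ ^ 2) ^ d) := by
    have h5 : ∀ w ∈ W, (L.orthCount (2 * X) w : ℝ) * X ^ d
        ≤ B * N4 * ((Ideal.absNorm (L.content w) : ℝ) / ∏ σ : K →+* ℝ, L.nrm σ w) := by
      intro w hw
      obtain ⟨hw1, hw2⟩ := Finset.mem_filter.mp hw
      have hP : 0 < ∏ σ : K →+* ℝ, L.nrm σ w := Finset.prod_pos fun σ _ => L.nrm_pos σ hw2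
      have := hB L C hC _ X w hw2 hw1 (by
        calc (B : ℝ) * θ ^ 2 ≤ θ ^ 4 * θ ^ 2 := by
              have : (θ : ℝ) ≤ θ ^ 4 := le_self_pow₀ hθR (by norm_num)
              gcongr; linarith
          _ = X := by rw [hX]; ring) (by
        calc (C : ℝ) * (θ ^ 2) ^ 2 ≤ θ ^ 2 * (θ ^ 2) ^ 2 := by
              have : (θ : ℝ) ≤ θ ^ 2 := le_self_pow₀ hθR (by norm_num)
              gcongr; linarith
          _ = X := by rw [hX]; ring)
      rw [← mul_div_assoc, le_div_iff₀ hP]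
      refine this.trans (le_of_eq ?_)
      rw [hN4]; ring
    push_cast
    rw [Finset.sum_mul]
    refine (Finset.sum_le_sum h5).trans ?_
    rw [← Finset.mul_sum]
    gcongr
  set E : ℕ := ((L.cube X ×ˢ L.cube X).filter fun p => L.form p.1 p.1 = L.form p.2 p.2).card
  set T : ℕ := ∑ w ∈ W, L.orthCount (2 * X) w
  have hE : (E : ℝ) ≤ N2 + (4 * θ ^ 4) ^ (r * d - d) * (N2 + T) := by
    exact_mod_cast hs1.trans (Nat.add_le_add_left hs2 _)
  have hrd : d ≤ r * d := Nat.le_mul_of_pos_left d (by omega)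
  have e1 : (4 * (θ : ℝ) ^ 4) ^ (r * d - d) ≤ 4 ^ (r * d) * θ ^ (4 * (r * d - d)) := by
    rw [mul_pow, ← pow_mul]
    gcongr
    · norm_num
    · omega
  have e2 : (θ : ℝ) ^ (4 * (r * d - d) + 12 * d) ≤ N := by
    refine le_trans (pow_le_pow_right₀ hθR ?_) hNbig
    have : 8 * d ≤ r * d := Nat.mul_le_mul_right _ (by omega)
    omega
  have e3 : (θ : ℝ) ^ (12 * d) ≤ N := by
    refine le_trans (pow_le_pow_right₀ hθR ?_) e2
    omega
  have e4 : (θ : ℝ) ^ (4 * (r * d - d)) * θ ^ (12 * d) * T ≤ B * A * N4 * N2 := by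
    have h6 : (T : ℝ) * θ ^ (8 * d) ≤ B * A * N4 * Nρ := by
      have h7 : X ^ d = (θ : ℝ) ^ (6 * d) := by rw [hX, pow_mul]
      rw [h7, ← pow_mul, mul_comm 6 d] at hs3
      have h8 : (T : ℝ) * θ ^ (d * 6) * θ ^ (2 * d)
          ≤ (B * N4 * (A * Nρ / (θ : ℝ) ^ (2 * d))) * θ ^ (2 * d) := by gcongr
      have h9 : (θ : ℝ) ^ (8 * d) = θ ^ (d * 6) * θ ^ (2 * d) := by rw [← pow_add]; congr 1; ring
      rw [h9]
      calc _ = (T : ℝ) * θ ^ (d * 6) * θ ^ (2 * d) := by ring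
        _ ≤ _ := h8
        _ = _ := by field_simp
    have h10 : (θ : ℝ) ^ (4 * (r * d - d)) * θ ^ (12 * d) = θ ^ (8 * d) * θ ^ (4 * (r * d)) := by
      rw [← pow_add, ← pow_add]; congr 1; omega
    calc (θ : ℝ) ^ (4 * (r * d - d)) * θ ^ (12 * d) * T
        = (T * θ ^ (8 * d)) * θ ^ (4 * (r * d)) := by rw [h10]; ring
      _ ≤ (B * A * N4 * Nρ) * θ ^ (4 * (r * d)) := by gcongr
      _ = B * A * N4 * (Nρ * θ ^ (4 * (r * d))) := by ring
      _ ≤ _ := by gcongr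
  have f1 : (N2 : ℝ) * θ ^ (12 * d) ≤ 4 ^ (r * d) * N * N := by gcongr
  have f2 : (N2 : ℝ) * (θ ^ (4 * (r * d - d)) * θ ^ (12 * d)) ≤ 4 ^ (r * d) * N * N := by
    rw [← pow_add]; gcongr
  calc (E : ℝ) * θ ^ (12 * d)
      ≤ (N2 + 4 ^ (r * d) * θ ^ (4 * (r * d - d)) * (N2 + T)) * θ ^ (12 * d) := by
        refine mul_le_mul_of_nonneg_right (hE.trans ?_) (by positivity)
        gcongr
    _ = N2 * θ ^ (12 * d) + 4 ^ (r * d) * (N2 * (θ ^ (4 * (r * d - d)) * θ ^ (12 * d)))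
        + 4 ^ (r * d) * (θ ^ (4 * (r * d - d)) * θ ^ (12 * d) * T) := by ring
    _ ≤ 4 ^ (r * d) * N * N + 4 ^ (r * d) * (4 ^ (r * d) * N * N)
        + 4 ^ (r * d) * (B * A * (8 ^ (r * d) * N) * (4 ^ (r * d) * N)) := by
        refine add_le_add (add_le_add f1 (mul_le_mul_of_nonneg_left f2 (by positivity)))
          (mul_le_mul_of_nonneg_left (e4.trans ?_) (by positivity))
        gcongr
    _ = _ := by ring

variable (K) in
open Classical in
/-- Lattices of large rank have a positive proportion of values in large cubes. -/
theorem card_values_ge {r : ℕ} (hr : 2 * Module.finrank ℚ K + 8 ≤ r) :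
    ∃ A : ℝ, 0 ≤ A ∧ ∀ L : OKLattice K, L.Good r → ∃ θ₀ : ℕ, ∀ θ : ℕ, θ₀ ≤ θ →
      (θ : ℝ) ^ (12 * Module.finrank ℚ K)
        ≤ A * ((L.cube ((θ : ℝ) ^ 6)).image fun x => L.form x x).card := by
  obtain ⟨A, hA0, hA⟩ := card_eq_pairs_mul_le K hr
  refine ⟨A, hA0, fun L hL => ?_⟩
  obtain ⟨θ₀, h⟩ := hA L hL
  refine ⟨θ₀, fun θ hθ => ?_⟩
  have h1 := h θ hθ
  have h2 := Finset.card_sq_le_card_image_mul (L.cube ((θ : ℝ) ^ 6)) fun x => L.form x x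
  set N : ℕ := (L.cube ((θ : ℝ) ^ 6)).card with hN
  set V : ℕ := ((L.cube ((θ : ℝ) ^ 6)).image fun x => L.form x x).card
  set E : ℕ := ((L.cube ((θ : ℝ) ^ 6) ×ˢ L.cube ((θ : ℝ) ^ 6)).filter
        fun p => L.form p.1 p.1 = L.form p.2 p.2).card
  have hNpos : 0 < N := Finset.card_pos.mpr ⟨0, L.zero_mem_box fun _ => by positivity⟩
  have h2R : (N : ℝ) ^ 2 ≤ V * E := by exact_mod_cast h2
  have hE : (0 : ℝ) < E := by
    have : 0 < V * E := lt_of_lt_of_le (by positivity) h2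
    exact_mod_cast Nat.pos_of_mul_pos_left this
  refine le_of_mul_le_mul_left ?_ hE
  calc (E : ℝ) * θ ^ (12 * Module.finrank ℚ K) ≤ A * N ^ 2 := h1
    _ ≤ A * (V * E) := by gcongr
    _ = _ := by ring

end OKLattice

namespace OKLattice

variable {K : Type} [Field K] [NumberField K] (L : OKLattice K)

theorem rank_eq_finrank : L.rank = Module.finrank (𝓞 K) L.carrier :=
  (TensorProduct.isBaseChange (𝓞 K) L.carrier K).finrank_eq

/-- Every lattice contains a free sublattice of full rank. -/
theorem exists_free : ∃ e : Fin L.rank → L.carrier, LinearIndependent (𝓞 K) e ∧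
    ∃ b : 𝓞 K, b ≠ 0 ∧ ∀ x, b • x ∈ Submodule.span (𝓞 K) (Set.range e) := by
  classical
  obtain ⟨e, he⟩ := exists_linearIndependent_of_le_finrank (R := 𝓞 K) (M := L.carrier)
    L.rank_eq_finrank.le
  refine ⟨e, he, ?_⟩
  set F := Submodule.span (𝓞 K) (Set.range e) with hF
  have h1 := Submodule.finrank_quotient_add_finrank F
  have h2 : Module.finrank (𝓞 K) F = L.rank := by
    rw [hF, finrank_span_eq_card he, Fintype.card_fin]
  rw [h2, L.rank_eq_finrank] at h1
  have h3 : Module.finrank (𝓞 K) (L.carrier ⧸ F) = 0 := by omega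
  have h4 : ∀ x : L.carrier, ∃ a : 𝓞 K, a ≠ 0 ∧ a • x ∈ F := fun x => by
    obtain ⟨a, ha, hax⟩ := Module.finrank_eq_zero_iff.mp h3 (F.mkQ x)
    refine ⟨a, ha, ?_⟩
    rwa [← map_smul, Submodule.mkQ_apply, Submodule.Quotient.mk_eq_zero] at hax
  choose c hc0 hc using h4
  obtain ⟨n, s, hs⟩ := Module.Finite.exists_fin (R := 𝓞 K) (M := L.carrier)
  refine ⟨∏ i, c (s i), Finset.prod_ne_zero_iff.mpr fun i _ => hc0 _, fun x => ?_⟩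
  have hx : x ∈ Submodule.span (𝓞 K) (Set.range s) := hs ▸ Submodule.mem_top
  induction hx using Submodule.span_induction with
  | mem x h =>
    obtain ⟨i, rfl⟩ := h
    rw [← Finset.prod_erase_mul _ _ (Finset.mem_univ i), mul_smul]
    exact F.smul_mem _ (hc _)
  | zero => rw [smul_zero]; exact F.zero_mem
  | add x y _ _ hx hy => rw [smul_add]; exact F.add_mem hx hy
  | smul a x _ hx => rw [smul_comm]; exact F.smul_mem _ hx

theorem finrank_int : Module.finrank ℤ L.carrier = L.rank * Module.finrank ℚ K := by
  obtain ⟨e, he, b, hb, hbx⟩ := L.exists_free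
  set F := Submodule.span (𝓞 K) (Set.range e) with hF
  have h0 : Module.finrank ℤ F = L.rank * Module.finrank ℚ K := by
    rw [((Module.Basis.span he).equivFun.restrictScalars ℤ).finrank_eq, Module.finrank_pi_fintype]
    simp [RingOfIntegers.rank K]
  have hFfin : Module.Finite ℤ F := Module.Finite.trans (𝓞 K) F
  apply le_antisymm
  · let ψ : L.carrier →ₗ[𝓞 K] F := (LinearMap.lsmul (𝓞 K) L.carrier b).codRestrict F hbx
    have hψ : Function.Injective ψ := fun x y h =>
      smul_right_injective _ hb (congrArg Subtype.val h)
    have := LinearMap.finrank_le_finrank_of_injective (f := ψ.restrictScalars ℤ) hψ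
    rwa [h0] at this
  · have := LinearMap.finrank_le_finrank_of_injective (f := F.subtype.restrictScalars ℤ)
      F.injective_subtype
    rwa [h0] at this

end OKLattice

theorem AddSubgroup.exists_finset_of_index {G : Type*} [AddCommGroup G] (H : AddSubgroup G)
    (h : H.index ≠ 0) : ∃ T : Finset G, T.card = H.index ∧
      ∀ x ∈ T, ∀ y ∈ T, x - y ∈ H → x = y := by
  classical
  have hfin : Finite (G ⧸ H) := Nat.finite_of_card_ne_zero h
  have : Fintype (G ⧸ H) := Fintype.ofFinite _
  have hinj : ∀ x y : G ⧸ H, Quotient.out x - Quotient.out y ∈ H → x = y := by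
    intro x y hxy
    rw [← Quotient.out_eq x, ← Quotient.out_eq y]
    refine (QuotientAddGroup.eq).mpr ?_
    rw [← neg_mem_iff]
    rwa [neg_add_rev, neg_neg, neg_add_eq_sub]
  let φ : G ⧸ H → G := fun x => Quotient.out x
  refine ⟨Finset.univ.image φ, ?_, ?_⟩
  · rw [Finset.card_image_of_injective _ fun x y h => hinj x y
        (by rw [show Quotient.out x = Quotient.out y from h, sub_self]; exact H.zero_mem),
      Finset.card_univ, ← Nat.card_eq_fintype_card]; rfl
  · intro x hx y hy hxy
    obtain ⟨x, -, rfl⟩ := Finset.mem_image.mp hx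
    obtain ⟨y, -, rfl⟩ := Finset.mem_image.mp hy
    rw [hinj x y hxy]

namespace OKLattice

variable {K : Type} [Field K] [NumberField K] (L : OKLattice K)

theorem finite_quotient {b : 𝓞 K} (hb : b ≠ 0) {F : Submodule (𝓞 K) L.carrier}
    (hF : ∀ x, b • x ∈ F) : Finite (L.carrier ⧸ F) := by
  have : Module.Finite ℤ (L.carrier ⧸ F) := Module.Finite.trans (𝓞 K) _
  refine Module.finite_of_fg_torsion _ fun x => ?_
  obtain ⟨x, rfl⟩ := F.mkQ_surjective x
  have hN : (nmN b : ℤ) ≠ 0 := by exact_mod_cast (nmN_pos hb).ne'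
  refine ⟨⟨nmN b, mem_nonZeroDivisors_of_ne_zero hN⟩, ?_⟩
  obtain ⟨c, hc⟩ := nmN_dvd_self b
  have h1 : ((nmN b : ℕ) : 𝓞 K) • x ∈ F := by
    rw [hc, mul_comm, mul_smul]; exact F.smul_mem _ (hF x)
  have h2 : (nmN b : ℤ) • F.mkQ x = F.mkQ (((nmN b : ℕ) : 𝓞 K) • x) := by
    rw [map_smul, natCast_zsmul, Nat.cast_smul_eq_nsmul]
  show (nmN b : ℤ) • F.mkQ x = 0
  rw [h2, Submodule.mkQ_apply, Submodule.Quotient.mk_eq_zero]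
  exact h1

theorem exists_finset_smul {a : 𝓞 K} (ha : a ≠ 0) : ∃ T : Finset L.carrier,
    T.card = nmN a ^ L.rank ∧ ∀ x ∈ T, ∀ y ∈ T, (∃ z, x - y = a • z) → x = y := by
  classical
  obtain ⟨e, he, b, hb, hbx⟩ := L.exists_free
  set F := Submodule.span (𝓞 K) (Set.range e) with hF
  let ψ : (Fin L.rank → 𝓞 K) →ₗ[𝓞 K] L.carrier := Fintype.linearCombination (𝓞 K) e
  have hψ : Function.Injective ψ.toAddMonoidHom :=
    linearIndependent_iff_injective_fintypeLinearCombination.mp he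
  have hψr : LinearMap.range ψ = F := Fintype.range_linearCombination (𝓞 K) e
  let μ : L.carrier →+ L.carrier := DistribSMul.toAddMonoidHom L.carrier a
  have hμ : Function.Injective μ := smul_right_injective _ ha
  let H : AddSubgroup L.carrier := (⊤ : AddSubgroup _).map ψ.toAddMonoidHom
  have hHF : H = F.toAddSubgroup := by
    rw [← hψr]; ext x; simp [H]
  let P : AddSubgroup (Fin L.rank → 𝓞 K) :=
    AddSubgroup.pi Set.univ fun _ => (Ideal.span {a}).toAddSubgroup
  have hP : P.map ψ.toAddMonoidHom = H.map μ := by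
    ext x
    constructor
    · rintro ⟨y, hy, rfl⟩
      have h1 : ∀ i, ∃ c, y i = a * c := fun i =>
        Ideal.mem_span_singleton.mp (hy i (Set.mem_univ i))
      choose c hc using h1
      refine ⟨ψ c, ⟨c, trivial, rfl⟩, ?_⟩
      show a • ψ c = ψ y
      rw [← map_smul]; congr 1; ext i; simp [hc]
    · rintro ⟨_, ⟨c, -, rfl⟩, rfl⟩
      refine ⟨a • c, fun i _ => Ideal.mem_span_singleton.mpr ⟨c i, rfl⟩, ?_⟩
      show ψ (a • c) = a • ψ c
      rw [map_smul]
  have hi : H.index ≠ 0 := by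
    have := L.finite_quotient hb hbx
    rw [hHF]
    exact (Nat.card_pos (α := L.carrier ⧸ F)).ne'
  have hle : H.map μ ≤ H := by
    rw [hHF]
    rintro _ ⟨x, hx, rfl⟩
    exact F.smul_mem a hx
  have h1 : (H.map μ).relIndex H = nmN a ^ L.rank := by
    rw [← hP, AddSubgroup.relIndex_map_map_of_injective _ _ hψ, AddSubgroup.relIndex_top_right,
      AddSubgroup.index_pi, Finset.prod_const, Finset.card_univ, Fintype.card_fin]
    congr 1
    rw [nmN_eq_absNorm]; rfl
  have h2 : ((⊤ : AddSubgroup L.carrier).map μ).index = nmN a ^ L.rank := by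
    have h3 := AddSubgroup.relIndex_mul_index hle
    have h4 := AddSubgroup.relIndex_mul_index (AddSubgroup.map_mono (f := μ) (le_top (a := H)))
    rw [AddSubgroup.relIndex_map_map_of_injective _ _ hμ, AddSubgroup.relIndex_top_right] at h4
    rw [h1, ← h4, mul_comm] at h3
    exact (Nat.eq_of_mul_eq_mul_left (Nat.pos_of_ne_zero hi) h3).symm
  obtain ⟨T, hT1, hT2⟩ := AddSubgroup.exists_finset_of_index ((⊤ : AddSubgroup L.carrier).map μ) (by
    rw [h2]; exact pow_ne_zero _ (nmN_pos ha).ne')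
  refine ⟨T, hT1.trans h2, fun x hx y hy h => hT2 x hx y hy ?_⟩
  obtain ⟨z, hz⟩ := h
  exact ⟨z, trivial, hz.symm⟩

end OKLattice

section Primes

variable {R : Type*} [CommRing R] [IsDedekindDomain R]

theorem Ideal.exists_mem_notMem_mul {P I : Ideal R} (hP : Prime P) (hI : I ≠ ⊥) :
    ∃ a ∈ I, a ∉ P * I := by
  by_contra! h
  have h1 : P * I = 1 * I := by
    rw [one_mul]; exact le_antisymm Ideal.mul_le_right h
  exact hP.not_isUnit (by rw [mul_right_cancel₀ hI h1]; exact isUnit_one)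

theorem Ideal.mem_of_mul_mem_mul {P I : Ideal R} (hP : Prime P) (hI : I ≠ ⊥) {a b : R}
    (ha : a ∈ I) (haP : a ∉ P * I) (h : a * b ∈ P * I) : b ∈ P := by
  obtain ⟨J, hJ⟩ := Ideal.dvd_span_singleton.mpr ha
  have h1 : P * I ∣ Ideal.span {a * b} := Ideal.dvd_span_singleton.mpr h
  rw [← Ideal.span_singleton_mul_span_singleton, hJ, mul_comm P, mul_assoc] at h1
  have h2 : P ∣ J * Ideal.span {b} := (mul_dvd_mul_iff_left hI).mp h1
  obtain h3 | h3 := hP.dvd_or_dvd h2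
  · refine absurd ?_ haP
    rw [← Ideal.dvd_span_singleton, hJ, mul_comm P]
    exact mul_dvd_mul_left I h3
  · exact Ideal.dvd_span_singleton.mp h3

theorem Ideal.exists_uniformizer {P : Ideal R} (hP : Prime P) :
    ∃ π ∈ P, ∀ x ∈ P, ∃ c, x - c * π ∈ P ^ 2 := by
  obtain ⟨π, hπ, hπ2⟩ := Ideal.exists_mem_notMem_mul hP hP.ne_zero
  have : P.IsPrime := Ideal.isPrime_of_prime hP
  refine ⟨π, hπ, fun x hx => ?_⟩
  have h1 : P ^ 2 ⊔ Ideal.span {π} = P ^ 1 := by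
    refine Ideal.eq_prime_pow_of_succ_lt_of_le hP.ne_zero ?_ ?_
    · refine lt_of_le_of_ne le_sup_left fun h => hπ2 ?_
      rw [← sq, show P ^ 2 = _ from h]
      exact Ideal.mem_sup_right (Ideal.mem_span_singleton_self π)
    · rw [pow_one]
      refine sup_le (Ideal.pow_le_self two_ne_zero) ?_
      rwa [Ideal.span_singleton_le_iff_mem]
  rw [pow_one] at h1
  rw [← h1] at hx
  obtain ⟨y, hy, z, hz, hyz⟩ := Submodule.mem_sup.mp hx
  obtain ⟨c, rfl⟩ := Ideal.mem_span_singleton'.mp hz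
  exact ⟨c, by rw [← hyz]; simpa using hy⟩

/-- Fibers over a maximal ideal are at least as large as the rank. -/
theorem Ideal.finrank_le_finrank_quotient {M : Type*} [AddCommGroup M] [Module R M]
    [Module.Finite R M] [Module.IsTorsionFree R M] (P : Ideal R) [P.IsMaximal] :
    Module.finrank R M ≤ Module.finrank (R ⧸ P) (M ⧸ (P • ⊤ : Submodule R M)) := by
  classical
  let _ : Field (R ⧸ P) := Ideal.Quotient.field P
  have hfin : Module.Finite (R ⧸ P) (M ⧸ (P • ⊤ : Submodule R M)) :=
    Module.Finite.of_restrictScalars_finite R _ _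
  let b := Module.finBasis (R ⧸ P) (M ⧸ (P • ⊤ : Submodule R M))
  choose s hs using fun i => Submodule.mkQ_surjective (P • ⊤ : Submodule R M) (b i)
  set S := Submodule.span R (Set.range s) with hS
  have h1 : ∀ x : M, ∃ y ∈ S, x - y ∈ (P • ⊤ : Submodule R M) := fun x => by
    set c := b.repr (Submodule.mkQ _ x)
    choose t ht using fun i => Ideal.Quotient.mk_surjective (c i)
    refine ⟨∑ i, t i • s i, S.sum_mem fun i _ => S.smul_mem _ (Submodule.subset_span ⟨i, rfl⟩), ?_⟩
    refine (Submodule.Quotient.mk_eq_zero _).mp ?_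
    rw [← Submodule.mkQ_apply, map_sub, sub_eq_zero]
    rw [← b.sum_repr (Submodule.mkQ _ x), map_sum]
    refine Finset.sum_congr rfl fun i _ => ?_
    rw [map_smul, hs]
    show c i • b i = _
    rw [← ht i]; rfl
  have h2 : (⊤ : Submodule R (M ⧸ S)) ≤ P • ⊤ := by
    rintro x -
    obtain ⟨x, rfl⟩ := S.mkQ_surjective x
    obtain ⟨y, hy, hxy⟩ := h1 x
    have h3 : S.mkQ x = S.mkQ (x - y) := by
      rw [map_sub, (by simpa using hy : S.mkQ y = 0), sub_zero]
    rw [h3]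
    have h4 := Submodule.mem_map_of_mem (f := S.mkQ) hxy
    rw [Submodule.map_smul''] at h4
    exact (Submodule.smul_mono le_rfl le_top : P • _ ≤ P • _) h4
  obtain ⟨a, ha, haS⟩ := Submodule.exists_sub_one_mem_and_smul_eq_zero_of_fg_of_le_smul P
    (⊤ : Submodule R (M ⧸ S)) Module.Finite.fg_top h2
  have ha0 : a ≠ 0 := by
    rintro rfl
    refine (Ideal.IsMaximal.ne_top ‹P.IsMaximal›) ((Ideal.eq_top_iff_one P).mpr ?_)
    simpa using ha
  have h3 : ∀ x : M, a • x ∈ S := fun x => by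
    have := haS (S.mkQ x) trivial
    rwa [← map_smul, Submodule.mkQ_apply, Submodule.Quotient.mk_eq_zero] at this
  let ψ : M →ₗ[R] S := (LinearMap.lsmul R M a).codRestrict S h3
  have hψ : Function.Injective ψ := fun x y h =>
    smul_right_injective M ha0 (congrArg Subtype.val h)
  have h4 := LinearMap.finrank_le_finrank_of_injective hψ
  have h5 := finrank_range_le_card (R := R) s
  rw [Fintype.card_fin] at h5
  exact h4.trans h5

end Primes

section Chevalley

open MvPolynomial

/-- A ternary quadratic form over a finite field is isotropic. -/
theorem exists_isotropic {k : Type*} [Field k] [Finite k] (A : Fin 3 → Fin 3 → k) :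
    ∃ t : Fin 3 → k, t ≠ 0 ∧ ∑ i, ∑ j, t i * t j * A i j = 0 := by
  classical
  have : Fintype k := Fintype.ofFinite k
  obtain ⟨p, hp⟩ := CharP.exists k
  have hpp : Fact p.Prime := ⟨CharP.char_is_prime k p⟩
  let g : MvPolynomial (Fin 3) k := ∑ i, ∑ j, X i * X j * C (A i j)
  have hdeg : g.totalDegree < Fintype.card (Fin 3) := by
    refine lt_of_le_of_lt (b := 2) ?_ (by simp)
    refine totalDegree_finsetSum_le fun i _ => totalDegree_finsetSum_le fun j _ => ?_
    refine (totalDegree_mul _ _).trans ?_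
    have := totalDegree_mul (X i) (X j : MvPolynomial (Fin 3) k)
    rw [totalDegree_X, totalDegree_X] at this
    rw [totalDegree_C]; exact this
  have hev : ∀ t : Fin 3 → k, eval t g = ∑ i, ∑ j, t i * t j * A i j := fun t => by
    simp [g, map_sum]
  have h1 := char_dvd_card_solutions p hdeg
  have h0 : eval (0 : Fin 3 → k) g = 0 := by rw [hev]; simp
  have h2 : 1 < Fintype.card {x : Fin 3 → k // eval x g = 0} :=
    hpp.out.one_lt.trans_le (Nat.le_of_dvd (Fintype.card_pos_iff.mpr ⟨⟨0, h0⟩⟩) h1)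
  obtain ⟨⟨t, ht⟩, ht0⟩ := Fintype.exists_ne_of_one_lt_card h2 ⟨0, h0⟩
  exact ⟨t, fun h => ht0 (Subtype.ext h), by rw [← hev, ht]⟩

end Chevalley

namespace OKLattice

variable {K : Type} [Field K] [NumberField K] (L : OKLattice K)

/-- A local maximality property of integral lattices. -/
def IsMax : Prop := ∀ P : Ideal (𝓞 K), Prime P → ∀ x : L.carrier, (∀ z, L.form x z ∈ P) →
  L.form x x ∈ P ^ 2 → x ∈ (P • ⊤ : Submodule (𝓞 K) L.carrier)

/-- The radical of a lattice modulo an ideal. -/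
def radMod (P : Ideal (𝓞 K)) : Submodule (𝓞 K) L.carrier where
  carrier := {x | ∀ z, L.form x z ∈ P}
  add_mem' hx hy z := by rw [map_add]; exact P.add_mem (hx z) (hy z)
  zero_mem' z := by rw [map_zero]; exact P.zero_mem
  smul_mem' a x hx z := by rw [map_smul]; exact P.mul_mem_left a (hx z)

variable {L}

theorem IsMax.exists_finset_prime (hL : L.IsMax) {P : Ideal (𝓞 K)} (hP : Prime P) :
    ∃ T : Finset L.carrier, Ideal.absNorm P ^ (L.rank - 2) ≤ T.card ∧
      ∀ x ∈ T, ∀ y ∈ T, (∀ z, L.form (x - y) z ∈ P) → x = y := by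
  classical
  have hPp : P.IsPrime := Ideal.isPrime_of_prime hP
  have hPm : P.IsMaximal := hPp.isMaximal hP.ne_zero
  let _ : Field (𝓞 K ⧸ P) := Ideal.Quotient.field P
  have hfinP : Finite (𝓞 K ⧸ P) := Ideal.finiteQuotientOfFreeOfNeBot P hP.ne_zero
  set V := L.carrier ⧸ (P • ⊤ : Submodule (𝓞 K) L.carrier) with hV
  have hfin : Module.Finite (𝓞 K ⧸ P) V := Module.Finite.of_restrictScalars_finite (𝓞 K) _ _
  let m : L.carrier →ₗ[𝓞 K] V := Submodule.mkQ _
  have hsm : ∀ (a : 𝓞 K) (v : V), Ideal.Quotient.mk P a • v = a • v := fun a v => rfl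
  let R : Submodule (𝓞 K ⧸ P) V :=
    { carrier := m '' {x | ∀ z, L.form x z ∈ P}
      add_mem' := by
        rintro _ _ ⟨x, hx, rfl⟩ ⟨y, hy, rfl⟩
        exact ⟨x + y, (L.radMod P).add_mem hx hy, map_add _ _ _⟩
      zero_mem' := ⟨0, (L.radMod P).zero_mem, map_zero _⟩
      smul_mem' := by
        rintro c _ ⟨x, hx, rfl⟩
        obtain ⟨a, rfl⟩ := Ideal.Quotient.mk_surjective c
        exact ⟨a • x, (L.radMod P).smul_mem a hx, map_smul _ _ _⟩ }
  have hR : Module.finrank (𝓞 K ⧸ P) R ≤ 2 := by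
    by_contra! h
    obtain ⟨w, hw⟩ := exists_linearIndependent_of_le_finrank (R := 𝓞 K ⧸ P) (M := R) (n := 3) h
    choose x hx hxw using fun i => (w i).2
    obtain ⟨π, hπ, hπ2⟩ := Ideal.exists_uniformizer hP
    choose A hA using fun i j => hπ2 (L.form (x i) (x j)) (hx i (x j))
    obtain ⟨t, ht0, ht⟩ := exists_isotropic fun i j => Ideal.Quotient.mk P (A i j)
    choose s hs using fun i => Ideal.Quotient.mk_surjective (t i)
    have h1 : ∑ i, ∑ j, s i * s j * A i j ∈ P := by
      rw [← Ideal.Quotient.eq_zero_iff_mem, ← ht]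
      simp [hs]
    set y := ∑ i, s i • x i with hy
    have h2 : L.form y y = ∑ i, ∑ j, s i * s j * L.form (x i) (x j) := by
      simp only [hy, map_sum, LinearMap.sum_apply, map_smul, LinearMap.smul_apply, smul_eq_mul]
      rw [Finset.sum_comm' (t' := Finset.univ) (s' := fun _ => Finset.univ) (by simp)]
      refine Finset.sum_congr rfl fun i _ => ?_
      rw [Finset.mul_sum]
      refine Finset.sum_congr rfl fun j _ => ?_
      rw [L.symm]; ring
    have h3 : L.form y y ∈ P ^ 2 := by
      have h4 : L.form y y = ∑ i, ∑ j, s i * s j * (L.form (x i) (x j) - A i j * π)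
          + (∑ i, ∑ j, s i * s j * A i j) * π := by
        rw [h2, Finset.sum_mul, ← Finset.sum_add_distrib]
        refine Finset.sum_congr rfl fun i _ => ?_
        rw [Finset.sum_mul, ← Finset.sum_add_distrib]
        refine Finset.sum_congr rfl fun j _ => by ring
      rw [h4]
      refine add_mem (sum_mem fun i _ => sum_mem fun j _ => Ideal.mul_mem_left _ _ (hA i j)) ?_
      rw [sq]; exact Ideal.mul_mem_mul h1 hπ
    have h4 : y ∈ (P • ⊤ : Submodule (𝓞 K) L.carrier) :=
      hL P hP y ((L.radMod P).sum_mem fun i _ => (L.radMod P).smul_mem _ (hx i)) h3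
    have h5 : m y = 0 := (Submodule.Quotient.mk_eq_zero _).mpr h4
    have h6 : ∑ i, t i • w i = 0 := by
      apply Subtype.ext
      rw [ZeroMemClass.coe_zero, ← h5, hy, map_sum, AddSubmonoidClass.coe_finsetSum]
      refine Finset.sum_congr rfl fun i _ => ?_
      rw [Submodule.coe_smul, ← hxw, map_smul, ← hs]; rfl
    exact ht0 (funext (Fintype.linearIndependent_iff.mp hw t h6))
  obtain ⟨C, hC⟩ := R.exists_isCompl
  have hCr : L.rank - 2 ≤ Module.finrank (𝓞 K ⧸ P) C := by
    have h1 := Submodule.finrank_add_eq_of_isCompl hC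
    have h2 := Ideal.finrank_le_finrank_quotient (M := L.carrier) P
    rw [L.rank_eq_finrank]
    have h3 : Module.finrank (𝓞 K) L.carrier ≤ Module.finrank (𝓞 K ⧸ P) V := h2
    omega
  have hfinC : Finite C := Module.finite_of_finite (𝓞 K ⧸ P)
  have : Fintype C := Fintype.ofFinite C
  choose u hu using fun c : C => Submodule.mkQ_surjective (P • ⊤ : Submodule (𝓞 K) L.carrier) c.1
  have hinj : Function.Injective u := fun x y h => Subtype.ext (by rw [← hu, ← hu, h])
  refine ⟨Finset.univ.image u, ?_, ?_⟩
  · rw [Finset.card_image_of_injective _ hinj, Finset.card_univ, ← Nat.card_eq_fintype_card,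
      Module.natCard_eq_pow_finrank (K := 𝓞 K ⧸ P) (V := C)]
    exact Nat.pow_le_pow_right (Nat.card_pos (α := 𝓞 K ⧸ P)) hCr
  · intro x hx y hy h
    obtain ⟨x, -, rfl⟩ := Finset.mem_image.mp hx
    obtain ⟨y, -, rfl⟩ := Finset.mem_image.mp hy
    have h1 : (x - y : V) ∈ R := ⟨u x - u y, h, by
      show Submodule.mkQ _ (u x - u y) = _
      rw [map_sub, hu, hu]⟩
    have h2 : (x - y : V) ∈ C := C.sub_mem x.2 y.2
    have h3 := Submodule.disjoint_def.mp hC.disjoint _ h1 h2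
    rw [Subtype.ext (sub_eq_zero.mp h3)]

theorem IsMax.exists_finset_ideal (hL : L.IsMax) (I : Ideal (𝓞 K)) (hI : I ≠ ⊥) :
    ∃ T : Finset L.carrier, Ideal.absNorm I ^ (L.rank - 2) ≤ T.card ∧
      ∀ x ∈ T, ∀ y ∈ T, (∀ z, L.form (x - y) z ∈ I) → x = y := by
  classical
  induction I using UniqueFactorizationMonoid.induction_on_prime with
  | h₁ => exact absurd rfl hI
  | h₂ x hx =>
    refine ⟨{0}, ?_, by simp⟩
    rw [Ideal.isUnit_iff.mp hx]; simp
  | h₃ I P hI0 hP ih =>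
    obtain ⟨T, hT1, hT2⟩ := ih hI0
    obtain ⟨U, hU1, hU2⟩ := hL.exists_finset_prime hP
    obtain ⟨a, ha, haP⟩ := Ideal.exists_mem_notMem_mul hP hI0
    have key : ∀ x ∈ U, ∀ x' ∈ U, ∀ y ∈ T, ∀ y' ∈ T,
        (∀ z, L.form ((a • x + y) - (a • x' + y')) z ∈ P * I) → x = x' ∧ y = y' := by
      intro x hx x' hx' y hy y' hy' h
      have h1 : y = y' := hT2 y hy y' hy' fun z => by
        have h2 : L.form (y - y') z = L.form ((a • x + y) - (a • x' + y')) z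
            - a * L.form (x - x') z := by
          simp only [map_sub, map_add, map_smul, LinearMap.sub_apply, LinearMap.add_apply,
            LinearMap.smul_apply, smul_eq_mul]
          ring
        rw [h2]
        exact I.sub_mem (Ideal.mul_le_right (h z)) (I.mul_mem_right _ ha)
      refine ⟨hU2 x hx x' hx' fun z => ?_, h1⟩
      refine Ideal.mem_of_mul_mem_mul hP hI0 ha haP ?_
      have h2 := h z
      rw [h1, add_sub_add_right_eq_sub, ← smul_sub, map_smul] at h2
      exact h2
    refine ⟨(U ×ˢ T).image fun p => a • p.1 + p.2, ?_, ?_⟩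
    · rw [Finset.card_image_of_injOn, Finset.card_product, map_mul, mul_pow]
      · exact Nat.mul_le_mul hU1 hT1
      · rintro ⟨x, y⟩ hx ⟨x', y'⟩ hx' h
        simp only [Finset.coe_product, Set.mem_prod, Finset.mem_coe] at hx hx'
        have h0 : (a • x + y) - (a • x' + y') = 0 := sub_eq_zero.mpr h
        obtain ⟨h1, h2⟩ := key x hx.1 x' hx'.1 y hx.2 y' hx'.2 fun z => by
          rw [h0, map_zero]; exact Ideal.zero_mem _
        subst h1 h2
        rfl
    · intro v hv v' hv' h
      obtain ⟨⟨x, y⟩, hx, rfl⟩ := Finset.mem_image.mp hv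
      obtain ⟨⟨x', y'⟩, hx', rfl⟩ := Finset.mem_image.mp hv'
      rw [Finset.mem_product] at hx hx'
      obtain ⟨h1, h2⟩ := key x hx.1 x' hx'.1 y hx.2 y' hx'.2 h
      subst h1 h2
      rfl

theorem IsMax.good (hL : L.IsMax) : L.Good L.rank where
  rank := L.finrank_int
  smul a ha := by
    obtain ⟨T, hT, hT2⟩ := L.exists_finset_smul ha
    exact ⟨T, hT.ge, hT2⟩
  ideal := hL.exists_finset_ideal

end OKLattice

section Spaces

variable {K : Type} [Field K]

/-- A totally positive definite symmetric bilinear form over `K`. -/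
structure IsPD {V : Type*} [AddCommGroup V] [Module K V] (B : LinearMap.BilinForm K V) :
    Prop where
  symm : ∀ x y, B x y = B y x
  pos : ∀ v, v ≠ 0 → ∀ σ : K →+* ℝ, 0 < σ (B v v)

theorem IsPD.comp {V W : Type*} [AddCommGroup V] [Module K V] [AddCommGroup W] [Module K W]
    {B : LinearMap.BilinForm K V} (hB : IsPD B) (f : W →ₗ[K] V) (hf : Function.Injective f) :
    IsPD (B.comp f f) where
  symm x y := hB.symm _ _
  pos v hv σ := hB.pos (f v) (fun h => hv (hf (by rw [h, map_zero]))) σ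

/-- The lattice structure on a module embedded in a positive definite space with integral values. -/
def OKLattice.ofMap {V X : Type} [AddCommGroup V] [Module K V] [Module (𝓞 K) V]
    [IsScalarTower (𝓞 K) K V] [AddCommGroup X] [Module (𝓞 K) X] [Module.Finite (𝓞 K) X]
    {B : LinearMap.BilinForm K V} (hB : IsPD B) (f : X →ₗ[𝓞 K] V) (hf : Function.Injective f)
    (h : ∀ x y, ∃ a : 𝓞 K, algebraMap (𝓞 K) K a = B (f x) (f y)) : OKLattice K :=
  have hinj : Function.Injective (algebraMap (𝓞 K) K) := RingOfIntegers.coe_injective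
  have hs : ∀ (a : 𝓞 K) (v : V), a • v = algebraMap (𝓞 K) K a • v := fun a v =>
    (algebraMap_smul K a v).symm
  have hspec : ∀ x y, algebraMap (𝓞 K) K (h x y).choose = B (f x) (f y) :=
    fun x y => (h x y).choose_spec
  { carrier := X
    torsionFree := ⟨fun {a x} hax => by
      have h1 : algebraMap (𝓞 K) K a • f x = 0 := by rw [← hs, ← map_smul, hax, map_zero]
      rcases smul_eq_zero.mp h1 with h2 | h2
      · exact Or.inl (hinj (by rw [h2, map_zero]))
      · exact Or.inr (hf (by rw [h2, map_zero]))⟩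
    form := LinearMap.mk₂ (𝓞 K) (fun x y => (h x y).choose)
      (fun x y z => hinj ((hspec _ _).trans (by
        rw [(algebraMap (𝓞 K) K).map_add, hspec, hspec, f.map_add, map_add, LinearMap.add_apply])))
      (fun a x y => hinj ((hspec _ _).trans (by
        rw [smul_eq_mul, (algebraMap (𝓞 K) K).map_mul, hspec, f.map_smul, hs, map_smul,
          LinearMap.smul_apply, smul_eq_mul])))
      (fun x y z => hinj ((hspec _ _).trans (by
        rw [(algebraMap (𝓞 K) K).map_add, hspec, hspec, f.map_add, map_add])))
      (fun a x y => hinj ((hspec _ _).trans (by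
        rw [smul_eq_mul, (algebraMap (𝓞 K) K).map_mul, hspec, f.map_smul, hs, map_smul,
          smul_eq_mul])))
    symm := fun x y => hinj (by simp only [LinearMap.mk₂_apply, hspec, hB.symm (f x)])
    posDef := fun v hv σ => by
      simp only [LinearMap.mk₂_apply, hspec]
      exact hB.pos (f v) (fun h => hv (hf (by rw [h, map_zero]))) σ }

theorem OKLattice.ofMap_form {V X : Type} [AddCommGroup V] [Module K V] [Module (𝓞 K) V]
    [IsScalarTower (𝓞 K) K V] [AddCommGroup X] [Module (𝓞 K) X] [Module.Finite (𝓞 K) X]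
    {B : LinearMap.BilinForm K V} (hB : IsPD B) (f : X →ₗ[𝓞 K] V) (hf : Function.Injective f)
    (h : ∀ x y, ∃ a : 𝓞 K, algebraMap (𝓞 K) K a = B (f x) (f y)) (x y : X) :
    algebraMap (𝓞 K) K ((OKLattice.ofMap hB f hf h).form x y) = B (f x) (f y) :=
  (h x y).choose_spec

end Spaces

section Maximal

variable {K : Type} [Field K] [NumberField K]

theorem finrank_le_of_injective {V X : Type*} [AddCommGroup V] [Module K V] [Module (𝓞 K) V]
    [IsScalarTower (𝓞 K) K V] [Module.Finite K V] [AddCommGroup X] [Module (𝓞 K) X]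
    [Module.Finite (𝓞 K) X] (f : X →ₗ[𝓞 K] V) (hf : Function.Injective f) :
    Module.finrank (𝓞 K) X ≤ Module.finrank K V := by
  obtain ⟨e, he⟩ := exists_linearIndependent_of_le_finrank (R := 𝓞 K) (M := X) le_rfl
  have h1 : LinearIndependent (𝓞 K) (f ∘ e) := he.map' f (LinearMap.ker_eq_bot.mpr hf)
  have h2 : LinearIndependent K (f ∘ e) := (LinearIndependent.iff_fractionRing (𝓞 K) K).mp h1
  simpa using h2.fintype_card_le_finrank

/-- A form is integral on a submodule. -/
def IntegralOn {V : Type*} [AddCommGroup V] [Module K V] [Module (𝓞 K) V]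
    (B : LinearMap.BilinForm K V) (M : Submodule (𝓞 K) V) : Prop :=
  ∀ x ∈ M, ∀ y ∈ M, ∃ a : 𝓞 K, algebraMap (𝓞 K) K a = B x y

variable {r : ℕ} {B : LinearMap.BilinForm K (Fin r → K)}

theorem exists_scale (B : LinearMap.BilinForm K (Fin r → K)) : ∃ b : 𝓞 K, b ≠ 0 ∧
    ∀ i j, ∃ a : 𝓞 K, algebraMap (𝓞 K) K a
      = B (algebraMap (𝓞 K) K b • Pi.single i 1) (algebraMap (𝓞 K) K b • Pi.single j 1) := by
  obtain ⟨b, hb⟩ := IsLocalization.exist_integer_multiples_of_finite (nonZeroDivisors (𝓞 K))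
    (fun p : Fin r × Fin r => B (Pi.single p.1 1) (Pi.single p.2 1))
  refine ⟨b, nonZeroDivisors.coe_ne_zero b, fun i j => ?_⟩
  obtain ⟨a, ha⟩ := hb (i, j)
  refine ⟨b * a, ?_⟩
  rw [map_mul, ha, map_smul, map_smul, LinearMap.smul_apply, smul_eq_mul, smul_eq_mul,
    Algebra.smul_def]

theorem integral_span {V : Type*} [AddCommGroup V] [Module K V] [Module (𝓞 K) V]
    [IsScalarTower (𝓞 K) K V] (B : LinearMap.BilinForm K V) (S : Set V) {y : V}
    (h : ∀ x ∈ S, ∃ a : 𝓞 K, algebraMap (𝓞 K) K a = B x y) :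
    ∀ x ∈ Submodule.span (𝓞 K) S, ∃ a : 𝓞 K, algebraMap (𝓞 K) K a = B x y := by
  intro x hx
  induction hx using Submodule.span_induction with
  | mem x hx => exact h x hx
  | zero => exact ⟨0, by simp⟩
  | add x z _ _ hx hz =>
    obtain ⟨a, ha⟩ := hx
    obtain ⟨b, hb⟩ := hz
    exact ⟨a + b, by rw [map_add, ha, hb, map_add, LinearMap.add_apply]⟩
  | smul c x _ hx =>
    obtain ⟨a, ha⟩ := hx
    exact ⟨c * a, by
      rw [map_mul, ha, ← algebraMap_smul K c x, map_smul, LinearMap.smul_apply, smul_eq_mul]⟩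

theorem exists_sum_inverse (P : Ideal (𝓞 K)) (hP : P ≠ ⊥) {V : Type*} [AddCommGroup V]
    [Module K V] [Module (𝓞 K) V] [IsScalarTower (𝓞 K) K V] (N : Submodule (𝓞 K) V) (x : V)
    (hx : x ∈ N)
    (h : ∀ c : K, (∀ p ∈ P, ∃ a : 𝓞 K, algebraMap (𝓞 K) K a = c * algebraMap (𝓞 K) K p) →
      c • x ∈ N) : (⟨x, hx⟩ : N) ∈ (P • ⊤ : Submodule (𝓞 K) N) := by
  have key : ∀ z ∈ (P : FractionalIdeal (nonZeroDivisors (𝓞 K)) K) *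
      (P : FractionalIdeal (nonZeroDivisors (𝓞 K)) K)⁻¹,
      ∃ w ∈ (P • ⊤ : Submodule (𝓞 K) N), (w : V) = z • x := by
    intro z hz
    refine FractionalIdeal.mul_induction_on hz (fun i hi j hj => ?_) fun z w hz hw => ?_
    · obtain ⟨p, hp, rfl⟩ := (FractionalIdeal.mem_coeIdeal _).mp hi
      have hj' : j • x ∈ N := h j fun q hq => by
        have := (FractionalIdeal.mem_inv_iff (FractionalIdeal.coeIdeal_ne_zero.mpr hP)).mp hj _
          (FractionalIdeal.mem_coeIdeal_of_mem (nonZeroDivisors (𝓞 K)) hq)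
        exact (FractionalIdeal.mem_one_iff _).mp this
      refine ⟨p • ⟨j • x, hj'⟩, Submodule.smul_mem_smul hp trivial, ?_⟩
      show p • (j • x) = _
      rw [mul_smul, algebraMap_smul]
    · obtain ⟨u, hu, huz⟩ := hz
      obtain ⟨v, hv, hvw⟩ := hw
      exact ⟨u + v, Submodule.add_mem _ hu hv, by rw [add_smul, ← huz, ← hvw]; rfl⟩
  obtain ⟨w, hw, hwx⟩ := key 1 (by
    rw [mul_inv_cancel₀ (FractionalIdeal.coeIdeal_ne_zero.mpr hP)]
    exact FractionalIdeal.one_mem_one _)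
  rw [one_smul] at hwx
  rwa [← show w = ⟨x, hx⟩ from Subtype.ext hwx]

variable [htr : Fact (TotallyReal K)]

theorem IsPD.eq_zero {V : Type*} [AddCommGroup V] [Module K V] {B : LinearMap.BilinForm K V}
    (hB : IsPD B) {x : V} (h : B x x = 0) : x = 0 := by
  by_contra h0
  obtain ⟨σ⟩ := nonempty_emb (K := K)
  have := hB.pos x h0 σ
  rw [h, map_zero] at this
  exact this.ne rfl

theorem IsPD.exists_isMax (hB : IsPD B) : ∃ L : OKLattice K, L.rank = r ∧ L.IsMax ∧
    ∃ f : L.carrier →ₗ[𝓞 K] (Fin r → K), ∀ x y,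
      algebraMap (𝓞 K) K (L.form x y) = B (f x) (f y) := by
  classical
  obtain ⟨b, hb, hbB⟩ := exists_scale B
  have hb' : algebraMap (𝓞 K) K b ≠ 0 := by
    rw [Ne, RingOfIntegers.coe_eq_zero_iff]; exact hb
  set e : Fin r → Fin r → K := fun i => algebraMap (𝓞 K) K b • Pi.single i 1 with he
  set M₀ := Submodule.span (𝓞 K) (Set.range e) with hM₀
  have hM₀i : IntegralOn B M₀ := by
    intro x hx y hy
    refine integral_span B _ (fun z hz => ?_) x hx
    obtain ⟨i, rfl⟩ := hz
    obtain ⟨a, ha⟩ := integral_span B (Set.range e) (y := e i) (fun z hz => by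
      obtain ⟨j, rfl⟩ := hz
      exact hbB j i) y hy
    exact ⟨a, by rw [ha, hB.symm]⟩
  obtain ⟨N, hN₀, hN⟩ := zorn_le_nonempty₀ {M | IntegralOn B M} (fun c hc hch M hM => by
    refine ⟨sSup c, ?_, fun z hz => le_sSup hz⟩
    intro x hx y hy
    have hd := hch.directedOn
    rw [Submodule.mem_sSup_of_directed ⟨M, hM⟩ hd] at hx hy
    obtain ⟨X, hX, hx⟩ := hx
    obtain ⟨Y, hY, hy⟩ := hy
    obtain ⟨Z, hZ, hXZ, hYZ⟩ := hd X hX Y hY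
    exact hc hZ x (hXZ hx) y (hYZ hy)) M₀ hM₀i
  have hNi : IntegralOn B N := hN.prop
  have heN : ∀ i, e i ∈ N := fun i => hN₀ (Submodule.subset_span ⟨i, rfl⟩)
  choose φ hφ using fun (x : N) (i : Fin r) => hNi x x.2 (e i) (heN i)
  have hinj : Function.Injective (algebraMap (𝓞 K) K) := RingOfIntegers.coe_injective
  have hs : ∀ (a : 𝓞 K) (v : Fin r → K), a • v = algebraMap (𝓞 K) K a • v := fun a v =>
    (algebraMap_smul K a v).symm
  let Φ : N →ₗ[𝓞 K] (Fin r → 𝓞 K) :=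
    { toFun := φ
      map_add' := fun x y => funext fun i => hinj (by
        rw [hφ, Pi.add_apply, map_add, hφ, hφ, Submodule.coe_add, map_add, LinearMap.add_apply])
      map_smul' := fun a x => funext fun i => hinj (by
        rw [hφ, RingHom.id_apply, Pi.smul_apply, smul_eq_mul, map_mul, hφ, Submodule.coe_smul, hs,
          (B).map_smul, LinearMap.smul_apply, smul_eq_mul]) }
  have hBe : ∀ x : Fin r → K, (∀ i, B x (e i) = 0) → x = 0 := by
    intro x hx
    refine hB.eq_zero ?_
    have h1 : B x = 0 := (Pi.basisFun K (Fin r)).ext fun i => by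
      have h2 := hx i
      rw [he, map_smul, smul_eq_mul] at h2
      simpa [hb'] using h2
    rw [h1, LinearMap.zero_apply]
  have hΦ : Function.Injective Φ := by
    refine (injective_iff_map_eq_zero Φ).mpr fun x hx => Subtype.ext (hBe x fun i => ?_)
    rw [← hφ]
    show algebraMap (𝓞 K) K (Φ x i) = 0
    rw [hx, Pi.zero_apply, map_zero]
  have hfin : Module.Finite (𝓞 K) N := Module.Finite.of_injective Φ hΦ
  let L := OKLattice.ofMap (X := N) hB N.subtype N.injective_subtype fun x y => hNi x x.2 y y.2
  have hLf : ∀ x y : N, algebraMap (𝓞 K) K (L.form x y) = B x y := fun x y =>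
    OKLattice.ofMap_form hB N.subtype N.injective_subtype _ x y
  refine ⟨L, ?_, ?_, N.subtype, hLf⟩
  · rw [L.rank_eq_finrank]
    show Module.finrank (𝓞 K) N = r
    refine le_antisymm ?_ ?_
    · have := finrank_le_of_injective N.subtype N.injective_subtype
      simpa using this
    · have h1 : LinearIndependent K e := by
        have := (Pi.basisFun K (Fin r)).linearIndependent.units_smul
          (fun _ => Units.mk0 (algebraMap (𝓞 K) K b) hb')
        convert this using 1
        ext i j
        simp [he, Units.smul_def, Algebra.smul_def]
      have h2 : LinearIndependent (𝓞 K) e := h1.restrict_scalars' (𝓞 K)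
      have h3 : LinearIndependent (𝓞 K) (fun i => (⟨e i, heN i⟩ : N)) :=
        LinearIndependent.of_comp N.subtype h2
      simpa using h3.fintype_card_le_finrank
  · intro P hP (x : N) hx hxx
    have hx' : ∀ z ∈ N, ∃ a ∈ P, algebraMap (𝓞 K) K a = B x z := fun z hz =>
      ⟨_, hx ⟨z, hz⟩, hLf x ⟨z, hz⟩⟩
    let Q : Submodule (𝓞 K) K :=
      { carrier := {c | ∀ p ∈ P, ∃ a : 𝓞 K, algebraMap (𝓞 K) K a = c * algebraMap (𝓞 K) K p}
        add_mem' := fun {c c'} hc hc' p hp => by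
          obtain ⟨a, ha⟩ := hc p hp
          obtain ⟨a', ha'⟩ := hc' p hp
          exact ⟨a + a', by rw [map_add, ha, ha', add_mul]⟩
        zero_mem' := fun p hp => ⟨0, by rw [map_zero, zero_mul]⟩
        smul_mem' := fun s c hc p hp => by
          obtain ⟨a, ha⟩ := hc p hp
          exact ⟨s * a, by rw [map_mul, ha, Algebra.smul_def, mul_assoc]⟩ }
    let N' : Submodule (𝓞 K) (Fin r → K) :=
      N ⊔ Q.map ((LinearMap.toSpanSingleton K (Fin r → K) (x : Fin r → K)).restrictScalars (𝓞 K))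
    have hQ2 : ∀ c ∈ Q, ∀ c' ∈ Q, ∀ p ∈ P ^ 2,
        ∃ a : 𝓞 K, algebraMap (𝓞 K) K a = c * c' * algebraMap (𝓞 K) K p := by
      intro c hc c' hc' p hp
      rw [sq] at hp
      refine Submodule.mul_induction_on hp (fun m hm n hn => ?_) fun m n hm hn => ?_
      · obtain ⟨a, ha⟩ := hc m hm
        obtain ⟨a', ha'⟩ := hc' n hn
        exact ⟨a * a', by rw [map_mul, ha, ha', map_mul]; ring⟩
      · obtain ⟨a, ha⟩ := hm
        obtain ⟨a', ha'⟩ := hn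
        exact ⟨a + a', by rw [map_add, ha, ha', map_add]; ring⟩
    have hN'i : IntegralOn B N' := by
      intro u hu v hv
      obtain ⟨y, hy, _, ⟨c, hc, rfl⟩, rfl⟩ := Submodule.mem_sup.mp hu
      obtain ⟨y', hy', _, ⟨c', hc', rfl⟩, rfl⟩ := Submodule.mem_sup.mp hv
      obtain ⟨a₁, h₁⟩ := hNi y hy y' hy'
      obtain ⟨p₂, hp₂, h₂⟩ := hx' y hy
      obtain ⟨p₃, hp₃, h₃⟩ := hx' y' hy'
      obtain ⟨a₂, h₂'⟩ := hc' p₂ hp₂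
      obtain ⟨a₃, h₃'⟩ := hc p₃ hp₃
      obtain ⟨a₄, h₄⟩ := hQ2 c hc c' hc' _ hxx
      refine ⟨a₁ + a₂ + a₃ + a₄, ?_⟩
      rw [map_add, map_add, map_add, h₁, h₂', h₃', h₄, h₂, h₃, hLf x x, hB.symm _ y]
      simp only [LinearMap.coe_restrictScalars, LinearMap.toSpanSingleton_apply, map_add,
        LinearMap.add_apply, map_smul, LinearMap.smul_apply, smul_eq_mul]
      ring
    have hN' : N' ≤ N := hN.le_of_ge hN'i le_sup_left
    exact exists_sum_inverse P hP.ne_zero N x x.2 fun c hc =>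
      hN' (Submodule.mem_sup_right ⟨c, hc, rfl⟩)

end Maximal

theorem Finset.exists_lt_card_filter {β ι : Type*} [DecidableEq β] [Fintype ι] (S : Finset β)
    (V : ι → Finset β) (hV : ∀ i, V i ⊆ S) (q : ℕ) (h : q * S.card < ∑ i, (V i).card) :
    ∃ α ∈ S, q < (Finset.univ.filter fun i => α ∈ V i).card := by
  classical
  by_contra! hc
  have h1 : ∑ i, (V i).card = ∑ α ∈ S, (Finset.univ.filter fun i => α ∈ V i).card := by
    have := Finset.sum_card_bipartiteAbove_eq_sum_card_bipartiteBelow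
      (s := (Finset.univ : Finset ι)) (t := S) (fun i α => α ∈ V i)
    rw [← show _ = ∑ α ∈ S, (Finset.univ.filter fun i => α ∈ V i).card from this]
    refine Finset.sum_congr rfl fun i _ => ?_
    congr 1
    ext α
    simpa [Finset.bipartiteAbove] using fun hα => hV i hα
  have h2 := Finset.sum_le_sum hc
  rw [Finset.sum_const, smul_eq_mul, mul_comm] at h2
  omega

section Waring

variable (K : Type) [Field K] [NumberField K] [htr : Fact (TotallyReal K)]

theorem exists_repr_one : ∃ c : ℕ, ∀ (V : Type) [AddCommGroup V] [Module K V] [Module.Finite K V]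
    (B : LinearMap.BilinForm K V), IsPD B → c ≤ Module.finrank K V → ∃ v, B v v = 1 := by
  classical
  set d := Module.finrank ℚ K with hd
  have hd0 : 0 < d := Module.finrank_pos
  obtain ⟨A, hA0, hA⟩ := OKLattice.card_values_ge K (r := 2 * d + 8) le_rfl
  set r := 2 * d + 8 with hr
  obtain ⟨s, hs⟩ := exists_nat_gt (2 * (A + 1) * ((4 * d : ℕ) * 2 ^ d))
  refine ⟨s * r, fun V _ _ _ B hB hV => ?_⟩
  obtain ⟨b, hb⟩ := LinearMap.BilinForm.exists_orthogonal_basis (K := K) (B := B)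
    ⟨fun x y => hB.symm x y⟩
  let ix : Fin s × Fin r → Fin (Module.finrank K V) := fun p => Fin.castLE hV (finProdFinEquiv p)
  have hix : Function.Injective ix := (Fin.castLE_injective hV).comp finProdFinEquiv.injective
  let F : Fin s → (Fin r → K) →ₗ[K] V := fun i => Fintype.linearCombination K fun k => b (ix (i, k))
  have hF : ∀ i, Function.Injective (F i) := fun i =>
    linearIndependent_iff_injective_fintypeLinearCombination.mp
      (b.linearIndependent.comp _ fun k l h => by simpa using hix h)
  have horth : ∀ i j, i ≠ j → ∀ x y, B (F i x) (F j y) = 0 := by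
    intro i j hij x y
    simp only [F, Fintype.linearCombination_apply, map_sum, LinearMap.sum_apply, map_smul,
      LinearMap.smul_apply, smul_eq_mul]
    refine Finset.sum_eq_zero fun k _ => ?_
    refine mul_eq_zero_of_right _ (Finset.sum_eq_zero fun l _ => ?_)
    rw [show B (b (ix (i, l))) (b (ix (j, k))) = 0 from
      hb fun h => hij (by simpa using congrArg Prod.fst (hix h))]
    simp
  choose L hLr hLm f hf using fun i => (hB.comp (F i) (hF i)).exists_isMax
  choose θ₀ hθ₀ using fun i => hA (L i) (by have := (hLm i).good; rwa [hLr i] at this)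
  obtain ⟨θ₁, hθ₁⟩ := exists_nat_ge (2 * (A + 1))
  set θ := θ₁ + ∑ i, θ₀ i with hθ
  have hθi : ∀ i, θ₀ i ≤ θ := fun i =>
    (Finset.single_le_sum (fun _ _ => Nat.zero_le _) (Finset.mem_univ i)).trans
      (Nat.le_add_left _ _)
  have hθ1 : (2 * (A + 1) : ℝ) ≤ θ := by
    refine hθ₁.trans ?_
    exact_mod_cast Nat.le_add_right _ _
  have hθ1' : (1 : ℝ) ≤ θ := by linarith
  set X : ℝ := (θ : ℝ) ^ (12 * d) with hX
  have hX1 : (2 * (A + 1) : ℝ) ≤ X :=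
    hθ1.trans (le_self_pow₀ hθ1' (by omega))
  let Vf : Fin s → Finset (𝓞 K) := fun i =>
    ((L i).cube ((θ : ℝ) ^ 6)).image fun x => (L i).form x x
  have hVf : ∀ i, X ≤ (A + 1) * (Vf i).card := fun i => by
    refine (hθ₀ i θ (hθi i)).trans ?_
    exact mul_le_mul_of_nonneg_right (by linarith) (Nat.cast_nonneg _)
  let S : Set (𝓞 K) := {α | ∀ σ : K →+* ℝ, 0 ≤ ov σ α ∧ ov σ α ≤ (θ : ℝ) ^ 12}
  obtain ⟨hSf, hSc⟩ := finite_of_diff_lt S (a := 2 * θ ^ 12) fun x hx y hy σ => by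
    have h1 : (1 : ℝ) ≤ (θ : ℝ) ^ 12 := one_le_pow₀ hθ1'
    rw [map_sub, abs_lt]
    push_cast
    constructor <;> linarith [(hx σ).1, (hx σ).2, (hy σ).1, (hy σ).2]
  have hVS : ∀ i, (Vf i).erase 0 ⊆ hSf.toFinset.erase 0 := fun i => by
    refine Finset.erase_subset_erase 0 fun α hα => ?_
    obtain ⟨x, hx, rfl⟩ := Finset.mem_image.mp hα
    rw [Set.Finite.mem_toFinset]
    intro σ
    refine ⟨(L i).q_nonneg σ x, ?_⟩
    have h1 := (L i).mem_box.mp hx σ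
    have h2 : (L i).q σ x ≤ (θ : ℝ) ^ 12 := by
      rw [← (L i).nrm_sq]
      calc (L i).nrm σ x ^ 2 ≤ ((θ : ℝ) ^ 6) ^ 2 :=
            pow_le_pow_left₀ (Real.sqrt_nonneg _) h1 2
        _ = _ := by ring
    exact h2
  have hS' : ((hSf.toFinset.erase 0).card : ℝ) ≤ 2 ^ d * X := by
    have h1 : (hSf.toFinset.erase 0).card ≤ (2 * θ ^ 12) ^ d := by
      refine (Finset.card_le_card (Finset.erase_subset _ _)).trans ?_
      rw [← Set.ncard_eq_toFinset_card S hSf]; exact hSc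
    refine (Nat.cast_le.mpr h1).trans (le_of_eq ?_)
    push_cast
    rw [mul_pow, ← pow_mul, hX]
  obtain ⟨α, hαS, hα⟩ := Finset.exists_lt_card_filter (hSf.toFinset.erase 0) _ hVS (4 * d) (by
    rw [← Nat.cast_lt (α := ℝ)]
    push_cast
    have h1 : ∀ i, X / (A + 1) - 1 ≤ ((Vf i).erase 0).card := fun i => by
      have h2 : (Vf i).card ≤ ((Vf i).erase 0).card + 1 := by
        have := Finset.pred_card_le_card_erase (s := Vf i) (a := 0)
        omega
      have h3 : ((Vf i).card : ℝ) ≤ ((Vf i).erase 0).card + 1 := by exact_mod_cast h2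
      have h4 : X / (A + 1) ≤ (Vf i).card := by
        rw [div_le_iff₀ (by linarith), mul_comm]; exact hVf i
      linarith
    have h5 : (s : ℝ) * (X / (A + 1) - 1) ≤ ∑ i, (((Vf i).erase 0).card : ℝ) := by
      calc (s : ℝ) * (X / (A + 1) - 1) = ∑ i : Fin s, (X / (A + 1) - 1) := by
            rw [Finset.sum_const, Finset.card_univ, Fintype.card_fin, nsmul_eq_mul]
        _ ≤ _ := Finset.sum_le_sum fun i _ => h1 i
    refine lt_of_lt_of_le ?_ h5
    have h6 : X / (2 * (A + 1)) ≤ X / (A + 1) - 1 := by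
      have : 1 ≤ X / (2 * (A + 1)) := by rw [le_div_iff₀ (by linarith)]; linarith
      have h7 : X / (A + 1) = 2 * (X / (2 * (A + 1))) := by
        field_simp
      linarith
    have hX0 : 0 < X := by linarith
    have hA1 : 0 < 2 * (A + 1) := by linarith
    calc 4 * (d : ℝ) * ((hSf.toFinset.erase 0).card : ℝ) ≤ 4 * d * (2 ^ d * X) :=
          mul_le_mul_of_nonneg_left hS' (by positivity)
      _ = (2 * (A + 1) * ((4 * d : ℕ) * 2 ^ d)) * (X / (2 * (A + 1))) := by
          push_cast; field_simp
      _ < s * (X / (2 * (A + 1))) := mul_lt_mul_of_pos_right hs (by positivity)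
      _ ≤ _ := mul_le_mul_of_nonneg_left h6 (Nat.cast_nonneg _))
  have hα0 : α ≠ 0 := Finset.ne_of_mem_erase hαS
  have hαpos : ∀ σ : K →+* ℝ, 0 < σ (algebraMap (𝓞 K) K α)⁻¹ := fun σ => by
    rw [map_inv₀, inv_pos]
    have h1 := ((hSf.mem_toFinset.mp (Finset.mem_of_mem_erase hαS)) σ).1
    exact lt_of_le_of_ne h1 fun h => hα0 ((ov_eq_zero σ).mp h.symm)
  obtain ⟨z, hz⟩ := exists_sum_sq hαpos
  obtain ⟨T, hT, hTc⟩ := Finset.exists_subset_card_eq hα.le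
  let g : Fin (4 * d) → Fin s := fun k => (T.equivFinOfCardEq hTc).symm k
  have hg : Function.Injective g := Subtype.val_injective.comp (Equiv.injective _)
  have hgx : ∀ k, ∃ x, (L (g k)).form x x = α := fun k => by
    have h1 := hT ((T.equivFinOfCardEq hTc).symm k).2
    have h2 := Finset.mem_of_mem_erase (Finset.mem_filter.mp h1).2
    obtain ⟨x, -, hx⟩ := Finset.mem_image.mp h2
    exact ⟨x, hx⟩
  choose x hx using hgx
  refine ⟨∑ k, z k • F (g k) (f (g k) (x k)), ?_⟩
  simp only [map_sum, LinearMap.sum_apply, map_smul, LinearMap.smul_apply, smul_eq_mul]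
  rw [Finset.sum_congr rfl fun k _ => ?_, ← Finset.sum_mul, hz, inv_mul_cancel₀]
  · rwa [Ne, RingOfIntegers.coe_eq_zero_iff]
  rw [Finset.sum_eq_single k]
  · have h1 := hf (g k) (x k) (x k)
    rw [hx] at h1
    rw [h1, LinearMap.BilinForm.comp_apply]
    ring
  · intro l _ hl
    rw [horth _ _ (fun h => hl (hg h))]
    simp
  · simp

/-- A space embeds isometrically in a sum of squares. -/
def EmbedsIn {V : Type} [AddCommGroup V] [Module K V] (B : LinearMap.BilinForm K V) (m : ℕ) :
    Prop := ∃ φ : V →ₗ[K] (Fin m → K), ∀ x y, φ x ⬝ᵥ φ y = B x y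

variable {K} in
theorem EmbedsIn.mono {V : Type} [AddCommGroup V] [Module K V] {B : LinearMap.BilinForm K V}
    {m m' : ℕ} (h : EmbedsIn K B m) (hm : m ≤ m') : EmbedsIn K B m' := by
  obtain ⟨k, rfl⟩ := Nat.exists_eq_add_of_le hm
  obtain ⟨φ, hφ⟩ := h
  refine ⟨LinearMap.pi fun i => Fin.addCases (fun j => LinearMap.proj j ∘ₗ φ) (fun _ => 0) i,
    fun x y => ?_⟩
  rw [← hφ, dotProduct, Fin.sum_univ_add]
  simp [dotProduct]

theorem exists_embedsIn : ∃ c : ℕ, ∀ (n : ℕ) (V : Type) [AddCommGroup V] [Module K V]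
    [Module.Finite K V] (B : LinearMap.BilinForm K V), IsPD B → Module.finrank K V = n →
    EmbedsIn K B (n + c) := by
  classical
  set d := Module.finrank ℚ K with hd
  obtain ⟨c₀, hc₀⟩ := exists_repr_one K
  refine ⟨c₀ * (4 * d), fun n => ?_⟩
  induction n with
  | zero =>
    intro V _ _ _ B hB hV
    have := Module.finrank_zero_iff.mp hV
    refine ⟨0, fun x y => ?_⟩
    rw [Subsingleton.elim x 0]; simp
  | succ n ih =>
    intro V _ _ _ B hB hV
    by_cases hn : c₀ ≤ n + 1
    · obtain ⟨v, hv⟩ := hc₀ V B hB (hV ▸ hn)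
      have hv0 : v ≠ 0 := by rintro rfl; simp at hv
      let W := LinearMap.ker (B v)
      have hW : Module.finrank K W = n := by
        have h1 := (B v).finrank_range_add_finrank_ker
        have h2 : LinearMap.range (B v) = ⊤ := LinearMap.range_eq_top.mpr fun a =>
          ⟨a • v, by rw [map_smul, hv, smul_eq_mul, mul_one]⟩
        rw [h2, finrank_top, Module.finrank_self, hV] at h1
        show Module.finrank K (LinearMap.ker (B v)) = n
        omega
      obtain ⟨φ, hφ⟩ := ih W (B.comp W.subtype W.subtype)
        (hB.comp W.subtype W.injective_subtype) hW
      let p : V →ₗ[K] W := (LinearMap.id - (B v).smulRight v).codRestrict W fun x => by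
        show B v (x - B v x • v) = 0
        rw [map_sub, map_smul, hv, smul_eq_mul, mul_one, sub_self]
      have hp : ∀ x, ((p x : W) : V) = x - B v x • v := fun x => rfl
      have key : EmbedsIn K B (n + c₀ * (4 * d) + 1) := by
        refine ⟨LinearMap.pi fun i => Fin.cases (B v) (fun j => LinearMap.proj j ∘ₗ φ ∘ₗ p) i,
          fun x y => ?_⟩
        rw [dotProduct, Fin.sum_univ_succ]
        have h1 := hφ (p x) (p y)
        rw [dotProduct] at h1
        simp only [LinearMap.pi_apply, Fin.cases_zero, Fin.cases_succ, LinearMap.comp_apply,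
          LinearMap.proj_apply]
        rw [h1, LinearMap.BilinForm.comp_apply, Submodule.subtype_apply, Submodule.subtype_apply,
          hp, hp]
        simp only [map_sub, map_smul, LinearMap.sub_apply, LinearMap.smul_apply, smul_eq_mul, hv,
          hB.symm x v]
        ring
      exact key.mono (by omega)
    · push Not at hn
      obtain ⟨b, hb⟩ := LinearMap.BilinForm.exists_orthogonal_basis (K := K) (B := B)
        ⟨fun x y => hB.symm x y⟩
      choose z hz using fun i => exists_sum_sq (hB.pos (b i) (b.ne_zero i))
      have key : EmbedsIn K B (Module.finrank K V * (4 * d)) := by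
        refine ⟨LinearMap.pi fun k => z (finProdFinEquiv.symm k).1 (finProdFinEquiv.symm k).2 •
          b.coord (finProdFinEquiv.symm k).1, fun x y => ?_⟩
        rw [dotProduct, ← finProdFinEquiv.sum_comp, Fintype.sum_prod_type]
        have h1 : B x y = ∑ i, B (b i) (b i) * (b.repr x i * b.repr y i) := by
          conv_lhs => rw [← b.sum_repr x, ← b.sum_repr y]
          simp only [map_sum, LinearMap.sum_apply, map_smul, LinearMap.smul_apply, smul_eq_mul]
          refine Finset.sum_congr rfl fun i _ => ?_
          rw [Finset.sum_eq_single i]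
          · ring
          · intro j _ hj
            rw [show B (b j) (b i) = 0 from hb hj]; simp
          · simp
        rw [h1]
        refine Finset.sum_congr rfl fun i _ => ?_
        rw [← hz i, Finset.sum_mul]
        refine Finset.sum_congr rfl fun j _ => ?_
        simp only [LinearMap.pi_apply, Equiv.symm_apply_apply, LinearMap.smul_apply,
          Module.Basis.coord_apply, smul_eq_mul]
        ring
      refine key.mono ?_
      rw [hV]
      exact (Nat.mul_le_mul_right _ hn.le).trans (Nat.le_add_left _ _)

end Waring

section Dual

variable {K : Type} [Field K] [NumberField K] {m : ℕ}

/-- The integers of `K` as a submodule. -/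
abbrev intK (K : Type) [Field K] : Submodule (𝓞 K) K := LinearMap.range (Algebra.linearMap (𝓞 K) K)

theorem dot_smul_left (a : 𝓞 K) (x y : Fin m → K) : (a • x) ⬝ᵥ y = a • (x ⬝ᵥ y) := by
  simp [dotProduct, Finset.mul_sum, Algebra.smul_def, mul_assoc]

/-- The dual of a module with respect to the dot product. -/
def dotDual (P : Submodule (𝓞 K) (Fin m → K)) : Submodule (𝓞 K) (Fin m → K) where
  carrier := {x | ∀ y ∈ P, x ⬝ᵥ y ∈ intK K}
  add_mem' hx hx' y hy := by
    rw [add_dotProduct]; exact add_mem (hx y hy) (hx' y hy)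
  zero_mem' y _ := by rw [zero_dotProduct]; exact zero_mem _
  smul_mem' a x hx y hy := by
    rw [dot_smul_left]; exact Submodule.smul_mem _ _ (hx y hy)

/-- The standard lattice. -/
def stdLat (K : Type) [Field K] (m : ℕ) : Submodule (𝓞 K) (Fin m → K) :=
  Submodule.pi Set.univ fun _ => intK K

theorem mem_stdLat {x : Fin m → K} : x ∈ stdLat K m ↔ ∀ i, x i ∈ intK K := by
  simp [stdLat, Submodule.mem_pi]

theorem single_mem_stdLat (i : Fin m) : (Pi.single i 1 : Fin m → K) ∈ stdLat K m := by
  classical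
  refine mem_stdLat.mpr fun j => ?_
  obtain rfl | h := eq_or_ne j i
  · exact ⟨1, by simp⟩
  · exact ⟨0, by simp [Pi.single_eq_of_ne h]⟩

theorem mul_mem_intK {x y : K} (hx : x ∈ intK K) (hy : y ∈ intK K) : x * y ∈ intK K := by
  obtain ⟨a, rfl⟩ := hx
  obtain ⟨b, rfl⟩ := hy
  exact ⟨a * b, by simp⟩

theorem dotDual_stdLat : dotDual (stdLat K m) = stdLat K m := by
  classical
  ext x
  constructor
  · intro hx
    refine mem_stdLat.mpr fun i => ?_
    simpa using hx _ (single_mem_stdLat i)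
  · intro hx y hy
    exact sum_mem fun i _ => mul_mem_intK (mem_stdLat.mp hx i) (mem_stdLat.mp hy i)

theorem dotDual_sup (P Q : Submodule (𝓞 K) (Fin m → K)) :
    dotDual (P ⊔ Q) = dotDual P ⊓ dotDual Q := by
  ext x
  constructor
  · intro hx
    exact ⟨fun y hy => hx y (Submodule.mem_sup_left hy),
      fun y hy => hx y (Submodule.mem_sup_right hy)⟩
  · rintro ⟨h1, h2⟩ y hy
    obtain ⟨p, hp, q, hq, rfl⟩ := Submodule.mem_sup.mp hy
    rw [dotProduct_add]
    exact add_mem (h1 p hp) (h2 q hq)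

theorem stdLat_fg : (stdLat K m).FG := by
  let g : (Fin m → 𝓞 K) →ₗ[𝓞 K] (Fin m → K) :=
    LinearMap.pi fun i => Algebra.linearMap (𝓞 K) K ∘ₗ LinearMap.proj i
  have h : stdLat K m = LinearMap.range g := by
    ext x
    rw [mem_stdLat]
    constructor
    · intro h
      choose a ha using h
      exact ⟨a, funext fun i => ha i⟩
    · rintro ⟨a, rfl⟩ i
      exact ⟨a i, rfl⟩
  rw [h, LinearMap.range_eq_map]
  exact Submodule.FG.map g Module.Finite.fg_top

theorem exists_smul_mem_stdLat (x : Fin m → K) : ∃ b : 𝓞 K, b ≠ 0 ∧ b • x ∈ stdLat K m := by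
  obtain ⟨b, hb⟩ := IsLocalization.exist_integer_multiples_of_finite (nonZeroDivisors (𝓞 K)) x
  refine ⟨b, nonZeroDivisors.coe_ne_zero b, mem_stdLat.mpr fun i => ?_⟩
  obtain ⟨a, ha⟩ := hb i
  exact ⟨a, ha⟩

/-- A functional on a module of full rank is given by the dot product. -/
theorem exists_dot_eq (P : Submodule (𝓞 K) (Fin m → K)) {b : 𝓞 K} (hb : b ≠ 0)
    (hP : ∀ x ∈ stdLat K m, b • x ∈ P) (l : P →ₗ[𝓞 K] 𝓞 K) :
    ∃ y : Fin m → K, ∀ x : P, algebraMap (𝓞 K) K (l x) = (x : Fin m → K) ⬝ᵥ y := by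
  classical
  have hb' : algebraMap (𝓞 K) K b ≠ 0 := by
    rwa [Ne, RingOfIntegers.coe_eq_zero_iff]
  refine ⟨fun i => algebraMap (𝓞 K) K (l ⟨_, hP _ (single_mem_stdLat i)⟩) / algebraMap (𝓞 K) K b,
    fun x => ?_⟩
  obtain ⟨c, hc, hcx⟩ := exists_smul_mem_stdLat (x : Fin m → K)
  have hc' : algebraMap (𝓞 K) K c ≠ 0 := by
    rwa [Ne, RingOfIntegers.coe_eq_zero_iff]
  choose a ha using mem_stdLat.mp hcx
  have h1 : (b * c) • x = ∑ i, a i • (⟨_, hP _ (single_mem_stdLat i)⟩ : P) := by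
    apply Subtype.ext
    rw [AddSubmonoidClass.coe_finsetSum]
    ext j
    rw [Finset.sum_apply, Finset.sum_eq_single j]
    · have := ha j
      simp only [Algebra.linearMap_apply, Pi.smul_apply, Algebra.smul_def] at this
      simp only [Submodule.coe_smul, Pi.smul_apply, Algebra.smul_def, Pi.single_eq_same, this,
        map_mul]
      ring
    · intro i _ hi
      simp [Pi.single_eq_of_ne hi.symm]
    · simp
  have h2 := congrArg (fun z => algebraMap (𝓞 K) K (l z)) h1
  simp only [map_smul, map_sum, smul_eq_mul, map_mul] at h2
  have h3 : ∀ i, algebraMap (𝓞 K) K (a i) = algebraMap (𝓞 K) K c * (x : Fin m → K) i := fun i => by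
    have := ha i
    simpa [Algebra.smul_def] using this
  have h4 : algebraMap (𝓞 K) K b * algebraMap (𝓞 K) K c * algebraMap (𝓞 K) K (l x)
      = algebraMap (𝓞 K) K b * algebraMap (𝓞 K) K c * ((x : Fin m → K) ⬝ᵥ fun i =>
        algebraMap (𝓞 K) K (l ⟨_, hP _ (single_mem_stdLat i)⟩) / algebraMap (𝓞 K) K b) := by
    rw [h2, dotProduct, Finset.mul_sum]
    refine Finset.sum_congr rfl fun i _ => ?_
    rw [h3]
    field_simp
  exact mul_left_cancel₀ (mul_ne_zero hb' hc') h4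

theorem dotDual_dotDual {P : Submodule (𝓞 K) (Fin m → K)} (hP : P.FG) (hs : stdLat K m ≤ P) :
    dotDual (dotDual P) = P := by
  classical
  refine le_antisymm (fun z hz => ?_) fun x hx y hy => by
    rw [dotProduct_comm]; exact hy x hx
  have hfin : Module.Finite (𝓞 K) P := Module.Finite.iff_fg.mpr hP
  obtain ⟨k, g, hg⟩ := Module.Finite.exists_fin' (𝓞 K) P
  have hfp : Module.FinitePresentation (𝓞 K) P := Module.finitePresentation_of_finite _ _
  have hproj : Module.Projective (𝓞 K) P := Module.Flat.projective_of_finitePresentation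
  obtain ⟨s, hs'⟩ := Module.projective_lifting_property g LinearMap.id hg
  choose y hy using fun j => exists_dot_eq P one_ne_zero (fun x hx => by
    rw [one_smul]; exact hs hx) (LinearMap.proj j ∘ₗ s)
  have hyP : ∀ j, y j ∈ dotDual P := fun j x hx => by
    rw [dotProduct_comm]
    exact ⟨_, hy j ⟨x, hx⟩⟩
  have h1 : ∀ x : P, (x : Fin m → K) =
    ∑ j, ((x : Fin m → K) ⬝ᵥ y j) • (g (Pi.single j 1) : Fin m → K) := by
    intro x
    have h2 : x = ∑ j, (s x j) • g (Pi.single j 1) := by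
      conv_lhs => rw [← show g (s x) = x from LinearMap.congr_fun hs' x, pi_eq_sum_univ' (s x)]
      rw [map_sum]
      refine Finset.sum_congr rfl fun j _ => ?_
      rw [map_smul]
    conv_lhs => rw [h2]
    rw [AddSubmonoidClass.coe_finsetSum]
    refine Finset.sum_congr rfl fun j _ => ?_
    rw [← hy, algebraMap_smul]; rfl
  have h2 : ∀ x : Fin m → K, x = ∑ j, (x ⬝ᵥ y j) • (g (Pi.single j 1) : Fin m → K) := by
    intro x
    obtain ⟨c, hc, hcx⟩ := exists_smul_mem_stdLat x
    have h3 := h1 ⟨_, hs hcx⟩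
    simp only [dot_smul_left, smul_assoc, ← Finset.smul_sum] at h3
    exact smul_right_injective _ hc h3
  rw [h2 z]
  refine sum_mem fun j _ => ?_
  obtain ⟨a, ha⟩ := hz (y j) (hyP j)
  rw [← ha, Algebra.linearMap_apply, algebraMap_smul]
  exact P.smul_mem a (g _).2

theorem exists_selfDual {M : Submodule (𝓞 K) (Fin m → K)} (hM : M.FG) (hi : M ≤ dotDual M) :
    ∃ U : Submodule (𝓞 K) (Fin m → K), M ≤ U ∧ U.FG ∧ dotDual U = U ∧
      ∃ b : 𝓞 K, b ≠ 0 ∧ ∀ x ∈ stdLat K m, b • x ∈ U := by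
  have hstd : IsNoetherian (𝓞 K) (stdLat K m) := isNoetherian_of_fg_of_noetherian _ stdLat_fg
  refine ⟨M ⊔ (dotDual M ⊓ stdLat K m), le_sup_left, ?_, ?_, ?_⟩
  · refine hM.sup ?_
    have h := (IsNoetherian.noetherian (Submodule.comap (stdLat K m).subtype (dotDual M))).map
      (stdLat K m).subtype
    rwa [Submodule.map_comap_subtype, inf_comm] at h
  · rw [dotDual_sup]
    have h1 : dotDual M ⊓ stdLat K m = dotDual (M ⊔ stdLat K m) := by
      rw [dotDual_sup, dotDual_stdLat]
    conv_lhs => rw [h1]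
    rw [dotDual_dotDual (hM.sup stdLat_fg) le_sup_right]
    rw [inf_comm (dotDual M) (stdLat K m), ← sup_inf_assoc_of_le _ hi, inf_comm]
  · obtain ⟨S, hS⟩ := hM
    obtain ⟨b, hb⟩ := IsLocalization.exist_integer_multiples_of_finite (nonZeroDivisors (𝓞 K))
      (fun p : S × Fin m => (p.1 : Fin m → K) p.2)
    refine ⟨b, nonZeroDivisors.coe_ne_zero b, fun x hx => Submodule.mem_sup_right
      ⟨fun y hy => ?_, Submodule.smul_mem _ _ hx⟩⟩
    rw [← hS] at hy
    induction hy using Submodule.span_induction with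
    | mem y hy =>
      rw [dot_smul_left, dotProduct, Finset.smul_sum]
      refine sum_mem fun i _ => ?_
      obtain ⟨a, ha⟩ := hb (⟨y, hy⟩, i)
      rw [← mul_smul_comm]
      exact mul_mem_intK (mem_stdLat.mp hx i) ⟨a, ha⟩
    | zero => rw [dotProduct_zero]; exact zero_mem _
    | add y z _ _ hy hz => rw [dotProduct_add]; exact add_mem hy hz
    | smul a y _ hy =>
      rw [dotProduct_comm, dot_smul_left, dotProduct_comm]; exact Submodule.smul_mem _ _ hy

end Dual

namespace OKLattice

variable {K : Type} [Field K] [NumberField K] (L : OKLattice K)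

/-- Unimodularity: every functional is represented by a vector. -/
def IsUnimodular : Prop := ∀ l : L.carrier →ₗ[𝓞 K] 𝓞 K, ∃ y, ∀ x, l x = L.form x y

/-- The form on the ambient space. -/
def spaceForm : LinearMap.BilinForm K (K ⊗[𝓞 K] L.carrier) :=
  LinearMap.BilinForm.baseChange K L.form

theorem spaceForm_tmul (x y : L.carrier) :
    L.spaceForm (1 ⊗ₜ x) (1 ⊗ₜ y) = algebraMap (𝓞 K) K (L.form x y) := by
  rw [spaceForm, LinearMap.BilinForm.baseChange_tmul]
  simp [Algebra.smul_def]

theorem exists_smul_eq_tmul (v : K ⊗[𝓞 K] L.carrier) :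
    ∃ b : 𝓞 K, b ≠ 0 ∧ ∃ x : L.carrier, b • v = 1 ⊗ₜ x := by
  induction v using TensorProduct.induction_on with
  | zero => exact ⟨1, one_ne_zero, 0, by simp⟩
  | tmul c x =>
    obtain ⟨b, hb⟩ := IsLocalization.exists_integer_multiple (nonZeroDivisors (𝓞 K)) c
    obtain ⟨a, ha⟩ := hb
    refine ⟨b, nonZeroDivisors.coe_ne_zero b, a • x, ?_⟩
    rw [TensorProduct.smul_tmul', TensorProduct.tmul_smul, TensorProduct.smul_tmul', ← ha,
      Algebra.algebraMap_eq_smul_one]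
  | add v w hv hw =>
    obtain ⟨b, hb, x, hx⟩ := hv
    obtain ⟨c, hc, y, hy⟩ := hw
    refine ⟨b * c, mul_ne_zero hb hc, c • x + b • y, ?_⟩
    rw [smul_add, TensorProduct.tmul_add, TensorProduct.tmul_smul, TensorProduct.tmul_smul, ← hx,
      ← hy, smul_smul, smul_smul, mul_comm c b]

theorem isPD_spaceForm : IsPD L.spaceForm where
  symm v w := by
    obtain ⟨b, hb, x, hx⟩ := L.exists_smul_eq_tmul v
    obtain ⟨c, hc, y, hy⟩ := L.exists_smul_eq_tmul w
    have hb' : algebraMap (𝓞 K) K b ≠ 0 := by rwa [Ne, RingOfIntegers.coe_eq_zero_iff]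
    have hc' : algebraMap (𝓞 K) K c ≠ 0 := by rwa [Ne, RingOfIntegers.coe_eq_zero_iff]
    rw [← algebraMap_smul K] at hx hy
    have h1 := L.spaceForm_tmul x y
    have h2 := L.spaceForm_tmul y x
    rw [← hx, ← hy, map_smul, map_smul, LinearMap.smul_apply, smul_eq_mul, smul_eq_mul] at h1 h2
    rw [L.symm, ← h1] at h2
    have h3 : algebraMap (𝓞 K) K c * algebraMap (𝓞 K) K b * L.spaceForm w v
        = algebraMap (𝓞 K) K c * algebraMap (𝓞 K) K b * L.spaceForm v w := by
      linear_combination h2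
    exact (mul_left_cancel₀ (mul_ne_zero hc' hb') h3).symm
  pos v hv σ := by
    obtain ⟨b, hb, x, hx⟩ := L.exists_smul_eq_tmul v
    have hb' : algebraMap (𝓞 K) K b ≠ 0 := by rwa [Ne, RingOfIntegers.coe_eq_zero_iff]
    rw [← algebraMap_smul K] at hx
    have hx0 : x ≠ 0 := by
      rintro rfl
      rw [TensorProduct.tmul_zero] at hx
      exact (smul_ne_zero hb' hv) hx
    have h1 := L.spaceForm_tmul x x
    have h2 := L.posDef x hx0 σ
    have h3 : L.spaceForm (algebraMap (𝓞 K) K b • v) (algebraMap (𝓞 K) K b • v)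
        = algebraMap (𝓞 K) K b * algebraMap (𝓞 K) K b * L.spaceForm v v := by
      rw [map_smul, map_smul, LinearMap.smul_apply, smul_eq_mul, smul_eq_mul, mul_assoc]
    rw [← h1, ← hx, h3, map_mul, map_mul] at h2
    exact pos_of_mul_pos_right h2 (mul_self_nonneg _)

end OKLattice

section Unimodular

variable {K : Type} [Field K] [NumberField K]

/-- The dot product as a bilinear form. -/
def dotForm (K : Type) [Field K] (m : ℕ) : LinearMap.BilinForm K (Fin m → K) :=
  LinearMap.mk₂ K (fun x y => x ⬝ᵥ y) (fun x y z => add_dotProduct x y z)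
    (fun a x y => smul_dotProduct a x y) (fun x y z => dotProduct_add x y z)
    (fun a x y => dotProduct_smul a x y)

theorem dotForm_apply {m : ℕ} (x y : Fin m → K) : dotForm K m x y = x ⬝ᵥ y := rfl

theorem isPD_dotForm (m : ℕ) : IsPD (dotForm K m) where
  symm x y := dotProduct_comm x y
  pos v hv σ := by
    obtain ⟨i, hi⟩ := Function.ne_iff.mp hv
    rw [dotForm_apply, dotProduct, map_sum]
    refine Finset.sum_pos' (fun j _ => by rw [map_mul]; exact mul_self_nonneg _)
      ⟨i, Finset.mem_univ _, ?_⟩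
    rw [map_mul]
    exact mul_self_pos.mpr ((map_ne_zero σ).mpr hi)

variable (K) in
theorem exists_isUnimodular [htr : Fact (TotallyReal K)] : ∃ c : ℕ, ∀ L : OKLattice K,
    ∃ U : OKLattice K, U.rank = L.rank + c ∧ U.IsUnimodular ∧ U.Represents L := by
  classical
  obtain ⟨c, hc⟩ := exists_embedsIn K
  refine ⟨c, fun L => ?_⟩
  obtain ⟨m, hm⟩ : ∃ m, m = L.rank + c := ⟨_, rfl⟩
  have hE := hc L.rank (K ⊗[𝓞 K] L.carrier) L.spaceForm L.isPD_spaceForm rfl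
  rw [← hm] at hE ⊢
  obtain ⟨φ, hφ⟩ := hE
  let ι : L.carrier →ₗ[𝓞 K] (Fin m → K) :=
    (φ.restrictScalars (𝓞 K)) ∘ₗ (TensorProduct.mk (𝓞 K) K L.carrier 1)
  have hι : ∀ x y, ι x ⬝ᵥ ι y = algebraMap (𝓞 K) K (L.form x y) := fun x y => by
    rw [← L.spaceForm_tmul, ← hφ]; rfl
  obtain ⟨U, hMU, hUfg, hUU, b, hb, hbU⟩ := exists_selfDual (M := LinearMap.range ι)
    (by rw [LinearMap.range_eq_map]; exact Module.Finite.fg_top.map ι)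
    (by rintro _ ⟨x, rfl⟩ _ ⟨y, rfl⟩; exact ⟨_, (hι x y).symm⟩)
  have hfin : Module.Finite (𝓞 K) U := Module.Finite.iff_fg.mpr hUfg
  have hint : ∀ x y : U, ∃ a : 𝓞 K, algebraMap (𝓞 K) K a
      = dotForm K m (U.subtype x) (U.subtype y) := fun x y => by
    have hx : (x : Fin m → K) ∈ dotDual U := by rw [hUU]; exact x.2
    exact hx y y.2
  let W : OKLattice K := OKLattice.ofMap (isPD_dotForm m) U.subtype U.subtype_injective hint
  have hW : ∀ x y : U, algebraMap (𝓞 K) K (W.form x y) = (x : Fin m → K) ⬝ᵥ (y : Fin m → K) :=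
    fun x y => OKLattice.ofMap_form (isPD_dotForm m) U.subtype U.subtype_injective hint x y
  refine ⟨W, ?_, ?_, ?_⟩
  · rw [W.rank_eq_finrank]
    refine le_antisymm ?_ ?_
    · have := finrank_le_of_injective (K := K) U.subtype U.subtype_injective
      rw [Module.finrank_fin_fun] at this
      exact this
    · let j : (Fin m → 𝓞 K) →ₗ[𝓞 K] (Fin m → K) :=
        b • LinearMap.pi fun i => Algebra.linearMap (𝓞 K) K ∘ₗ LinearMap.proj i
      have hj : ∀ x, j x ∈ U := fun x => hbU _ (mem_stdLat.mpr fun i => ⟨x i, rfl⟩)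
      have hji : Function.Injective (j.codRestrict U hj) := by
        intro x y hxy
        have h1 : j x = j y := congrArg Subtype.val hxy
        ext i
        have h2 := congrFun h1 i
        have h3 : b • algebraMap (𝓞 K) K (x i) = b • algebraMap (𝓞 K) K (y i) := h2
        exact (smul_right_injective K hb) h3
      have := LinearMap.finrank_le_finrank_of_injective hji
      rw [Module.finrank_fin_fun] at this
      exact this
  · intro l
    obtain ⟨y, hy⟩ := exists_dot_eq U hb hbU l
    have hyU : y ∈ U := by
      rw [← hUU]
      intro x hx
      rw [dotProduct_comm]
      exact ⟨_, hy ⟨x, hx⟩⟩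
    exact ⟨⟨y, hyU⟩, fun x => RingOfIntegers.coe_injective
      ((hy x).trans (hW x ⟨y, hyU⟩).symm)⟩
  · refine ⟨ι.codRestrict U fun x => hMU ⟨x, rfl⟩, fun x => RingOfIntegers.coe_injective ?_⟩
    exact (hW _ _).trans (hι x x)

end Unimodular

section SmallVectors

variable (K : Type) [Field K] [NumberField K] [htr : Fact (TotallyReal K)]

/-- Many integers in a cube. -/
theorem exists_finset_ov_le : ∃ C : ℝ, 1 ≤ C ∧ ∀ N : ℕ, ∃ F : Finset (𝓞 K),
    F.card = N ^ Fintype.card (K →+* ℝ) ∧ ∀ x ∈ F, ∀ σ : K →+* ℝ, |ov σ x| ≤ C * N := by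
  classical
  obtain ⟨C, hC, h⟩ := exists_integer_approx K
  refine ⟨3 * C, by linarith, fun N => ?_⟩
  choose f hf using fun g : (K →+* ℝ) → Fin N => h fun σ => 3 * C * (g σ : ℕ)
  refine ⟨Finset.univ.image f, ?_, ?_⟩
  · rw [Finset.card_image_of_injective, Finset.card_univ, Fintype.card_fun, Fintype.card_fin]
    intro g g' hgg
    funext σ
    by_contra hne
    have h1 := hf g σ
    have h2 := hf g' σ
    rw [hgg] at h1
    have h3 : |3 * C * ((g' σ : ℕ) : ℝ) - 3 * C * ((g σ : ℕ) : ℝ)| ≤ 2 * C := by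
      rw [abs_le] at h1 h2 ⊢
      constructor <;> linarith [h1.1, h1.2, h2.1, h2.2]
    have h4 : (1 : ℝ) ≤ |((g' σ : ℕ) : ℝ) - ((g σ : ℕ) : ℝ)| := by
      have : (1 : ℤ) ≤ |((g' σ : ℕ) : ℤ) - ((g σ : ℕ) : ℤ)| := by
        apply Int.one_le_abs
        intro h0
        exact hne (Fin.ext (by omega))
      exact_mod_cast this
    rw [← mul_sub, abs_mul, abs_of_pos (by linarith)] at h3
    nlinarith
  · intro x hx σ
    obtain ⟨g, -, rfl⟩ := Finset.mem_image.mp hx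
    have h1 := abs_le.mp (hf g σ)
    have h2 : ((g σ : ℕ) : ℝ) + 1 ≤ N := by exact_mod_cast (g σ).2
    have h3 : (0 : ℝ) ≤ ((g σ : ℕ) : ℝ) := Nat.cast_nonneg _
    rw [abs_le]
    constructor <;> nlinarith

theorem exists_many_small : ∃ C : ℝ, 1 ≤ C ∧ ∀ (ι : Type) [Fintype ι] (o : ι → ℕ)
    (w : (K →+* ℝ) → ι → ℝ) (L : (K →+* ℝ) → ι → ι → ℝ) (ρ : ℝ), (∀ σ i, 0 < w σ i) →
    (∀ σ i j, L σ i j ≠ 0 → o j < o i) → 0 < ρ → ∃ X : Finset (ι → 𝓞 K),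
      ∏ σ : K →+* ℝ, ∏ i, (ρ / (C * w σ i)) ≤ X.card ∧ ∀ x ∈ X, ∀ σ i,
        w σ i * |ov σ (x i) + ∑ j, L σ i j * ov σ (x j)| ≤ ρ := by
  classical
  obtain ⟨C, hC, hF⟩ := exists_finset_ov_le K
  refine ⟨5 * C, by linarith, fun ι _ o w L ρ hw hL hρ => ?_⟩
  have hC0 : 0 < C := by linarith
  obtain ⟨Q, hQ⟩ := exists_nat_ge (1 + ∑ σ : K →+* ℝ, ∑ i, (∑ j, |L σ i j| + 2 * ρ / w σ i))
  have hQ1 : ∀ σ i, 1 + (∑ j, |L σ i j| + 2 * ρ / w σ i) ≤ (Q : ℝ) := by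
    intro σ i
    have h0 : ∀ σ i, 0 ≤ ∑ j, |L σ i j| + 2 * ρ / w σ i := fun σ i =>
      add_nonneg (Finset.sum_nonneg fun _ _ => abs_nonneg _)
        (div_nonneg (by linarith) (hw σ i).le)
    have h1 := Finset.single_le_sum (fun i _ => h0 σ i) (Finset.mem_univ i)
    have h2 := Finset.single_le_sum
      (f := fun σ : K →+* ℝ => ∑ i, (∑ j, |L σ i j| + 2 * ρ / w σ i))
      (fun σ _ => Finset.sum_nonneg fun i _ => h0 σ i) (Finset.mem_univ σ)
    linarith
  have hQ0 : (1 : ℝ) ≤ Q := le_trans (by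
    have : 0 ≤ ∑ σ : K →+* ℝ, ∑ i, (∑ j, |L σ i j| + 2 * ρ / w σ i) :=
      Finset.sum_nonneg fun σ _ => Finset.sum_nonneg fun i _ =>
        add_nonneg (Finset.sum_nonneg fun _ _ => abs_nonneg _)
          (div_nonneg (by linarith) (hw σ i).le)
    linarith) hQ
  choose F hFc hFb using hF
  let N : ι → ℕ := fun i => Q ^ (o i + 1)
  have hN0 : ∀ i, (0 : ℝ) < N i := fun i => by
    simp only [N, Nat.cast_pow]; positivity
  have hNQ : ∀ i, (Q : ℝ) ≤ N i := fun i => by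
    simp only [N, Nat.cast_pow]
    exact le_self_pow₀ hQ0 (by omega)
  have hNN : ∀ i j, o j < o i → (Q : ℝ) * N j ≤ N i := fun i j hij => by
    simp only [N, Nat.cast_pow]
    rw [← pow_succ']
    exact pow_le_pow_right₀ hQ0 (by omega)
  let z : (ι → 𝓞 K) → (K →+* ℝ) → ι → ℝ := fun x σ i =>
    w σ i * (ov σ (x i) + ∑ j, L σ i j * ov σ (x j))
  let X₀ : Finset (ι → 𝓞 K) := Fintype.piFinset fun i => F (N i)
  have hz : ∀ x ∈ X₀, ∀ σ i, |z x σ i| ≤ 2 * (w σ i * (C * N i)) := by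
    intro x hx σ i
    have hx' := Fintype.mem_piFinset.mp hx
    simp only [z]
    rw [abs_mul, abs_of_pos (hw σ i), mul_left_comm]
    refine mul_le_mul_of_nonneg_left ?_ (hw σ i).le
    have h1 := hFb _ _ (hx' i) σ
    have h2 : |∑ j, L σ i j * ov σ (x j)| ≤ C * N i := by
      calc |∑ j, L σ i j * ov σ (x j)| ≤ ∑ j, |L σ i j| * (C * (N i / Q)) := by
            refine (Finset.abs_sum_le_sum_abs _ _).trans (Finset.sum_le_sum fun j _ => ?_)
            rw [abs_mul]
            by_cases h0 : L σ i j = 0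
            · simp [h0]
            · refine mul_le_mul_of_nonneg_left ((hFb _ _ (hx' j) σ).trans ?_) (abs_nonneg _)
              refine mul_le_mul_of_nonneg_left ?_ hC0.le
              rw [le_div_iff₀ (by linarith), mul_comm]
              exact hNN i j (hL _ _ _ h0)
        _ = (∑ j, |L σ i j|) * (C * (N i / Q)) := by rw [Finset.sum_mul]
        _ ≤ Q * (C * (N i / Q)) := by
            refine mul_le_mul_of_nonneg_right ?_ (by positivity)
            have := hQ1 σ i
            have h3 : 0 ≤ 2 * ρ / w σ i := div_nonneg (by linarith) (hw σ i).le
            linarith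
        _ = C * N i := by field_simp
    exact (abs_add_le _ _).trans (by linarith)
  let T : Finset ((K →+* ℝ) → ι → ℤ) := Fintype.piFinset fun σ => Fintype.piFinset fun i =>
    Finset.Icc ⌊-(2 * (w σ i * (C * N i))) / ρ⌋ ⌊2 * (w σ i * (C * N i)) / ρ⌋
  let φ : (ι → 𝓞 K) → (K →+* ℝ) → ι → ℤ := fun x σ i => ⌊z x σ i / ρ⌋
  have hφ : ∀ x ∈ X₀, φ x ∈ T := by
    intro x hx
    refine Fintype.mem_piFinset.mpr fun σ => Fintype.mem_piFinset.mpr fun i => ?_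
    have h1 := abs_le.mp (hz x hx σ i)
    rw [Finset.mem_Icc]
    exact ⟨Int.floor_mono (div_le_div_of_nonneg_right h1.1 hρ.le),
      Int.floor_mono (div_le_div_of_nonneg_right h1.2 hρ.le)⟩
  have hT : (T.card : ℝ) ≤ ∏ σ : K →+* ℝ, ∏ i, (5 * C * w σ i / ρ * N i) := by
    simp only [T, Fintype.card_piFinset, Nat.cast_prod]
    refine Finset.prod_le_prod (fun _ _ => Finset.prod_nonneg fun _ _ => Nat.cast_nonneg _)
      fun σ _ => Finset.prod_le_prod (fun _ _ => Nat.cast_nonneg _) fun i _ => ?_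
    rw [Int.card_Icc]
    set y := 2 * (w σ i * (C * N i)) / ρ with hy
    have hy2 : 4 ≤ y := by
      rw [hy, le_div_iff₀ hρ]
      have h1 := hQ1 σ i
      have h2 : 2 * ρ / w σ i ≤ N i := by
        have : 0 ≤ ∑ j, |L σ i j| := Finset.sum_nonneg fun _ _ => abs_nonneg _
        linarith [hNQ i]
      rw [div_le_iff₀ (hw σ i)] at h2
      have h3 : w σ i * N i ≤ w σ i * (C * N i) :=
        mul_le_mul_of_nonneg_left (le_mul_of_one_le_left (hN0 i).le hC) (hw σ i).le
      linarith
    have h1 : -(2 * (w σ i * (C * N i))) / ρ = -y := by rw [hy]; ring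
    rw [h1]
    have h2 : 0 ≤ ⌊y⌋ + 1 - ⌊-y⌋ := by
      have h3 := Int.floor_mono (show -y ≤ y by linarith)
      linarith
    have h3 : ((⌊y⌋ + 1 - ⌊-y⌋).toNat : ℝ) = ((⌊y⌋ + 1 - ⌊-y⌋ : ℤ) : ℝ) := by
      exact_mod_cast congrArg (Int.cast : ℤ → ℝ) (Int.toNat_of_nonneg h2)
    rw [h3]
    push_cast
    have h4 := Int.floor_le y
    have h5 := Int.lt_floor_add_one (-y)
    have h6 : 5 * C * w σ i / ρ * N i = 5 / 2 * y := by rw [hy]; ring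
    rw [h6]
    linarith
  have hX₀ : (X₀.card : ℝ) = ∏ σ : K →+* ℝ, ∏ i, (N i : ℝ) := by
    simp only [X₀, Fintype.card_piFinset, hFc, Nat.cast_prod, Nat.cast_pow]
    rw [Finset.prod_const, Finset.card_univ, Finset.prod_pow]
  have hpos : 0 < ∏ σ : K →+* ℝ, ∏ i, (ρ / (5 * C * w σ i)) :=
    Finset.prod_pos fun σ _ => Finset.prod_pos fun i _ => by have := hw σ i; positivity
  have hne : X₀.Nonempty := by
    rw [← Finset.card_pos]
    have : (0 : ℝ) < X₀.card := by
      rw [hX₀]; exact Finset.prod_pos fun σ _ => Finset.prod_pos fun i _ => hN0 i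
    exact_mod_cast this
  obtain ⟨t, ht, hcard⟩ := Finset.exists_le_card_fiber_of_nsmul_le_card_of_maps_to
    (b := ∏ σ : K →+* ℝ, ∏ i, (ρ / (5 * C * w σ i))) hφ
    (let ⟨x, hx⟩ := hne; ⟨_, hφ x hx⟩) (by
      rw [nsmul_eq_mul, hX₀]
      refine (mul_le_mul_of_nonneg_right hT hpos.le).trans_eq ?_
      rw [← Finset.prod_mul_distrib]
      refine Finset.prod_congr rfl fun σ _ => ?_
      rw [← Finset.prod_mul_distrib]
      refine Finset.prod_congr rfl fun i _ => ?_
      have := hw σ i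
      field_simp)
  have hfne : (X₀.filter fun x => φ x = t).Nonempty := by
    rw [← Finset.card_pos]
    exact_mod_cast hpos.trans_le hcard
  obtain ⟨x₀, hx₀⟩ := hfne
  refine ⟨(X₀.filter fun x => φ x = t).image fun x => x - x₀, ?_, ?_⟩
  · rwa [Finset.card_image_of_injective _ (sub_left_injective)]
  · intro y hy σ i
    obtain ⟨x, hx, rfl⟩ := Finset.mem_image.mp hy
    have h1 : φ x = φ x₀ := (Finset.mem_filter.mp hx).2.trans (Finset.mem_filter.mp hx₀).2.symm
    have h2 := Int.abs_sub_lt_one_of_floor_eq_floor (congrFun (congrFun h1 σ) i)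
    have h3 : z x σ i / ρ - z x₀ σ i / ρ = (w σ i *
        (ov σ ((x - x₀) i) + ∑ j, L σ i j * ov σ ((x - x₀) j))) / ρ := by
      simp only [z, Pi.sub_apply, map_sub, mul_sub, Finset.sum_sub_distrib]
      ring
    rw [h3, abs_div, abs_of_pos hρ, div_lt_one hρ, abs_mul, abs_of_pos (hw σ i)] at h2
    exact h2.le

end SmallVectors

section GramSchmidt

open scoped Matrix

variable {K : Type} [Field K] [NumberField K]

/-- A symmetric matrix together with its decomposition into a unitriangular and a diagonal one. -/
structure IsGS {m : ℕ} (A : Matrix (Fin m) (Fin m) (𝓞 K)) (h : Fin m → K)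
    (μ : Matrix (Fin m) (Fin m) K) : Prop where
  pos : ∀ (σ : K →+* ℝ) i, 0 < σ (h i)
  diag : ∀ i, μ i i = 1
  tri : ∀ i j, i < j → μ i j = 0
  eq : ∀ i j, algebraMap (𝓞 K) K (A i j) = ∑ l, μ i l * h l * μ j l

/-- The inverse of a unitriangular matrix. -/
theorem exists_unitriangular_inv {m : ℕ} {μ : Matrix (Fin m) (Fin m) K} (hd : ∀ i, μ i i = 1)
    (ht : ∀ i j, i < j → μ i j = 0) : ∃ ν : Matrix (Fin m) (Fin m) K,
      (∀ i, ν i i = 1) ∧ (∀ i j, i < j → ν i j = 0) ∧ μ * ν = 1 ∧ ν * μ = 1 := by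
  have hb : μ.BlockTriangular OrderDual.toDual := fun i j hij => ht i j hij
  have hdet : μ.det = 1 := by
    rw [Matrix.det_of_isLowerTriangular μ hb]
    exact Finset.prod_eq_one fun i _ => hd i
  have hu : IsUnit μ.det := by rw [hdet]; exact isUnit_one
  have hinv : Invertible μ := Matrix.invertibleOfIsUnitDet μ hu
  have hb' : μ⁻¹.BlockTriangular OrderDual.toDual :=
    Matrix.blockTriangular_inv_of_blockTriangular hb
  have h1 := Matrix.mul_nonsing_inv μ hu
  refine ⟨μ⁻¹, fun i => ?_, fun i j hij => hb' hij, h1, Matrix.nonsing_inv_mul μ hu⟩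
  have h2 := congrFun (congrFun h1 i) i
  rw [Matrix.mul_apply, Finset.sum_eq_single i, hd, one_mul, Matrix.one_apply_eq] at h2
  · exact h2
  · intro j _ hj
    rcases lt_or_gt_of_ne hj with h3 | h3
    · rw [hb' (show OrderDual.toDual i < OrderDual.toDual j from h3), mul_zero]
    · rw [ht i j h3, zero_mul]
  · simp

/-- The matrix obtained by adding a row and a column. -/
def bordered {R : Type*} {k : ℕ} (A : Matrix (Fin k) (Fin k) R) (w : Fin k → R) (α : R) :
    Matrix (Fin (k + 1)) (Fin (k + 1)) R :=
  fun i => Fin.snoc (α := fun _ => R)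
    (Fin.snoc (α := fun _ => Fin k → R) (fun i => A i) w i)
    (Fin.snoc (α := fun _ => R) w α i)

section Bordered

variable {R : Type*} {k : ℕ} (A : Matrix (Fin k) (Fin k) R) (w : Fin k → R) (α : R)

@[simp] theorem bordered_castSucc_castSucc (i j : Fin k) :
    bordered A w α i.castSucc j.castSucc = A i j := by simp [bordered]

@[simp] theorem bordered_castSucc_last (i : Fin k) :
    bordered A w α i.castSucc (Fin.last k) = w i := by simp [bordered]

@[simp] theorem bordered_last_castSucc (j : Fin k) :
    bordered A w α (Fin.last k) j.castSucc = w j := by simp [bordered]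

@[simp] theorem bordered_last_last : bordered A w α (Fin.last k) (Fin.last k) = α := by
  simp [bordered]

end Bordered

theorem IsGS.bordered {k : ℕ} {A : Matrix (Fin k) (Fin k) (𝓞 K)} {h : Fin k → K}
    {μ : Matrix (Fin k) (Fin k) K} (hA : IsGS A h μ) {w : Fin k → 𝓞 K} {α : 𝓞 K} {p : Fin k → K}
    (hp : ∀ i, algebraMap (𝓞 K) K (w i) = ∑ l, μ i l * h l * p l) {s : K}
    (hs : ∀ σ : K →+* ℝ, 0 < σ s)
    (hα : algebraMap (𝓞 K) K α = s + ∑ l, p l * h l * p l) :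
    IsGS (bordered A w α) (Fin.snoc (α := fun _ => K) h s)
      (fun i => Fin.snoc (α := fun _ => K) (Fin.snoc (α := fun _ => Fin k → K) (fun i => μ i) p i)
        (Fin.snoc (α := fun _ => K) (fun _ => 0) 1 i)) where
  pos σ i := by
    induction i using Fin.lastCases with
    | last => simpa using hs σ
    | cast i => simpa using hA.pos σ i
  diag i := by
    induction i using Fin.lastCases with
    | last => simp
    | cast i => simpa using hA.diag i
  tri i j hij := by
    induction i using Fin.lastCases with
    | last => exact absurd hij (not_lt.mpr (Fin.le_last j))
    | cast i =>
      induction j using Fin.lastCases with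
      | last => simp
      | cast j => simpa using hA.tri i j (by simpa using hij)
  eq i j := by
    induction i using Fin.lastCases with
    | last =>
      induction j using Fin.lastCases with
      | last => simp [Fin.sum_univ_castSucc, hα, add_comm]
      | cast j =>
        simp only [bordered_last_castSucc, Fin.sum_univ_castSucc, Fin.snoc_castSucc,
          Fin.snoc_last, hp]
        simp only [mul_zero, add_zero]
        exact Finset.sum_congr rfl fun l _ => by ring
    | cast i =>
      induction j using Fin.lastCases with
      | last => simp [Fin.sum_univ_castSucc, hp]
      | cast j => simp [Fin.sum_univ_castSucc, hA.eq]

/-- The value of the form in terms of the decomposition. -/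
theorem IsGS.sum_eq {m : ℕ} {A : Matrix (Fin m) (Fin m) (𝓞 K)} {h : Fin m → K}
    {μ : Matrix (Fin m) (Fin m) K} (hA : IsGS A h μ) (x : Fin m → K) :
    ∑ i, ∑ j, x i * algebraMap (𝓞 K) K (A i j) * x j = ∑ l, h l * (∑ i, x i * μ i l) ^ 2 := by
  simp only [hA.eq, Finset.mul_sum, Finset.sum_mul, sq]
  rw [Finset.sum_comm]
  conv_lhs => enter [2, j]; rw [Finset.sum_comm]
  rw [Finset.sum_comm]
  refine Finset.sum_congr rfl fun l _ => Finset.sum_congr rfl fun i _ =>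
    Finset.sum_congr rfl fun j _ => by ring

/-- The free lattice with a given Gram matrix. -/
theorem IsGS.exists_lattice {m : ℕ} {A : Matrix (Fin m) (Fin m) (𝓞 K)} {h : Fin m → K}
    {μ : Matrix (Fin m) (Fin m) K} (hA : IsGS A h μ) : ∃ L : OKLattice K, L.rank = m ∧
      ∃ e : Fin m → L.carrier, ∀ i j, L.form (e i) (e j) = A i j := by
  classical
  have hinj : Function.Injective (algebraMap (𝓞 K) K) := RingOfIntegers.coe_injective
  let B : (Fin m → 𝓞 K) →ₗ[𝓞 K] (Fin m → 𝓞 K) →ₗ[𝓞 K] 𝓞 K := Matrix.toLinearMap₂' (𝓞 K) A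
  have hB : ∀ x y, B x y = ∑ i, ∑ j, x i * A i j * y j := fun x y => by
    simp only [B, Matrix.toLinearMap₂'_apply, smul_eq_mul]
    exact Finset.sum_congr rfl fun i _ => Finset.sum_congr rfl fun j _ => by ring
  have hsymm : ∀ i j, A i j = A j i := fun i j => hinj (by
    rw [hA.eq, hA.eq]; exact Finset.sum_congr rfl fun l _ => by ring)
  let L : OKLattice K :=
    { carrier := Fin m → 𝓞 K
      form := B
      symm := fun x y => by
        rw [hB, hB, Finset.sum_comm]
        refine Finset.sum_congr rfl fun i _ => Finset.sum_congr rfl fun j _ => ?_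
        rw [hsymm]; ring
      posDef := fun v hv σ => by
        have h1 : algebraMap (𝓞 K) K (B v v)
            = ∑ l, h l * (∑ i, algebraMap (𝓞 K) K (v i) * μ i l) ^ 2 := by
          rw [← hA.sum_eq, hB]; simp
        obtain ⟨ν, -, -, hμν, -⟩ := exists_unitriangular_inv hA.diag hA.tri
        have h2 : ∃ l, ∑ i, algebraMap (𝓞 K) K (v i) * μ i l ≠ 0 := by
          by_contra hcon
          push Not at hcon
          apply hv
          have h3 : (fun i => algebraMap (𝓞 K) K (v i)) ᵥ* μ = 0 := funext hcon
          have h4 := congrArg (fun z => z ᵥ* ν) h3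
          simp only [Matrix.vecMul_vecMul, hμν, Matrix.vecMul_one, Matrix.zero_vecMul] at h4
          exact funext fun i => hinj (by rw [congrFun h4 i]; simp)
        obtain ⟨l, hl⟩ := h2
        rw [h1, map_sum]
        refine Finset.sum_pos' (fun l _ => ?_) ⟨l, Finset.mem_univ l, ?_⟩
        · rw [map_mul, map_pow]
          exact mul_nonneg (hA.pos σ l).le (sq_nonneg _)
        · rw [map_mul, map_pow]
          exact mul_pos (hA.pos σ l) (by have := (map_ne_zero σ).mpr hl; positivity) }
  refine ⟨L, ?_, fun i => Pi.single i 1, fun i j => ?_⟩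
  · rw [L.rank_eq_finrank]
    exact Module.finrank_fin_fun (𝓞 K)
  · refine (hB _ _).trans ?_
    rw [Finset.sum_eq_single i, Finset.sum_eq_single j]
    · simp
    · intro b _ hb; simp [Pi.single_eq_of_ne hb]
    · simp
    · intro b _ hb; simp [Pi.single_eq_of_ne hb]
    · simp

variable (K) in
theorem exists_many_matrices [htr : Fact (TotallyReal K)] : ∃ C : ℝ, 1 ≤ C ∧ ∀ m a : ℕ, 0 < m →
    0 < a → ∀ k ≤ m, ∃ S : Finset (Matrix (Fin k) (Fin k) (𝓞 K)),
      ∏ i ∈ Finset.range k, ((a : ℝ) / (C * √m)) ^ (Fintype.card (K →+* ℝ) * i) ≤ S.card ∧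
      ∀ A ∈ S, (∀ i, A i i = a) ∧ ∃ h μ, IsGS A h μ ∧ ∀ (σ : K →+* ℝ) i, (a : ℝ) / 2 ≤ σ (h i) := by
  classical
  obtain ⟨C, hC, hX⟩ := exists_many_small K
  refine ⟨2 * C, by linarith, fun m a hm ha k => ?_⟩
  have hm' : (0 : ℝ) < m := by exact_mod_cast hm
  have ha' : (0 : ℝ) < a := by exact_mod_cast ha
  have hinj : Function.Injective (algebraMap (𝓞 K) K) := RingOfIntegers.coe_injective
  induction k with
  | zero =>
    intro _
    refine ⟨{0}, by simp, fun A _ => ⟨fun i => i.elim0, Fin.elim0, 0,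
      ⟨fun _ i => i.elim0, fun i => i.elim0, fun i => i.elim0, fun i => i.elim0⟩,
      fun _ i => i.elim0⟩⟩
  | succ k ih =>
    intro hk
    obtain ⟨S, hS, hSA⟩ := ih (by omega)
    set ρ : ℝ := √(a / (2 * m)) with hρdef
    have hρ : 0 < ρ := Real.sqrt_pos.mpr (by positivity)
    have hρ2 : ρ ^ 2 = a / (2 * m) := Real.sq_sqrt (by positivity)
    have hrow : ∀ A ∈ S, ∃ X : Finset (Fin k → 𝓞 K),
        ((a : ℝ) / (2 * C * √m)) ^ (Fintype.card (K →+* ℝ) * k) ≤ X.card ∧ ∀ w ∈ X,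
          ∃ h μ, IsGS (_root_.bordered A w a) h μ ∧ ∀ (σ : K →+* ℝ) i, (a : ℝ) / 2 ≤ σ (h i) := by
      intro A hA
      obtain ⟨hdiag, h, μ, hGS, hh⟩ := hSA A hA
      obtain ⟨ν, hνd, hνt, hμν, hνμ⟩ := exists_unitriangular_inv hGS.diag hGS.tri
      obtain ⟨X, hXc, hXs⟩ := hX (Fin k) (fun i => i) (fun σ i => 1 / √(σ (h i)))
        (fun σ i j => if j < i then σ (ν i j) else 0) ρ
        (fun σ i => by have := Real.sqrt_pos.mpr (hGS.pos σ i); positivity)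
        (fun σ i j hij => by
          by_contra hcon
          exact hij (if_neg (by simpa using hcon))) hρ
      refine ⟨X, le_trans ?_ hXc, fun w hw => ?_⟩
      · rw [mul_comm (Fintype.card _) k, pow_mul, ← Finset.card_univ (α := K →+* ℝ),
          ← Finset.prod_const]
        refine Finset.prod_le_prod (fun _ _ => by positivity) fun σ _ => ?_
        have h1 : ((a : ℝ) / (2 * C * √m)) ^ k = ∏ _i : Fin k, (a : ℝ) / (2 * C * √m) := by
          rw [Finset.prod_const, Finset.card_univ, Fintype.card_fin]
        rw [h1]
        refine Finset.prod_le_prod (fun _ _ => by positivity) fun i _ => ?_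
        have h2 : √((a : ℝ) / 2) ≤ √(σ (h i)) := Real.sqrt_le_sqrt (hh σ i)
        have h3 : ρ * √((a : ℝ) / 2) = a / (2 * √m) := by
          rw [hρdef, ← Real.sqrt_mul (by positivity), show (a : ℝ) / (2 * m) * (a / 2)
            = (a / 2) ^ 2 / m by field_simp; try ring, Real.sqrt_div (by positivity),
            Real.sqrt_sq (by positivity)]
          field_simp
        have h4 := Real.sqrt_pos.mpr (hGS.pos σ i)
        have h5 : ρ / (C * (1 / √(σ (h i)))) = ρ * √(σ (h i)) / C := by field_simp
        have h6 : (a : ℝ) / (2 * C * √m) = ρ * √((a : ℝ) / 2) / C := by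
          rw [h3]; field_simp
        rw [h5, h6]
        gcongr
      · let p : Fin k → K := fun l => (∑ i, ν l i * algebraMap (𝓞 K) K (w i)) / h l
        have hh0 : ∀ l, h l ≠ 0 := fun l h0 => by
          obtain ⟨σ⟩ := nonempty_emb (K := K)
          have := hGS.pos σ l
          rw [h0, map_zero] at this
          exact lt_irrefl _ this
        have hp : ∀ i, algebraMap (𝓞 K) K (w i) = ∑ l, μ i l * h l * p l := by
          intro i
          have h1 : ∀ l, μ i l * h l * p l =
            μ i l * (ν *ᵥ fun i => algebraMap (𝓞 K) K (w i)) l := by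
            intro l
            simp only [p, Matrix.mulVec, dotProduct]
            have := hh0 l
            field_simp
          simp only [h1]
          have h2 : (μ *ᵥ (ν *ᵥ fun i => algebraMap (𝓞 K) K (w i))) i
              = algebraMap (𝓞 K) K (w i) := by
            rw [Matrix.mulVec_mulVec, hμν, Matrix.one_mulVec]
          exact h2.symm
        have hq : ∀ σ : K →+* ℝ, σ (∑ l, p l * h l * p l) ≤ a / 2 := by
          intro σ
          rw [map_sum]
          calc ∑ l, σ (p l * h l * p l) ≤ ∑ _l : Fin k, (a : ℝ) / (2 * m) := by
                refine Finset.sum_le_sum fun l _ => ?_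
                have h1 := hXs w hw σ l
                have hl := hGS.pos σ l
                have hl2 := Real.sqrt_pos.mpr hl
                have h2 : ov σ (w l) + ∑ j, (if j < l then σ (ν l j) else 0) * ov σ (w j)
                    = σ (h l) * σ (p l) := by
                  rw [← map_mul, mul_div_cancel₀ _ (hh0 l), map_sum,
                    ← Finset.add_sum_erase Finset.univ
                      (fun j => σ (ν l j * algebraMap (𝓞 K) K (w j)))
                      (Finset.mem_univ l),
                    ← Finset.add_sum_erase Finset.univ
                      (fun j => (if j < l then σ (ν l j) else 0) * ov σ (w j)) (Finset.mem_univ l)]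
                  rw [if_neg (lt_irrefl l), zero_mul, zero_add, hνd, one_mul, ← ov_apply]
                  refine congrArg _ (Finset.sum_congr rfl fun j hj => ?_)
                  rw [map_mul, ← ov_apply]
                  split_ifs with hjl
                  · rfl
                  · rw [hνt l j (lt_of_le_of_ne (not_lt.mp hjl) (Finset.ne_of_mem_erase hj).symm),
                      map_zero]
                rw [h2, abs_mul, abs_of_pos hl, ← mul_assoc] at h1
                have h3 : 1 / √(σ (h l)) * σ (h l) = √(σ (h l)) := by
                  rw [one_div, inv_mul_eq_div, Real.div_sqrt]
                rw [h3] at h1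
                rw [← hρ2]
                have h4 : σ (p l * h l * p l) = (√(σ (h l)) * |σ (p l)|) ^ 2 := by
                  rw [mul_pow, Real.sq_sqrt hl.le, sq_abs, map_mul, map_mul]; ring
                rw [h4]
                exact pow_le_pow_left₀ (by positivity) h1 2
            _ = k * ((a : ℝ) / (2 * m)) := by simp
            _ ≤ m * ((a : ℝ) / (2 * m)) := by
                refine mul_le_mul_of_nonneg_right ?_ (by positivity)
                exact_mod_cast (by omega : k ≤ m)
            _ = a / 2 := by field_simp
        have hs : ∀ σ : K →+* ℝ, (a : ℝ) / 2 ≤ σ ((a : K) - ∑ l, p l * h l * p l) := by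
          intro σ
          rw [map_sub, map_natCast]
          linarith [hq σ]
        refine ⟨_, _, hGS.bordered (α := (a : 𝓞 K)) hp (s := (a : K) - ∑ l, p l * h l * p l)
          (fun σ => lt_of_lt_of_le (by positivity) (hs σ)) (by simp), fun σ i => ?_⟩
        induction i using Fin.lastCases with
        | last => simpa using hs σ
        | cast i => simpa using hh σ i
    choose! X hXc hXw using hrow
    refine ⟨(S.sigma X).image fun q => _root_.bordered q.1 q.2 (a : 𝓞 K), ?_, ?_⟩
    · rw [Finset.card_image_of_injective, Finset.card_sigma, Finset.prod_range_succ, Nat.cast_sum]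
      · refine (mul_le_mul_of_nonneg_right hS (by positivity)).trans ?_
        rw [← nsmul_eq_mul, ← Finset.sum_const]
        exact Finset.sum_le_sum fun A hA => hXc A hA
      · rintro ⟨A, w⟩ ⟨A', w'⟩ hAA
        dsimp only at hAA
        have h1 : A = A' := by
          ext i j
          have := congrFun (congrFun hAA i.castSucc) j.castSucc
          simpa using this
        subst h1
        have h2 : w = w' := by
          ext i
          have := congrFun (congrFun hAA i.castSucc) (Fin.last k)
          simpa using this
        rw [h2]
    · intro A' hA'
      obtain ⟨⟨A, w⟩, hq, rfl⟩ := Finset.mem_image.mp hA'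
      obtain ⟨hA, hw⟩ := Finset.mem_sigma.mp hq
      refine ⟨fun i => ?_, hXw A hA w hw⟩
      induction i using Fin.lastCases with
      | last => simp
      | cast i => simpa using (hSA A hA).1 i

end GramSchmidt

namespace OKLattice

variable {K : Type} [Field K] [NumberField K] [htr : Fact (TotallyReal K)] (L : OKLattice K)

theorem q_eq_natCast {a : ℕ} {x : L.carrier} (hx : L.form x x = a) (σ : K →+* ℝ) :
    L.q σ x = a := by
  rw [q, hx, map_natCast]

theorem abs_trZ_form_le {a : ℕ} {x y : L.carrier} (hx : L.form x x = a) (hy : L.form y y = a) :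
    |trZ (L.form x y)| ≤ (a * Module.finrank ℚ K : ℕ) := by
  have h : (|trZ (L.form x y)| : ℝ) ≤ ((a * Module.finrank ℚ K : ℕ) : ℝ) := by
    rw [trZ_eq_sum]
    refine (Finset.abs_sum_le_sum_abs _ _).trans ((Finset.sum_le_sum fun σ _ =>
      (L.abs_form_le σ x y)).trans ?_)
    simp only [nrm, L.q_eq_natCast hx, L.q_eq_natCast hy, Real.mul_self_sqrt (Nat.cast_nonneg a),
      Finset.sum_const, Finset.card_univ, card_emb, nsmul_eq_mul]
    push_cast
    rw [mul_comm]
  exact_mod_cast h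

theorem eq_of_trZ_form_eq {a : ℕ} {x y : L.carrier} (hx : L.form x x = a) (hy : L.form y y = a)
    (h : trZ (L.form x y) = (a * Module.finrank ℚ K : ℕ)) : x = y := by
  have h1 : ((trZ (L.form (x - y) (x - y)) : ℤ) : ℝ) = 0 := by
    have h2 : L.form (x - y) (x - y) = a + a - (L.form x y + L.form x y) := by
      simp only [map_sub, LinearMap.sub_apply, hx, hy, L.symm y x]; ring
    have h3 : ((trZ (L.form x y) : ℤ) : ℝ) = (a * Module.finrank ℚ K : ℕ) := by rw [h]; simp
    rw [trZ_eq_sum] at h3 ⊢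
    rw [h2]
    simp only [map_sub, map_add, map_natCast, Finset.sum_sub_distrib, Finset.sum_add_distrib,
      h3, Finset.sum_const, Finset.card_univ, card_emb, nsmul_eq_mul]
    push_cast
    ring
  rw [trZ_eq_sum] at h1
  by_contra hne
  have h4 : 0 < ∑ σ : K →+* ℝ, ov σ (L.form (x - y) (x - y)) :=
    Finset.sum_pos (fun σ _ => L.q_pos σ (sub_ne_zero.mpr hne)) Finset.univ_nonempty
  exact h4.ne' h1

/-- The number of vectors of a given integral norm is polynomially bounded in the rank. -/
theorem card_le_of_form_eq (a : ℕ) (T : Finset L.carrier) (hT : ∀ x ∈ T, L.form x x = a) :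
    T.card ≤ (L.rank * Module.finrank ℚ K + 1) ^ (2 * (a * Module.finrank ℚ K)) := by
  classical
  set N := a * Module.finrank ℚ K with hN
  let b := Module.finBasisOfFinrankEq ℤ L.carrier L.finrank_int
  let X : Option (Fin (L.rank * Module.finrank ℚ K)) → L.carrier → ℚ :=
    fun o x => o.elim 1 fun i => (b.repr x i : ℚ)
  let c : Option (Fin (L.rank * Module.finrank ℚ K)) → L.carrier → Fin (2 * N) → ℚ :=
    fun o y β => o.elim (N - β : ℚ) fun i => (trZ (L.form (b i) y) : ℚ)
  have hlin : ∀ x y (β : Fin (2 * N)), (trZ (L.form x y) : ℚ) + (N - (β : ℕ)) =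
    ∑ o, c o y β * X o x := by
    intro x y β
    have h1 : trZ (L.form x y) = ∑ i, b.repr x i * trZ (L.form (b i) y) := by
      conv_lhs => rw [← b.sum_repr x]
      simp only [map_sum, LinearMap.sum_apply, map_zsmul, LinearMap.smul_apply, smul_eq_mul]
    rw [Fintype.sum_option, h1]
    simp [X, c, add_comm, mul_comm]
  let F : (Fin (2 * N) → Option (Fin (L.rank * Module.finrank ℚ K))) → T → ℚ :=
    fun φ x => ∏ β, X (φ β) x
  have hF : ∀ x y : T, ∑ φ, (∏ β, c (φ β) y β) * F φ x
      = ∏ β : Fin (2 * N), ((trZ (L.form (x : L.carrier) y) : ℚ) + (N - (β : ℕ))) := by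
    intro x y
    simp only [hlin, Finset.prod_univ_sum, Fintype.piFinset_univ, Finset.prod_mul_distrib, F]
  have hne : ∀ x y : T, x ≠ y →
      ∏ β : Fin (2 * N), ((trZ (L.form (x : L.carrier) y) : ℚ) + (N - (β : ℕ))) = 0 := by
    intro x y hxy
    have h1 := abs_le.mp (L.abs_trZ_form_le (hT x x.2) (hT y y.2))
    have h2 : trZ (L.form (x : L.carrier) y) ≠ (N : ℕ) := fun h =>
      hxy (Subtype.ext (L.eq_of_trZ_form_eq (hT x x.2) (hT y y.2) h))
    rw [← hN] at h1
    have h3 : trZ (L.form (x : L.carrier) y) < (N : ℕ) := lt_of_le_of_ne h1.2 h2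
    obtain ⟨β, hβ⟩ := Int.eq_ofNat_of_zero_le (show 0 ≤ trZ (L.form (x : L.carrier) y) + N by
      linarith [h1.1])
    refine Finset.prod_eq_zero (Finset.mem_univ ⟨β, by omega⟩) ?_
    have h4 : ((trZ (L.form (x : L.carrier) y) + N : ℤ) : ℚ) = β := by rw [hβ]; simp
    push_cast at h4
    dsimp only
    linarith
  have hself : ∀ x : T,
      ∏ β : Fin (2 * N), ((trZ (L.form (x : L.carrier) x) : ℚ) + (N - (β : ℕ))) ≠ 0 := by
    intro x
    refine Finset.prod_ne_zero_iff.mpr fun β _ => ?_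
    have h1 : trZ (L.form (x : L.carrier) x) = N := by
      have h2 : ((trZ (L.form (x : L.carrier) x) : ℤ) : ℝ) = (N : ℕ) := by
        rw [trZ_eq_sum, hT x x.2]
        simp [card_emb, hN, mul_comm]
      exact_mod_cast h2
    rw [h1]
    have h3 : ((β : ℕ) : ℚ) < 2 * N := by exact_mod_cast β.2
    push_cast
    intro h4
    linarith
  have hli : LinearIndependent ℚ fun (x : T) φ => F φ x := by
    rw [Fintype.linearIndependent_iff]
    intro g hg y
    have h1 : ∑ φ, (∏ β, c (φ β) y β) * ∑ x, g x * F φ x = 0 := by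
      refine Finset.sum_eq_zero fun φ _ => ?_
      have := congrFun hg φ
      simp only [Finset.sum_apply, Pi.smul_apply, smul_eq_mul, Pi.zero_apply] at this
      rw [this, mul_zero]
    have h2 : ∑ φ, (∏ β, c (φ β) y β) * ∑ x, g x * F φ x
        = ∑ x, g x * ∑ φ, (∏ β, c (φ β) y β) * F φ x := by
      simp only [Finset.mul_sum]
      rw [Finset.sum_comm]
      exact Finset.sum_congr rfl fun x _ => Finset.sum_congr rfl fun φ _ => by ring
    rw [h2, Finset.sum_eq_single y (fun x _ hx => by rw [hF, hne x y hx, mul_zero])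
      (fun h => absurd (Finset.mem_univ y) h), hF] at h1
    exact (mul_eq_zero.mp h1).resolve_right (hself y)
  have h5 := hli.fintype_card_le_finrank
  rw [Module.finrank_fintype_fun_eq_card, Fintype.card_fun, Fintype.card_option, Fintype.card_fin,
    Fintype.card_fin, Fintype.card_coe] at h5
  exact h5

end OKLattice

namespace OKLattice

section Isometry

variable {K : Type} [Field K]

/-- Two lattices are isometric. -/
def Isometric (L L' : OKLattice K) : Prop :=
  ∃ e : L.carrier ≃ₗ[𝓞 K] L'.carrier, ∀ x y, L'.form (e x) (e y) = L.form x y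

theorem Isometric.refl (L : OKLattice K) : L.Isometric L := ⟨.refl _ _, fun _ _ => rfl⟩

theorem Isometric.symm {L L' : OKLattice K} (h : L.Isometric L') : L'.Isometric L := by
  obtain ⟨e, he⟩ := h
  exact ⟨e.symm, fun x y => by rw [← he, e.apply_symm_apply, e.apply_symm_apply]⟩

theorem Isometric.trans {L L' L'' : OKLattice K} (h : L.Isometric L') (h' : L'.Isometric L'') :
    L.Isometric L'' := by
  obtain ⟨e, he⟩ := h
  obtain ⟨e', he'⟩ := h'
  exact ⟨e.trans e', fun x y => by simp [he, he']⟩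

theorem Isometric.represents {L L' : OKLattice K} (h : L.Isometric L') : L'.Represents L := by
  obtain ⟨e, he⟩ := h
  exact ⟨e, fun x => he x x⟩

theorem Represents.trans {L L' L'' : OKLattice K} (h : L.Represents L') (h' : L'.Represents L'') :
    L.Represents L'' := by
  obtain ⟨i, hi⟩ := h
  obtain ⟨j, hj⟩ := h'
  exact ⟨i.comp j, fun x => by simp [hi, hj]⟩

/-- The orthogonal sum of two lattices. -/
def prod (L L' : OKLattice K) : OKLattice K where
  carrier := L.carrier × L'.carrier
  torsionFree := ⟨fun {c x} h => by
    rcases eq_or_ne c 0 with hc | hc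
    · exact Or.inl hc
    · right
      have h1 := congrArg Prod.fst h
      have h2 := congrArg Prod.snd h
      exact Prod.ext ((smul_eq_zero.mp h1).resolve_left hc) ((smul_eq_zero.mp h2).resolve_left hc)⟩
  form := LinearMap.mk₂ (𝓞 K) (fun x y => L.form x.1 y.1 + L'.form x.2 y.2)
    (fun _ _ _ => by simp; ring) (fun _ _ _ => by simp; ring) (fun _ _ _ => by simp; ring)
    (fun _ _ _ => by simp; ring)
  symm x y := by simp [L.symm x.1, L'.symm x.2]
  posDef v hv σ := by
    have h0 : ∀ (M : OKLattice K) (x : M.carrier),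
        0 ≤ σ (algebraMap (𝓞 K) K (M.form x x)) := fun M x => by
      rcases eq_or_ne x 0 with rfl | hx
      · simp
      · exact (M.posDef x hx σ).le
    simp only [LinearMap.mk₂_apply, map_add]
    by_cases h1 : v.1 = 0
    · have h2 : v.2 ≠ 0 := fun h2 => hv (Prod.ext h1 h2)
      exact add_pos_of_nonneg_of_pos (h0 _ _) (L'.posDef _ h2 σ)
    · exact add_pos_of_pos_of_nonneg (L.posDef _ h1 σ) (h0 _ _)

@[simp] theorem prod_form (L L' : OKLattice K) (x y : (L.prod L').carrier) :
    (L.prod L').form x y = L.form x.1 y.1 + L'.form x.2 y.2 := rfl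

theorem prod_represents_left (L L' : OKLattice K) : (L.prod L').Represents L :=
  ⟨LinearMap.inl _ _ _, fun x =>
    show L.form x x + L'.form 0 0 = _ by simp⟩

theorem prod_represents_right (L L' : OKLattice K) : (L.prod L').Represents L' :=
  ⟨LinearMap.inr _ _ _, fun x =>
    show L.form 0 0 + L'.form x x = _ by simp⟩

theorem Isometric.prod {L L' M M' : OKLattice K} (h : L.Isometric L') (h' : M.Isometric M') :
    (L.prod M).Isometric (L'.prod M') := by
  obtain ⟨e, he⟩ := h
  obtain ⟨e', he'⟩ := h'
  exact ⟨e.prodCongr e', fun x y =>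
    show L'.form (e x.1) (e y.1) + M'.form (e' x.2) (e' y.2) = _ by rw [he, he']; rfl⟩

/-- The zero lattice. -/
def zero (K : Type) [Field K] : OKLattice K where
  carrier := PUnit
  torsionFree := ⟨fun {_ x} _ => Or.inr (Subsingleton.elim x 0)⟩
  form := 0
  symm _ _ := rfl
  posDef v hv := absurd (Subsingleton.elim v 0) hv

end Isometry

variable {K : Type} [Field K] [NumberField K]

theorem Isometric.rank_eq {L L' : OKLattice K} (h : L.Isometric L') : L.rank = L'.rank := by
  obtain ⟨e, -⟩ := h
  rw [rank_eq_finrank, rank_eq_finrank, e.finrank_eq]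

theorem finrank_range_add_ker {M N : Type*} [AddCommGroup M] [AddCommGroup N] [Module (𝓞 K) M]
    [Module (𝓞 K) N] [Module.Finite (𝓞 K) M] (f : M →ₗ[𝓞 K] N) :
    Module.finrank (𝓞 K) (LinearMap.range f) + Module.finrank (𝓞 K) (LinearMap.ker f)
      = Module.finrank (𝓞 K) M := by
  rw [← f.quotKerEquivRange.finrank_eq]
  exact Submodule.finrank_quotient_add_finrank _

theorem rank_prod (L L' : OKLattice K) : (L.prod L').rank = L.rank + L'.rank := by
  rw [rank_eq_finrank, rank_eq_finrank, rank_eq_finrank]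
  have h := finrank_range_add_ker
    (LinearMap.fst (𝓞 K) L.carrier L'.carrier)
  rw [Submodule.range_fst, finrank_top, LinearMap.ker_fst,
    LinearMap.finrank_range_of_inj LinearMap.inr_injective] at h
  exact h.symm

/-- The sublattice supported on a submodule. -/
def restrict (L : OKLattice K) (N : Submodule (𝓞 K) L.carrier) : OKLattice K where
  carrier := N
  torsionFree := ⟨fun {c x} h => by
    rcases smul_eq_zero.mp (congrArg Subtype.val h : c • (x : L.carrier) = 0) with h | h
    · exact Or.inl h
    · exact Or.inr (Subtype.ext h)⟩
  form := L.form.compl₁₂ N.subtype N.subtype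
  symm x y := L.symm x y
  posDef v hv σ := L.posDef v (fun h => hv (Subtype.ext h)) σ

theorem restrict_form (L : OKLattice K) (N : Submodule (𝓞 K) L.carrier) (x y : N) :
    (L.restrict N).form x y = L.form (x : L.carrier) (y : L.carrier) := rfl

theorem rank_restrict (L : OKLattice K) (N : Submodule (𝓞 K) L.carrier) :
    (L.restrict N).rank = Module.finrank (𝓞 K) N := rank_eq_finrank _

/-- Representations preserve the bilinear form. -/
theorem form_eq_of_norm_eq {L L' : OKLattice K} (i : L'.carrier →ₗ[𝓞 K] L.carrier)
    (hi : ∀ x, L.form (i x) (i x) = L'.form x x) (x y : L'.carrier) :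
    L.form (i x) (i y) = L'.form x y := by
  have h := hi (x + y)
  simp only [map_add, LinearMap.add_apply, hi, L.symm (i y) (i x), L'.symm y x] at h
  have h2 : (2 : 𝓞 K) * (L.form (i x) (i y) - L'.form x y) = 0 := by linear_combination h
  exact sub_eq_zero.mp ((mul_eq_zero.mp h2).resolve_left two_ne_zero)

theorem Isometric.isUnimodular {L L' : OKLattice K} (h : L.Isometric L') (hL : L.IsUnimodular) :
    L'.IsUnimodular := by
  obtain ⟨e, he⟩ := h
  intro l
  obtain ⟨y, hy⟩ := hL (l.comp e.toLinearMap)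
  refine ⟨e y, fun x => ?_⟩
  have := hy (e.symm x)
  simpa [← he] using this

end OKLattice

namespace OKLattice

variable {K : Type} [Field K] [NumberField K]

theorem rank_eq_zero_iff {L : OKLattice K} : L.rank = 0 ↔ ∀ x : L.carrier, x = 0 := by
  have : Module.IsTorsionFree (𝓞 K) L.carrier := inferInstance
  rw [rank_eq_finrank]
  have h := Module.finrank_pos_iff_exists_ne_zero (R := 𝓞 K) (M := L.carrier)
  rw [← not_iff_not, ← ne_eq, ← Nat.pos_iff_ne_zero, h]
  push Not
  rfl

theorem rank_range_eq_zero {L : OKLattice K} {P : L.carrier →ₗ[𝓞 K] L.carrier}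
    (h : (L.restrict (LinearMap.range P)).rank = 0) : P = 0 := by
  ext x
  exact congrArg Subtype.val (rank_eq_zero_iff.mp h (P.rangeRestrict x))

/-- An orthogonal projection of a lattice into itself. -/
structure IsProj (L : OKLattice K) (P : L.carrier →ₗ[𝓞 K] L.carrier) : Prop where
  idem : ∀ x, P (P x) = P x
  symm : ∀ x y, L.form (P x) y = L.form x (P y)

theorem IsProj.one_sub {L : OKLattice K} {P : L.carrier →ₗ[𝓞 K] L.carrier} (hP : L.IsProj P) :
    L.IsProj (LinearMap.id - P) where
  idem x := by simp [hP.idem]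
  symm x y := by simp [hP.symm]

theorem IsProj.form_apply_sub {L : OKLattice K} {P : L.carrier →ₗ[𝓞 K] L.carrier}
    (hP : L.IsProj P) (x : L.carrier) : L.form (P x) (x - P x) = 0 := by
  rw [map_sub, hP.symm x (P x), hP.idem, hP.symm, sub_self]

/-- A lattice with exactly two orthogonal projections. -/
def IsIndec (L : OKLattice K) : Prop :=
  L.rank ≠ 0 ∧ ∀ P, L.IsProj P → P = 0 ∨ P = LinearMap.id

theorem Isometric.isIndec {L L' : OKLattice K} (h : L.Isometric L') (hL : L.IsIndec) :
    L'.IsIndec := by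
  refine ⟨h.rank_eq ▸ hL.1, fun P hP => ?_⟩
  obtain ⟨e, he⟩ := h
  have hQ : L.IsProj ((e.symm.toLinearMap.comp P).comp e.toLinearMap) :=
    ⟨fun x => by simp [hP.idem], fun x y => by
      have := hP.symm (e x) (e y)
      rw [← he, ← he]
      simpa using this⟩
  rcases hL.2 _ hQ with h | h
  · left
    ext y
    have := LinearMap.congr_fun h (e.symm y)
    simpa using this
  · right
    ext y
    have := LinearMap.congr_fun h (e.symm y)
    simpa using this

theorem IsProj.rank_add {L : OKLattice K} {P : L.carrier →ₗ[𝓞 K] L.carrier} (hP : L.IsProj P) :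
    (L.restrict (LinearMap.range P)).rank
      + (L.restrict (LinearMap.range (LinearMap.id - P))).rank = L.rank := by
  have h : LinearMap.ker P = LinearMap.range (LinearMap.id - P) := by
    ext x
    constructor
    · intro hx
      exact ⟨x, by simp [LinearMap.mem_ker.mp hx]⟩
    · rintro ⟨y, rfl⟩
      simp [hP.idem]
  rw [rank_restrict, rank_restrict, ← h, finrank_range_add_ker, rank_eq_finrank]

theorem IsProj.isUnimodular {L : OKLattice K} (hL : L.IsUnimodular)
    {P : L.carrier →ₗ[𝓞 K] L.carrier} (hP : L.IsProj P) :
    (L.restrict (LinearMap.range P)).IsUnimodular := by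
  intro l
  obtain ⟨y, hy⟩ := hL (l.comp P.rangeRestrict)
  refine ⟨(⟨P y, y, rfl⟩ : LinearMap.range P), ?_⟩
  rintro ⟨x, z, rfl⟩
  have h1 := hy (P z)
  have h2 : P.rangeRestrict (P z) = ⟨P z, z, rfl⟩ := Subtype.ext (hP.idem z)
  have h3 : l ⟨P z, z, rfl⟩ = L.form (P z) y := h1 ▸ congrArg l h2.symm
  rw [h3]
  refine Eq.trans ?_ (restrict_form L _ _ _).symm
  rw [← hP.symm, hP.idem]

theorem IsProj.isometric_prod {L : OKLattice K} {P : L.carrier →ₗ[𝓞 K] L.carrier}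
    (hP : L.IsProj P) : L.Isometric ((L.restrict (LinearMap.range P)).prod
      (L.restrict (LinearMap.range (LinearMap.id - P)))) := by
  refine ⟨{ toFun := fun x => (P.rangeRestrict x, (LinearMap.id - P).rangeRestrict x)
            map_add' := fun x y => by simp only [map_add]; rfl
            map_smul' := fun c x => by simp only [map_smul]; rfl
            invFun := fun x => ((show LinearMap.range P from x.1) : L.carrier)
              + ((show LinearMap.range (LinearMap.id - P) from x.2) : L.carrier)
            left_inv := fun x => ?_
            right_inv := ?_ }, fun x y => ?_⟩
  · change P x + (x - P x) = x
    abel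
  · rintro ⟨⟨x, u, rfl⟩, ⟨y, v, rfl⟩⟩
    refine Prod.ext (Subtype.ext ?_) (Subtype.ext ?_)
    · change P (P u + (v - P v)) = P u
      simp [hP.idem]
    · change (P u + (v - P v)) - P (P u + (v - P v)) = v - P v
      simp [hP.idem]
  · change L.form (P x) (P y) + L.form (x - P x) (y - P y) = L.form x y
    have h1 : L.form (P x) (P y) = L.form x (P y) := by rw [hP.symm, hP.idem]
    simp only [map_sub, LinearMap.sub_apply, h1, hP.symm x y]
    ring

/-- A nonzero lattice has an indecomposable orthogonal summand. -/
theorem exists_isIndec (L : OKLattice K) (hL : L.rank ≠ 0) : ∃ P, L.IsProj P ∧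
    (L.restrict (LinearMap.range P)).IsIndec := by
  classical
  have hex : ∃ r, ∃ P, L.IsProj P ∧ (L.restrict (LinearMap.range P)).rank = r ∧ r ≠ 0 :=
    ⟨L.rank, LinearMap.id, ⟨fun _ => rfl, fun _ _ => rfl⟩, by
      rw [rank_restrict, LinearMap.range_id, finrank_top, rank_eq_finrank], hL⟩
  obtain ⟨P, hP, hr, hr0⟩ := Nat.find_spec hex
  have hmin := fun r => Nat.find_min' hex (m := r)
  refine ⟨P, hP, by rw [hr]; exact hr0, fun Q hQ => ?_⟩
  let Q' : LinearMap.range P →ₗ[𝓞 K] LinearMap.range P := Q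
  have hQi : ∀ x, Q' (Q' x) = Q' x := hQ.idem
  have hQs : ∀ x y : LinearMap.range P, L.form (Q' x : L.carrier) (y : L.carrier)
    = L.form (x : L.carrier) (Q' y : L.carrier) := hQ.symm
  let R : L.carrier →ₗ[𝓞 K] L.carrier := (LinearMap.range P).subtype.comp (Q'.comp P.rangeRestrict)
  have hR : ∀ x, R x = Q' (P.rangeRestrict x) := fun x => rfl
  have hPr : ∀ z : LinearMap.range P, P.rangeRestrict (z : L.carrier) = z := by
    rintro ⟨_, u, rfl⟩
    exact Subtype.ext (hP.idem u)
  have hRp : L.IsProj R := by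
    refine ⟨fun x => ?_, fun x y => ?_⟩
    · rw [hR (R x), hR x, hPr, hQi]
    · have h1 : ∀ x y, L.form (R x) y = L.form (Q' (P.rangeRestrict x) : L.carrier) (P y) := by
        intro x y
        rw [← hP.symm, hR]
        exact congrArg (fun z => L.form z y)
          (congrArg Subtype.val (hPr (Q' (P.rangeRestrict x)))).symm
      rw [h1, L.symm x, h1, L.symm _ (P x)]
      exact hQs (P.rangeRestrict x) (P.rangeRestrict y)
  have hsum := hRp.rank_add
  have hsumQ := hQ.rank_add
  by_cases hz : Q = 0
  · exact Or.inl hz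
  right
  have hrange : LinearMap.range R = (LinearMap.range Q').map (LinearMap.range P).subtype := by
    rw [LinearMap.range_comp, LinearMap.range_comp, LinearMap.range_rangeRestrict,
      Submodule.map_top]
  have hrk : (L.restrict (LinearMap.range R)).rank
      = ((L.restrict (LinearMap.range P)).restrict (LinearMap.range Q)).rank := by
    rw [rank_restrict, rank_restrict, hrange]
    exact (Submodule.equivMapOfInjective _ (Submodule.injective_subtype _)
      (LinearMap.range Q')).finrank_eq.symm
  have hle := hmin _ ⟨R, hRp, hrk, fun h0 => hz (rank_range_eq_zero h0)⟩
  have h0 := rank_range_eq_zero (P := LinearMap.id - Q) (by omega)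
  exact (sub_eq_zero.mp h0).symm

end OKLattice

namespace OKLattice

variable {K : Type} [Field K] [NumberField K]

theorem trZ_form_pos [htr : Fact (TotallyReal K)] (L : OKLattice K) {x : L.carrier} (hx : x ≠ 0) :
    0 < trZ (L.form x x) := by
  have h : (0 : ℝ) < trZ (L.form x x) := by
    rw [trZ_eq_sum]
    exact Finset.sum_pos (fun σ _ => L.q_pos σ hx) Finset.univ_nonempty
  exact_mod_cast h

/-- Orthogonal projections of a positive definite lattice commute. -/
theorem IsProj.commute [htr : Fact (TotallyReal K)] {L : OKLattice K}
    {P Q : L.carrier →ₗ[𝓞 K] L.carrier} (hP : L.IsProj P) (hQ : L.IsProj Q) (x : L.carrier) :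
    P (Q x) = Q (P x) := by
  obtain ⟨n, hn⟩ : ∃ n : ℕ, trZ (L.form x x) ≤ n := ⟨_, Int.self_le_toNat _⟩
  induction n using Nat.strong_induction_on generalizing x with
  | _ n ih =>
    by_cases hdec : ∃ y z : L.carrier, y ≠ 0 ∧ z ≠ 0 ∧ L.form y z = 0 ∧ x = y + z
    · obtain ⟨y, z, hy, hz, hyz, rfl⟩ := hdec
      have h1 : L.form (y + z) (y + z) = L.form y y + L.form z z := by
        simp [L.symm z y, hyz]
      have h4 : trZ (L.form y y + L.form z z) = trZ (L.form y y) + trZ (L.form z z) :=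
        map_add _ _ _
      rw [h1, h4] at hn
      have hy' := L.trZ_form_pos hy
      have hz' := L.trZ_form_pos hz
      have h2 := ih (trZ (L.form y y)).toNat (by omega) y (by omega)
      have h3 := ih (trZ (L.form z z)).toNat (by omega) z (by omega)
      simp only [map_add, h2, h3]
    · push Not at hdec
      have hcase : ∀ R, L.IsProj R → R x = 0 ∨ R x = x := by
        intro R hR
        by_contra! hcon
        exact hdec (R x) (x - R x) hcon.1 (sub_ne_zero.mpr hcon.2.symm) (hR.form_apply_sub x)
          (by abel)
      rcases hcase P hP with h1 | h1 <;> rcases hcase Q hQ with h2 | h2 <;> simp [h1, h2]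

theorem eq_of_form_eq (L : OKLattice K) {x y : L.carrier} [htr : Fact (TotallyReal K)]
    (h : ∀ z, L.form z x = L.form z y) : x = y := by
  have h1 : L.form (x - y) (x - y) = 0 := by rw [map_sub (L.form (x - y)), h, sub_self]
  exact sub_eq_zero.mp (L.form_self_eq_zero.mp h1)

/-- A unimodular lattice represented by `L` splits off as an orthogonal summand. -/
theorem IsUnimodular.exists_isProj [htr : Fact (TotallyReal K)] {L M : OKLattice K}
    (hM : M.IsUnimodular) (h : L.Represents M) :
    ∃ P, L.IsProj P ∧ M.Isometric (L.restrict (LinearMap.range P)) := by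
  obtain ⟨i, hi⟩ := h
  have hi2 := form_eq_of_norm_eq i hi
  choose p hp using fun x => hM ((L.form x).comp i)
  have hp' : ∀ x y, M.form y (p x) = L.form x (i y) := fun x y => (hp x y).symm
  have hpi : ∀ y, p (i y) = y := fun y => M.eq_of_form_eq fun z => by
    rw [hp', hi2, M.symm]
  have hinj : Function.Injective i := fun y z h => by rw [← hpi y, ← hpi z, h]
  let P : L.carrier →ₗ[𝓞 K] L.carrier :=
    { toFun := fun x => i (p x)
      map_add' := fun x y => by
        rw [← map_add]
        congr 1
        exact M.eq_of_form_eq fun z => by simp [hp']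
      map_smul' := fun c x => by
        rw [RingHom.id_apply, ← map_smul]
        congr 1
        exact M.eq_of_form_eq fun z => by simp [hp'] }
  have hPa : ∀ x, P x = i (p x) := fun _ => rfl
  have hr : LinearMap.range P = LinearMap.range i := by
    ext x
    constructor
    · rintro ⟨y, rfl⟩
      exact ⟨p y, rfl⟩
    · rintro ⟨y, rfl⟩
      exact ⟨i y, by rw [hPa, hpi]⟩
  refine ⟨P, ⟨fun x => by simp only [hPa, hpi], fun x y => ?_⟩, ?_⟩
  · rw [hPa, hPa, L.symm, ← hp', ← hp', M.symm]
  · rw [hr]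
    exact ⟨LinearEquiv.ofInjective i hinj, fun x y => hi2 x y⟩

/-- Two indecomposable orthogonal summands coincide or are orthogonal. -/
theorem IsProj.eq_or_comp_eq_zero [htr : Fact (TotallyReal K)] {L : OKLattice K}
    {P Q : L.carrier →ₗ[𝓞 K] L.carrier} (hP : L.IsProj P) (hQ : L.IsProj Q)
    (hPi : (L.restrict (LinearMap.range P)).IsIndec)
    (hQi : (L.restrict (LinearMap.range Q)).IsIndec) :
    P = Q ∨ ∀ x, P (Q x) = 0 := by
  have key : ∀ P Q : L.carrier →ₗ[𝓞 K] L.carrier, L.IsProj P → L.IsProj Q →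
      (L.restrict (LinearMap.range P)).IsIndec → (∀ x, P (Q x) = 0) ∨ ∀ x, P (Q x) = P x := by
    intro P Q hP hQ hPi
    have hmap : ∀ x ∈ LinearMap.range P, Q x ∈ LinearMap.range P := by
      rintro _ ⟨x, rfl⟩
      exact ⟨Q x, hP.commute hQ x⟩
    have hR : (L.restrict (LinearMap.range P)).IsProj (Q.restrict hmap) :=
      ⟨fun x => Subtype.ext (hQ.idem _), fun x y => hQ.symm _ _⟩
    rcases hPi.2 _ hR with h | h
    · left
      intro x
      rw [hP.commute hQ]
      exact congrArg Subtype.val (LinearMap.congr_fun h (P.rangeRestrict x))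
    · right
      intro x
      rw [hP.commute hQ]
      exact congrArg Subtype.val (LinearMap.congr_fun h (P.rangeRestrict x))
  rcases key P Q hP hQ hPi with h | h
  · exact Or.inr h
  · rcases key Q P hQ hP hQi with hq | hq
    · right
      intro x
      rw [hP.commute hQ, hq]
    · left
      ext x
      rw [← h, hP.commute hQ, hq]

/-- The lattices with property `p` fall into at most `H` isometry classes. -/
def Covered (p : OKLattice K → Prop) (H : ℝ) : Prop :=
  ∃ (ι : Type) (_ : Fintype ι) (F : ι → OKLattice K), (Fintype.card ι : ℝ) ≤ H ∧
    ∀ L, p L → ∃ i, L.Isometric (F i)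

theorem Covered.mono {p p' : OKLattice K → Prop} {H H' : ℝ} (h : Covered p H) (hH : H ≤ H')
    (hp : ∀ L, p' L → p L) : Covered p' H' := by
  obtain ⟨ι, hι, F, h1, h2⟩ := h
  exact ⟨ι, hι, F, h1.trans hH, fun L hL => h2 L (hp L hL)⟩

theorem covered_isIndec [htr : Fact (TotallyReal K)] (W : OKLattice K) :
    Covered (fun M => M.IsUnimodular ∧ M.IsIndec ∧ W.Represents M) W.rank := by
  classical
  let ι : Type := {P : W.carrier →ₗ[𝓞 K] W.carrier //
    W.IsProj P ∧ (W.restrict (LinearMap.range P)).IsIndec}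
  have hne : ∀ P : ι, ∃ x, P.1 x ≠ 0 := by
    intro P
    by_contra! hcon
    refine P.2.2.1 (rank_eq_zero_iff.mpr ?_)
    rintro ⟨_, u, rfl⟩
    exact Subtype.ext (hcon u)
  choose v hv using hne
  have horth : ∀ P Q : ι, P ≠ Q → W.form (P.1 (v P)) (Q.1 (v Q)) = 0 := by
    intro P Q hPQ
    rcases P.2.1.eq_or_comp_eq_zero Q.2.1 P.2.2 Q.2.2 with h | h
    · exact absurd (Subtype.ext h) hPQ
    · rw [P.2.1.symm, h, map_zero]
  have hli : LinearIndependent (𝓞 K) fun P : ι => P.1 (v P) := by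
    rw [linearIndependent_iff']
    intro s g hg P hP
    have h1 := congrArg (fun z => W.form (P.1 (v P)) z) hg
    simp only [map_sum, map_smul, smul_eq_mul, map_zero] at h1
    rw [Finset.sum_eq_single P (fun Q _ hQ => by rw [horth P Q hQ.symm, mul_zero])
      (fun h => absurd hP h)] at h1
    exact (mul_eq_zero.mp h1).resolve_right fun h => hv P (W.form_self_eq_zero.mp h)
  have hfin : Finite ι := hli.finite
  have hft : Fintype ι := Fintype.ofFinite ι
  refine ⟨ι, hft, fun P => W.restrict (LinearMap.range P.1), ?_, ?_⟩
  · rw [rank_eq_finrank]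
    exact_mod_cast hli.fintype_card_le_finrank
  · rintro M ⟨hM, hMi, hWM⟩
    obtain ⟨P, hP, hMP⟩ := hM.exists_isProj hWM
    exact ⟨⟨P, hP, hMP.isIndec hMi⟩, hMP⟩

end OKLattice

namespace OKLattice

variable {K : Type} [Field K] [NumberField K]

variable (K) in
theorem exists_rank_eq (k : ℕ) : ∃ L : OKLattice K, L.rank = k := by
  have h : IsGS (1 : Matrix (Fin k) (Fin k) (𝓞 K)) (fun _ => 1) 1 :=
    ⟨fun σ _ => by simp, fun i => by simp, fun i j hij => Matrix.one_apply_ne hij.ne,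
      fun i j => by simp [Matrix.one_apply]⟩
  obtain ⟨L, hL, -⟩ := h.exists_lattice
  exact ⟨L, hL⟩

theorem IsUniversal.represents {W : OKLattice K} {n : ℕ} (hW : W.IsUniversal n) {L : OKLattice K}
    (hL : L.rank ≤ n) : W.Represents L := by
  obtain ⟨E, hE⟩ := exists_rank_eq K (n - L.rank)
  exact (hW (L.prod E) (by rw [rank_prod]; omega)).trans (L.prod_represents_left E)

theorem isometric_zero {L : OKLattice K} (h : L.rank = 0) : L.Isometric (zero K) := by
  have h0 := rank_eq_zero_iff.mp h
  refine ⟨{ toFun := fun _ => PUnit.unit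
            map_add' := fun _ _ => rfl
            map_smul' := fun _ _ => rfl
            invFun := fun _ => 0
            left_inv := fun x => (h0 x).symm
            right_inv := fun _ => rfl }, fun x y => ?_⟩
  rw [h0 x, map_zero, map_zero, LinearMap.zero_apply, map_zero, LinearMap.zero_apply]

/-- Bounding the number of unimodular lattices by the number of indecomposable ones. -/
theorem covered_isUnimodular {G κ : ℝ} (hG : 1 ≤ G) (hκ : 0 ≤ κ) {N : ℕ}
    (h : ∀ r, 1 ≤ r → r ≤ N → Covered (K := K) (fun M => M.IsUnimodular ∧ M.IsIndec ∧ M.rank = r)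
      (G * Real.exp (κ * r ^ 2))) (s : ℕ) (hs : s ≤ N) :
    Covered (K := K) (fun M => M.IsUnimodular ∧ M.rank = s)
      ((G * N) ^ s * Real.exp (κ * s ^ 2)) := by
  induction s using Nat.strong_induction_on with
  | _ s ih =>
    rcases Nat.eq_zero_or_pos s with rfl | hs0
    · exact ⟨Unit, inferInstance, fun _ => zero K, by simp, fun L hL =>
        ⟨(), isometric_zero hL.2⟩⟩
    have h1 : ∀ r : Fin s, Covered (K := K) (fun M => M.IsUnimodular ∧ M.IsIndec ∧ M.rank = r + 1)
      (G * Real.exp (κ * (r + 1 : ℕ) ^ 2)) := fun r => h _ (by omega) (by omega)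
    have h2 := fun r : Fin s => ih (s - 1 - r) (by omega) (by omega)
    choose ι hι F hF hFs using h1
    choose ι' hι' F' hF' hFs' using h2
    refine ⟨Σ r : Fin s, ι r × ι' r, inferInstance, fun q => (F q.1 q.2.1).prod (F' q.1 q.2.2),
      ?_, ?_⟩
    · rw [Fintype.card_sigma]
      push_cast [Fintype.card_prod]
      have hN : (1 : ℝ) ≤ N := by exact_mod_cast (by omega : 1 ≤ N)
      have hGN : 1 ≤ G * N := one_le_mul_of_one_le_of_one_le hG hN
      calc ∑ r : Fin s, (Fintype.card (ι r) : ℝ) * Fintype.card (ι' r)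
          ≤ ∑ _r : Fin s, G * (G * N) ^ (s - 1) * Real.exp (κ * s ^ 2) := by
            refine Finset.sum_le_sum fun r _ => ?_
            calc (Fintype.card (ι r) : ℝ) * Fintype.card (ι' r)
                ≤ (G * Real.exp (κ * (r + 1 : ℕ) ^ 2)) * ((G * N) ^ (s - 1 - (r : ℕ))
                    * Real.exp (κ * (s - 1 - r : ℕ) ^ 2)) := by
                  exact mul_le_mul (hF r) (hF' r) (Nat.cast_nonneg _) (by positivity)
              _ = G * (G * N) ^ (s - 1 - (r : ℕ))
                    * Real.exp (κ * ((r + 1 : ℕ) ^ 2 + (s - 1 - r : ℕ) ^ 2)) := by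
                  rw [mul_add, Real.exp_add]; ring
              _ ≤ G * (G * N) ^ (s - 1) * Real.exp (κ * s ^ 2) := by
                  have h3 : ((r + 1 : ℕ) : ℝ) ^ 2 + ((s - 1 - r : ℕ) : ℝ) ^ 2 ≤ s ^ 2 := by
                    have h4 : (s : ℝ) = (r + 1 : ℕ) + (s - 1 - r : ℕ) := by
                      exact_mod_cast (by omega : s = (r + 1) + (s - 1 - r))
                    rw [h4]
                    have : (0 : ℝ) ≤ ((r + 1 : ℕ) : ℝ) * ((s - 1 - r : ℕ) : ℝ) := by positivity
                    nlinarith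
                  have h5 : (G * N) ^ (s - 1 - (r : ℕ)) ≤ (G * N) ^ (s - 1) :=
                    pow_le_pow_right₀ hGN (by omega)
                  gcongr
        _ = s * (G * (G * N) ^ (s - 1) * Real.exp (κ * s ^ 2)) := by simp
        _ ≤ N * (G * (G * N) ^ (s - 1) * Real.exp (κ * s ^ 2)) := by gcongr
        _ = (G * N) ^ s * Real.exp (κ * s ^ 2) := by
            obtain ⟨t, rfl⟩ : ∃ t, s = t + 1 := ⟨s - 1, by omega⟩
            rw [Nat.add_sub_cancel, pow_succ]; ring
    · rintro L ⟨hLu, hLr⟩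
      obtain ⟨P, hP, hPi⟩ := L.exists_isIndec (by omega)
      have hrk := hP.rank_add
      have hr0 := hPi.1
      have hlt : (L.restrict (LinearMap.range P)).rank - 1 < s := by omega
      obtain ⟨i, hi⟩ := hFs ⟨_, hlt⟩ _ ⟨hP.isUnimodular hLu, hPi, by dsimp only; omega⟩
      obtain ⟨j, hj⟩ := hFs' ⟨_, hlt⟩ (L.restrict (LinearMap.range (LinearMap.id - P)))
        ⟨hP.one_sub.isUnimodular hLu, by dsimp only; omega⟩
      exact ⟨⟨_, i, j⟩, hP.isometric_prod.trans (hi.prod hj)⟩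

/-- Distinct Gram matrices with constant diagonal force many isometry classes. -/
theorem card_le_of_covered [htr : Fact (TotallyReal K)] {n m a : ℕ} {H : ℝ}
    (h : Covered (K := K) (fun M => M.IsUnimodular ∧ M.rank = n) H)
    (S : Finset (Matrix (Fin m) (Fin m) (𝓞 K)))
    (hS : ∀ A ∈ S, ∃ U : OKLattice K, U.IsUnimodular ∧ U.rank = n ∧ ∃ e : Fin m → U.carrier,
      ∀ i j, U.form (e i) (e j) = A i j) (ha : ∀ A ∈ S, ∀ i, A i i = a) :
    (S.card : ℝ) ≤ ((n * Module.finrank ℚ K + 1) ^ (2 * (a * Module.finrank ℚ K)) : ℕ) ^ m * H := by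
  classical
  obtain ⟨ι, hι, F, hF, hFs⟩ := h
  have h1 : ∀ A ∈ S, ∃ i : ι, (F i).rank = n ∧ ∃ e : Fin m → (F i).carrier,
      ∀ k l, (F i).form (e k) (e l) = A k l := by
    intro A hA
    obtain ⟨U, hU, hUr, e, he⟩ := hS A hA
    obtain ⟨i, f, hf⟩ := hFs U ⟨hU, hUr⟩
    exact ⟨i, by rw [← hUr]; exact Isometric.rank_eq (Isometric.symm ⟨f, hf⟩), fun k => f (e k),
      fun k l => by rw [hf, he]⟩
  have hne : S.Nonempty → Nonempty ι := fun ⟨A, hA⟩ => ⟨(h1 A hA).choose⟩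
  rcases S.eq_empty_or_nonempty with rfl | hSne
  · have : 0 ≤ H := (Nat.cast_nonneg _).trans hF
    simpa using by positivity
  have hι' := hne hSne
  choose! i hi e he using h1
  set b := (n * Module.finrank ℚ K + 1) ^ (2 * (a * Module.finrank ℚ K)) with hb
  have hcard : S.card ≤ b ^ m * Fintype.card ι := by
    refine Finset.card_le_mul_card_image_of_maps_to (f := i) (t := Finset.univ)
      (fun _ _ => Finset.mem_univ _) _ fun k _ => ?_
    by_cases hk : ∃ A ∈ S, i A = k
    · obtain ⟨A₀, hA₀, hk⟩ := hk
      have hrk : (F k).rank = n := hk ▸ hi A₀ hA₀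
      have h2 : ∀ A ∈ S.filter fun A => i A = k, ∃ e : Fin m → (F k).carrier,
          ∀ j l, (F k).form (e j) (e l) = A j l := by
        intro A hA
        obtain ⟨hAS, rfl⟩ := Finset.mem_filter.mp hA
        exact ⟨e A, he A hAS⟩
      choose! g hg using h2
      set T : Finset (F k).carrier :=
        (S.filter fun A => i A = k).biUnion fun A => Finset.univ.image (g A) with hT
      have hTc : T.card ≤ b := by
        rw [hb, ← hrk]
        refine (F k).card_le_of_form_eq a T fun x hx => ?_
        obtain ⟨A, hA, hx⟩ := Finset.mem_biUnion.mp hx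
        obtain ⟨j, -, rfl⟩ := Finset.mem_image.mp hx
        rw [hg A hA, ha A (Finset.mem_filter.mp hA).1]
      have h3 : (S.filter fun A => i A = k).card ≤ (Fintype.piFinset fun _ : Fin m => T).card := by
        refine Finset.card_le_card_of_injOn g (fun A hA => ?_) fun A hA A' hA' hAA => ?_
        · exact Fintype.mem_piFinset.mpr fun j => Finset.mem_biUnion.mpr
            ⟨A, hA, Finset.mem_image_of_mem _ (Finset.mem_univ j)⟩
        · ext j l
          rw [← hg A hA, ← hg A' hA', hAA]
      refine h3.trans ?_
      rw [Fintype.card_piFinset, Finset.prod_const, Finset.card_univ, Fintype.card_fin]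
      exact Nat.pow_le_pow_left hTc m
    · rw [Finset.filter_eq_empty_iff.mpr fun A hA hAk => hk ⟨A, hA, hAk⟩]
      simp
  calc (S.card : ℝ) ≤ (b : ℝ) ^ m * Fintype.card ι := by exact_mod_cast hcard
    _ ≤ (b : ℝ) ^ m * H := by gcongr

end OKLattice

section Lower

variable {K : Type} [Field K] [NumberField K] [htr : Fact (TotallyReal K)]

theorem minUnivRank_spec {n : ℕ} (h : ∃ L : OKLattice K, L.IsUniversal n) :
    ∃ L : OKLattice K, L.IsUniversal n ∧ L.rank = minUnivRank K n := by
  obtain ⟨L, hL⟩ := h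
  exact Nat.sInf_mem (s := {m | ∃ L : OKLattice K, L.IsUniversal n ∧ L.rank = m}) ⟨_, L, hL, rfl⟩

theorem covered_of_minUnivRank_le (hex : ∀ n, ∃ L : OKLattice K, L.IsUniversal n) {θ : ℝ}
    (hθ : 0 ≤ θ) {n₀ : ℕ}
    (h : ∀ n ≥ n₀, (minUnivRank K n : ℝ) ≤ Real.exp (θ * Real.log n * n ^ 2)) :
    ∃ G : ℝ, 1 ≤ G ∧ ∀ N ≥ n₀, OKLattice.Covered (K := K) (fun M => M.IsUnimodular ∧ M.rank = N)
      ((G * N) ^ N * Real.exp (θ * Real.log N * N ^ 2)) := by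
  refine ⟨max 1 (minUnivRank K n₀), le_max_left _ _, fun N hN => ?_⟩
  have hlog : ∀ n : ℕ, 0 ≤ Real.log n := Real.log_natCast_nonneg
  refine OKLattice.covered_isUnimodular (le_max_left _ _) (mul_nonneg hθ (hlog N))
    (fun r hr1 hrN => ?_) N le_rfl
  rcases le_or_gt n₀ r with hr | hr
  · obtain ⟨W, hW, hWr⟩ := minUnivRank_spec (hex r)
    refine (OKLattice.covered_isIndec W).mono ?_ fun L hL =>
      ⟨hL.1, hL.2.1, hW.represents hL.2.2.le⟩
    rw [hWr]
    refine (h r hr).trans ?_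
    have h1 : Real.exp (θ * Real.log r * r ^ 2) ≤ Real.exp (θ * Real.log N * r ^ 2) := by
      have : Real.log r ≤ Real.log N :=
        Real.log_le_log (by exact_mod_cast hr1) (by exact_mod_cast hrN)
      gcongr
    exact h1.trans (le_mul_of_one_le_left (Real.exp_pos _).le (le_max_left _ _))
  · obtain ⟨W, hW, hWr⟩ := minUnivRank_spec (hex n₀)
    refine (OKLattice.covered_isIndec W).mono ?_ fun L hL =>
      ⟨hL.1, hL.2.1, hW.represents (by omega)⟩
    rw [hWr]
    refine (le_max_right 1 _).trans (le_mul_of_one_le_right (by positivity) ?_)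
    exact Real.one_le_exp (mul_nonneg (mul_nonneg hθ (hlog N)) (sq_nonneg _))

variable (K) in
theorem exists_card_bound : ∃ (c : ℕ) (C : ℝ), 1 ≤ C ∧ ∀ N > c, ∀ a : ℕ, 0 < a → ∀ H : ℝ,
    OKLattice.Covered (K := K) (fun M => M.IsUnimodular ∧ M.rank = N) H →
    ∏ i ∈ Finset.range (N - c), ((a : ℝ) / (C * √(N - c : ℕ))) ^ (Module.finrank ℚ K * i)
      ≤ ((N * Module.finrank ℚ K + 1) ^ (2 * (a * Module.finrank ℚ K)) : ℕ) ^ (N - c) * H := by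
  obtain ⟨c, hc⟩ := exists_isUnimodular K
  obtain ⟨C, hC, hS⟩ := exists_many_matrices K
  refine ⟨c, C, hC, fun N hN a ha H hH => ?_⟩
  obtain ⟨S, hSc, hSA⟩ := hS (N - c) a (by omega) ha (N - c) le_rfl
  rw [card_emb] at hSc
  refine hSc.trans (OKLattice.card_le_of_covered hH S (fun A hA => ?_) fun A hA => (hSA A hA).1)
  obtain ⟨-, h, μ, hGS, -⟩ := hSA A hA
  obtain ⟨L, hL, e, he⟩ := hGS.exists_lattice
  obtain ⟨U, hUr, hU, i, hi⟩ := hc L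
  exact ⟨U, hU, by omega, fun k => i (e k), fun k l => by
    rw [OKLattice.form_eq_of_norm_eq i hi, he]⟩

theorem prod_range_pow_mul (x : ℝ) (d m : ℕ) :
    ∏ i ∈ Finset.range m, x ^ (d * i) = x ^ (d * (m * (m - 1) / 2)) := by
  rw [Finset.prod_pow_eq_pow_sum, ← Finset.mul_sum, Finset.sum_range_id]

theorem exists_log_bound (hex : ∀ n, ∃ L : OKLattice K, L.IsUniversal n) {θ : ℝ}
    (hθ : 0 ≤ θ) {n₀ : ℕ}
    (h : ∀ n ≥ n₀, (minUnivRank K n : ℝ) ≤ Real.exp (θ * Real.log n * n ^ 2)) :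
    ∃ c C G : ℝ, 0 ≤ c ∧ 1 ≤ C ∧ 1 ≤ G ∧ ∀ N : ℕ, n₀ ≤ N → c < N → ∀ a : ℕ, 0 < a →
      C * √N ≤ a →
      (Module.finrank ℚ K : ℝ) / 2 * (N - c) ^ 2 * (Real.log a - Real.log C - Real.log N / 2)
        ≤ 2 * a * Module.finrank ℚ K * N * (Real.log (Module.finrank ℚ K + 1) + Real.log N)
          + N * (Real.log G + Real.log N) + θ * Real.log N * N ^ 2 := by
  obtain ⟨G, hG, hcov⟩ := covered_of_minUnivRank_le hex hθ h
  obtain ⟨c, C, hC, hb⟩ := exists_card_bound K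
  set d := Module.finrank ℚ K with hd
  have hd1 : 0 < d := Module.finrank_pos
  refine ⟨(c + 1 : ℕ), C, G, by positivity, hC, hG, fun N hN hcN a ha haN => ?_⟩
  have hcN' : c + 1 < N := by exact_mod_cast hcN
  have hN0 : (1 : ℝ) ≤ N := by exact_mod_cast (by omega : 1 ≤ N)
  have ha0 : (0 : ℝ) < a := by exact_mod_cast ha
  have h1 := hb N (by omega) a ha _ (hcov N hN)
  rw [prod_range_pow_mul] at h1
  set m := N - c with hm
  have hm0 : (0 : ℝ) < m := by exact_mod_cast (by omega : 0 < m)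
  have hmN : (m : ℝ) ≤ N := by exact_mod_cast (by omega : m ≤ N)
  have h2 : (a : ℝ) / (C * √N) ≤ a / (C * √m) := by gcongr
  have h3 : 1 ≤ (a : ℝ) / (C * √N) := by rwa [le_div_iff₀ (by positivity), one_mul]
  have h4 := (pow_le_pow_left₀ (by positivity) h2 (d * (m * (m - 1) / 2))).trans h1
  have h5 := Real.log_le_log (by positivity) h4
  have hb0 : (0 : ℝ) < ((N * d + 1) ^ (2 * (a * d)) : ℕ) := by positivity
  rw [Real.log_mul (by positivity) (by positivity), Real.log_mul (by positivity) (by positivity),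
    Real.log_exp, Real.log_pow, Real.log_pow, Real.log_pow, Nat.cast_pow, Real.log_pow,
    Real.log_mul (by positivity) (by positivity), Real.log_div (by positivity) (by positivity),
    Real.log_mul (by positivity) (by positivity), Real.log_sqrt (by positivity)] at h5
  have h6 : Real.log ((N * d + 1 : ℕ) : ℝ) ≤ Real.log (d + 1) + Real.log N := by
    rw [← Real.log_mul (by positivity) (by positivity)]
    refine Real.log_le_log (by positivity) ?_
    push_cast
    nlinarith
  have h7 : 0 ≤ Real.log a - Real.log C - Real.log N / 2 := by
    have := Real.log_nonneg h3
    rw [Real.log_div (by positivity) (by positivity), Real.log_mul (by positivity) (by positivity),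
      Real.log_sqrt (by positivity)] at this
    linarith
  have h8 : (d : ℝ) / 2 * (N - (c + 1 : ℕ)) ^ 2 ≤ ((d * (m * (m - 1) / 2) : ℕ) : ℝ) := by
    have h9 : m * (m - 1) / 2 * 2 = m * (m - 1) :=
      Nat.div_mul_cancel (Nat.even_mul_pred_self m).two_dvd
    have h10 : ((m * (m - 1) / 2 : ℕ) : ℝ) * 2 = m * (m - 1) := by
      have := congrArg (Nat.cast (R := ℝ)) h9
      rw [Nat.cast_mul, Nat.cast_mul m, Nat.cast_sub (show 1 ≤ m by omega), Nat.cast_one] at this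
      exact this
    have h11 : (N : ℝ) - (c + 1 : ℕ) = m - 1 := by
      rw [hm, Nat.cast_sub (by omega)]; push_cast; ring
    have h12 : (1 : ℝ) ≤ m := by exact_mod_cast (by omega : 1 ≤ m)
    rw [h11, Nat.cast_mul]
    have h13 : ((m : ℝ) - 1) ^ 2 ≤ ((m * (m - 1) / 2 : ℕ) : ℝ) * 2 := by rw [h10]; nlinarith
    have h14 : (0 : ℝ) < d := by exact_mod_cast hd1
    nlinarith
  calc (d : ℝ) / 2 * (N - (c + 1 : ℕ)) ^ 2 * (Real.log a - Real.log C - Real.log N / 2)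
      ≤ ((d * (m * (m - 1) / 2) : ℕ) : ℝ) * (Real.log a - Real.log C - Real.log N / 2) := by
        gcongr
    _ = ((d * (m * (m - 1) / 2) : ℕ) : ℝ) * (Real.log a - (Real.log C + Real.log N / 2)) := by ring
    _ ≤ _ := h5
    _ ≤ _ := by
      rw [← add_assoc]
      have h15 : (m : ℝ) * (((2 * (a * d) : ℕ) : ℝ) * Real.log ((N * d + 1 : ℕ) : ℝ))
          ≤ N * (((2 * (a * d) : ℕ) : ℝ) * (Real.log (d + 1) + Real.log N)) := by
        have : 0 ≤ Real.log ((N * d + 1 : ℕ) : ℝ) := Real.log_natCast_nonneg _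
        gcongr
      refine add_le_add (add_le_add (h15.trans (le_of_eq ?_)) le_rfl) le_rfl
      push_cast
      ring

end Lower

open Filter Topology in
theorem not_eventually_le_exp {K : Type} [Field K] [NumberField K] [htr : Fact (TotallyReal K)]
    (hex : ∀ n, ∃ L : OKLattice K, L.IsUniversal n) {δ : ℝ} (hδ : 0 < δ) (hδ1 : δ < 1) :
    ¬ ∀ᶠ n : ℕ in atTop, (minUnivRank K n : ℝ)
      ≤ Real.exp ((1 - δ) * ((Module.finrank ℚ K : ℝ) / 4) * Real.log n * n ^ 2) := by
  intro hev
  obtain ⟨n₁, hn₁⟩ := eventually_atTop.mp hev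
  set d : ℝ := (Module.finrank ℚ K : ℝ) with hd
  have hd0 : 0 < d := by
    have : 0 < Module.finrank ℚ K := Module.finrank_pos
    rw [hd]; exact_mod_cast this
  obtain ⟨c, C, G, hc, hC, hG, hb⟩ := exists_log_bound hex
    (θ := (1 - δ) * (d / 4)) (mul_nonneg (by linarith) (by positivity))
    (n₀ := max n₁ 1) (fun n hn => hn₁ n (le_trans (le_max_left _ _) hn))
  have hcast : Tendsto (fun N : ℕ => (N : ℝ)) atTop atTop := tendsto_natCast_atTop_atTop
  have hlog : Tendsto (fun N : ℕ => Real.log N) atTop atTop := Real.tendsto_log_atTop.comp hcast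
  have hy : Tendsto (fun N : ℕ => (Real.log N)⁻¹) atTop (𝓝 0) := tendsto_inv_atTop_zero.comp hlog
  have hz : Tendsto (fun N : ℕ => ((N : ℝ))⁻¹) atTop (𝓝 0) := tendsto_inv_atTop_zero.comp hcast
  have hw : Tendsto (fun N : ℕ => (N : ℝ) ^ (-(δ / 4))) atTop (𝓝 0) :=
    (tendsto_rpow_neg_atTop (by linarith)).comp hcast
  have hv : Tendsto (fun N : ℕ => (N : ℝ) ^ (1 / 2 - δ / 4)) atTop atTop :=
    (tendsto_rpow_atTop (by linarith)).comp hcast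
  have hle : ∀ᶠ N : ℕ in atTop,
      2 * (1 - c * ((N : ℝ))⁻¹) ^ 2 * (1 / 2 - δ / 4 - Real.log C * (Real.log N)⁻¹)
        ≤ 16 * (N : ℝ) ^ (-(δ / 4)) * (Real.log (d + 1) * (Real.log N)⁻¹ + 1)
          + 4 / d * ((N : ℝ))⁻¹ * (Real.log G * (Real.log N)⁻¹ + 1) + (1 - δ) := by
    filter_upwards [eventually_ge_atTop (max n₁ 1), hcast.eventually_gt_atTop c,
      hlog.eventually_gt_atTop 0, hv.eventually_ge_atTop C] with N hN hcN hl hCN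
    have hN0 : (0 : ℝ) < N := hc.trans_lt hcN
    have hN1 : (1 : ℝ) ≤ N := by exact_mod_cast (le_max_right _ _).trans hN
    set b : ℝ := (N : ℝ) ^ (1 - δ / 4) with hbdef
    have hb1 : 1 ≤ b := Real.one_le_rpow hN1 (by linarith)
    have hbw : b = N * (N : ℝ) ^ (-(δ / 4)) := by
      rw [hbdef, sub_eq_add_neg, Real.rpow_add hN0, Real.rpow_one]
    have hbs : C * √N ≤ b := by
      have : b = (N : ℝ) ^ (1 / 2 - δ / 4) * √N := by
        rw [hbdef, Real.sqrt_eq_rpow, ← Real.rpow_add hN0]; congr 1; ring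
      rw [this]; gcongr
    have ha1 : b ≤ ⌈b⌉₊ := Nat.le_ceil b
    have ha2 : (⌈b⌉₊ : ℝ) ≤ 2 * b := by
      have := Nat.ceil_lt_add_one (by linarith : 0 ≤ b)
      linarith
    have h := hb N hN hcN ⌈b⌉₊ (by
      rw [Nat.ceil_pos]; linarith) (hbs.trans ha1)
    have hla : (1 - δ / 4) * Real.log N ≤ Real.log ⌈b⌉₊ := by
      rw [← Real.log_rpow hN0]
      exact Real.log_le_log (by linarith) ha1
    have hP : 0 < d / 4 * N ^ 2 * Real.log N := by positivity
    refine le_of_mul_le_mul_left ?_ hP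
    have hld : 0 ≤ Real.log (d + 1) + Real.log N :=
      add_nonneg (Real.log_nonneg (by linarith)) hl.le
    calc d / 4 * N ^ 2 * Real.log N * (2 * (1 - c * ((N : ℝ))⁻¹) ^ 2
          * (1 / 2 - δ / 4 - Real.log C * (Real.log N)⁻¹))
        = d / 2 * (N - c) ^ 2 * ((1 - δ / 4) * Real.log N - Real.log C - Real.log N / 2) := by
          field_simp; ring
      _ ≤ d / 2 * (N - c) ^ 2 * (Real.log ⌈b⌉₊ - Real.log C - Real.log N / 2) := by gcongr
      _ ≤ _ := h
      _ ≤ 2 * (2 * b) * d * N * (Real.log (d + 1) + Real.log N)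
          + N * (Real.log G + Real.log N)
          + (1 - δ) * (d / 4) * Real.log N * N ^ 2 := by gcongr
      _ = _ := by
          rw [hbw]; field_simp; ring
  have h1 : Tendsto (fun N : ℕ =>
      2 * (1 - c * ((N : ℝ))⁻¹) ^ 2 * (1 / 2 - δ / 4 - Real.log C * (Real.log N)⁻¹)) atTop
      (𝓝 (2 * (1 - c * 0) ^ 2 * (1 / 2 - δ / 4 - Real.log C * 0))) :=
    (((tendsto_const_nhds.sub (hz.const_mul c)).pow 2).const_mul 2).mul
      (tendsto_const_nhds.sub (hy.const_mul _))
  have h2 : Tendsto (fun N : ℕ =>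
      16 * (N : ℝ) ^ (-(δ / 4)) * (Real.log (d + 1) * (Real.log N)⁻¹ + 1)
          + 4 / d * ((N : ℝ))⁻¹ * (Real.log G * (Real.log N)⁻¹ + 1) + (1 - δ)) atTop
      (𝓝 (16 * 0 * (Real.log (d + 1) * 0 + 1) + 4 / d * 0 * (Real.log G * 0 + 1) + (1 - δ))) :=
    (((hw.const_mul 16).mul ((hy.const_mul _).add_const 1)).add
      ((hz.const_mul _).mul ((hy.const_mul _).add_const 1))).add_const _
  have h3 := le_of_tendsto_of_tendsto h1 h2 hle
  linarith

section Index

open scoped Matrix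

variable {K : Type} [Field K] [NumberField K]

/-- The index of the image of a matrix over the ring of integers. -/
theorem card_quotient_range_mulVecLin {k : ℕ} (A : Matrix (Fin k) (Fin k) (𝓞 K)) (hA : A.det ≠ 0) :
    Nat.card ((Fin k → 𝓞 K) ⧸ LinearMap.range A.mulVecLin) = nmN A.det := by
  have hinj : Function.Injective (A.mulVecLin.restrictScalars ℤ) :=
    Matrix.mulVec_injective_of_det_ne_zero hA
  have h1 := Submodule.natAbs_det_equiv (LinearMap.range (A.mulVecLin.restrictScalars ℤ))
    (LinearEquiv.ofInjective _ hinj)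
  have h2 : (LinearMap.range (A.mulVecLin.restrictScalars ℤ)).subtype ∘ₗ
      AddMonoidHom.toIntLinearMap ((LinearEquiv.ofInjective _ hinj : _ ≃ₗ[ℤ] _) : _ →+ _) =
      A.mulVecLin.restrictScalars ℤ := by
    ext; rfl
  rw [h2, LinearMap.det_restrictScalars] at h1
  rw [← Matrix.toLin'_apply', LinearMap.det_toLin'] at h1
  exact h1.symm

end Index

section Projections

variable {K : Type} [Field K] {V : Type*} [AddCommGroup V] [Module K V]
  (B : LinearMap.BilinForm K V)

/-- The endomorphism subtracting the component along `u`. -/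
def removeComp (u : V) : V →ₗ[K] V :=
  LinearMap.id - ((B u u)⁻¹ • B.flip u).smulRight u

theorem removeComp_apply (u v : V) : removeComp B u v = v - ((B u u)⁻¹ * B v u) • u := by
  simp [removeComp]

/-- The orthogonal projection away from the first vectors of a sequence. -/
def gsProj (e : ℕ → V) : ℕ → V →ₗ[K] V
  | 0 => LinearMap.id
  | k + 1 => removeComp B (gsProj e k (e k)) ∘ₗ gsProj e k

/-- The orthogonalised vector. -/
def gsVec (e : ℕ → V) (k : ℕ) : V := gsProj B e k (e k)

/-- The norm of an orthogonalised vector. -/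
def gsNorm (e : ℕ → V) (k : ℕ) : K := B (gsVec B e k) (gsVec B e k)

/-- The coefficient of a vector along an orthogonalised vector. -/
def gsCoeff (e : ℕ → V) (k : ℕ) (v : V) : K :=
  (gsNorm B e k)⁻¹ * B (gsProj B e k v) (gsVec B e k)

variable (e : ℕ → V)

@[simp] theorem gsProj_zero : gsProj B e 0 = LinearMap.id := rfl

theorem gsProj_succ (k : ℕ) (v : V) :
    gsProj B e (k + 1) v = gsProj B e k v - gsCoeff B e k v • gsVec B e k :=
  removeComp_apply _ _ _

theorem gsProj_congr {e e' : ℕ → V} {k : ℕ} (h : ∀ i < k, e i = e' i) :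
    gsProj B e k = gsProj B e' k := by
  induction k with
  | zero => rfl
  | succ k ih =>
    simp only [gsProj, ih fun i hi => h i (hi.trans k.lt_succ_self), h k k.lt_succ_self]

theorem gsCoeff_add (k : ℕ) (v w : V) :
    gsCoeff B e k (v + w) = gsCoeff B e k v + gsCoeff B e k w := by
  simp only [gsCoeff, map_add, LinearMap.add_apply, mul_add]

theorem gsCoeff_smul (k : ℕ) (c : K) (v : V) : gsCoeff B e k (c • v) = c * gsCoeff B e k v := by
  simp only [gsCoeff, map_smul, LinearMap.smul_apply, smul_eq_mul]; ring

theorem gsProj_eq_zero_of_le {j k : ℕ} (h : j ≤ k) {v : V} (hv : gsProj B e j v = 0) :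
    gsProj B e k v = 0 := by
  induction k, h using Nat.le_induction with
  | base => exact hv
  | succ k _ ih => rw [gsProj_succ, gsCoeff, ih, map_zero, LinearMap.zero_apply]; simp

theorem gsCoeff_eq_zero {k : ℕ} {v : V} (hv : gsProj B e k v = 0) : gsCoeff B e k v = 0 := by
  rw [gsCoeff, hv, map_zero, LinearMap.zero_apply, mul_zero]

variable {B}

theorem gsCoeff_self {k : ℕ} (h : gsNorm B e k ≠ 0) : gsCoeff B e k (e k) = 1 := by
  rw [gsCoeff, ← gsVec, ← gsNorm, inv_mul_cancel₀ h]

theorem exists_sub_gsProj_eq (k : ℕ) (v : V) :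
    ∃ x : Fin k → K, v - gsProj B e k v = ∑ i, x i • e i := by
  induction k generalizing v with
  | zero => exact ⟨0, by simp⟩
  | succ k ih =>
    obtain ⟨x, hx⟩ := ih v
    obtain ⟨y, hy⟩ := ih (e k)
    rw [← gsVec] at hy
    refine ⟨Fin.snoc (α := fun _ => K) (x - gsCoeff B e k v • y) (gsCoeff B e k v), ?_⟩
    have h1 : gsVec B e k = e k - ∑ i : Fin k, y i • e i := by rw [← hy]; abel
    rw [gsProj_succ, Fin.sum_univ_castSucc, h1]
    simp only [Fin.snoc_castSucc, Fin.snoc_last, Fin.val_castSucc, Fin.val_last, Pi.sub_apply,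
      Pi.smul_apply, smul_eq_mul, sub_smul, mul_smul, Finset.sum_sub_distrib, ← Finset.smul_sum,
      smul_sub, ← hx]
    abel

variable [NumberField K] [htr : Fact (TotallyReal K)]

theorem gsVec_eq_zero_of_norm (hB : IsPD B) {k : ℕ} (h : gsNorm B e k = 0) : gsVec B e k = 0 := by
  by_contra hne
  obtain ⟨σ⟩ := nonempty_emb (K := K)
  have := hB.pos _ hne σ
  rw [← gsNorm, h, map_zero] at this
  exact lt_irrefl _ this

theorem form_gsProj_succ_gsVec (hB : IsPD B) (k : ℕ) (v : V) :
    B (gsProj B e (k + 1) v) (gsVec B e k) = 0 := by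
  rw [gsProj_succ, map_sub, LinearMap.sub_apply, map_smul, LinearMap.smul_apply, smul_eq_mul,
    ← gsNorm, gsCoeff]
  by_cases h : gsNorm B e k = 0
  · rw [gsVec_eq_zero_of_norm e hB h]; simp
  · field_simp; ring

theorem form_gsProj_gsVec (hB : IsPD B) {j k : ℕ} (h : j < k) (v : V) :
    B (gsProj B e k v) (gsVec B e j) = 0 := by
  induction k, Nat.succ_le_of_lt h using Nat.le_induction generalizing v with
  | base => exact form_gsProj_succ_gsVec e hB j v
  | succ k hk ih =>
    have h1 : j < k := hk
    rw [gsProj_succ, map_sub, LinearMap.sub_apply, map_smul, LinearMap.smul_apply, ih h1 v]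
    have h2 := ih h1 (e k)
    rw [← gsVec] at h2
    rw [h2]; simp

theorem form_gsProj_eq (hB : IsPD B) {j k : ℕ} (h : j ≤ k) (v w : V) :
    B (gsProj B e k v) (gsProj B e j w) = B (gsProj B e k v) w := by
  induction j with
  | zero => rfl
  | succ j ih =>
    rw [gsProj_succ, map_sub, map_smul, form_gsProj_gsVec e hB h, smul_zero, sub_zero,
      ih (Nat.le_of_succ_le h)]

theorem form_eq_sum_add (hB : IsPD B) (k : ℕ) (v w : V) :
    B v w = ∑ l ∈ Finset.range k, gsCoeff B e l v * gsNorm B e l * gsCoeff B e l w +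
      B (gsProj B e k v) (gsProj B e k w) := by
  induction k with
  | zero => simp
  | succ k ih =>
    rw [ih, Finset.sum_range_succ, add_assoc, add_right_inj]
    have h1 := form_gsProj_succ_gsVec e hB k v
    have h2 := form_gsProj_succ_gsVec e hB k w
    have h3 : gsProj B e k v = gsProj B e (k + 1) v + gsCoeff B e k v • gsVec B e k := by
      rw [gsProj_succ]; abel
    have h4 : gsProj B e k w = gsProj B e (k + 1) w + gsCoeff B e k w • gsVec B e k := by
      rw [gsProj_succ]; abel
    have h5 := hB.symm (gsVec B e k) (gsProj B e (k + 1) w)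
    rw [h2] at h5
    rw [h3, h4]
    simp only [map_add, LinearMap.add_apply, map_smul, LinearMap.smul_apply, smul_eq_mul, h1, h5,
      gsNorm]
    ring

theorem form_gsProj_gsProj_eq_sum (hB : IsPD B) {k m : ℕ} (h : k ≤ m) (v w : V) :
    B (gsProj B e k v) (gsProj B e k w) =
      ∑ l ∈ Finset.Ico k m, gsCoeff B e l v * gsNorm B e l * gsCoeff B e l w +
      B (gsProj B e m v) (gsProj B e m w) := by
  have h1 := form_eq_sum_add e hB k v w
  have h2 := form_eq_sum_add e hB m v w
  rw [← Finset.sum_range_add_sum_Ico _ h, add_assoc, h1, add_right_inj] at h2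
  exact h2

theorem gsProj_self (hB : IsPD B) {i k : ℕ} (h : i < k) : gsProj B e k (e i) = 0 := by
  refine gsProj_eq_zero_of_le B e (Nat.succ_le_of_lt h) ?_
  rw [gsProj_succ, gsCoeff, ← gsVec, ← gsNorm]
  by_cases h : gsNorm B e i = 0
  · rw [gsVec_eq_zero_of_norm e hB h]; simp
  · rw [inv_mul_cancel₀ h, one_smul, sub_self]

theorem gsCoeff_self_of_lt (hB : IsPD B) {i l : ℕ} (h : i < l) : gsCoeff B e l (e i) = 0 :=
  gsCoeff_eq_zero B e (gsProj_self e hB h)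

end Projections

namespace OKLattice

section Frames

open scoped Matrix

variable {K : Type} [Field K] [NumberField K] (L : OKLattice K)

/-- The embedding of a lattice in its ambient space. -/
def emb : L.carrier →ₗ[𝓞 K] K ⊗[𝓞 K] L.carrier := TensorProduct.mk (𝓞 K) K L.carrier 1

theorem spaceForm_emb (x y : L.carrier) :
    L.spaceForm (L.emb x) (L.emb y) = algebraMap (𝓞 K) K (L.form x y) := L.spaceForm_tmul x y

theorem emb_smul (a : 𝓞 K) (x : L.carrier) :
    L.emb (a • x) = algebraMap (𝓞 K) K a • L.emb x := by
  rw [map_smul, algebraMap_smul K]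

theorem exists_smul_eq_emb (v : K ⊗[𝓞 K] L.carrier) :
    ∃ b : 𝓞 K, b ≠ 0 ∧ ∃ x : L.carrier, b • v = L.emb x := L.exists_smul_eq_tmul v

/-- The Gram matrix of the first vectors of a sequence. -/
def gram (e : ℕ → L.carrier) (k : ℕ) : Matrix (Fin k) (Fin k) (𝓞 K) :=
  Matrix.of fun i j => L.form (e i) (e j)

/-- The values of the form of a vector with the first vectors of a sequence. -/
def row (e : ℕ → L.carrier) (k : ℕ) (v : L.carrier) : Fin k → 𝓞 K := fun i => L.form v (e i)

/-- The projection of a lattice vector away from the first vectors of a sequence. -/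
def pj (e : ℕ → L.carrier) (k : ℕ) : L.carrier →ₗ[𝓞 K] K ⊗[𝓞 K] L.carrier :=
  (gsProj L.spaceForm (fun i => L.emb (e i)) k).restrictScalars (𝓞 K) ∘ₗ L.emb

/-- The norm of an orthogonalised lattice vector. -/
def gnorm (e : ℕ → L.carrier) (k : ℕ) : K := gsNorm L.spaceForm (fun i => L.emb (e i)) k

/-- The coefficient of a lattice vector along an orthogonalised lattice vector. -/
def gcoeff (e : ℕ → L.carrier) (k : ℕ) (v : L.carrier) : K :=
  gsCoeff L.spaceForm (fun i => L.emb (e i)) k (L.emb v)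

variable (e : ℕ → L.carrier)

theorem gram_succ (k : ℕ) :
    L.gram e (k + 1) = bordered (L.gram e k) (L.row e k (e k)) (L.form (e k) (e k)) := by
  ext i j
  induction i using Fin.lastCases with
  | last =>
    induction j using Fin.lastCases with
    | last => simp [gram]
    | cast j => simp [gram, row]
  | cast i =>
    induction j using Fin.lastCases with
    | last => simp [gram, row, L.symm (e k)]
    | cast j => simp [gram]

theorem gcoeff_smul (k : ℕ) (a : 𝓞 K) (v : L.carrier) :
    L.gcoeff e k (a • v) = algebraMap (𝓞 K) K a * L.gcoeff e k v := by
  rw [gcoeff, emb_smul, gsCoeff_smul]; rfl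

theorem gcoeff_add (k : ℕ) (v w : L.carrier) :
    L.gcoeff e k (v + w) = L.gcoeff e k v + L.gcoeff e k w := by
  rw [gcoeff, map_add, gsCoeff_add]; rfl

/-- The coefficient along an orthogonalised lattice vector as a linear map. -/
def gcoeffLin (k : ℕ) : L.carrier →ₗ[𝓞 K] K where
  toFun := L.gcoeff e k
  map_add' := L.gcoeff_add e k
  map_smul' a v := by rw [gcoeff_smul, RingHom.id_apply, Algebra.smul_def]

theorem gcoeffLin_apply (k : ℕ) (v : L.carrier) : L.gcoeffLin e k v = L.gcoeff e k v := rfl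

theorem pj_succ (k : ℕ) (v : L.carrier) :
    L.pj e (k + 1) v = L.pj e k v - L.gcoeff e k v • L.pj e k (e k) := gsProj_succ _ _ _ _

theorem gnorm_eq (k : ℕ) :
    L.gnorm e k = L.spaceForm (L.pj e k (e k)) (L.pj e k (e k)) := rfl

theorem pj_congr {e e' : ℕ → L.carrier} {k : ℕ} (h : ∀ i < k, e i = e' i) :
    L.pj e k = L.pj e' k := by
  rw [pj, pj, gsProj_congr L.spaceForm fun i hi => by rw [h i hi]]

theorem gram_congr {e e' : ℕ → L.carrier} {k : ℕ} (h : ∀ i < k, e i = e' i) :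
    L.gram e k = L.gram e' k := by
  ext i j; simp [gram, h i i.2, h j j.2]

theorem row_congr {e e' : ℕ → L.carrier} {k : ℕ} (h : ∀ i < k, e i = e' i) (v : L.carrier) :
    L.row e k v = L.row e' k v := by
  ext i; simp [row, h i i.2]

variable [htr : Fact (TotallyReal K)]

theorem emb_injective : Function.Injective L.emb := by
  refine (injective_iff_map_eq_zero L.emb).mpr fun x hx => ?_
  rw [← L.form_self_eq_zero]
  have := L.spaceForm_emb x x
  rw [hx, map_zero] at this
  exact (RingOfIntegers.coe_eq_zero_iff).mp this.symm

theorem gnorm_pos {k : ℕ} (h : L.pj e k (e k) ≠ 0) (σ : K →+* ℝ) : 0 < σ (L.gnorm e k) :=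
  L.isPD_spaceForm.pos _ h σ

theorem gnorm_ne_zero {k : ℕ} (h : L.pj e k (e k) ≠ 0) : L.gnorm e k ≠ 0 := fun h0 =>
  h (L.isPD_spaceForm.eq_zero h0)

theorem pj_self {i k : ℕ} (h : i < k) : L.pj e k (e i) = 0 :=
  gsProj_self (fun i => L.emb (e i)) L.isPD_spaceForm h

theorem pj_sum (k : ℕ) (x : Fin k → 𝓞 K) : L.pj e k (∑ i, x i • e i) = 0 := by
  rw [map_sum]
  refine Finset.sum_eq_zero fun i _ => ?_
  rw [map_smul, L.pj_self e i.2, smul_zero]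

theorem gcoeff_self_of_lt {i k : ℕ} (h : i < k) : L.gcoeff e k (e i) = 0 :=
  gsCoeff_self_of_lt (fun i => L.emb (e i)) L.isPD_spaceForm h

theorem gcoeff_self {k : ℕ} (h : L.pj e k (e k) ≠ 0) : L.gcoeff e k (e k) = 1 :=
  gsCoeff_self (fun i => L.emb (e i)) (L.gnorm_ne_zero e h)

theorem form_eq_sum (k : ℕ) (v w : L.carrier) :
    algebraMap (𝓞 K) K (L.form v w) =
      ∑ l ∈ Finset.range k, L.gcoeff e l v * L.gnorm e l * L.gcoeff e l w +
      L.spaceForm (L.pj e k v) (L.pj e k w) := by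
  rw [← spaceForm_emb]
  exact form_eq_sum_add (fun i => L.emb (e i)) L.isPD_spaceForm k _ _

theorem spaceForm_pj_eq_sum {k m : ℕ} (h : k ≤ m) (v w : L.carrier) :
    L.spaceForm (L.pj e k v) (L.pj e k w) =
      ∑ l ∈ Finset.Ico k m, L.gcoeff e l v * L.gnorm e l * L.gcoeff e l w +
      L.spaceForm (L.pj e m v) (L.pj e m w) :=
  form_gsProj_gsProj_eq_sum (fun i => L.emb (e i)) L.isPD_spaceForm h _ _

theorem isGS_gram {k : ℕ} (h : ∀ j < k, L.pj e j (e j) ≠ 0) :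
    IsGS (L.gram e k) (fun i => L.gnorm e i) (fun i j => L.gcoeff e j (e i)) where
  pos σ i := L.gnorm_pos e (h i i.2) σ
  diag i := L.gcoeff_self e (h i i.2)
  tri i j hij := L.gcoeff_self_of_lt e hij
  eq i j := by
    rw [gram, Matrix.of_apply, L.form_eq_sum e k, L.pj_self e i.2, map_zero, LinearMap.zero_apply,
      add_zero, Finset.sum_range]

theorem exists_projection_coords (k : ℕ) (v : L.carrier) : ∃ x : Fin k → K,
    (∀ j : Fin k, ∑ i, x i * algebraMap (𝓞 K) K (L.gram e k i j) =
      algebraMap (𝓞 K) K (L.row e k v j)) ∧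
    L.spaceForm (L.pj e k v) (L.pj e k v) = algebraMap (𝓞 K) K (L.form v v) -
      ∑ i, x i * algebraMap (𝓞 K) K (L.row e k v i) := by
  obtain ⟨x, hx⟩ := exists_sub_gsProj_eq (B := L.spaceForm) (fun i => L.emb (e i)) k (L.emb v)
  have key : ∀ w : L.carrier, algebraMap (𝓞 K) K (L.form v w) -
      L.spaceForm (L.pj e k v) (L.pj e k w) =
      ∑ i, x i * algebraMap (𝓞 K) K (L.form (e i) w) := by
    intro w
    have h1 : L.spaceForm (L.pj e k v) (L.pj e k w) = L.spaceForm (L.pj e k v) (L.emb w) :=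
      form_gsProj_eq (fun i => L.emb (e i)) L.isPD_spaceForm le_rfl _ _
    have h2 : L.emb v - L.pj e k v = ∑ i, x i • L.emb (e i) := hx
    rw [h1, ← spaceForm_emb, ← LinearMap.sub_apply, ← map_sub, h2]
    simp only [map_sum, map_smul, LinearMap.sum_apply, LinearMap.smul_apply, smul_eq_mul,
      spaceForm_emb]
  refine ⟨x, fun j => ?_, ?_⟩
  · have := key (e j)
    rw [L.pj_self e j.2, map_zero, sub_zero] at this
    exact this.symm
  · have := key v
    simp only [L.symm _ v] at this
    exact eq_sub_of_add_eq (by simp only [row, ← this]; ring)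

end Frames

end OKLattice

section Det

open scoped Matrix

variable {K : Type} [Field K] [NumberField K]

theorem IsGS.det_eq {m : ℕ} {A : Matrix (Fin m) (Fin m) (𝓞 K)} {h : Fin m → K}
    {μ : Matrix (Fin m) (Fin m) K} (hA : IsGS A h μ) :
    algebraMap (𝓞 K) K A.det = ∏ i, h i := by
  have h1 : (algebraMap (𝓞 K) K).mapMatrix A = μ * Matrix.diagonal h * μᵀ := by
    ext i j
    rw [RingHom.mapMatrix_apply, Matrix.map_apply, hA.eq, Matrix.mul_apply]
    simp [Matrix.mul_diagonal]
  have h2 : μ.det = 1 := by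
    rw [Matrix.det_of_isLowerTriangular μ fun i j hij => hA.tri i j hij]
    exact Finset.prod_eq_one fun i _ => hA.diag i
  rw [RingHom.map_det, h1, Matrix.det_mul, Matrix.det_mul, Matrix.det_transpose, h2,
    Matrix.det_diagonal]
  ring

theorem IsGS.det_ne_zero [Fact (TotallyReal K)] {m : ℕ} {A : Matrix (Fin m) (Fin m) (𝓞 K)}
    {h : Fin m → K} {μ : Matrix (Fin m) (Fin m) K} (hA : IsGS A h μ) : A.det ≠ 0 := by
  intro h0
  have h1 := hA.det_eq
  rw [h0, map_zero] at h1
  obtain ⟨σ⟩ := nonempty_emb (K := K)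
  have h2 : 0 < ∏ i, σ (h i) := Finset.prod_pos fun i _ => hA.pos σ i
  rw [← map_prod, ← h1, map_zero] at h2
  exact lt_irrefl _ h2

end Det

namespace OKLattice

section Reduced

open scoped Matrix

variable {K : Type} [Field K] [NumberField K] (L : OKLattice K)

/-- The trace of the norm of a projected vector. -/
def ptr (e : ℕ → L.carrier) (k : ℕ) (v : L.carrier) : ℝ :=
  ∑ σ : K →+* ℝ, σ (L.spaceForm (L.pj e k v) (L.pj e k v))

/-- A vector whose projection is as short as possible. -/
def IsShortest (e : ℕ → L.carrier) (k : ℕ) (v : L.carrier) : Prop :=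
  L.pj e k v ≠ 0 ∧ ∀ w, L.pj e k w ≠ 0 → L.ptr e k v ≤ L.ptr e k w

/-- A representative of a vector modulo the image of a matrix. -/
def normalForm {k : ℕ} (A : Matrix (Fin k) (Fin k) (𝓞 K)) (r : Fin k → 𝓞 K) : Fin k → 𝓞 K :=
  Quotient.out (Submodule.Quotient.mk (p := LinearMap.range A.mulVecLin) r)

/-- A reduced sequence of vectors. -/
def IsReduced (e : ℕ → L.carrier) (m : ℕ) : Prop :=
  ∀ k < m, L.IsShortest e k (e k) ∧
    ∃ r, L.row e k (e k) = normalForm (L.gram e k) r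

theorem exists_normalForm_eq {k : ℕ} (A : Matrix (Fin k) (Fin k) (𝓞 K)) (r : Fin k → 𝓞 K) :
    ∃ x, normalForm A r = r + A *ᵥ x := by
  have h : Submodule.Quotient.mk (p := LinearMap.range A.mulVecLin) (normalForm A r) =
      Submodule.Quotient.mk r := Quotient.out_eq _
  obtain ⟨x, hx⟩ := (Submodule.Quotient.eq _).mp h
  refine ⟨x, ?_⟩
  rw [← Matrix.mulVecLin_apply, hx]; abel

theorem card_range_normalForm {k : ℕ} (A : Matrix (Fin k) (Fin k) (𝓞 K)) (hA : A.det ≠ 0) :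
    ∃ F : Finset (Fin k → 𝓞 K), F.card ≤ nmN A.det ∧ ∀ r, normalForm A r ∈ F := by
  classical
  have hc := card_quotient_range_mulVecLin A hA
  have hf : Finite ((Fin k → 𝓞 K) ⧸ LinearMap.range A.mulVecLin) :=
    Nat.finite_of_card_ne_zero (by rw [hc]; exact nmN_ne_zero hA)
  have := Fintype.ofFinite ((Fin k → 𝓞 K) ⧸ LinearMap.range A.mulVecLin)
  refine ⟨Finset.univ.image fun q : (Fin k → 𝓞 K) ⧸ LinearMap.range A.mulVecLin => Quotient.out q,
    ?_, fun r => Finset.mem_image_of_mem _ (Finset.mem_univ _)⟩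
  refine Finset.card_image_le.trans ?_
  rw [Finset.card_univ, ← Nat.card_eq_fintype_card, hc]

theorem finrank_space : Module.finrank K (K ⊗[𝓞 K] L.carrier) = L.rank := rfl

variable [htr : Fact (TotallyReal K)]

theorem exists_pj_ne_zero (e : ℕ → L.carrier) {k : ℕ} (hk : k < L.rank) :
    ∃ v, L.pj e k v ≠ 0 := by
  by_contra! h
  have h1 : Submodule.span K (Set.range fun i : Fin k => L.emb (e i)) = ⊤ := by
    rw [eq_top_iff]
    intro v _
    obtain ⟨b, hb, x, hx⟩ := L.exists_smul_eq_emb v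
    obtain ⟨y, hy⟩ := exists_sub_gsProj_eq (B := L.spaceForm) (fun i => L.emb (e i)) k (L.emb x)
    have h2 : gsProj L.spaceForm (fun i => L.emb (e i)) k (L.emb x) = 0 := h x
    rw [h2, sub_zero] at hy
    have h3 : L.emb x ∈ Submodule.span K (Set.range fun i : Fin k => L.emb (e i)) := by
      rw [hy]
      exact Submodule.sum_mem _ fun i _ => Submodule.smul_mem _ _ (Submodule.subset_span ⟨i, rfl⟩)
    have hb' : algebraMap (𝓞 K) K b ≠ 0 := by rwa [Ne, RingOfIntegers.coe_eq_zero_iff]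
    rw [← hx, ← algebraMap_smul K] at h3
    exact (Submodule.smul_mem_iff _ hb').mp h3
  have h2 := finrank_range_le_card (R := K) fun i : Fin k => L.emb (e i)
  rw [Set.finrank, h1, finrank_top, L.finrank_space, Fintype.card_fin] at h2
  omega

theorem exists_natCast_smul_pj (e : ℕ → L.carrier) (k : ℕ) :
    ∃ n : ℕ, n ≠ 0 ∧ ∀ v, ∃ x, (n : 𝓞 K) • L.pj e k v = L.emb x := by
  classical
  obtain ⟨s, hs⟩ := (Module.finite_def (R := 𝓞 K) (M := L.carrier)).mp inferInstance
  choose b hb x hx using fun v => L.exists_smul_eq_emb (L.pj e k v)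
  have hN : (∏ v ∈ s, b v) ≠ 0 := Finset.prod_ne_zero_iff.mpr fun v _ => hb v
  refine ⟨nmN (∏ v ∈ s, b v), nmN_ne_zero hN, fun v => ?_⟩
  obtain ⟨c, hc⟩ := nmN_dvd_self (∏ v ∈ s, b v)
  have h1 : v ∈ Submodule.span (𝓞 K) (s : Set L.carrier) := by rw [hs]; trivial
  have h2 : Submodule.span (𝓞 K) (s : Set L.carrier) ≤
      (LinearMap.range L.emb).comap ((nmN (∏ v ∈ s, b v) : 𝓞 K) • L.pj e k) := by
    rw [Submodule.span_le]
    intro w hw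
    refine ⟨(c * ∏ v ∈ s.erase w, b v) • x w, ?_⟩
    rw [LinearMap.smul_apply, hc, ← Finset.mul_prod_erase s b hw, map_smul, ← hx, smul_smul]
    congr 1; ring
  obtain ⟨y, hy⟩ := h2 h1
  exact ⟨y, hy.symm⟩

theorem exists_isShortest (e : ℕ → L.carrier) {k : ℕ} (hk : k < L.rank) :
    ∃ v, L.IsShortest e k v := by
  obtain ⟨n, hn, hx⟩ := L.exists_natCast_smul_pj e k
  choose x hx using hx
  have hn' : (0 : ℝ) < (n : ℝ) ^ 2 := by positivity
  have key : ∀ v, L.ptr e k v * (n : ℝ) ^ 2 = (trZ (L.form (x v) (x v)) : ℝ) := by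
    intro v
    rw [trZ_eq_sum, ptr, Finset.sum_mul]
    refine Finset.sum_congr rfl fun σ _ => ?_
    rw [ov_apply, ← L.spaceForm_emb, ← hx, ← algebraMap_smul K]
    simp only [map_smul, LinearMap.smul_apply, smul_eq_mul, map_mul, map_natCast]
    ring
  have hnn : ∀ v, 0 ≤ trZ (L.form (x v) (x v)) := by
    intro v
    have : (0 : ℝ) ≤ (trZ (L.form (x v) (x v)) : ℝ) := by
      rw [trZ_eq_sum]
      exact Finset.sum_nonneg fun σ _ => L.q_nonneg σ _
    exact_mod_cast this
  obtain ⟨v0, hv0⟩ := L.exists_pj_ne_zero e hk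
  let S : Set L.carrier := {v | L.pj e k v ≠ 0}
  have hS : S.Nonempty := ⟨v0, hv0⟩
  let f : L.carrier → ℕ := fun v => (trZ (L.form (x v) (x v))).toNat
  refine ⟨Function.argminOn f S hS, Function.argminOn_mem f S hS, fun w hw => ?_⟩
  have h1 : f (Function.argminOn f S hS) ≤ f w := Function.argminOn_le f S hw
  rw [← mul_le_mul_iff_of_pos_right hn', key, key]
  have h3 : ((f (Function.argminOn f S hS) : ℕ) : ℤ) ≤ ((f w : ℕ) : ℤ) := by exact_mod_cast h1
  simp only [f] at h3
  rw [Int.toNat_of_nonneg (hnn _), Int.toNat_of_nonneg (hnn _)] at h3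
  exact_mod_cast h3

theorem pj_add_sum (e : ℕ → L.carrier) (k : ℕ) (v : L.carrier) (x : Fin k → 𝓞 K) :
    L.pj e k (v + ∑ i, x i • e i) = L.pj e k v := by
  rw [map_add, pj_sum, add_zero]

theorem exists_isReduced : ∃ e, L.IsReduced e L.rank := by
  suffices h : ∀ k ≤ L.rank, ∃ e, L.IsReduced e k from h _ le_rfl
  intro k
  induction k with
  | zero => exact fun _ => ⟨0, fun k hk => absurd hk (Nat.not_lt_zero k)⟩
  | succ k ih =>
    intro hk
    obtain ⟨e, he⟩ := ih (Nat.le_of_succ_le hk)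
    obtain ⟨v, hv0, hv⟩ := L.exists_isShortest e hk
    obtain ⟨x, hx⟩ := exists_normalForm_eq (L.gram e k) (L.row e k v)
    have hpj := L.pj_add_sum e k v x
    set v' := v + ∑ i, x i • e i with hv'
    have hrow : L.row e k v' = normalForm (L.gram e k) (L.row e k v) := by
      rw [hx]
      ext j
      simp [row, hv', gram, Matrix.mulVec, dotProduct, mul_comm, L.symm (e j)]
    have hag : ∀ j ≤ k, ∀ i < j, Function.update e k v' i = e i := fun j hj i hi =>
      Function.update_of_ne (by omega) _ _
    refine ⟨Function.update e k v', fun j hj => ?_⟩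
    have hjk : j ≤ k := Nat.le_of_lt_succ hj
    have e1 : ∀ w, L.pj (Function.update e k v') j w = L.pj e j w := fun w => by
      rw [L.pj_congr (hag j hjk)]
    have e2 := L.gram_congr (hag j hjk)
    have e3 := L.row_congr (hag j hjk)
    rcases hjk.lt_or_eq with h | rfl
    · rw [IsShortest, e2, e3, Function.update_of_ne h.ne]
      simp only [ptr, e1]
      exact he j h
    · rw [IsShortest, e2, e3, Function.update_self]
      simp only [ptr, e1, hpj]
      exact ⟨⟨hv0, hv⟩, _, hrow⟩

end Reduced

end OKLattice

namespace OKLattice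

section Saturation

variable {K : Type} [Field K] [NumberField K] [htr : Fact (TotallyReal K)] (L : OKLattice K)

theorem pj_eq_zero_of_gcoeff_lt (e : ℕ → L.carrier) {k : ℕ} (he : L.IsShortest e k (e k))
    {v : L.carrier} (hv : L.pj e (k + 1) v = 0)
    (hc : ∀ σ : K →+* ℝ, |σ (L.gcoeff e k v)| < 1) : L.pj e k v = 0 := by
  by_contra h
  have h1 := he.2 v h
  have h2 : L.pj e k v = L.gcoeff e k v • L.pj e k (e k) := by
    rw [pj_succ, sub_eq_zero] at hv
    exact hv
  refine absurd h1 (not_le.mpr ?_)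
  rw [ptr, ptr, h2]
  refine Finset.sum_lt_sum_of_nonempty Finset.univ_nonempty fun σ _ => ?_
  have h3 := L.gnorm_pos e he.1 σ
  have h4 := (sq_lt_one_iff_abs_lt_one _).mpr (hc σ)
  simp only [map_smul, LinearMap.smul_apply, smul_eq_mul, map_mul]
  rw [← gnorm_eq]
  nlinarith

variable (K) in
theorem exists_card_saturation_le : ∃ q : ℕ, 1 ≤ q ∧ ∀ (L : OKLattice K) (e : ℕ → L.carrier)
    (k : ℕ), L.IsShortest e k (e k) → ∃ R : Finset L.carrier, R.card ≤ q ∧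
      ∀ v, L.pj e (k + 1) v = 0 → ∃ r ∈ R, ∃ a : 𝓞 K, L.pj e k (v - r - a • e k) = 0 := by
  classical
  obtain ⟨C, hC1, hC⟩ := exists_integer_approx K
  set N : ℤ := ⌈C⌉ + 1 with hN
  let D : Finset ((K →+* ℝ) → ℤ) := Fintype.piFinset fun _ => Finset.Icc (-N) N
  have h0D : (0 : (K →+* ℝ) → ℤ) ∈ D := by
    have : (0 : ℤ) ≤ N := by have := Int.ceil_nonneg (zero_le_one.trans hC1); omega
    simp [D, this]
  refine ⟨D.card, Finset.card_pos.mpr ⟨_, h0D⟩, fun L e k he => ?_⟩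
  let κ : L.carrier → (K →+* ℝ) → ℤ := fun v σ => ⌊σ (L.gcoeff e k v)⌋
  have hrep : ∀ d : (K →+* ℝ) → ℤ, ∃ r : L.carrier, L.pj e (k + 1) r = 0 ∧
      ∀ v, L.pj e (k + 1) v = 0 → κ v = d → κ r = d := by
    intro d
    by_cases h : ∃ v, L.pj e (k + 1) v = 0 ∧ κ v = d
    · obtain ⟨r, hr, hr'⟩ := h
      exact ⟨r, hr, fun _ _ _ => hr'⟩
    · exact ⟨0, map_zero _, fun v hv hd => absurd ⟨v, hv, hd⟩ h⟩
  choose rep hrep0 hrep using hrep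
  refine ⟨D.image rep, Finset.card_image_le, fun v hv => ?_⟩
  obtain ⟨a, ha⟩ := hC fun σ => σ (L.gcoeff e k v)
  have hv' : L.pj e (k + 1) (v - a • e k) = 0 := by
    rw [map_sub, map_smul, L.pj_self e k.lt_succ_self, hv, smul_zero, sub_zero]
  have hsub : ∀ v w, L.gcoeff e k (v - w) = L.gcoeff e k v - L.gcoeff e k w :=
    fun v w => map_sub (L.gcoeffLin e k) v w
  have hc : ∀ σ : K →+* ℝ, |σ (L.gcoeff e k (v - a • e k))| ≤ C := by
    intro σ
    rw [hsub, gcoeff_smul, L.gcoeff_self e he.1, mul_one, map_sub, ← ov_apply, abs_sub_comm]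
    exact ha σ
  have hmem : κ (v - a • e k) ∈ D := by
    rw [Fintype.mem_piFinset]
    intro σ
    have h1 := abs_le.mp (hc σ)
    rw [Finset.mem_Icc]
    constructor
    · rw [Int.le_floor, hN]
      push_cast
      have := Int.le_ceil C
      linarith [h1.1]
    · have h2 : κ (v - a • e k) σ ≤ ⌈C⌉ := by
        have h3 : ((κ (v - a • e k) σ : ℤ) : ℝ) ≤ (⌈C⌉ : ℝ) :=
          (Int.floor_le _).trans (h1.2.trans (Int.le_ceil C))
        exact_mod_cast h3
      omega
  refine ⟨_, Finset.mem_image_of_mem rep hmem, a, ?_⟩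
  have hr := hrep _ _ hv' rfl
  have hr0 := hrep0 (κ (v - a • e k))
  have heq : v - rep (κ (v - a • e k)) - a • e k = (v - a • e k) - rep (κ (v - a • e k)) := by abel
  rw [heq]
  refine L.pj_eq_zero_of_gcoeff_lt e he (by rw [map_sub, hv', hr0, sub_zero]) fun σ => ?_
  rw [hsub, map_sub]
  exact Int.abs_sub_lt_one_of_floor_eq_floor (congrFun hr σ).symm

theorem exists_cover_span {q : ℕ} (hq : ∀ (L : OKLattice K) (e : ℕ → L.carrier)
    (k : ℕ), L.IsShortest e k (e k) → ∃ R : Finset L.carrier, R.card ≤ q ∧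
      ∀ v, L.pj e (k + 1) v = 0 → ∃ r ∈ R, ∃ a : 𝓞 K, L.pj e k (v - r - a • e k) = 0)
    (e : ℕ → L.carrier) (k : ℕ) (he : ∀ j < k, L.IsShortest e j (e j)) :
    ∃ R : Finset L.carrier, R.card ≤ q ^ k ∧
      ∀ v, L.pj e k v = 0 → ∃ r ∈ R, ∃ x : Fin k → 𝓞 K, v = r + ∑ i, x i • e i := by
  classical
  induction k with
  | zero =>
    refine ⟨{0}, by simp, fun v hv => ⟨0, by simp, 0, ?_⟩⟩
    have : v = 0 := L.emb_injective (by rw [map_zero]; exact hv)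
    simp [this]
  | succ k ih =>
    obtain ⟨R, hR, hR'⟩ := ih fun j hj => he j (hj.trans k.lt_succ_self)
    obtain ⟨S, hS, hS'⟩ := hq L e k (he k k.lt_succ_self)
    refine ⟨Finset.image₂ (· + ·) R S, (Finset.card_image₂_le _ _ _).trans ?_, fun v hv => ?_⟩
    · rw [pow_succ]; exact Nat.mul_le_mul hR hS
    · obtain ⟨s, hs, a, ha⟩ := hS' v hv
      obtain ⟨r, hr, x, hx⟩ := hR' _ ha
      refine ⟨r + s, Finset.mem_image₂_of_mem hr hs, Fin.snoc (α := fun _ => 𝓞 K) x a, ?_⟩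
      rw [Fin.sum_univ_castSucc]
      simp only [Fin.snoc_castSucc, Fin.snoc_last, Fin.val_castSucc, Fin.val_last]
      rw [sub_eq_iff_eq_add, sub_eq_iff_eq_add] at hx
      rw [hx]; abel

theorem linearIndependent_emb (e : ℕ → L.carrier) {k : ℕ} (he : ∀ j < k, L.pj e j (e j) ≠ 0) :
    LinearIndependent K fun i : Fin k => L.emb (e i) := by
  classical
  rw [Fintype.linearIndependent_iff]
  intro g hg
  by_contra! h
  obtain ⟨i, hi⟩ := h
  obtain ⟨j, hj, hmax⟩ := Finset.exists_max_image (Finset.univ.filter fun i => g i ≠ 0) id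
    ⟨i, by simpa using hi⟩
  have hj' : g j ≠ 0 := by simpa using hj
  have h1 : gsProj L.spaceForm (fun i => L.emb (e i)) j (∑ i, g i • L.emb (e i)) =
      g j • L.pj e j (e j) := by
    rw [map_sum, Finset.sum_eq_single j]
    · rw [map_smul]; rfl
    · intro l _ hl
      rw [map_smul]
      by_cases hgl : g l = 0
      · rw [hgl, zero_smul]
      · have hlj : l ≤ j := hmax l (by simpa using hgl)
        have : gsProj L.spaceForm (fun i => L.emb (e i)) j (L.emb (e l)) = 0 :=
          L.pj_self e (show (l : ℕ) < j from lt_of_le_of_ne hlj fun h => hl (Fin.ext h))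
        rw [this, smul_zero]
    · simp
  rw [hg, map_zero] at h1
  exact (smul_ne_zero hj' (he j j.2)) h1.symm

theorem pj_rank_eq_zero (e : ℕ → L.carrier) (he : ∀ j < L.rank, L.pj e j (e j) ≠ 0)
    (v : L.carrier) : L.pj e L.rank v = 0 := by
  have hli := L.linearIndependent_emb e he
  have hsp := hli.span_eq_top_of_card_eq_finrank' (by rw [L.finrank_space, Fintype.card_fin])
  have h1 : L.emb v ∈ Submodule.span K (Set.range fun i : Fin L.rank => L.emb (e i)) := by
    rw [hsp]; trivial
  have h2 : Submodule.span K (Set.range fun i : Fin L.rank => L.emb (e i)) ≤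
      LinearMap.ker (gsProj L.spaceForm (fun i => L.emb (e i)) L.rank) := by
    rw [Submodule.span_le]
    rintro _ ⟨i, rfl⟩
    exact L.pj_self e i.2
  exact h2 h1

/-- The linear map of a sequence of vectors. -/
def frameMap (e : ℕ → L.carrier) (k : ℕ) : (Fin k → 𝓞 K) →ₗ[𝓞 K] L.carrier :=
  Fintype.linearCombination (𝓞 K) fun i : Fin k => e i

theorem frameMap_apply (e : ℕ → L.carrier) (k : ℕ) (x : Fin k → 𝓞 K) :
    L.frameMap e k x = ∑ i, x i • e i := by
  simp [frameMap, Fintype.linearCombination_apply]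

theorem frameMap_injective (e : ℕ → L.carrier) {k : ℕ} (he : ∀ j < k, L.pj e j (e j) ≠ 0) :
    Function.Injective (L.frameMap e k) := by
  refine (injective_iff_map_eq_zero _).mpr fun x hx => ?_
  have h := Fintype.linearIndependent_iff.mp (L.linearIndependent_emb e he)
    (fun i => algebraMap (𝓞 K) K (x i)) (by
      simp only [← emb_smul, ← map_sum]
      rw [← L.frameMap_apply e k, hx, map_zero])
  ext i
  simpa using h i

end Saturation

end OKLattice

/-- Generators of a finite quotient adapted to a cyclic decomposition. -/
theorem AddSubgroup.exists_generators {G : Type*} [AddCommGroup G] (H : AddSubgroup G)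
    (h : H.index ≠ 0) : ∃ (ι : Type) (_ : Fintype ι) (n : ι → ℕ) (u : ι → G),
      (∀ i, 1 < n i) ∧ ∏ i, n i = H.index ∧ (∀ i, n i • u i ∈ H) ∧
      ∀ v, ∃ c : ι → ℤ, v - ∑ i, c i • u i ∈ H := by
  classical
  have hfin : Finite (G ⧸ H) := Nat.finite_of_card_ne_zero h
  obtain ⟨ι, hι, n, hn, ⟨f⟩⟩ := AddCommGroup.equiv_directSum_zmod_of_finite' (G ⧸ H)
  let f' : G ⧸ H ≃+ ∀ i, ZMod (n i) := f.trans (DirectSum.addEquivProd _)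
  have hsurj := QuotientAddGroup.mk'_surjective H
  choose u hu using fun i => hsurj (f'.symm (Pi.single i 1))
  have hmem : ∀ x, QuotientAddGroup.mk' H x = 0 ↔ x ∈ H := fun x =>
    QuotientAddGroup.eq_zero_iff x
  refine ⟨ι, hι, n, u, hn, ?_, fun i => ?_, fun v => ?_⟩
  · rw [AddSubgroup.index, Nat.card_congr f'.toEquiv, Nat.card_pi]
    exact Finset.prod_congr rfl fun i _ => (Nat.card_zmod _).symm
  · rw [← hmem, map_nsmul, hu, ← map_nsmul, ← Pi.single_smul, nsmul_eq_mul, mul_one,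
      ZMod.natCast_self, Pi.single_zero, map_zero]
  · have hcast : ∀ i, ∃ c : ℤ, (c : ZMod (n i)) = f' (QuotientAddGroup.mk' H v) i := fun i =>
      ZMod.intCast_surjective _
    choose c hc using hcast
    refine ⟨c, ?_⟩
    rw [← hmem, map_sub, map_sum, sub_eq_zero]
    apply f'.injective
    ext i
    rw [map_sum, Finset.sum_apply, Finset.sum_eq_single i]
    · rw [map_zsmul, hu, map_zsmul, AddEquiv.apply_symm_apply, Pi.smul_apply, Pi.single_eq_same,
        zsmul_eq_mul, mul_one, hc]
    · intro j _ hj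
      rw [map_zsmul, hu, map_zsmul, AddEquiv.apply_symm_apply, Pi.smul_apply,
        Pi.single_eq_of_ne hj.symm, smul_zero]
    · simp

theorem AddSubgroup.index_le_of_cover {G : Type*} [AddCommGroup G] (H : AddSubgroup G)
    (R : Finset G) (hR : ∀ v, ∃ r ∈ R, v - r ∈ H) : H.index ≠ 0 ∧ H.index ≤ R.card := by
  classical
  let g : R → G ⧸ H := fun r => QuotientAddGroup.mk' H r
  have hg : Function.Surjective g := by
    intro y
    obtain ⟨v, rfl⟩ := QuotientAddGroup.mk'_surjective H y
    obtain ⟨r, hr, hv⟩ := hR v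
    refine ⟨⟨r, hr⟩, ?_⟩
    rw [← sub_eq_zero, ← map_sub]
    refine (QuotientAddGroup.eq_zero_iff _).mpr ?_
    rw [← neg_sub]; exact H.neg_mem hv
  have hfin : Finite (G ⧸ H) := Finite.of_surjective g hg
  refine ⟨Nat.card_pos.ne', (Nat.card_le_card_of_surjective g hg).trans ?_⟩
  simp

section Quot

variable {K : Type} [Field K] [NumberField K]

theorem card_quotient_span_natCast (n : ℕ) :
    Nat.card (𝓞 K ⧸ Ideal.span {(n : 𝓞 K)}) = n ^ Module.finrank ℚ K := by
  rw [← nmN_natCast, nmN_eq_absNorm]; rfl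

end Quot

namespace OKLattice

section Index

open scoped Matrix

variable {K : Type} [Field K] [NumberField K] [htr : Fact (TotallyReal K)] (L : OKLattice K)

/-- The values of the form of a lattice vector with the first vectors of a sequence, as a linear
map. -/
def rowLin (e : ℕ → L.carrier) (k : ℕ) : L.carrier →ₗ[𝓞 K] Fin k → 𝓞 K :=
  LinearMap.pi fun i => L.form.flip (e i)

theorem rowLin_apply (e : ℕ → L.carrier) (k : ℕ) (v : L.carrier) :
    L.rowLin e k v = L.row e k v := rfl

theorem rowLin_frameMap (e : ℕ → L.carrier) (k : ℕ) (x : Fin k → 𝓞 K) :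
    L.rowLin e k (L.frameMap e k x) = L.gram e k *ᵥ x := by
  funext j
  rw [frameMap_apply, rowLin_apply, row]
  simp [gram, Matrix.mulVec, dotProduct, mul_comm, L.symm (e j)]

/-- The coordinates of a multiple of a lattice vector. -/
theorem exists_coords {e : ℕ → L.carrier} {k N : ℕ}
    (hinj : Function.Injective (L.frameMap e k))
    (hN : ∀ v : L.carrier, N • v ∈ LinearMap.range (L.frameMap e k)) :
    ∃ c : L.carrier →ₗ[𝓞 K] (Fin k → 𝓞 K), ∀ v, L.frameMap e k (c v) = N • v := by
  let g : L.carrier →ₗ[𝓞 K] LinearMap.range (L.frameMap e k) :=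
    ((N : 𝓞 K) • LinearMap.id).codRestrict _ fun v => by
      have := hN v
      rw [← Nat.cast_smul_eq_nsmul (𝓞 K)] at this
      exact this
  refine ⟨(LinearEquiv.ofInjective _ hinj).symm.toLinearMap ∘ₗ g, fun v => ?_⟩
  have h1 := LinearEquiv.apply_symm_apply (LinearEquiv.ofInjective _ hinj) (g v)
  have h2 := congrArg Subtype.val h1
  rw [LinearEquiv.ofInjective_apply] at h2
  rw [← Nat.cast_smul_eq_nsmul (𝓞 K)]
  exact h2

theorem index_range_rowLin_le (hL : L.IsUnimodular) {e : ℕ → L.carrier} {k : ℕ}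
    (hinj : Function.Injective (L.frameMap e k))
    (hidx : (LinearMap.range (L.frameMap e k)).toAddSubgroup.index ≠ 0) :
    (LinearMap.range (L.rowLin e k)).toAddSubgroup.index ≠ 0 ∧
    (LinearMap.range (L.rowLin e k)).toAddSubgroup.index ≤
      (LinearMap.range (L.frameMap e k)).toAddSubgroup.index ^ Module.finrank ℚ K := by
  classical
  obtain ⟨ι, _, n, u, hn, hprod, hu, hgen⟩ :=
    AddSubgroup.exists_generators (LinearMap.range (L.frameMap e k)).toAddSubgroup hidx
  set N := (LinearMap.range (L.frameMap e k)).toAddSubgroup.index with hNdef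
  have hN : ∀ v : L.carrier, N • v ∈ LinearMap.range (L.frameMap e k) := fun v =>
    AddSubgroup.nsmul_index_mem (H := (LinearMap.range (L.frameMap e k)).toAddSubgroup) v
  obtain ⟨c, hc⟩ := L.exists_coords hinj hN
  choose z hz using hu
  let Θ : (Fin k → 𝓞 K) →+ ∀ i, 𝓞 K ⧸ Ideal.span {(n i : 𝓞 K)} :=
    AddMonoidHom.mk' (fun x i => Ideal.Quotient.mk _ (z i ⬝ᵥ x)) (by
      intro x y; ext i; simp [dotProduct_add])
  have hN0 : (N : 𝓞 K) ≠ 0 := Nat.cast_ne_zero.mpr hidx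
  have hcz : ∀ x : Fin k → 𝓞 K, c (L.frameMap e k x) = N • x := fun x => by
    apply hinj; rw [hc, map_nsmul]
  have hcu : ∀ i, n i • c (u i) = N • z i := fun i => by
    rw [← map_nsmul, ← hz i, hcz]
  have hker : Θ.ker ≤ (LinearMap.range (L.rowLin e k)).toAddSubgroup := by
    intro x hx
    have hx' : ∀ i, (n i : 𝓞 K) ∣ z i ⬝ᵥ x := fun i => by
      have : Ideal.Quotient.mk (Ideal.span {(n i : 𝓞 K)}) (z i ⬝ᵥ x) = 0 :=
        congrFun (AddMonoidHom.mem_ker.mp hx) i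
      rwa [Ideal.Quotient.eq_zero_iff_dvd] at this
    have hdvd : ∀ v, (N : 𝓞 K) ∣ c v ⬝ᵥ x := by
      intro v
      obtain ⟨a, w, hw⟩ := hgen v
      have h1 : v = L.frameMap e k w + ∑ i, a i • u i := by rw [hw]; abel
      rw [h1, map_add, hcz, add_dotProduct, smul_dotProduct, nsmul_eq_mul]
      refine dvd_add (dvd_mul_right _ _) ?_
      rw [map_sum, sum_dotProduct]
      refine Finset.dvd_sum fun i _ => ?_
      rw [map_zsmul, smul_dotProduct, zsmul_eq_mul]
      refine Dvd.dvd.mul_left ?_ _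
      have hni : (n i : 𝓞 K) ≠ 0 := Nat.cast_ne_zero.mpr (zero_lt_one.trans (hn i)).ne'
      have h2 : (n i : 𝓞 K) * (c (u i) ⬝ᵥ x) = N * (z i ⬝ᵥ x) := by
        rw [← nsmul_eq_mul, ← smul_dotProduct, hcu, smul_dotProduct, nsmul_eq_mul]
      obtain ⟨y, hy⟩ := hx' i
      refine ⟨y, mul_left_cancel₀ hni ?_⟩
      rw [h2, hy]; ring
    choose l hl using hdvd
    let l' : L.carrier →ₗ[𝓞 K] 𝓞 K :=
      { toFun := l
        map_add' := fun v w => mul_left_cancel₀ hN0 (by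
          rw [← hl, map_add, add_dotProduct, hl, hl, mul_add])
        map_smul' := fun a v => mul_left_cancel₀ hN0 (by
          rw [← hl, map_smul, smul_dotProduct, hl, smul_eq_mul, smul_eq_mul, RingHom.id_apply]
          ring) }
    obtain ⟨y, hy⟩ := hL l'
    refine ⟨y, ?_⟩
    funext j
    have h1 : l (e j) = L.form (e j) y := hy (e j)
    have h2 : e j = L.frameMap e k (Pi.single j 1) := by
      rw [frameMap_apply]; simp [Pi.single_apply, ite_smul]
    rw [rowLin_apply, row, L.symm, ← h1]
    refine mul_left_cancel₀ hN0 ?_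
    rw [← hl]
    conv_lhs => rw [h2, hcz]
    rw [smul_dotProduct, single_one_dotProduct, nsmul_eq_mul]
  have hni : ∀ i, n i ≠ 0 := fun i => (zero_lt_one.trans (hn i)).ne'
  have hfin : ∀ i, Finite (𝓞 K ⧸ Ideal.span {(n i : 𝓞 K)}) := fun i =>
    Nat.finite_of_card_ne_zero (by rw [card_quotient_span_natCast]; exact pow_ne_zero _ (hni i))
  have hcard : Nat.card (∀ i, 𝓞 K ⧸ Ideal.span {(n i : 𝓞 K)}) = N ^ Module.finrank ℚ K := by
    rw [Nat.card_pi, ← hprod, ← Finset.prod_pow]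
    exact Finset.prod_congr rfl fun i _ => card_quotient_span_natCast _
  have hidxker : Θ.ker.index ≤ N ^ Module.finrank ℚ K := by
    rw [AddSubgroup.index_ker, ← hcard]
    exact Nat.card_le_card_of_injective _ Subtype.val_injective
  have hker0 : Θ.ker.index ≠ 0 := by
    rw [AddSubgroup.index_ker]; exact Nat.card_pos.ne'
  have hd := AddSubgroup.index_dvd_of_le hker
  exact ⟨fun h0 => hker0 (Nat.eq_zero_of_zero_dvd (h0 ▸ hd)),
    (Nat.le_of_dvd (Nat.pos_of_ne_zero hker0) hd).trans hidxker⟩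

theorem rowLin_injective {e : ℕ → L.carrier} {k : ℕ} (hA : (L.gram e k).det ≠ 0)
    (hidx : (LinearMap.range (L.frameMap e k)).toAddSubgroup.index ≠ 0) :
    Function.Injective (L.rowLin e k) := by
  refine (injective_iff_map_eq_zero _).mpr fun v hv => ?_
  obtain ⟨x, hx⟩ := AddSubgroup.nsmul_index_mem
    (H := (LinearMap.range (L.frameMap e k)).toAddSubgroup) v
  have h1 := L.rowLin_frameMap e k x
  rw [hx, map_nsmul, hv, smul_zero] at h1
  have h2 : x = 0 := Matrix.mulVec_injective_of_det_ne_zero hA (by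
    rw [← h1, Matrix.mulVec_zero])
  rw [h2, map_zero] at hx
  have h3 : ((LinearMap.range (L.frameMap e k)).toAddSubgroup.index : 𝓞 K) • v = 0 := by
    rw [Nat.cast_smul_eq_nsmul]; exact hx.symm
  exact (smul_eq_zero.mp h3).resolve_left (Nat.cast_ne_zero.mpr hidx)

theorem range_mulVecLin_gram (e : ℕ → L.carrier) (k : ℕ) :
    (LinearMap.range (L.gram e k).mulVecLin).toAddSubgroup =
      (LinearMap.range (L.frameMap e k)).toAddSubgroup.map (L.rowLin e k).toAddMonoidHom := by
  ext y
  constructor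
  · rintro ⟨x, rfl⟩
    exact ⟨_, ⟨x, rfl⟩, L.rowLin_frameMap e k x⟩
  · rintro ⟨_, ⟨x, rfl⟩, rfl⟩
    exact ⟨x, (L.rowLin_frameMap e k x).symm⟩

theorem nmN_det_gram_le (hL : L.IsUnimodular) {e : ℕ → L.carrier} {k : ℕ}
    (hinj : Function.Injective (L.frameMap e k)) (hA : (L.gram e k).det ≠ 0)
    (hidx : (LinearMap.range (L.frameMap e k)).toAddSubgroup.index ≠ 0) :
    nmN (L.gram e k).det ≤
      (LinearMap.range (L.frameMap e k)).toAddSubgroup.index ^ (Module.finrank ℚ K + 1) := by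
  obtain ⟨-, h1⟩ := L.index_range_rowLin_le hL hinj hidx
  have h2 := card_quotient_range_mulVecLin _ hA
  have hω := L.rowLin_injective hA hidx
  have h3 := L.range_mulVecLin_gram e k
  have h4 : (L.rowLin e k).toAddMonoidHom.ker = ⊥ :=
    (AddMonoidHom.ker_eq_bot_iff _).mpr hω
  have h5 : (LinearMap.range (L.gram e k).mulVecLin).toAddSubgroup.index = nmN (L.gram e k).det :=
    h2
  rw [← h5, h3, AddSubgroup.index_map, h4, sup_bot_eq, pow_succ, mul_comm]
  exact Nat.mul_le_mul_right _ h1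

end Index

end OKLattice

namespace OKLattice

section Hermite

open scoped Matrix

variable {K : Type} [Field K] [NumberField K] [htr : Fact (TotallyReal K)] (L : OKLattice K)

/-- The logarithm of the absolute norm of a Gram determinant. -/
def logDet (e : ℕ → L.carrier) (k : ℕ) : ℝ := Real.log (nmN (L.gram e k).det)

theorem logDet_nonneg (e : ℕ → L.carrier) (k : ℕ) : 0 ≤ L.logDet e k := Real.log_natCast_nonneg _

theorem det_gram_ne_zero {e : ℕ → L.carrier} {k : ℕ} (he : ∀ j < k, L.pj e j (e j) ≠ 0) :
    (L.gram e k).det ≠ 0 := (L.isGS_gram e he).det_ne_zero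

theorem logDet_eq_sum {e : ℕ → L.carrier} {k : ℕ} (he : ∀ j < k, L.pj e j (e j) ≠ 0) :
    L.logDet e k = ∑ j ∈ Finset.range k, ∑ σ : K →+* ℝ, Real.log (σ (L.gnorm e j)) := by
  have h1 : ∀ σ : K →+* ℝ, |ov σ (L.gram e k).det| = ∏ j ∈ Finset.range k, σ (L.gnorm e j) := by
    intro σ
    rw [ov_apply, (L.isGS_gram e he).det_eq, map_prod, Finset.prod_range, abs_of_pos]
    exact Finset.prod_pos fun i _ => L.gnorm_pos e (he i i.2) σ
  have h2 : ∀ σ : K →+* ℝ, ∀ j ∈ Finset.range k, σ (L.gnorm e j) ≠ 0 := fun σ j hj =>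
    (L.gnorm_pos e (he j (Finset.mem_range.mp hj)) σ).ne'
  rw [logDet, nmN_eq_prod, Real.log_prod fun σ _ => by
    rw [h1]; exact Finset.prod_ne_zero_iff.mpr (h2 σ), Finset.sum_comm]
  refine Finset.sum_congr rfl fun σ _ => ?_
  rw [h1, Real.log_prod (h2 σ)]

theorem gcoeff_sum (e : ℕ → L.carrier) (l : ℕ) {t : ℕ} (x : Fin t → 𝓞 K) (f : Fin t → L.carrier) :
    L.gcoeff e l (∑ i, x i • f i) = ∑ i, algebraMap (𝓞 K) K (x i) * L.gcoeff e l (f i) := by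
  rw [← gcoeffLin_apply, map_sum]
  refine Finset.sum_congr rfl fun i _ => ?_
  rw [map_smul, gcoeffLin_apply, Algebra.smul_def]

theorem prod_exp_div_sqrt_eq {T S : Type*} [Fintype T] [Fintype S] {g : T → S → ℝ}
    (hg : ∀ σ i, 0 < g σ i) {C : ℝ} (hC : 0 < C) {D : ℝ}
    (hD : D = Fintype.card T * Fintype.card S) (hD0 : 0 < D) :
    ∏ σ, ∏ i, (2 * C * Real.exp ((∑ σ, ∑ i, Real.log (g σ i)) / (2 * D)) /
      (C * Real.sqrt (g σ i))) = 2 ^ (Fintype.card S * Fintype.card T) := by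
  set B := ∑ σ, ∑ i, Real.log (g σ i) with hB
  have h1 : ∀ σ i, 2 * C * Real.exp (B / (2 * D)) / (C * Real.sqrt (g σ i)) =
      2 * Real.exp (B / (2 * D) - Real.log (g σ i) / 2) := by
    intro σ i
    have h2 : Real.sqrt (g σ i) = Real.exp (Real.log (g σ i) / 2) := by
      rw [Real.exp_half, Real.exp_log (hg σ i)]
    rw [h2, Real.exp_sub]
    field_simp
  simp only [h1, Finset.prod_mul_distrib, Finset.prod_const, Finset.card_univ, ← pow_mul,
    ← Real.exp_sum, Finset.sum_sub_distrib, Finset.sum_const, ← Finset.sum_div, nsmul_eq_mul]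
  rw [← hB]
  have h3 : (Fintype.card T : ℝ) * (Fintype.card S * (B / (2 * D))) - B / 2 = 0 := by
    have : (Fintype.card T : ℝ) * (Fintype.card S * (B / (2 * D))) = D * (B / (2 * D)) := by
      rw [hD]; ring
    rw [this]; field_simp; ring
  rw [h3, Real.exp_zero, mul_one]

variable (K) in
/-- A Hermite bound for the successive reduced norms. -/
theorem exists_gnorm_le : ∃ C : ℝ, 1 ≤ C ∧ ∀ (L : OKLattice K) (e : ℕ → L.carrier) (k t : ℕ),
    k + t = L.rank → 0 < t → (∀ j < L.rank, L.IsShortest e j (e j)) → ∀ σ : K →+* ℝ,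
      σ (L.gnorm e k) ≤ C * t * Real.exp
        ((L.logDet e L.rank - L.logDet e k) / (t * Module.finrank ℚ K)) := by
  classical
  obtain ⟨C, hC, hX⟩ := exists_many_small K
  have hC0 : 0 < C := by linarith
  have hd : 0 < Module.finrank ℚ K := finrank_pos_K
  have hd' : (1 : ℝ) ≤ Module.finrank ℚ K := by exact_mod_cast hd
  refine ⟨4 * C ^ 2 * Module.finrank ℚ K, by nlinarith, fun L e k t hkt ht he τ => ?_⟩
  have he0 : ∀ j < L.rank, L.pj e j (e j) ≠ 0 := fun j hj => (he j hj).1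
  have hlt : ∀ i : Fin t, k + i < L.rank := fun i => by omega
  set g : (K →+* ℝ) → Fin t → ℝ := fun σ i => σ (L.gnorm e (k + i)) with hg
  have hg0 : ∀ σ i, 0 < g σ i := fun σ i => L.gnorm_pos e (he0 _ (hlt i)) σ
  set B := ∑ σ, ∑ i, Real.log (g σ i) with hB
  have hBe : B = L.logDet e L.rank - L.logDet e k := by
    rw [L.logDet_eq_sum he0, L.logDet_eq_sum fun j hj => he0 j (by omega),
      Finset.range_eq_Ico, Finset.range_eq_Ico,
      ← Finset.sum_Ico_consecutive _ (Nat.zero_le k) (by omega : k ≤ L.rank), add_sub_cancel_left,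
      Finset.sum_Ico_eq_sum_range, ← hkt, Nat.add_sub_cancel_left, Finset.sum_range, hB,
      Finset.sum_comm]
  set D : ℝ := Fintype.card (K →+* ℝ) * Fintype.card (Fin t) with hD
  have hDe : D = t * Module.finrank ℚ K := by
    rw [hD, card_emb, Fintype.card_fin, mul_comm]
  have ht' : (0 : ℝ) < t := by exact_mod_cast ht
  have hD0 : 0 < D := by rw [hDe]; positivity
  set ρ := 2 * C * Real.exp (B / (2 * D)) with hρ
  have hρ0 : 0 < ρ := by positivity
  have hρ2 : ρ ^ 2 = 4 * C ^ 2 * Real.exp (B / D) := by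
    have : B / D = B / (2 * D) + B / (2 * D) := by field_simp; ring
    rw [this, Real.exp_add, hρ]; ring
  let M : (K →+* ℝ) → Fin t → Fin t → ℝ := fun σ l i =>
    if i = l then 0 else σ (L.gcoeff e (k + l) (e (k + i)))
  have hM : ∀ σ l i, M σ l i ≠ 0 → t - (i : ℕ) < t - (l : ℕ) := by
    intro σ l i h
    by_cases hil : i = l
    · simp [M, hil] at h
    · have : ¬ i < l := fun h' => h (by
        simp only [M, if_neg hil]
        rw [L.gcoeff_self_of_lt e (by have := Fin.lt_def.mp h'; omega), map_zero])
      have h2 : l < i := lt_of_le_of_ne (not_lt.mp this) (Ne.symm hil)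
      have h3 := Fin.lt_def.mp h2
      omega
  obtain ⟨X, hXc, hXm⟩ := hX (Fin t) (fun i => t - (i : ℕ)) (fun σ i => Real.sqrt (g σ i)) M ρ
    (fun σ i => Real.sqrt_pos.mpr (hg0 σ i)) hM hρ0
  have hprod := prod_exp_div_sqrt_eq hg0 hC0 hD hD0
  rw [← hB, ← hρ] at hprod
  rw [hprod] at hXc
  have hX2 : 1 < X.card := by
    have h1 : Fintype.card (Fin t) * Fintype.card (K →+* ℝ) ≠ 0 := by
      rw [card_emb, Fintype.card_fin]; positivity
    have h2 : (2 : ℝ) ≤ X.card := (le_self_pow₀ (by norm_num) h1).trans hXc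
    exact_mod_cast h2
  obtain ⟨x, hxX, hx0⟩ := Finset.exists_mem_ne hX2 0
  set v : L.carrier := ∑ i, x i • e (k + i) with hv
  have hco : ∀ (σ : K →+* ℝ) (l : Fin t), σ (L.gcoeff e (k + l) v) =
      ov σ (x l) + ∑ i, M σ l i * ov σ (x i) := by
    intro σ l
    rw [hv, gcoeff_sum, map_sum, ← Finset.add_sum_erase _ _ (Finset.mem_univ l),
      ← Finset.add_sum_erase (Finset.univ) (fun i => M σ l i * ov σ (x i)) (Finset.mem_univ l),
      map_mul, L.gcoeff_self e (he0 _ (hlt l))]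
    simp only [M, if_true, zero_mul, zero_add, map_one, mul_one]
    refine congrArg₂ _ rfl (Finset.sum_congr rfl fun i hi => ?_)
    rw [if_neg (Finset.ne_of_mem_erase hi), map_mul, mul_comm]; rfl
  have hsp : ∀ σ : K →+* ℝ, σ (L.spaceForm (L.pj e k v) (L.pj e k v)) =
      ∑ l : Fin t, g σ l * σ (L.gcoeff e (k + l) v) ^ 2 := by
    intro σ
    rw [L.spaceForm_pj_eq_sum e (by omega : k ≤ L.rank), L.pj_rank_eq_zero e he0, map_zero,
      add_zero, Finset.sum_Ico_eq_sum_range, ← hkt, Nat.add_sub_cancel_left, Finset.sum_range,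
      map_sum]
    refine Finset.sum_congr rfl fun l _ => ?_
    rw [map_mul, map_mul, hg]; ring
  have hv0 : L.pj e k v ≠ 0 := by
    intro h0
    have hne : (Finset.univ.filter fun i => x i ≠ 0).Nonempty := by
      obtain ⟨i, hi⟩ := Function.ne_iff.mp hx0
      exact ⟨i, by simpa using hi⟩
    obtain ⟨l, hl, hmax⟩ := Finset.exists_max_image _ id hne
    have hl0 : x l ≠ 0 := by simpa using hl
    have h1 := hsp τ
    rw [h0, map_zero, map_zero] at h1
    have h2 := (Finset.sum_eq_zero_iff_of_nonneg fun l _ =>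
      mul_nonneg (hg0 τ l).le (sq_nonneg _)).mp h1.symm l (Finset.mem_univ l)
    have h3 : τ (L.gcoeff e (k + l) v) = 0 := by
      rcases mul_eq_zero.mp h2 with h | h
      · exact absurd h (hg0 τ l).ne'
      · exact pow_eq_zero_iff two_ne_zero |>.mp h
    rw [hco, Finset.sum_eq_zero, add_zero] at h3
    · exact hl0 ((ov_eq_zero τ).mp h3)
    · intro i _
      by_cases hxi : x i = 0
      · rw [hxi, map_zero, mul_zero]
      · have h4 : i ≤ l := hmax i (by simpa using hxi)
        by_contra h5
        have h6 := hM τ l i (left_ne_zero_of_mul h5)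
        have h7 := Fin.le_def.mp h4
        omega
  have hvle : ∀ σ : K →+* ℝ, σ (L.spaceForm (L.pj e k v) (L.pj e k v)) ≤ t * ρ ^ 2 := by
    intro σ
    rw [hsp]
    refine (Finset.sum_le_card_nsmul _ _ (ρ ^ 2) fun l _ => ?_).trans (by simp)
    have h1 := hXm x hxX σ l
    rw [← hco] at h1
    have h2 : g σ l * σ (L.gcoeff e (k + l) v) ^ 2 =
        (Real.sqrt (g σ l) * |σ (L.gcoeff e (k + l) v)|) ^ 2 := by
      rw [mul_pow, Real.sq_sqrt (hg0 σ l).le, sq_abs]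
    rw [h2]
    exact pow_le_pow_left₀ (by positivity) h1 2
  have hmin := (he k (by omega)).2 v hv0
  have h1 : τ (L.gnorm e k) ≤ L.ptr e k (e k) := by
    refine Finset.single_le_sum (f := fun σ : K →+* ℝ => σ (L.gnorm e k)) (fun σ _ => ?_)
      (Finset.mem_univ τ)
    exact (L.gnorm_pos e (he0 k (by omega)) σ).le
  have h2 : L.ptr e k v ≤ Module.finrank ℚ K * (t * ρ ^ 2) := by
    refine (Finset.sum_le_card_nsmul _ _ (t * ρ ^ 2) fun σ _ => hvle σ).trans ?_
    rw [Finset.card_univ, card_emb, nsmul_eq_mul]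
  refine (h1.trans (hmin.trans h2)).trans (le_of_eq ?_)
  rw [hρ2, ← hBe, ← hDe]; ring

end Hermite

end OKLattice

namespace OKLattice

section Growth

open scoped Matrix

variable {K : Type} [Field K] [NumberField K] [htr : Fact (TotallyReal K)]

variable (K) in
/-- Reduced frames of unimodular lattices have bounded index. -/
theorem exists_index_le : ∃ q : ℕ, 1 ≤ q ∧ ∀ (L : OKLattice K) (e : ℕ → L.carrier),
    L.IsUnimodular → (∀ j < L.rank, L.IsShortest e j (e j)) →
      (LinearMap.range (L.frameMap e L.rank)).toAddSubgroup.index ≠ 0 ∧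
      (LinearMap.range (L.frameMap e L.rank)).toAddSubgroup.index ≤ q ^ L.rank ∧
      nmN (L.gram e L.rank).det ≤ (q ^ L.rank) ^ (Module.finrank ℚ K + 1) := by
  obtain ⟨q, hq1, hq⟩ := exists_card_saturation_le K
  refine ⟨q, hq1, fun L e hL he => ?_⟩
  have he0 : ∀ j < L.rank, L.pj e j (e j) ≠ 0 := fun j hj => (he j hj).1
  obtain ⟨R, hR, hR'⟩ := L.exists_cover_span hq e L.rank he
  obtain ⟨h1, h2⟩ := AddSubgroup.index_le_of_cover
    (LinearMap.range (L.frameMap e L.rank)).toAddSubgroup R fun v => by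
      obtain ⟨r, hr, x, hx⟩ := hR' v (L.pj_rank_eq_zero e he0 v)
      refine ⟨r, hr, x, ?_⟩
      rw [frameMap_apply, hx]; abel
  refine ⟨h1, h2.trans hR, ?_⟩
  exact (L.nmN_det_gram_le hL (L.frameMap_injective e he0) (L.det_gram_ne_zero he0) h1).trans
    (Nat.pow_le_pow_left (h2.trans hR) _)

/-- A bound for the logarithms of the Gram determinants of a reduced frame. -/
def logBound (d C : ℝ) (m : ℕ) : ℕ → ℝ
  | 0 => 0
  | k + 1 => (1 - 1 / ((m - k : ℕ) : ℝ)) * logBound d C m k +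
      (d * Real.log (C * (m - k : ℕ)) + C * m / (m - k : ℕ))

variable (K) in
theorem exists_reduced_bounds : ∃ C : ℝ, 1 ≤ C ∧ ∀ (L : OKLattice K) (e : ℕ → L.carrier),
    L.IsUnimodular → (∀ j < L.rank, L.IsShortest e j (e j)) →
      L.logDet e L.rank ≤ C * L.rank ∧
      (∀ k < L.rank, ∀ σ : K →+* ℝ, σ (L.gnorm e k) ≤
        C * (L.rank - k : ℕ) * Real.exp (C * L.rank / (L.rank - k : ℕ))) ∧
      ∀ k ≤ L.rank, L.logDet e k ≤ logBound (Module.finrank ℚ K) C L.rank k := by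
  obtain ⟨q, hq1, hq⟩ := exists_index_le K
  obtain ⟨C₀, hC₀, hg⟩ := exists_gnorm_le K
  have hlq : 0 ≤ Real.log q := Real.log_natCast_nonneg q
  have hd : (1 : ℝ) ≤ Module.finrank ℚ K := by exact_mod_cast finrank_pos_K (K := K)
  set C := C₀ + (Module.finrank ℚ K + 1) * Real.log q with hC
  have hCC : C₀ ≤ C := by rw [hC]; nlinarith
  have hC1 : 1 ≤ C := hC₀.trans hCC
  refine ⟨C, hC1, fun L e hL he => ?_⟩
  have he0 : ∀ j < L.rank, L.pj e j (e j) ≠ 0 := fun j hj => (he j hj).1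
  have hdet : 0 < nmN (L.gram e L.rank).det := nmN_pos (L.det_gram_ne_zero he0)
  have hb : L.logDet e L.rank ≤ C * L.rank := by
    have h1 := (hq L e hL he).2.2
    have h2 : L.logDet e L.rank ≤ Real.log (((q : ℝ) ^ L.rank) ^ (Module.finrank ℚ K + 1)) := by
      refine Real.log_le_log (by exact_mod_cast hdet) (by exact_mod_cast h1)
    rw [Real.log_pow, Real.log_pow] at h2
    refine h2.trans ?_
    push_cast
    rw [hC, add_mul]
    have : 0 ≤ C₀ * (L.rank : ℝ) := by positivity
    nlinarith
  have hexp : ∀ k < L.rank, (L.logDet e L.rank - L.logDet e k) /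
      ((L.rank - k : ℕ) * Module.finrank ℚ K) ≤ C * L.rank / (L.rank - k : ℕ) := by
    intro k hk
    have ht : (1 : ℝ) ≤ (L.rank - k : ℕ) := by exact_mod_cast (by omega : 1 ≤ L.rank - k)
    have h0 := L.logDet_nonneg e k
    refine div_le_div₀ (by positivity) (by linarith) (by linarith) (by nlinarith)
  have hgn : ∀ k < L.rank, ∀ σ : K →+* ℝ, σ (L.gnorm e k) ≤ C * (L.rank - k : ℕ) *
      Real.exp ((L.logDet e L.rank - L.logDet e k) / ((L.rank - k : ℕ) * Module.finrank ℚ K)) :=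
    fun k hk σ => (hg L e k (L.rank - k) (by omega) (by omega) he σ).trans (by gcongr)
  refine ⟨hb, fun k hk σ => (hgn k hk σ).trans ?_, fun k => ?_⟩
  · exact mul_le_mul_of_nonneg_left (Real.exp_le_exp.mpr (hexp k hk)) (by positivity)
  induction k with
  | zero =>
    intro _
    rw [L.logDet_eq_sum fun j hj => absurd hj (Nat.not_lt_zero j)]
    simp [logBound]
  | succ k ih =>
    intro hk
    have ih := ih (by omega)
    set t : ℝ := ((L.rank - k : ℕ) : ℝ) with ht
    have ht1 : 1 ≤ t := by
      rw [ht]; exact_mod_cast (by omega : 1 ≤ L.rank - k)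
    have h1 : L.logDet e (k + 1) = L.logDet e k + ∑ σ : K →+* ℝ, Real.log (σ (L.gnorm e k)) := by
      rw [L.logDet_eq_sum fun j hj => he0 j (by omega),
        L.logDet_eq_sum fun j hj => he0 j (by omega), Finset.sum_range_succ]
    have h2 : ∑ σ : K →+* ℝ, Real.log (σ (L.gnorm e k)) ≤ Module.finrank ℚ K *
        (Real.log (C * t) + (L.logDet e L.rank - L.logDet e k) / (t * Module.finrank ℚ K)) := by
      refine (Finset.sum_le_card_nsmul _ _ (Real.log (C * t) +
        (L.logDet e L.rank - L.logDet e k) / (t * Module.finrank ℚ K)) fun σ _ => ?_).trans ?_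
      · have := Real.log_le_log (L.gnorm_pos e (he0 k (by omega)) σ) (hgn k (by omega) σ)
        rwa [Real.log_mul (by positivity) (Real.exp_ne_zero _), Real.log_exp] at this
      · rw [Finset.card_univ, card_emb, nsmul_eq_mul]
    have h3 : (Module.finrank ℚ K : ℝ) * (Real.log (C * t) +
        (L.logDet e L.rank - L.logDet e k) / (t * Module.finrank ℚ K)) =
        Module.finrank ℚ K * Real.log (C * t) + (L.logDet e L.rank - L.logDet e k) / t := by
      field_simp
    have h4 : (L.logDet e L.rank - L.logDet e k) / t ≤ C * L.rank / t - 1 / t * L.logDet e k := by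
      rw [sub_div, div_mul_eq_mul_div, one_mul]
      gcongr
    have h5 : (1 - 1 / t) * L.logDet e k ≤ (1 - 1 / t) * logBound (Module.finrank ℚ K) C L.rank k :=
      mul_le_mul_of_nonneg_left ih (by rw [sub_nonneg, div_le_one (by linarith)]; exact ht1)
    have h6 : logBound (Module.finrank ℚ K) C L.rank (k + 1) =
        (1 - 1 / t) * logBound (Module.finrank ℚ K) C L.rank k +
        (Module.finrank ℚ K * Real.log (C * t) + C * L.rank / t) := rfl
    rw [h6, h1]
    linarith

theorem logBound_nonneg {d C : ℝ} (hd : 0 ≤ d) (hC : 1 ≤ C) (m k : ℕ) (hk : k ≤ m) :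
    0 ≤ logBound d C m k := by
  induction k with
  | zero => exact le_rfl
  | succ k ih =>
    have ht : (1 : ℝ) ≤ (m - k : ℕ) := by exact_mod_cast (by omega : 1 ≤ m - k)
    have h1 : 0 ≤ Real.log (C * (m - k : ℕ)) := Real.log_nonneg (by nlinarith)
    have h2 : (0 : ℝ) ≤ 1 - 1 / (m - k : ℕ) := by
      rw [sub_nonneg, div_le_one (by linarith)]; exact ht
    have h3 := ih (by omega)
    have h4 : 0 ≤ C * m / (m - k : ℕ) := by positivity
    rw [logBound]
    positivity

theorem sum_logBound_le {d C : ℝ} (hd : 0 ≤ d) (hC : 1 ≤ C) {m : ℕ} (hm : 1 ≤ m) :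
    ∑ k ∈ Finset.range m, logBound d C m k ≤
      d / 4 * m ^ 2 * Real.log m + (d + d * Real.log C + C) * m ^ 2 := by
  have hm' : (1 : ℝ) ≤ m := by exact_mod_cast hm
  set f : ℕ → ℝ := fun k => ((m - k : ℕ) : ℝ) * logBound d C m k with hf
  have hstep : ∀ k ∈ Finset.range m, logBound d C m k + logBound d C m (k + 1) =
      (f k - f (k + 1)) + ((m - k : ℕ) * (d * Real.log (C * (m - k : ℕ))) + C * m) := by
    intro k hk
    have hk := Finset.mem_range.mp hk
    have h1 : ((m - (k + 1) : ℕ) : ℝ) = (m - k : ℕ) - 1 := by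
      rw [Nat.cast_sub (by omega), Nat.cast_sub hk.le]; push_cast; ring
    have ht : (0 : ℝ) < (m - k : ℕ) := by exact_mod_cast (by omega : 0 < m - k)
    simp only [hf, h1]
    rw [logBound]
    field_simp
    ring
  have hsum := Finset.sum_congr rfl hstep
  rw [Finset.sum_add_distrib, Finset.sum_add_distrib, Finset.sum_range_sub', Finset.sum_add_distrib,
    Finset.sum_const, Finset.card_range, nsmul_eq_mul] at hsum
  have hf0 : f 0 = 0 := by simp [hf, logBound]
  have hfm : f m = 0 := by simp [hf]
  have h1 : ∑ k ∈ Finset.range m, logBound d C m (k + 1) =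
      ∑ k ∈ Finset.range m, logBound d C m k + logBound d C m m := by
    have := Finset.sum_range_succ' (logBound d C m) m
    rw [Finset.sum_range_succ, show logBound d C m 0 = 0 from rfl, add_zero] at this
    exact this.symm
  have h2 := logBound_nonneg hd hC m m le_rfl
  have h3 : ∑ k ∈ Finset.range m, ((m - k : ℕ) : ℝ) * (d * Real.log (C * (m - k : ℕ))) ≤
      ∑ k ∈ Finset.range m, ((m - k : ℕ) : ℝ) * (d * (Real.log C + Real.log m)) := by
    refine Finset.sum_le_sum fun k hk => ?_
    have hk := Finset.mem_range.mp hk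
    have ht : (0 : ℝ) < (m - k : ℕ) := by exact_mod_cast (by omega : 0 < m - k)
    have ht' : ((m - k : ℕ) : ℝ) ≤ m := by exact_mod_cast Nat.sub_le m k
    rw [Real.log_mul (by positivity) ht.ne']
    gcongr
  have h4 : ∑ k ∈ Finset.range m, ((m - k : ℕ) : ℝ) = m * (m + 1) / 2 := by
    have h5 := Finset.sum_range_reflect (fun j => ((j + 1 : ℕ) : ℝ)) m
    have h6 : ∀ k ∈ Finset.range m, ((m - k : ℕ) : ℝ) = ((m - 1 - k + 1 : ℕ) : ℝ) := by
      intro k hk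
      have hk := Finset.mem_range.mp hk
      congr 1; omega
    rw [Finset.sum_congr rfl h6, h5]
    clear * -
    induction m with
    | zero => simp
    | succ m ih => rw [Finset.sum_range_succ, ih]; push_cast; ring
  rw [← Finset.sum_mul, h4] at h3
  have hl : Real.log m ≤ m := (Real.log_le_self (by positivity))
  have hl0 : 0 ≤ Real.log m := Real.log_nonneg hm'
  have hlC : 0 ≤ Real.log C := Real.log_nonneg hC
  have h7 : m * (m + 1) / 2 * (d * (Real.log C + Real.log m)) ≤
      d / 2 * m ^ 2 * Real.log m + (d * Real.log C + d) * m ^ 2 := by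
    have a1 : d * (m * Real.log m) ≤ d * m ^ 2 := by gcongr; nlinarith
    have a2 : d * Real.log C * m ≤ d * Real.log C * m ^ 2 := by gcongr; nlinarith
    nlinarith [mul_nonneg hd (sq_nonneg (m : ℝ))]
  have h8 : 0 ≤ d * m ^ 2 := by positivity
  have h9 : 0 ≤ d * Real.log C * m ^ 2 := by positivity
  have h10 : 0 ≤ C * m ^ 2 := by positivity
  rw [hf0, hfm, h1] at hsum
  nlinarith

end Growth

end OKLattice

namespace OKLattice

section GramCount

open scoped Matrix

variable {K : Type} [Field K] [NumberField K] [htr : Fact (TotallyReal K)]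

variable (K) in
/-- The Gram matrices of the first vectors of reduced frames of unimodular lattices. -/
def gramSet (m k : ℕ) : Set (Matrix (Fin k) (Fin k) (𝓞 K)) :=
  {A | ∃ (L : OKLattice K) (e : ℕ → L.carrier), L.IsUnimodular ∧ L.rank = m ∧
    L.IsReduced e m ∧ L.gram e k = A}

/-- A nonsingular Gram matrix and the adjacent row leave few choices for the next diagonal entry. -/
theorem card_diag_le {k : ℕ} {A : Matrix (Fin k) (Fin k) (𝓞 K)} (hA : A.det ≠ 0)
    (r : Fin k → 𝓞 K) {τ : ℝ} (hτ : 0 ≤ τ) :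
    ∃ T : Finset (𝓞 K), (T.card : ℝ) ≤ (τ + 1) ^ Module.finrank ℚ K ∧
      ∀ (L : OKLattice K) (e : ℕ → L.carrier), L.gram e k = A → L.row e k (e k) = r →
        (∀ σ : K →+* ℝ, 0 < σ (L.gnorm e k) ∧ σ (L.gnorm e k) ≤ τ) → L.form (e k) (e k) ∈ T := by
  set S : Set (𝓞 K) := {α | ∃ (L : OKLattice K) (e : ℕ → L.carrier), L.gram e k = A ∧
    L.row e k (e k) = r ∧ (∀ σ : K →+* ℝ, 0 < σ (L.gnorm e k) ∧ σ (L.gnorm e k) ≤ τ) ∧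
    L.form (e k) (e k) = α} with hS
  have hdet : ((algebraMap (𝓞 K) K).mapMatrix A).det ≠ 0 := by
    rw [← RingHom.map_det]
    exact fun h => hA (RingOfIntegers.coe_eq_zero_iff.mp h)
  have huniq : ∀ x x' : Fin k → K,
      (∀ j, ∑ i, x i * algebraMap (𝓞 K) K (A i j) = algebraMap (𝓞 K) K (r j)) →
      (∀ j, ∑ i, x' i * algebraMap (𝓞 K) K (A i j) = algebraMap (𝓞 K) K (r j)) → x = x' := by
    intro x x' h h'
    refine Matrix.vecMul_injective_of_isUnit
      ((Matrix.isUnit_iff_isUnit_det _).mpr (isUnit_iff_ne_zero.mpr hdet)) ?_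
    funext j
    exact (h j).trans (h' j).symm
  obtain ⟨hfin, hcard⟩ := finite_of_diff_lt S (a := ⌊τ⌋₊ + 1) (by
    rintro _ ⟨L, e, hg, hr, hn, rfl⟩ _ ⟨L', e', hg', hr', hn', rfl⟩ σ
    obtain ⟨x, hx1, hx2⟩ := L.exists_projection_coords e k (e k)
    obtain ⟨x', hx1', hx2'⟩ := L'.exists_projection_coords e' k (e' k)
    rw [hg, hr] at hx1
    rw [hg', hr'] at hx1'
    rw [hr] at hx2
    rw [hr', ← huniq x x' hx1 hx1'] at hx2'
    have h1 : algebraMap (𝓞 K) K (L.form (e k) (e k) - L'.form (e' k) (e' k)) =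
        L.gnorm e k - L'.gnorm e' k := by
      rw [gnorm_eq, gnorm_eq, hx2, hx2', map_sub]; ring
    rw [ov_apply, h1, map_sub]
    have h2 := hn σ
    have h3 := hn' σ
    have h4 := Nat.lt_floor_add_one τ
    push_cast
    rw [abs_lt]
    constructor <;> linarith [h2.1, h2.2, h3.1, h3.2])
  refine ⟨hfin.toFinset, ?_, fun L e hg hr hn => ?_⟩
  · rw [← Set.ncard_eq_toFinset_card S hfin]
    have h1 : (S.ncard : ℝ) ≤ ((⌊τ⌋₊ + 1 : ℕ) : ℝ) ^ Module.finrank ℚ K := by exact_mod_cast hcard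
    refine h1.trans (pow_le_pow_left₀ (Nat.cast_nonneg _) ?_ _)
    push_cast
    linarith [Nat.floor_le hτ]
  · rw [Set.Finite.mem_toFinset]
    exact ⟨L, e, hg, hr, hn, rfl⟩

variable (K) in
theorem exists_card_gramSet_le : ∃ C : ℝ, 1 ≤ C ∧ (∀ (L : OKLattice K) (e : ℕ → L.carrier),
    L.IsUnimodular → (∀ j < L.rank, L.IsShortest e j (e j)) → L.logDet e L.rank ≤ C * L.rank) ∧
    ∀ m k : ℕ, k ≤ m → ∃ S : Finset (Matrix (Fin k) (Fin k) (𝓞 K)), gramSet K m k ⊆ S ∧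
      (S.card : ℝ) ≤ Real.exp (∑ j ∈ Finset.range k, (logBound (Module.finrank ℚ K) C m j +
        Module.finrank ℚ K *
          Real.log (C * (m - j : ℕ) * Real.exp (C * m / (m - j : ℕ)) + 1))) := by
  classical
  obtain ⟨C, hC, hb⟩ := exists_reduced_bounds K
  refine ⟨C, hC, fun L e hL he => (hb L e hL he).1, fun m k => ?_⟩
  induction k with
  | zero =>
    intro _
    exact ⟨{0}, fun A _ => by simp [Subsingleton.elim A 0], by simp⟩
  | succ k ih =>
    intro hk
    obtain ⟨S, hS, hSc⟩ := ih (by omega)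
    set τ : ℝ := C * (m - k : ℕ) * Real.exp (C * m / (m - k : ℕ)) with hτ
    have hτ0 : 0 ≤ τ := by positivity
    set S' := S.filter fun A => A ∈ gramSet K m k with hS'
    have hdet : ∀ A ∈ gramSet K m k, A.det ≠ 0 ∧
        (nmN A.det : ℝ) ≤ Real.exp (logBound (Module.finrank ℚ K) C m k) := by
      rintro A ⟨L, e, hL, rfl, he, rfl⟩
      have hd := L.det_gram_ne_zero (e := e) (k := k) fun j hj => (he j (by omega)).1.1
      refine ⟨hd, ?_⟩
      have h1 := (hb L e hL fun j hj => (he j hj).1).2.2 k (by omega)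
      rw [← Real.log_le_iff_le_exp (by exact_mod_cast nmN_pos hd)]
      exact h1
    have hrow : ∀ A : Matrix (Fin k) (Fin k) (𝓞 K), ∃ F : Finset (Fin k → 𝓞 K),
        A ∈ gramSet K m k → (F.card : ℝ) ≤ Real.exp (logBound (Module.finrank ℚ K) C m k) ∧
          ∀ r, normalForm A r ∈ F := by
      intro A
      by_cases hA : A ∈ gramSet K m k
      · obtain ⟨F, hF, hF'⟩ := card_range_normalForm A (hdet A hA).1
        exact ⟨F, fun _ => ⟨(Nat.cast_le.mpr hF).trans (hdet A hA).2, hF'⟩⟩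
      · exact ⟨∅, fun h => absurd h hA⟩
    choose F hF using hrow
    have hdiag : ∀ (A : Matrix (Fin k) (Fin k) (𝓞 K)) (r : Fin k → 𝓞 K), ∃ T : Finset (𝓞 K),
        A ∈ gramSet K m k → (T.card : ℝ) ≤ (τ + 1) ^ Module.finrank ℚ K ∧
        ∀ (L : OKLattice K) (e : ℕ → L.carrier), L.gram e k = A → L.row e k (e k) = r →
        (∀ σ : K →+* ℝ, 0 < σ (L.gnorm e k) ∧ σ (L.gnorm e k) ≤ τ) → L.form (e k) (e k) ∈ T := by
      intro A r
      by_cases hA : A ∈ gramSet K m k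
      · obtain ⟨T, hT⟩ := card_diag_le (hdet A hA).1 r hτ0
        exact ⟨T, fun _ => hT⟩
      · exact ⟨∅, fun h => absurd h hA⟩
    choose T hT using hdiag
    refine ⟨S'.biUnion fun A => (F A).biUnion fun r => (T A r).image fun α => bordered A r α,
      ?_, ?_⟩
    · rintro _ ⟨L, e, hL, hm, he, rfl⟩
      have hA : L.gram e k ∈ gramSet K m k := ⟨L, e, hL, hm, he, rfl⟩
      obtain ⟨r, hr⟩ := (he k (by omega)).2
      rw [Finset.mem_coe, gram_succ]
      refine Finset.mem_biUnion.mpr ⟨_, Finset.mem_filter.mpr ⟨hS hA, hA⟩, ?_⟩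
      refine Finset.mem_biUnion.mpr ⟨L.row e k (e k), hr ▸ (hF _ hA).2 r, ?_⟩
      refine Finset.mem_image_of_mem _ ((hT _ _ hA).2 L e rfl rfl fun σ => ⟨?_, ?_⟩)
      · exact L.gnorm_pos e (he k (by omega)).1.1 σ
      · subst hm
        exact (hb L e hL fun j hj => (he j hj).1).2.1 k (by omega) σ
    · have h1 : ∀ A ∈ S', (((F A).biUnion fun r => (T A r).image fun α => bordered A r α).card : ℝ)
          ≤ Real.exp (logBound (Module.finrank ℚ K) C m k) * (τ + 1) ^ Module.finrank ℚ K := by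
        intro A hA
        have hA' := (Finset.mem_filter.mp hA).2
        have h2 : (((F A).biUnion fun r => (T A r).image fun α => bordered A r α).card : ℝ) ≤
            ∑ r ∈ F A, (((T A r).image fun α => bordered A r α).card : ℝ) := by
          exact_mod_cast Finset.card_biUnion_le
        refine h2.trans ((Finset.sum_le_card_nsmul _ _ ((τ + 1) ^ Module.finrank ℚ K)
          fun r _ => ?_).trans ?_)
        · exact (Nat.cast_le.mpr Finset.card_image_le).trans (hT A r hA').1
        · rw [nsmul_eq_mul]
          exact mul_le_mul_of_nonneg_right (hF A hA').1 (by positivity)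
      have h2 : ((S'.biUnion fun A => (F A).biUnion fun r =>
          (T A r).image fun α => bordered A r α).card : ℝ) ≤
          ∑ A ∈ S', (((F A).biUnion fun r => (T A r).image fun α => bordered A r α).card : ℝ) := by
        exact_mod_cast Finset.card_biUnion_le
      refine h2.trans ((Finset.sum_le_card_nsmul _ _ _ h1).trans ?_)
      rw [nsmul_eq_mul, Finset.sum_range_succ, Real.exp_add, Real.exp_add, ← Real.log_pow,
        Real.exp_log (by positivity)]
      refine mul_le_mul_of_nonneg_right ?_ (by positivity)
      exact (Nat.cast_le.mpr (Finset.card_filter_le _ _)).trans hSc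

variable (K) in
theorem exists_card_gramSet_le_exp : ∃ C : ℝ, 1 ≤ C ∧ (∀ (L : OKLattice K) (e : ℕ → L.carrier),
    L.IsUnimodular → (∀ j < L.rank, L.IsShortest e j (e j)) → L.logDet e L.rank ≤ C * L.rank) ∧
    ∀ m : ℕ, 1 ≤ m → ∃ S : Finset (Matrix (Fin m) (Fin m) (𝓞 K)), gramSet K m m ⊆ S ∧
      (S.card : ℝ) ≤ Real.exp ((Module.finrank ℚ K : ℝ) / 4 * m ^ 2 * Real.log m + C * m ^ 2) := by
  obtain ⟨C, hC, h1, h2⟩ := exists_card_gramSet_le K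
  set d : ℝ := (Module.finrank ℚ K : ℝ) with hd
  have hd0 : 0 ≤ d := Nat.cast_nonneg _
  have hlC : 0 ≤ Real.log (2 * C) := Real.log_nonneg (by linarith)
  have hlC' : 0 ≤ Real.log C := Real.log_nonneg hC
  refine ⟨C + ((d + d * Real.log C + C) + d * (Real.log (2 * C) + 1 + C)), by
    have : 0 ≤ (d + d * Real.log C + C) + d * (Real.log (2 * C) + 1 + C) := by positivity
    linarith, fun L e hL he => ?_, fun m hm => ?_⟩
  · refine (h1 L e hL he).trans (mul_le_mul_of_nonneg_right ?_ (Nat.cast_nonneg _))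
    have : 0 ≤ (d + d * Real.log C + C) + d * (Real.log (2 * C) + 1 + C) := by positivity
    linarith
  · obtain ⟨S, hS, hSc⟩ := h2 m m le_rfl
    have hm' : (1 : ℝ) ≤ m := by exact_mod_cast hm
    refine ⟨S, hS, hSc.trans (Real.exp_le_exp.mpr ?_)⟩
    rw [Finset.sum_add_distrib]
    have h3 := sum_logBound_le hd0 hC hm
    have h4 : ∑ j ∈ Finset.range m, d *
        Real.log (C * (m - j : ℕ) * Real.exp (C * m / (m - j : ℕ)) + 1) ≤
        m • (d * ((Real.log (2 * C) + 1 + C) * m)) := by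
      refine (Finset.sum_le_card_nsmul _ _ (d * ((Real.log (2 * C) + 1 + C) * m))
        fun j hj => ?_).trans (by rw [Finset.card_range])
      have hj := Finset.mem_range.mp hj
      have ht : (1 : ℝ) ≤ (m - j : ℕ) := by exact_mod_cast (by omega : 1 ≤ m - j)
      have ht' : ((m - j : ℕ) : ℝ) ≤ m := by exact_mod_cast Nat.sub_le m j
      refine mul_le_mul_of_nonneg_left ?_ hd0
      have h5 : C * (m - j : ℕ) * Real.exp (C * m / (m - j : ℕ)) + 1 ≤
          2 * C * m * Real.exp (C * m) := by
        have a1 : Real.exp (C * m / (m - j : ℕ)) ≤ Real.exp (C * m) :=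
          Real.exp_le_exp.mpr (div_le_self (by positivity) ht)
        have a2 : C * (m - j : ℕ) * Real.exp (C * m / (m - j : ℕ)) ≤
            C * m * Real.exp (C * m) := by gcongr
        have a3 : 1 ≤ C * m * Real.exp (C * m) := by
          have : 1 ≤ Real.exp (C * m) := Real.one_le_exp (by positivity)
          have : 1 ≤ C * m := by nlinarith
          nlinarith
        linarith
      refine (Real.log_le_log (by positivity) h5).trans ?_
      rw [Real.log_mul (by positivity) (Real.exp_ne_zero _), Real.log_exp,
        Real.log_mul (by positivity) (by positivity)]
      have a4 : Real.log m ≤ m := Real.log_le_self (by positivity)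
      nlinarith
    rw [nsmul_eq_mul] at h4
    have h6 : 0 ≤ C * (m : ℝ) ^ 2 := by positivity
    nlinarith

end GramCount

end OKLattice

/-- Small subgroups of a finite group have few generators. -/
theorem AddSubgroup.exists_closure_eq {G : Type*} [AddCommGroup G] [Finite G] (H : AddSubgroup G)
    {s : ℕ} (hs : Nat.card H ≤ 2 ^ s) : ∃ f : Fin s → G, AddSubgroup.closure (Set.range f) = H := by
  classical
  obtain ⟨ι, _, n, u, hn, hprod, -, hgen⟩ :=
    AddSubgroup.exists_generators (⊥ : AddSubgroup H) (by
      rw [AddSubgroup.index_bot]; exact Nat.card_pos.ne')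
  rw [AddSubgroup.index_bot] at hprod
  have hcard : Fintype.card ι ≤ s := by
    have h1 : 2 ^ Fintype.card ι ≤ Nat.card H := by
      rw [← hprod, Fintype.card, ← Finset.prod_const]
      exact Finset.prod_le_prod' fun i _ => hn i
    exact (Nat.pow_le_pow_iff_right one_lt_two).mp (h1.trans hs)
  obtain ⟨g⟩ : Nonempty (ι ↪ Fin s) :=
    Function.Embedding.nonempty_of_card_le (by rwa [Fintype.card_fin])
  refine ⟨Function.extend g (fun i => (u i : G)) 0, le_antisymm ?_ fun v hv => ?_⟩
  · rw [AddSubgroup.closure_le]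
    rintro _ ⟨j, rfl⟩
    by_cases hj : ∃ i, g i = j
    · obtain ⟨i, rfl⟩ := hj
      rw [g.injective.extend_apply]
      exact (u i).2
    · rw [Function.extend_apply' _ _ _ hj]
      exact H.zero_mem
  · obtain ⟨c, hc⟩ := hgen ⟨v, hv⟩
    rw [AddSubgroup.mem_bot, sub_eq_zero] at hc
    have h1 : v = ∑ i, c i • (u i : G) := by
      have := congrArg Subtype.val hc
      simpa using this
    rw [h1]
    refine AddSubgroup.sum_mem _ fun i _ => AddSubgroup.zsmul_mem _ ?_ _
    exact AddSubgroup.subset_closure ⟨g i, g.injective.extend_apply _ _ _⟩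

/-- There are few subgroups between a subgroup of finite index and a small extension of it. -/
theorem AddSubgroup.exists_finset_relIndex_le {G : Type*} [AddCommGroup G] (N : AddSubgroup G)
    (hN : N.index ≠ 0) (s : ℕ) : ∃ S : Finset (AddSubgroup G), S.card ≤ N.index ^ s ∧
      ∀ W, N ≤ W → N.relIndex W ≤ 2 ^ s → W ∈ S := by
  classical
  have hfin : Finite (G ⧸ N) := Nat.finite_of_card_ne_zero hN
  have := Fintype.ofFinite (G ⧸ N)
  refine ⟨Finset.univ.image fun f : Fin s → G ⧸ N =>
    (AddSubgroup.closure (Set.range f)).comap (QuotientAddGroup.mk' N), ?_, fun W hW hs => ?_⟩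
  · refine Finset.card_image_le.trans ?_
    rw [Finset.card_univ, Fintype.card_fun, Fintype.card_fin, AddSubgroup.index,
      Nat.card_eq_fintype_card]
  · have hcard : Nat.card (W.map (QuotientAddGroup.mk' N)) = N.relIndex W := by
      have h := AddSubgroup.relIndex_ker W (QuotientAddGroup.mk' N)
      rw [QuotientAddGroup.ker_mk'] at h
      exact h.symm
    obtain ⟨f, hf⟩ := AddSubgroup.exists_closure_eq (W.map (QuotientAddGroup.mk' N))
      (hcard.trans_le hs)
    refine Finset.mem_image.mpr ⟨f, Finset.mem_univ _, ?_⟩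
    rw [hf, AddSubgroup.comap_map_eq, QuotientAddGroup.ker_mk', sup_eq_left.mpr hW]

namespace OKLattice

section Classification

open scoped Matrix

variable {K : Type} [Field K] [NumberField K] [htr : Fact (TotallyReal K)]

/-- A lattice is determined by a Gram matrix and the values of its form on a frame. -/
theorem isometric_of_gram_eq {k : ℕ} {L L' : OKLattice K} {e : ℕ → L.carrier}
    {e' : ℕ → L'.carrier} (hA : (L.gram e k).det ≠ 0) (hgram : L.gram e k = L'.gram e' k)
    (hidx : (LinearMap.range (L.frameMap e k)).toAddSubgroup.index ≠ 0)
    (hidx' : (LinearMap.range (L'.frameMap e' k)).toAddSubgroup.index ≠ 0)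
    (hrange : LinearMap.range (L.rowLin e k) = LinearMap.range (L'.rowLin e' k)) :
    L.Isometric L' := by
  have hω := L.rowLin_injective hA hidx
  have hω' := L'.rowLin_injective (hgram ▸ hA) hidx'
  let φ : L.carrier ≃ₗ[𝓞 K] L'.carrier := (LinearEquiv.ofInjective _ hω).trans
    ((LinearEquiv.ofEq _ _ hrange).trans (LinearEquiv.ofInjective _ hω').symm)
  have hφ : ∀ v, L'.rowLin e' k (φ v) = L.rowLin e k v := by
    intro v
    have h1 := LinearEquiv.apply_symm_apply (LinearEquiv.ofInjective _ hω')
      (LinearEquiv.ofEq _ _ hrange (LinearEquiv.ofInjective _ hω v))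
    exact congrArg Subtype.val h1
  have hform : ∀ (M : OKLattice K) (f : ℕ → M.carrier) (x : Fin k → 𝓞 K) (v : M.carrier),
      M.form (M.frameMap f k x) v = x ⬝ᵥ M.rowLin f k v := by
    intro M f x v
    rw [frameMap_apply, map_sum, LinearMap.sum_apply, dotProduct]
    refine Finset.sum_congr rfl fun i _ => ?_
    rw [map_smul, LinearMap.smul_apply, smul_eq_mul, M.symm]
    rfl
  refine ⟨φ, fun u v => ?_⟩
  set N := (LinearMap.range (L.frameMap e k)).toAddSubgroup.index
  set N' := (LinearMap.range (L'.frameMap e' k)).toAddSubgroup.index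
  obtain ⟨c, hc⟩ := AddSubgroup.nsmul_index_mem
    (H := (LinearMap.range (L.frameMap e k)).toAddSubgroup) u
  obtain ⟨c', hc'⟩ := AddSubgroup.nsmul_index_mem
    (H := (LinearMap.range (L'.frameMap e' k)).toAddSubgroup) (φ u)
  have hcc : N' • c = N • c' := by
    refine Matrix.mulVec_injective_of_det_ne_zero hA ?_
    have h1 : L.gram e k *ᵥ c = N • L.rowLin e k u := by
      rw [← rowLin_frameMap, hc, map_nsmul]
    have h2 : L.gram e k *ᵥ c' = N' • L.rowLin e k u := by
      rw [hgram, ← rowLin_frameMap, hc', map_nsmul, hφ]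
    rw [Matrix.mulVec_smul, Matrix.mulVec_smul, h1, h2, smul_comm]
  have h1 : N' • (N • L.form u v) = (N' • c) ⬝ᵥ L.rowLin e k v := by
    rw [smul_dotProduct, ← hform, hc, map_nsmul, LinearMap.smul_apply]
  have h2 : N • (N' • L'.form (φ u) (φ v)) = (N • c') ⬝ᵥ L.rowLin e k v := by
    rw [smul_dotProduct, ← hφ v, ← hform, hc', map_nsmul, LinearMap.smul_apply]
  rw [hcc, ← h2, smul_comm] at h1
  have h3 : (N : 𝓞 K) ≠ 0 := Nat.cast_ne_zero.mpr hidx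
  have h4 : (N' : 𝓞 K) ≠ 0 := Nat.cast_ne_zero.mpr hidx'
  simp only [nsmul_eq_mul] at h1
  exact (mul_left_cancel₀ h4 (mul_left_cancel₀ h3 h1)).symm

theorem Covered.of_datum {α : Type} {p : OKLattice K → Prop} (S : Finset α)
    (D : OKLattice K → α → Prop) (h1 : ∀ L, p L → ∃ a ∈ S, D L a)
    (h2 : ∀ L L' a, D L a → D L' a → L.Isometric L') : Covered p S.card := by
  classical
  have hF : ∀ a : S, ∃ F : OKLattice K, ∀ L, D L a → L.Isometric F := by
    intro a
    by_cases h : ∃ L, D L a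
    · obtain ⟨F, hF⟩ := h
      exact ⟨F, fun L hL => h2 L F a hL hF⟩
    · exact ⟨zero K, fun L hL => absurd ⟨L, hL⟩ h⟩
  choose F hF using hF
  refine ⟨S, inferInstance, F, by simp, fun L hL => ?_⟩
  obtain ⟨a, ha, hD⟩ := h1 L hL
  exact ⟨⟨a, ha⟩, hF _ L hD⟩

variable (K) in
/-- An upper bound for the number of unimodular lattices of given rank. -/
theorem exists_covered_isUnimodular_rank_eq : ∃ C : ℝ, 1 ≤ C ∧ ∀ m : ℕ, 1 ≤ m →
    Covered (fun L : OKLattice K => L.IsUnimodular ∧ L.rank = m)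
      (Real.exp ((Module.finrank ℚ K : ℝ) / 4 * m ^ 2 * Real.log m + C * m ^ 2)) := by
  classical
  obtain ⟨C, hC, hdet, hgram⟩ := exists_card_gramSet_le_exp K
  obtain ⟨q, hq1, hq⟩ := exists_index_le K
  refine ⟨C + C * q, by nlinarith [(Nat.cast_nonneg q : (0 : ℝ) ≤ q)], fun m hm => ?_⟩
  obtain ⟨S, hS, hSc⟩ := hgram m hm
  set S' := S.filter fun A => A ∈ gramSet K m m with hS'
  have hT : ∀ A : Matrix (Fin m) (Fin m) (𝓞 K), ∃ T : Finset (AddSubgroup (Fin m → 𝓞 K)),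
      A ∈ gramSet K m m → (T.card : ℝ) ≤ Real.exp (C * q * m ^ 2) ∧
        ∀ W, (LinearMap.range A.mulVecLin).toAddSubgroup ≤ W →
        (LinearMap.range A.mulVecLin).toAddSubgroup.relIndex W ≤ 2 ^ (q * m) → W ∈ T := by
    intro A
    by_cases hA : A ∈ gramSet K m m
    · obtain ⟨L, e, hL, rfl, he, rfl⟩ := hA
      have hd := L.det_gram_ne_zero (e := e) (k := L.rank) fun j hj => (he j hj).1.1
      have hi : (LinearMap.range (L.gram e L.rank).mulVecLin).toAddSubgroup.index =
          nmN (L.gram e L.rank).det := card_quotient_range_mulVecLin _ hd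
      obtain ⟨T, hTc, hT⟩ := AddSubgroup.exists_finset_relIndex_le
        (LinearMap.range (L.gram e L.rank).mulVecLin).toAddSubgroup
        (hi ▸ nmN_ne_zero hd) (q * L.rank)
      refine ⟨T, fun _ => ⟨?_, hT⟩⟩
      have h1 : (T.card : ℝ) ≤ (nmN (L.gram e L.rank).det : ℝ) ^ (q * L.rank) := by
        rw [← hi]; exact_mod_cast hTc
      have h2 : (nmN (L.gram e L.rank).det : ℝ) ≤ Real.exp (C * L.rank) := by
        rw [← Real.log_le_iff_le_exp (by exact_mod_cast nmN_pos hd)]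
        exact hdet L e hL fun j hj => (he j hj).1
      refine h1.trans ((pow_le_pow_left₀ (Nat.cast_nonneg _) h2 _).trans (le_of_eq ?_))
      rw [← Real.exp_nat_mul]
      congr 1; push_cast; ring
    · exact ⟨∅, fun h => absurd h hA⟩
  choose T hT using hT
  let U : Finset (Matrix (Fin m) (Fin m) (𝓞 K) × AddSubgroup (Fin m → 𝓞 K)) :=
    S'.biUnion fun A => (T A).image fun W => (A, W)
  have hcov := Covered.of_datum (p := fun L : OKLattice K => L.IsUnimodular ∧ L.rank = m) U
    (fun L a => ∃ e : ℕ → L.carrier, (L.gram e m).det ≠ 0 ∧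
      (LinearMap.range (L.frameMap e m)).toAddSubgroup.index ≠ 0 ∧ L.gram e m = a.1 ∧
      (LinearMap.range (L.rowLin e m)).toAddSubgroup = a.2) (by
    rintro L ⟨hL, rfl⟩
    obtain ⟨e, he⟩ := L.exists_isReduced
    have he' : ∀ j < L.rank, L.IsShortest e j (e j) := fun j hj => (he j hj).1
    have hd := L.det_gram_ne_zero (e := e) (k := L.rank) fun j hj => (he j hj).1.1
    obtain ⟨h1, h2, -⟩ := hq L e hL he'
    have hA : L.gram e L.rank ∈ gramSet K L.rank L.rank := ⟨L, e, hL, rfl, he, rfl⟩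
    refine ⟨(L.gram e L.rank, (LinearMap.range (L.rowLin e L.rank)).toAddSubgroup), ?_,
      e, hd, h1, rfl, rfl⟩
    refine Finset.mem_biUnion.mpr ⟨_, Finset.mem_filter.mpr ⟨hS hA, hA⟩,
      Finset.mem_image_of_mem _ ((hT _ hA).2 _ ?_ ?_)⟩
    · rintro _ ⟨x, rfl⟩
      exact ⟨_, L.rowLin_frameMap e L.rank x⟩
    · have h3 : (LinearMap.range (L.gram e L.rank).mulVecLin).toAddSubgroup =
          (LinearMap.range (L.frameMap e L.rank)).toAddSubgroup.map
            (L.rowLin e L.rank).toAddMonoidHom := L.range_mulVecLin_gram e L.rank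
      have h4 : (LinearMap.range (L.rowLin e L.rank)).toAddSubgroup =
          (⊤ : AddSubgroup L.carrier).map (L.rowLin e L.rank).toAddMonoidHom := by
        ext y; simp
      rw [h3, h4, AddSubgroup.relIndex_map_map_of_injective _ _ (L.rowLin_injective hd h1),
        AddSubgroup.relIndex_top_right, pow_mul]
      exact h2.trans (Nat.pow_le_pow_left Nat.lt_two_pow_self.le _)) (by
    rintro L L' ⟨A, W⟩ ⟨e, hd, h1, h2, h3⟩ ⟨e', -, h1', h2', h3'⟩
    exact isometric_of_gram_eq hd (h2.trans h2'.symm) h1 h1'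
      (Submodule.toAddSubgroup_injective (h3.trans h3'.symm)))
  refine hcov.mono ?_ fun _ h => h
  have h1 : (U.card : ℝ) ≤ ∑ A ∈ S', (((T A).image fun W => (A, W)).card : ℝ) := by
    exact_mod_cast Finset.card_biUnion_le
  refine h1.trans ((Finset.sum_le_card_nsmul _ _ (Real.exp (C * q * m ^ 2))
    fun A hA => ?_).trans ?_)
  · exact (Nat.cast_le.mpr Finset.card_image_le).trans (hT A (Finset.mem_filter.mp hA).2).1
  · rw [nsmul_eq_mul, add_mul C, ← add_assoc, Real.exp_add]
    refine mul_le_mul_of_nonneg_right ?_ (Real.exp_pos _).le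
    exact (Nat.cast_le.mpr (Finset.card_filter_le _ _)).trans hSc

end Classification

end OKLattice

namespace OKLattice

section Upper

open Filter Topology

variable {K : Type} [Field K] [NumberField K]

theorem exists_represents_all {ι : Type} (s : Finset ι) (F : ι → OKLattice K) {m : ℕ}
    (hF : ∀ i, (F i).rank ≤ m) :
    ∃ W : OKLattice K, W.rank ≤ s.card * m ∧ ∀ i ∈ s, W.Represents (F i) := by
  classical
  induction s using Finset.induction_on with
  | empty =>
    refine ⟨zero K, ?_, fun i hi => absurd hi (Finset.notMem_empty i)⟩
    rw [rank_eq_finrank]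
    exact (Module.finrank_zero_of_subsingleton (R := 𝓞 K) (M := PUnit)).trans_le (Nat.zero_le _)
  | insert a s ha ih =>
    obtain ⟨W, hW, hW'⟩ := ih
    refine ⟨(F a).prod W, ?_, fun i hi => ?_⟩
    · rw [rank_prod, Finset.card_insert_of_notMem ha, add_mul, one_mul, add_comm]
      exact Nat.add_le_add hW (hF a)
    · rcases Finset.mem_insert.mp hi with rfl | hi
      · exact prod_represents_left _ _
      · exact (prod_represents_right _ _).trans (hW' i hi)

theorem Covered.exists_represents_all {p : OKLattice K → Prop} {H : ℝ} (h : Covered p H) {m : ℕ}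
    (hp : ∀ L, p L → L.rank ≤ m) :
    ∃ W : OKLattice K, (W.rank : ℝ) ≤ H * m ∧ ∀ L, p L → W.Represents L := by
  classical
  obtain ⟨ι, _, F, hc, hF⟩ := h
  let F' : ι → OKLattice K := fun i => if (F i).rank ≤ m then F i else zero K
  have hF' : ∀ i, (F' i).rank ≤ m := by
    intro i
    by_cases h : (F i).rank ≤ m
    · simp only [F', if_pos h]; exact h
    · simp only [F', if_neg h]
      rw [rank_eq_finrank]
      exact (Module.finrank_zero_of_subsingleton (R := 𝓞 K) (M := PUnit)).trans_le (Nat.zero_le _)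
  obtain ⟨W, hW, hW'⟩ := OKLattice.exists_represents_all Finset.univ F' hF'
  refine ⟨W, ?_, fun L hL => ?_⟩
  · have h1 : (W.rank : ℝ) ≤ Fintype.card ι * m := by exact_mod_cast hW
    exact h1.trans (mul_le_mul_of_nonneg_right hc (Nat.cast_nonneg _))
  · obtain ⟨i, hi⟩ := hF L hL
    have h1 : F' i = F i := if_pos (hi.rank_eq ▸ hp L hL)
    exact (h1 ▸ hW' i (Finset.mem_univ i)).trans hi.represents

variable [htr : Fact (TotallyReal K)]

variable (K) in
theorem exists_isUniversal_rank_le : ∃ (c : ℕ) (C : ℝ), 1 ≤ C ∧ ∀ n : ℕ, 1 ≤ n →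
    ∃ W : OKLattice K, W.IsUniversal n ∧ (W.rank : ℝ) ≤
      Real.exp ((Module.finrank ℚ K : ℝ) / 4 * (n + c : ℕ) ^ 2 * Real.log (n + c : ℕ) +
        C * (n + c : ℕ) ^ 2) * (n + c : ℕ) := by
  obtain ⟨c, hc⟩ := exists_isUnimodular K
  obtain ⟨C, hC, hcov⟩ := exists_covered_isUnimodular_rank_eq K
  refine ⟨c, C, hC, fun n hn => ?_⟩
  obtain ⟨W, hW, hW'⟩ := (hcov (n + c) (by omega)).exists_represents_all fun L hL => hL.2.le
  refine ⟨W, fun L hL => ?_, hW⟩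
  obtain ⟨U, hU, hUu, hUL⟩ := hc L
  exact (hW' U ⟨hUu, by rw [hU, hL]⟩).trans hUL

variable (K) in
theorem exists_isUniversal (n : ℕ) : ∃ L : OKLattice K, L.IsUniversal n := by
  obtain ⟨c, C, -, h⟩ := exists_isUniversal_rank_le K
  obtain ⟨W, hW, -⟩ := h (n + 1) (by omega)
  exact ⟨W, fun L hL => hW.represents (by omega)⟩

end Upper

end OKLattice

section Limsup

open Filter Topology

theorem tendsto_add_div (c : ℕ) :
    Tendsto (fun n : ℕ => ((n + c : ℕ) : ℝ) / n) atTop (𝓝 1) := by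
  have h := (tendsto_const_div_atTop_nhds_zero_nat (c : ℝ)).const_add 1
  rw [add_zero] at h
  refine h.congr' ?_
  filter_upwards [eventually_ge_atTop 1] with n hn
  have hn0 : (n : ℝ) ≠ 0 := by exact_mod_cast (by omega : n ≠ 0)
  push_cast
  field_simp

theorem tendsto_log_add_div_log (c : ℕ) :
    Tendsto (fun n : ℕ => Real.log (n + c : ℕ) / Real.log n) atTop (𝓝 1) := by
  have h1 : Tendsto (fun n : ℕ => Real.log ((n + c : ℕ) / n : ℝ) / Real.log n) atTop (𝓝 0) := by
    refine Tendsto.div_atTop (a := Real.log 1) ?_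
      (Real.tendsto_log_atTop.comp tendsto_natCast_atTop_atTop)
    exact (Real.continuousAt_log one_ne_zero).tendsto.comp (tendsto_add_div c)
  have h2 := h1.const_add 1
  rw [add_zero] at h2
  refine h2.congr' ?_
  filter_upwards [eventually_ge_atTop 2] with n hn
  have hn' : (1 : ℝ) < n := by exact_mod_cast hn
  have hl : 0 < Real.log n := Real.log_pos hn'
  rw [Real.log_div (by positivity) (by positivity)]
  field_simp
  ring

theorem tendsto_upper_div {d : ℝ} (hd : 0 < d) (C : ℝ) (c : ℕ) :
    Tendsto (fun n : ℕ => (d / 4 * (n + c : ℕ) ^ 2 * Real.log (n + c : ℕ) + C * (n + c : ℕ) ^ 2 +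
      Real.log (n + c : ℕ)) / (d / 4 * (n : ℝ) ^ 2 * Real.log n)) atTop (𝓝 1) := by
  have hr := tendsto_add_div c
  have hl := tendsto_log_add_div_log c
  have hlog : Tendsto (fun n : ℕ => Real.log n) atTop atTop :=
    Real.tendsto_log_atTop.comp tendsto_natCast_atTop_atTop
  have hsq : Tendsto (fun n : ℕ => d / 4 * (n : ℝ) ^ 2) atTop atTop :=
    ((tendsto_pow_atTop two_ne_zero).comp tendsto_natCast_atTop_atTop).const_mul_atTop
      (by positivity)
  have h1 := (hr.pow 2).mul hl
  have h2 := ((hr.pow 2).const_mul (4 * C / d)).div_atTop hlog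
  have h3 := hl.div_atTop hsq
  have h4 := (h1.add h2).add h3
  simp only [one_pow, mul_one, add_zero] at h4
  refine h4.congr' ?_
  filter_upwards [eventually_ge_atTop 2] with n hn
  have hn' : (1 : ℝ) < n := by exact_mod_cast hn
  have hl : 0 < Real.log n := Real.log_pos hn'
  have hn0 : (n : ℝ) ≠ 0 := by positivity
  field_simp

theorem limsup_log_minUnivRank {K : Type} [Field K] [NumberField K] [htr : Fact (TotallyReal K)] :
    limsup (fun n : ℕ => Real.log (minUnivRank K n) /
      ((Module.finrank ℚ K : ℝ) / 4 * (n : ℝ) ^ 2 * Real.log n)) atTop = 1 := by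
  set d : ℝ := (Module.finrank ℚ K : ℝ) with hd
  have hd0 : 0 < d := by rw [hd]; exact_mod_cast finrank_pos_K (K := K)
  set x : ℕ → ℝ := fun n => Real.log (minUnivRank K n) / (d / 4 * (n : ℝ) ^ 2 * Real.log n) with hx
  have hx0 : ∀ n, 0 ≤ x n := fun n => div_nonneg (Real.log_natCast_nonneg _)
    (mul_nonneg (by positivity) (Real.log_natCast_nonneg _))
  obtain ⟨c, C, hC, hU⟩ := OKLattice.exists_isUniversal_rank_le K
  set y : ℕ → ℝ := fun n => (d / 4 * (n + c : ℕ) ^ 2 * Real.log (n + c : ℕ) +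
    C * (n + c : ℕ) ^ 2 + Real.log (n + c : ℕ)) / (d / 4 * (n : ℝ) ^ 2 * Real.log n) with hy
  have hylim : Tendsto y atTop (𝓝 1) := tendsto_upper_div hd0 C c
  have hxy : x ≤ᶠ[atTop] y := by
    filter_upwards [eventually_ge_atTop 1] with n hn
    refine div_le_div_of_nonneg_right ?_ (mul_nonneg (by positivity) (Real.log_natCast_nonneg _))
    obtain ⟨W, hW, hWr⟩ := hU n hn
    have h1 : minUnivRank K n ≤ W.rank := Nat.sInf_le ⟨W, hW, rfl⟩
    rcases Nat.eq_zero_or_pos (minUnivRank K n) with h0 | h0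
    · rw [h0, Nat.cast_zero, Real.log_zero]
      have := Real.log_natCast_nonneg (n + c)
      positivity
    · have hnc : ((n + c : ℕ) : ℝ) ≠ 0 := by exact_mod_cast (by omega : n + c ≠ 0)
      have h2 := Real.log_le_log (by exact_mod_cast h0) ((Nat.cast_le.mpr h1).trans hWr)
      rwa [Real.log_mul (Real.exp_ne_zero _) hnc, Real.log_exp] at h2
  have hybdd : IsBoundedUnder (· ≤ ·) atTop y := hylim.isBoundedUnder_le
  have hxbdd : IsBoundedUnder (· ≤ ·) atTop x := hybdd.mono_le hxy
  have hxcob : IsCoboundedUnder (· ≤ ·) atTop x :=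
    (isBoundedUnder_of ⟨0, hx0⟩ : IsBoundedUnder (· ≥ ·) atTop x).isCoboundedUnder_le
  refine le_antisymm ?_ ?_
  · rw [← hylim.limsup_eq]
    exact limsup_le_limsup hxy hxcob hybdd
  · refine le_of_forall_sub_le fun ε hε => ?_
    set δ := min ε (1 / 2) with hδ
    have hδ0 : 0 < δ := lt_min hε (by norm_num)
    have hδ1 : δ < 1 := (min_le_right _ _).trans_lt (by norm_num)
    have hfr := not_eventually_le_exp (OKLattice.exists_isUniversal K) hδ0 hδ1
    rw [not_eventually] at hfr
    refine (sub_le_sub_left (min_le_left ε (1 / 2)) 1).trans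
      (le_limsup_of_frequently_le ((hfr.and_eventually (eventually_ge_atTop 2)).mono ?_) hxbdd)
    rintro n ⟨hn, hn2⟩
    have hn' : (1 : ℝ) < n := by exact_mod_cast hn2
    have hl : 0 < Real.log n := Real.log_pos hn'
    have h1 := Real.log_le_log (Real.exp_pos _) (not_le.mp hn).le
    rw [Real.log_exp] at h1
    rw [hx, le_div_iff₀ (by positivity)]
    linarith

end Limsup

theorem stmt1 (K : Type) [Field K] [NumberField K] (htr : TotallyReal K) :
    Filter.limsup
      (fun n : ℕ =>
        Real.log (minUnivRank K n) /
          ((Module.finrank ℚ K : ℝ) / 4 * (n : ℝ) ^ 2 * Real.log n))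
      Filter.atTop = 1 := by
  have : Fact (TotallyReal K) := ⟨htr⟩
  exact limsup_log_minUnivRank
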